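/- Fix an integer n ≥ 0 and let Q_n : ℝ → ℝ be the unique C² solution of the harmonic map ODE with lim_{r→-∞} Q_n(r) = 0 and lim_{r→+∞} Q_n(r) = nπ. Let ψ : ℝ × ℝ → ℝ be a global C² solution of the corotational wave map equation on the wormhole, ∂_t²ψ − ∂_r²ψ − (2r/(r²+1)) ∂_r ψ + sin(2ψ(t,r))/(r²+1) = 0, with finite energy (for every t, ∫_ℝ (|∂_t ψ(t,r)|² + |∂_r ψ(t,r)|² + 2 sin²(ψ(t,r))/(r²+1))(r²+1) dr < ∞) and degree n boundary values (for every t, lim_{r→-∞} ψ(t,r) = 0 and lim_{r→+∞} ψ(t,r) = nπ). Then ψ scatters to the harmonic map Q_n in both time directions: there exist finite-energy solutions φ_L^± of the linearized equation ∂_t²φ − ∂_r²φ − (2r/(r²+1)) ∂_r φ + (2/(r²+1)) φ = 0 such that ∫_ℝ ( |∂_r ψ(t,r) − Q_n'(r) − ∂_r φ_L^±(t,r)|² + |∂_t ψ(t,r) − ∂_t φ_L^±(t,r)|² )(r²+1) dr → 0 as t → ±∞. -/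

import Mathlib

open Real Filter MeasureTheory

/-- `F` is a (global, C²) solution of the harmonic map ODE
`F'' + (2r/(r²+1)) F' - sin(2F)/(r²+1) = 0` on the wormhole. -/
def IsHarmonicMapSol (F : ℝ → ℝ) : Prop :=
  ContDiff ℝ 2 F ∧
    ∀ r : ℝ, deriv (deriv F) r + (2 * r / (r ^ 2 + 1)) * deriv F r
      - Real.sin (2 * F r) / (r ^ 2 + 1) = 0

/-- `φ` is a finite-energy solution of the linearized equation
`∂_t²φ − ∂_r²φ − (2r/(r²+1)) ∂_r φ + (2/(r²+1)) φ = 0` on the 3d wormhole. -/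
def IsLinearizedSol (φ : ℝ → ℝ → ℝ) : Prop :=
  ContDiff ℝ 2 (fun p : ℝ × ℝ => φ p.1 p.2) ∧
    (∀ t r : ℝ,
      deriv (deriv (fun s => φ s r)) t - deriv (deriv (φ t)) r
        - (2 * r / (r ^ 2 + 1)) * deriv (φ t) r + (2 / (r ^ 2 + 1)) * φ t r = 0) ∧
    ∀ t : ℝ, Integrable (fun r : ℝ =>
      ((deriv (fun s => φ s r) t) ^ 2 + (deriv (φ t) r) ^ 2) * (r ^ 2 + 1))

namespace WMS

/-- chain rule along a curve from continuous partial derivatives -/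
theorem chain2 {f ft fr : ℝ → ℝ → ℝ}
    (ht : ∀ a b, HasDerivAt (fun s => f s b) (ft a b) a)
    (hr : ∀ a b, HasDerivAt (fun s => f a s) (fr a b) b)
    (ct : Continuous (fun p : ℝ × ℝ => ft p.1 p.2))
    (cr : Continuous (fun p : ℝ × ℝ => fr p.1 p.2)) (p : ℝ × ℝ) :
    HasStrictFDerivAt (fun p : ℝ × ℝ => f p.1 p.2)
      ((ContinuousLinearMap.toSpanSingleton ℝ (ft p.1 p.2)).coprod
        (ContinuousLinearMap.toSpanSingleton ℝ (fr p.1 p.2))) p := by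
  have := hasStrictFDerivAt_uncurry_coprod (𝕜 := ℝ) (u := p) (f := f)
    (f₁ := fun a b => ContinuousLinearMap.toSpanSingleton ℝ (ft a b))
    (f₂ := fun a b => ContinuousLinearMap.toSpanSingleton ℝ (fr a b))
    (Eventually.of_forall fun v => (ht v.1 v.2).hasFDerivAt)
    (Eventually.of_forall fun v => (hr v.1 v.2).hasFDerivAt)
    (by
      have : Continuous fun v : ℝ × ℝ => ContinuousLinearMap.toSpanSingleton ℝ (ft v.1 v.2) := by
        exact (ContinuousLinearMap.toSpanSingletonCLE (𝕜 := ℝ) (E := ℝ)).continuous.comp ct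
      exact this.continuousAt)
    (by
      have : Continuous fun v : ℝ × ℝ => ContinuousLinearMap.toSpanSingleton ℝ (fr v.1 v.2) := by
        exact (ContinuousLinearMap.toSpanSingletonCLE (𝕜 := ℝ) (E := ℝ)).continuous.comp cr
      exact this.continuousAt)
  exact this

theorem chainC {f ft fr : ℝ → ℝ → ℝ}
    (ht : ∀ a b, HasDerivAt (fun s => f s b) (ft a b) a)
    (hr : ∀ a b, HasDerivAt (fun s => f a s) (fr a b) b)
    (ct : Continuous (fun p : ℝ × ℝ => ft p.1 p.2))
    (cr : Continuous (fun p : ℝ × ℝ => fr p.1 p.2))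
    {x y : ℝ → ℝ} {x' y' s : ℝ} (hx : HasDerivAt x x' s) (hy : HasDerivAt y y' s) :
    HasDerivAt (fun s => f (x s) (y s)) (ft (x s) (y s) * x' + fr (x s) (y s) * y') s := by
  have h := (chain2 ht hr ct cr (x s, y s)).hasFDerivAt
  have := h.comp_hasDerivAt s (hx.prodMk hy)
  refine this.congr_deriv ?_
  simp [mul_comm]

theorem cont_of_partials {f ft fr : ℝ → ℝ → ℝ}
    (ht : ∀ a b, HasDerivAt (fun s => f s b) (ft a b) a)
    (hr : ∀ a b, HasDerivAt (fun s => f a s) (fr a b) b)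
    (ct : Continuous (fun p : ℝ × ℝ => ft p.1 p.2))
    (cr : Continuous (fun p : ℝ × ℝ => fr p.1 p.2)) :
    Continuous (fun p : ℝ × ℝ => f p.1 p.2) :=
  continuous_iff_continuousAt.2 fun p => (chain2 ht hr ct cr p).hasFDerivAt.continuousAt

theorem contDiff1_of_partials {f ft fr : ℝ → ℝ → ℝ}
    (ht : ∀ a b, HasDerivAt (fun s => f s b) (ft a b) a)
    (hr : ∀ a b, HasDerivAt (fun s => f a s) (fr a b) b)
    (ct : Continuous (fun p : ℝ × ℝ => ft p.1 p.2))
    (cr : Continuous (fun p : ℝ × ℝ => fr p.1 p.2)) :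
    ContDiff ℝ 1 (fun p : ℝ × ℝ => f p.1 p.2) := by
  rw [contDiff_one_iff_hasFDerivAt]
  refine ⟨_, ?_, fun p => (chain2 ht hr ct cr p).hasFDerivAt⟩
  have h1 : Continuous fun v : ℝ × ℝ => ContinuousLinearMap.toSpanSingleton ℝ (ft v.1 v.2) :=
    (ContinuousLinearMap.toSpanSingletonCLE (𝕜 := ℝ) (E := ℝ)).continuous.comp ct
  have h2 : Continuous fun v : ℝ × ℝ => ContinuousLinearMap.toSpanSingleton ℝ (fr v.1 v.2) :=
    (ContinuousLinearMap.toSpanSingletonCLE (𝕜 := ℝ) (E := ℝ)).continuous.comp cr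
  fun_prop

theorem contDiff2_of_partials {f ft fr : ℝ → ℝ → ℝ}
    (ht : ∀ a b, HasDerivAt (fun s => f s b) (ft a b) a)
    (hr : ∀ a b, HasDerivAt (fun s => f a s) (fr a b) b)
    (ct : ContDiff ℝ 1 (fun p : ℝ × ℝ => ft p.1 p.2))
    (cr : ContDiff ℝ 1 (fun p : ℝ × ℝ => fr p.1 p.2)) :
    ContDiff ℝ 2 (fun p : ℝ × ℝ => f p.1 p.2) := by
  have h2 : (2 : WithTop ℕ∞) = ((1 : ℕ) : WithTop ℕ∞) + 1 := by norm_num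
  rw [h2, contDiff_succ_iff_hasFDerivAt]
  refine ⟨fun p => ft p.1 p.2 • ContinuousLinearMap.fst ℝ ℝ ℝ
    + fr p.1 p.2 • ContinuousLinearMap.snd ℝ ℝ ℝ, ?_, fun p => ?_⟩
  · have ct' : ContDiff ℝ ((1 : ℕ) : WithTop ℕ∞) (fun p : ℝ × ℝ => ft p.1 p.2) := by simpa using ct
    have cr' : ContDiff ℝ ((1 : ℕ) : WithTop ℕ∞) (fun p : ℝ × ℝ => fr p.1 p.2) := by simpa using cr
    exact (ct'.smul contDiff_const).add (cr'.smul contDiff_const)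
  · have := (chain2 ht hr ct.continuous cr.continuous p).hasFDerivAt
    refine this.congr_fderiv ?_
    ext <;> simp

/-- A `C²` function of two variables bundled with its partial derivatives. -/
structure F2 where
  f : ℝ → ℝ → ℝ
  t : ℝ → ℝ → ℝ
  r : ℝ → ℝ → ℝ
  tt : ℝ → ℝ → ℝ
  tr : ℝ → ℝ → ℝ
  rr : ℝ → ℝ → ℝ
  ht : ∀ a b, HasDerivAt (fun s => f s b) (t a b) a
  hr : ∀ a b, HasDerivAt (fun s => f a s) (r a b) b
  htt : ∀ a b, HasDerivAt (fun s => t s b) (tt a b) a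
  htr : ∀ a b, HasDerivAt (fun s => t a s) (tr a b) b
  hrt : ∀ a b, HasDerivAt (fun s => r s b) (tr a b) a
  hrr : ∀ a b, HasDerivAt (fun s => r a s) (rr a b) b
  ctt : Continuous (fun p : ℝ × ℝ => tt p.1 p.2)
  ctr : Continuous (fun p : ℝ × ℝ => tr p.1 p.2)
  crr : Continuous (fun p : ℝ × ℝ => rr p.1 p.2)

namespace F2
variable (u : F2)
theorem ct : Continuous (fun p : ℝ × ℝ => u.t p.1 p.2) :=
  cont_of_partials u.htt u.htr u.ctt u.ctr
theorem cr : Continuous (fun p : ℝ × ℝ => u.r p.1 p.2) :=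
  cont_of_partials u.hrt u.hrr u.ctr u.crr
theorem cf : Continuous (fun p : ℝ × ℝ => u.f p.1 p.2) :=
  cont_of_partials u.ht u.hr u.ct u.cr
theorem contDiff : ContDiff ℝ 2 (fun p : ℝ × ℝ => u.f p.1 p.2) :=
  contDiff2_of_partials u.ht u.hr (contDiff1_of_partials u.htt u.htr u.ctt u.ctr)
    (contDiff1_of_partials u.hrt u.hrr u.ctr u.crr)
theorem cf' {x y : ℝ → ℝ} (hx : Continuous x) (hy : Continuous y) :
    Continuous fun s => u.f (x s) (y s) := u.cf.comp (hx.prodMk hy)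
theorem ct' {x y : ℝ → ℝ} (hx : Continuous x) (hy : Continuous y) :
    Continuous fun s => u.t (x s) (y s) := u.ct.comp (hx.prodMk hy)
theorem cr' {x y : ℝ → ℝ} (hx : Continuous x) (hy : Continuous y) :
    Continuous fun s => u.r (x s) (y s) := u.cr.comp (hx.prodMk hy)
theorem dt (a b : ℝ) : deriv (fun s => u.f s b) a = u.t a b := (u.ht a b).deriv
theorem dr (a b : ℝ) : deriv (u.f a) b = u.r a b := (u.hr a b).deriv
theorem dtt (a b : ℝ) : deriv (deriv (fun s => u.f s b)) a = u.tt a b := by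
  have : deriv (fun s => u.f s b) = fun s => u.t s b := funext fun s => u.dt s b
  rw [this]; exact (u.htt a b).deriv
theorem drr (a b : ℝ) : deriv (deriv (u.f a)) b = u.rr a b := by
  have : deriv (u.f a) = fun s => u.r a s := funext fun s => u.dr a s
  rw [this]; exact (u.hrr a b).deriv
end F2

theorem partials_of_contDiff1 {G : ℝ × ℝ → ℝ} (hG : ContDiff ℝ 1 G) :
    (∀ a b, HasDerivAt (fun s => G (s, b)) (fderiv ℝ G (a, b) (1, 0)) a) ∧
    (∀ a b, HasDerivAt (fun s => G (a, s)) (fderiv ℝ G (a, b) (0, 1)) b) ∧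
    (∀ v, Continuous fun p => fderiv ℝ G p v) := by
  have hd : Differentiable ℝ G := hG.differentiable (by norm_num)
  refine ⟨fun a b => ?_, fun a b => ?_, fun v => ?_⟩
  · have := (hd (a, b)).hasFDerivAt.comp_hasDerivAt a ((hasDerivAt_id a).prodMk (hasDerivAt_const a b))
    exact this
  · have := (hd (a, b)).hasFDerivAt.comp_hasDerivAt b ((hasDerivAt_const b a).prodMk (hasDerivAt_id b))
    exact this
  · exact (hG.continuous_fderiv (by norm_num)).clm_apply continuous_const

noncomputable def mkF2 (f : ℝ → ℝ → ℝ) (hf : ContDiff ℝ 2 (fun p : ℝ × ℝ => f p.1 p.2)) : F2 := by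
  have h1 : ∀ v : ℝ × ℝ, ContDiff ℝ 1 (fun p => fderiv ℝ (fun p : ℝ × ℝ => f p.1 p.2) p v) := by
    intro v
    have : ContDiff ℝ 1 (fderiv ℝ (fun p : ℝ × ℝ => f p.1 p.2)) :=
      hf.fderiv_right (by norm_num)
    exact this.clm_apply contDiff_const
  have h0 := partials_of_contDiff1 (hf.of_le (by norm_num : (1 : WithTop ℕ∞) ≤ 2))
  have ha := partials_of_contDiff1 (h1 (1, 0))
  have hb := partials_of_contDiff1 (h1 (0, 1))
  have hs : ∀ p : ℝ × ℝ, fderiv ℝ (fun p => fderiv ℝ (fun p : ℝ × ℝ => f p.1 p.2) p (0, 1)) p (1, 0)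
      = fderiv ℝ (fun p => fderiv ℝ (fun p : ℝ × ℝ => f p.1 p.2) p (1, 0)) p (0, 1) := by
    intro p
    have hsym := (hf.contDiffAt (x := p)).isSymmSndFDerivAt (by simp)
    have hdd : DifferentiableAt ℝ (fderiv ℝ (fun p : ℝ × ℝ => f p.1 p.2)) p :=
      (hf.fderiv_right (m := 1) (by norm_num)).differentiable (by norm_num) p
    have e : ∀ v w : ℝ × ℝ, fderiv ℝ (fun p => fderiv ℝ (fun p : ℝ × ℝ => f p.1 p.2) p v) p w
        = fderiv ℝ (fderiv ℝ (fun p : ℝ × ℝ => f p.1 p.2)) p w v := by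
      intro v w
      have := (hdd.hasFDerivAt.clm_apply (hasFDerivAt_const v p)).fderiv
      rw [this]; simp
    rw [e, e]; exact hsym _ _
  exact
  { f := f
    t := fun a b => fderiv ℝ (fun p : ℝ × ℝ => f p.1 p.2) (a, b) (1, 0)
    r := fun a b => fderiv ℝ (fun p : ℝ × ℝ => f p.1 p.2) (a, b) (0, 1)
    tt := fun a b => fderiv ℝ (fun p => fderiv ℝ (fun p : ℝ × ℝ => f p.1 p.2) p (1, 0)) (a, b) (1, 0)
    tr := fun a b => fderiv ℝ (fun p => fderiv ℝ (fun p : ℝ × ℝ => f p.1 p.2) p (1, 0)) (a, b) (0, 1)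
    rr := fun a b => fderiv ℝ (fun p => fderiv ℝ (fun p : ℝ × ℝ => f p.1 p.2) p (0, 1)) (a, b) (0, 1)
    ht := h0.1
    hr := h0.2.1
    htt := ha.1
    htr := ha.2.1
    hrt := fun a b => by rw [← hs]; exact hb.1 a b
    hrr := hb.2.1
    ctt := ha.2.2 _
    ctr := ha.2.2 _
    crr := hb.2.2 _ }

theorem mkF2_f (f : ℝ → ℝ → ℝ) (hf) : (mkF2 f hf).f = f := rfl

/-- Leibniz rule -/
theorem leibniz {f ft : ℝ → ℝ → ℝ} (a b : ℝ)
    (ht : ∀ t r, HasDerivAt (fun s => f s r) (ft t r) t)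
    (cf : ∀ t, Continuous (f t)) (ct : Continuous (fun p : ℝ × ℝ => ft p.1 p.2)) (t : ℝ) :
    HasDerivAt (fun t => ∫ r in a..b, f t r) (∫ r in a..b, ft t r) t := by
  obtain ⟨C, hC⟩ := ((isCompact_Icc (a := t - 1) (b := t + 1)).prod
    (isCompact_uIcc (a := a) (b := b))).exists_bound_of_continuousOn ct.continuousOn
  have hct : Continuous (ft t) := ct.comp (Continuous.prodMk_right t)
  refine (intervalIntegral.hasDerivAt_integral_of_dominated_loc_of_deriv_le
    (s := Set.Icc (t - 1) (t + 1)) (bound := fun _ => C)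
    (Icc_mem_nhds (by linarith) (by linarith)) ?_ ?_ ?_ ?_ ?_ ?_).2
  · exact Eventually.of_forall fun x => (cf x).aestronglyMeasurable
  · exact (cf t).intervalIntegrable _ _
  · exact hct.aestronglyMeasurable
  · refine Eventually.of_forall fun r hr x hx => hC (x, r) ⟨hx, Set.uIoc_subset_uIcc hr⟩
  · exact intervalIntegrable_const
  · exact Eventually.of_forall fun r _ x _ => ht x r
end WMS

namespace WMS

noncomputable def q (r : ℝ) : ℝ := √(r ^ 2 + 1)
theorem q_sq (r : ℝ) : q r ^ 2 = r ^ 2 + 1 := Real.sq_sqrt (by positivity)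
theorem q_pos (r : ℝ) : 0 < q r := Real.sqrt_pos.2 (by positivity)
theorem q_ne (r : ℝ) : q r ≠ 0 := (q_pos r).ne'
theorem one_le_q (r : ℝ) : 1 ≤ q r := by
  have := q_sq r; have := q_pos r; nlinarith [sq_nonneg r]
theorem abs_le_q (r : ℝ) : |r| ≤ q r := by
  have h := q_sq r
  exact abs_le_of_sq_le_sq (by linarith) (q_pos r).le
theorem q_le (r : ℝ) : q r ≤ |r| + 1 := by
  have h := q_sq r; have := q_pos r; have := abs_nonneg r; have := sq_abs r
  nlinarith
theorem q_neg (r : ℝ) : q (-r) = q r := by simp [q]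
theorem hasDerivAt_q (r : ℝ) : HasDerivAt q (r / q r) r := by
  have h : HasDerivAt (fun r : ℝ => r ^ 2 + 1) (2 * r) r := by
    simpa using (hasDerivAt_pow 2 r).add_const 1
  have := h.sqrt (by positivity)
  refine this.congr_deriv ?_
  unfold q; field_simp
@[fun_prop] theorem continuous_q : Continuous q := by unfold q; fun_prop

theorem hasDerivAt_w (r : ℝ) : HasDerivAt (fun r : ℝ => r ^ 2 + 1) (2 * r) r := by
  simpa using (hasDerivAt_pow 2 r).add_const 1

theorem integrable_of_bdd {f : ℝ → ℝ} (hf : Continuous f) (h0 : ∀ r, 0 ≤ f r) {K : ℝ}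
    (hK : ∀ R : ℝ, 0 ≤ R → ∫ r in (-R)..R, f r ≤ K) : Integrable f ∧ ∫ r, f r ≤ K := by
  have hi : Integrable f := by
    refine integrable_of_intervalIntegral_norm_bounded (l := atTop) (a := fun R : ℝ => -R)
      (b := fun R : ℝ => R) K (fun i => (hf.integrableOn_Ioc)) tendsto_neg_atTop_atBot tendsto_id ?_
    filter_upwards [eventually_ge_atTop 0] with R hR
    simpa [abs_of_nonneg (h0 _)] using hK R hR
  refine ⟨hi, le_of_tendsto (intervalIntegral_tendsto_integral hi tendsto_neg_atTop_atBot tendsto_id) ?_⟩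
  filter_upwards [eventually_ge_atTop 0] with R hR
  exact hK R hR

theorem interval_le_integral {f : ℝ → ℝ} (hi : Integrable f) (h0 : ∀ r, 0 ≤ f r) {a b : ℝ}
    (hab : a ≤ b) : ∫ r in a..b, f r ≤ ∫ r, f r := by
  rw [intervalIntegral.integral_of_le hab]
  exact setIntegral_le_integral hi (Eventually.of_forall h0)

theorem integrable_of_le {f g : ℝ → ℝ} (hg : Integrable g) (hf : Continuous f)
    (h : ∀ r, |f r| ≤ g r) : Integrable f :=
  hg.mono' hf.aestronglyMeasurable (Eventually.of_forall h)

theorem integrable_inv_w : Integrable (fun r : ℝ => 1 / (r ^ 2 + 1)) := by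
  simpa [add_comm] using integrable_inv_one_add_sq

theorem integral_inv_w : ∫ r : ℝ, 1 / (r ^ 2 + 1) = π := by
  simpa [add_comm] using integral_univ_inv_one_add_sq

theorem dcs {f : ℝ → ℝ} {d T a : ℝ} (h : HasDerivAt f d (T - a)) :
    HasDerivAt (fun s => f (T - s)) (-d) a := by
  have := h.comp a ((hasDerivAt_id a).const_sub T)
  exact this.congr_deriv (by simp)
theorem dng {f : ℝ → ℝ} {d a : ℝ} (h : HasDerivAt f d (-a)) :
    HasDerivAt (fun s => f (-s)) (-d) a := by
  have := h.comp a ((hasDerivAt_id a).neg)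
  exact this.congr_deriv (by simp)

namespace F2
/-- `g(r) * u` -/
noncomputable def mulr (u : F2) (g g1 g2 : ℝ → ℝ) (h1 : ∀ r, HasDerivAt g (g1 r) r)
    (h2 : ∀ r, HasDerivAt g1 (g2 r) r) (h3 : Continuous g2) : F2 where
  f t r := g r * u.f t r
  t t r := g r * u.t t r
  r t r := g1 r * u.f t r + g r * u.r t r
  tt t r := g r * u.tt t r
  tr t r := g1 r * u.t t r + g r * u.tr t r
  rr t r := g2 r * u.f t r + 2 * g1 r * u.r t r + g r * u.rr t r
  ht a b := (u.ht a b).const_mul _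
  hr a b := (h1 b).mul (u.hr a b)
  htt a b := (u.htt a b).const_mul _
  htr a b := (h1 b).mul (u.htr a b)
  hrt a b := ((u.ht a b).const_mul _).add ((u.hrt a b).const_mul _)
  hrr a b := (((h2 b).mul (u.hr a b)).add ((h1 b).mul (u.hrr a b))).congr_deriv (by ring)
  ctt := by
    have : Continuous g := continuous_iff_continuousAt.2 fun r => (h1 r).continuousAt
    have := u.ctt
    fun_prop
  ctr := by
    have : Continuous g := continuous_iff_continuousAt.2 fun r => (h1 r).continuousAt
    have : Continuous g1 := continuous_iff_continuousAt.2 fun r => (h2 r).continuousAt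
    have := u.ctr; have := u.ct
    fun_prop
  crr := by
    have : Continuous g := continuous_iff_continuousAt.2 fun r => (h1 r).continuousAt
    have : Continuous g1 := continuous_iff_continuousAt.2 fun r => (h2 r).continuousAt
    have := u.crr; have := u.cr; have := u.cf
    fun_prop

/-- time independent function -/
def stat (g g1 g2 : ℝ → ℝ) (h1 : ∀ r, HasDerivAt g (g1 r) r)
    (h2 : ∀ r, HasDerivAt g1 (g2 r) r) (h3 : Continuous g2) : F2 where
  f _ r := g r
  t _ _ := 0
  r _ r := g1 r
  tt _ _ := 0
  tr _ _ := 0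
  rr _ r := g2 r
  ht a b := hasDerivAt_const _ _
  hr a b := h1 b
  htt a b := hasDerivAt_const _ _
  htr a b := hasDerivAt_const _ _
  hrt a b := hasDerivAt_const _ _
  hrr a b := h2 b
  ctt := continuous_const
  ctr := continuous_const
  crr := by fun_prop

def sub (u v : F2) : F2 where
  f t r := u.f t r - v.f t r
  t t r := u.t t r - v.t t r
  r t r := u.r t r - v.r t r
  tt t r := u.tt t r - v.tt t r
  tr t r := u.tr t r - v.tr t r
  rr t r := u.rr t r - v.rr t r
  ht a b := (u.ht a b).sub (v.ht a b)
  hr a b := (u.hr a b).sub (v.hr a b)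
  htt a b := (u.htt a b).sub (v.htt a b)
  htr a b := (u.htr a b).sub (v.htr a b)
  hrt a b := (u.hrt a b).sub (v.hrt a b)
  hrr a b := (u.hrr a b).sub (v.hrr a b)
  ctt := u.ctt.sub v.ctt
  ctr := u.ctr.sub v.ctr
  crr := u.crr.sub v.crr

/-- time reversal about `T/2` -/
def rev (u : F2) (T : ℝ) : F2 where
  f t r := u.f (T - t) r
  t t r := -u.t (T - t) r
  r t r := u.r (T - t) r
  tt t r := u.tt (T - t) r
  tr t r := -u.tr (T - t) r
  rr t r := u.rr (T - t) r
  ht a b := dcs (f := fun s => u.f s b) (u.ht (T - a) b)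
  hr a b := u.hr _ b
  htt a b := by simpa using (dcs (f := fun s => u.t s b) (u.htt (T - a) b)).fun_neg
  htr a b := (u.htr _ b).neg
  hrt a b := dcs (f := fun s => u.r s b) (u.hrt (T - a) b)
  hrr a b := u.hrr _ b
  ctt := u.ctt.comp (f := fun p : ℝ × ℝ => (T - p.1, p.2)) (by fun_prop)
  ctr := (u.ctr.comp (f := fun p : ℝ × ℝ => (T - p.1, p.2)) (by fun_prop)).neg
  crr := u.crr.comp (f := fun p : ℝ × ℝ => (T - p.1, p.2)) (by fun_prop)

/-- reflection `c - u(t,-r)` -/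
def mir (u : F2) (c : ℝ) : F2 where
  f t r := c - u.f t (-r)
  t t r := -u.t t (-r)
  r t r := u.r t (-r)
  tt t r := -u.tt t (-r)
  tr t r := u.tr t (-r)
  rr t r := -u.rr t (-r)
  ht a b := (u.ht a (-b)).const_sub c
  hr a b := by simpa using (dng (f := fun s => u.f a s) (u.hr a (-b))).const_sub c
  htt a b := (u.htt a (-b)).neg
  htr a b := by simpa using (dng (f := fun s => u.t a s) (u.htr a (-b))).fun_neg
  hrt a b := u.hrt a (-b)
  hrr a b := dng (f := fun s => u.r a s) (u.hrr a (-b))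
  ctt := (u.ctt.comp (f := fun p : ℝ × ℝ => (p.1, -p.2)) (by fun_prop)).neg
  ctr := u.ctr.comp (f := fun p : ℝ × ℝ => (p.1, -p.2)) (by fun_prop)
  crr := (u.crr.comp (f := fun p : ℝ × ℝ => (p.1, -p.2)) (by fun_prop)).neg
end F2
end WMS

namespace WMS

/-- wave equation with zeroth order term `S/(r²+1)` -/
def Wv (u : F2) (S : ℝ → ℝ → ℝ) : Prop :=
  ∀ t r, u.tt t r - u.rr t r - (2 * r / (r ^ 2 + 1)) * u.r t r + S t r / (r ^ 2 + 1) = 0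

theorem Wv.eq {u : F2} {S} (h : Wv u S) (t r : ℝ) :
    (r ^ 2 + 1) * u.tt t r = (r ^ 2 + 1) * u.rr t r + 2 * r * u.r t r - S t r := by
  have h1 := h t r
  have hw : (r ^ 2 + 1) ≠ 0 := by positivity
  field_simp at h1
  linarith

theorem Wv.of_eq {u : F2} {S : ℝ → ℝ → ℝ} (h : ∀ t r : ℝ,
    (r ^ 2 + 1) * u.tt t r = (r ^ 2 + 1) * u.rr t r + 2 * r * u.r t r - S t r) : Wv u S := by
  intro t r
  have h1 := h t r
  have hw : (r ^ 2 + 1) ≠ 0 := by positivity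
  field_simp
  linarith

/-- energy density -/
noncomputable def en (g : ℝ → ℝ) (u : F2) (t r : ℝ) : ℝ :=
  (r ^ 2 + 1) * (u.t t r ^ 2 + u.r t r ^ 2) / 2 + g (u.f t r)

theorem en_nonneg {g : ℝ → ℝ} (g0 : ∀ x, 0 ≤ g x) (u : F2) (t r : ℝ) : 0 ≤ en g u t r := by
  unfold en; have := g0 (u.f t r); positivity

theorem en_cont {g : ℝ → ℝ} (hg : Continuous g) (u : F2) :
    Continuous fun p : ℝ × ℝ => en g u p.1 p.2 := by
  unfold en; have := u.cf; have := u.ct; have := u.cr; fun_prop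

theorem en_cont' {g : ℝ → ℝ} (hg : Continuous g) (u : F2) (t : ℝ) : Continuous (en g u t) :=
  (en_cont hg u).comp (Continuous.prodMk_right t)

theorem cutoff_mono {g gf : ℝ → ℝ} (hg : ∀ x, HasDerivAt g (gf x) x) (cgf : Continuous gf)
    (g0 : ∀ x, 0 ≤ g x) {u : F2} (hu : Wv u (fun t r => gf (u.f t r))) {t0 t1 : ℝ} (h01 : t0 ≤ t1)
    (M : ℝ) :
    ∫ r, smoothTransition (M - t1 - q r) * en g u t1 r
      ≤ ∫ r, smoothTransition (M - t0 - q r) * en g u t0 r := by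
  have cg : Continuous g := continuous_iff_continuousAt.2 fun r => (hg r).continuousAt
  set h := smoothTransition with hh
  set h' := deriv smoothTransition with hh'
  have hd : ∀ x, HasDerivAt h (h' x) x := fun x =>
    ((smoothTransition.contDiff (n := 1)).differentiable (by norm_num) x).hasDerivAt
  have hc : Continuous h := smoothTransition.continuous
  have hc' : Continuous h' := (smoothTransition.contDiff (n := 1)).continuous_deriv (by norm_num)
  have h'0 : ∀ x, 0 ≤ h' x := fun x => smoothTransition.monotone.deriv_nonneg
  set B := |M| + |t0| + 1 with hB
  have hBp : 0 < B := by positivity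
  have hz : ∀ t, t0 ≤ t → ∀ r, B ≤ |r| → h (M - t - q r) = 0 := by
    intro t ht r hr
    apply smoothTransition.zero_of_nonpos
    have := abs_le_q r; have := le_abs_self M; have := neg_abs_le t0; linarith
  have hintg : ∀ t, t0 ≤ t → ∫ r, h (M - t - q r) * en g u t r
      = ∫ r in (-B)..B, h (M - t - q r) * en g u t r := by
    intro t ht
    symm
    apply intervalIntegral.integral_eq_integral_of_support_subset
    intro r hr
    by_contra hcon
    apply hr
    have : B ≤ |r| := by
      by_contra hlt
      push Not at hlt
      have := abs_lt.1 hlt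
      exact hcon ⟨this.1, this.2.le⟩
    simp [hz t ht r this]
  rw [hintg t1 h01, hintg t0 le_rfl]
  set k : ℝ → ℝ := fun t => ∫ r in (-B)..B, h (M - t - q r) * en g u t r with hk
  set ent : ℝ → ℝ → ℝ := fun t r => (r ^ 2 + 1) * (u.t t r * u.tt t r + u.r t r * u.tr t r)
    + gf (u.f t r) * u.t t r with hent
  have het : ∀ t r, HasDerivAt (fun s => en g u s r) (ent t r) t := by
    intro t r
    have := ((((u.htt t r).pow 2).add ((u.hrt t r).pow 2)).const_mul (r ^ 2 + 1)).div_const 2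
    have := this.add ((hg _).comp t (u.ht t r))
    refine this.congr_deriv ?_
    simp [hent]; ring
  set F : ℝ → ℝ → ℝ := fun t r => h (M - t - q r) * en g u t r
  set Ft : ℝ → ℝ → ℝ := fun t r => -h' (M - t - q r) * en g u t r + h (M - t - q r) * ent t r
  have hFt : ∀ t r, HasDerivAt (fun s => F s r) (Ft t r) t := by
    intro t r
    have h1 : HasDerivAt (fun s => M - s - q r) (-1) t := by
      simpa using ((hasDerivAt_id t).const_sub M).sub_const (q r)
    have := ((hd _).comp t h1).mul (het t r)
    refine this.congr_deriv ?_
    simp [Ft]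
  have cen := en_cont cg u
  have cent : Continuous fun p : ℝ × ℝ => ent p.1 p.2 := by
    simp only [hent]
    have := u.cf; have := u.ct; have := u.cr; have := u.ctt; have := u.ctr
    fun_prop
  have cq2 : Continuous fun p : ℝ × ℝ => q p.2 := continuous_q.comp continuous_snd
  have cF : ∀ t, Continuous (F t) := by
    intro t
    have := en_cont' cg u t
    simp only [F]; fun_prop
  have cFt : Continuous fun p : ℝ × ℝ => Ft p.1 p.2 := by
    simp only [Ft]; fun_prop
  have hkd : ∀ t, HasDerivAt k (∫ r in (-B)..B, Ft t r) t := fun t => leibniz _ _ hFt cF cFt t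
  have hneg : ∀ t, t0 ≤ t → ∫ r in (-B)..B, Ft t r ≤ 0 := by
    intro t ht
    -- the flux
    set P : ℝ → ℝ := fun r => h (M - t - q r) * ((r ^ 2 + 1) * (u.t t r * u.r t r))
    set P' : ℝ → ℝ := fun r => -h' (M - t - q r) * (r / q r) * ((r ^ 2 + 1) * (u.t t r * u.r t r))
      + h (M - t - q r) * (2 * r * (u.t t r * u.r t r) + (r ^ 2 + 1) *
        (u.tr t r * u.r t r + u.t t r * u.rr t r))
    have hP : ∀ r, HasDerivAt P (P' r) r := by
      intro r
      have h1 : HasDerivAt (fun s => M - t - q s) (-(r / q r)) r := by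
        simpa using (hasDerivAt_q r).const_sub (M - t)
      have := ((hd _).comp r h1).mul ((hasDerivAt_w r).mul ((u.htr t r).mul (u.hrr t r)))
      refine this.congr_deriv ?_
      simp [P']
    have cq' : Continuous fun r => r / q r := continuous_id.div continuous_q q_ne
    have c1 := u.ct' (continuous_const (y := t)) continuous_id
    have c2 := u.cr' (continuous_const (y := t)) continuous_id
    have c3 : Continuous (u.tr t) := u.ctr.comp (Continuous.prodMk_right t)
    have c4 : Continuous (u.rr t) := u.crr.comp (Continuous.prodMk_right t)
    simp only [id] at c1 c2
    have cP' : Continuous P' := by simp only [P']; fun_prop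
    have hP0 : ∫ r in (-B)..B, P' r = 0 := by
      rw [intervalIntegral.integral_eq_sub_of_hasDerivAt (fun x _ => hP x) (cP'.intervalIntegrable _ _)]
      simp [P, hz t ht B (le_abs_self B), hz t ht (-B) (by simp [le_abs_self])]
    have : ∫ r in (-B)..B, Ft t r = ∫ r in (-B)..B, (Ft t r - P' r) := by
      rw [intervalIntegral.integral_sub _ (cP'.intervalIntegrable _ _), hP0, sub_zero]
      exact (cFt.comp (Continuous.prodMk_right t)).intervalIntegrable _ _
    rw [this]
    have : ∫ r in (-B)..B, (Ft t r - P' r) ≤ ∫ r in (-B)..B, (0:ℝ) := by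
      apply intervalIntegral.integral_mono_on (by linarith)
      · exact ((cFt.comp (Continuous.prodMk_right t)).sub cP').intervalIntegrable _ _
      · simp
      intro r _
      have hE := hu.eq t r
      have hq := q_pos r
      have e1 : Ft t r - P' r = h' (M - t - q r) *
          ((r / q r) * ((r ^ 2 + 1) * (u.t t r * u.r t r)) - en g u t r) := by
        simp only [Ft, P', hent]
        linear_combination (h (M - t - q r) * u.t t r) * hE
      rw [e1]
      apply mul_nonpos_of_nonneg_of_nonpos (h'0 _)
      have hrq : |r / q r| ≤ 1 := by
        rw [abs_div, abs_of_pos hq, div_le_one hq]; exact abs_le_q r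
      have h3 : (r / q r) * ((r ^ 2 + 1) * (u.t t r * u.r t r)) ≤
          (r ^ 2 + 1) * (u.t t r ^ 2 + u.r t r ^ 2) / 2 := by
        have := abs_le.1 hrq
        set c := r / q r
        have : c * (u.t t r * u.r t r) ≤ (u.t t r ^ 2 + u.r t r ^ 2) / 2 := by
          have h5 : |c * (u.t t r * u.r t r)| ≤ 1 * (|u.t t r| * |u.r t r|) := by
            rw [abs_mul, abs_mul]; gcongr
          have := le_abs_self (c * (u.t t r * u.r t r))
          nlinarith [sq_nonneg (|u.t t r| - |u.r t r|), sq_abs (u.t t r), sq_abs (u.r t r)]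
        nlinarith [sq_nonneg r]
      have := g0 (u.f t r)
      unfold en; linarith
    simpa using this
  have hanti : AntitoneOn k (Set.Ici t0) := by
    apply antitoneOn_of_deriv_nonpos (convex_Ici _)
    · exact fun x _ => (hkd x).continuousAt.continuousWithinAt
    · exact fun x _ => (hkd x).differentiableAt.differentiableWithinAt
    · intro x hx
      rw [(hkd x).deriv]
      simp at hx
      exact hneg x hx.le
  exact hanti (Set.mem_Ici.2 le_rfl) (Set.mem_Ici.2 h01) h01
end WMS

namespace WMS

theorem cut_integrable {e : ℝ → ℝ} (he : Continuous e) (M : ℝ) :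
    Integrable fun r => smoothTransition (M - q r) * e r := by
  have hc := smoothTransition.continuous
  apply Continuous.integrable_of_hasCompactSupport (by fun_prop)
  apply HasCompactSupport.of_support_subset_isCompact (isCompact_Icc (a := -M) (b := M))
  intro r hr
  by_contra hcon
  apply hr
  have : M ≤ |r| := by
    by_contra hlt
    push Not at hlt
    have := abs_lt.1 hlt
    exact hcon ⟨this.1.le, this.2.le⟩
  have := abs_le_q r
  simp [smoothTransition.zero_of_nonpos (by linarith : M - q r ≤ 0)]

theorem energy_le {g gf : ℝ → ℝ} (hg : ∀ x, HasDerivAt g (gf x) x) (cgf : Continuous gf)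
    (g0 : ∀ x, 0 ≤ g x) {u : F2} (hu : Wv u (fun t r => gf (u.f t r))) {t0 t1 : ℝ} (h01 : t0 ≤ t1)
    (hi : Integrable (en g u t0)) : Integrable (en g u t1) ∧ ∫ r, en g u t1 r ≤ ∫ r, en g u t0 r := by
  have cg : Continuous g := continuous_iff_continuousAt.2 fun r => (hg r).continuousAt
  refine integrable_of_bdd (en_cont' cg u t1) (en_nonneg g0 u t1) fun R hR => ?_
  have h1 := cutoff_mono hg cgf g0 hu h01 (t1 + R + 2)
  have i1 := cut_integrable (en_cont' cg u t1) (t1 + R + 2 - t1)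
  have i0 := cut_integrable (en_cont' cg u t0) (t1 + R + 2 - t0)
  have h2 : ∫ r, smoothTransition (t1 + R + 2 - t0 - q r) * en g u t0 r ≤ ∫ r, en g u t0 r := by
    apply integral_mono i0 hi
    intro r
    exact mul_le_of_le_one_left (en_nonneg g0 u t0 r) (smoothTransition.le_one _)
  refine le_trans ?_ (h1.trans h2)
  refine le_trans (le_of_eq ?_) (interval_le_integral i1
    (fun r => mul_nonneg (smoothTransition.nonneg _) (en_nonneg g0 u t1 r)) (by linarith : -R ≤ R))
  apply intervalIntegral.integral_congr
  intro r hr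
  rw [Set.uIcc_of_le (by linarith)] at hr
  have := q_le r
  have : |r| ≤ R := abs_le.2 hr
  simp only
  rw [smoothTransition.one_of_one_le (by linarith), one_mul]

theorem Wv.rev {u : F2} {S : ℝ → ℝ → ℝ} (h : Wv u S) (T : ℝ) : Wv (u.rev T) (fun t r => S (T - t) r) :=
  fun t r => h (T - t) r

theorem en_rev (g : ℝ → ℝ) (u : F2) (T t r : ℝ) : en g (u.rev T) t r = en g u (T - t) r := by
  simp [en, F2.rev]

theorem energy_const {g gf : ℝ → ℝ} (hg : ∀ x, HasDerivAt g (gf x) x) (cgf : Continuous gf)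
    (g0 : ∀ x, 0 ≤ g x) {u : F2} (hu : Wv u (fun t r => gf (u.f t r))) {t0 : ℝ}
    (hi : Integrable (en g u t0)) (t1 : ℝ) :
    Integrable (en g u t1) ∧ ∫ r, en g u t1 r = ∫ r, en g u t0 r := by
  have key : ∀ a b, Integrable (en g u a) →
      Integrable (en g u b) ∧ ∫ r, en g u b r ≤ ∫ r, en g u a r := by
    intro a b ha
    rcases le_total a b with hab | hab
    · exact energy_le hg cgf g0 hu hab ha
    · have e1 : en g (u.rev (a + b)) b = en g u a := by
        funext r; rw [en_rev]; congr 1; ring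
      have e2 : en g (u.rev (a + b)) a = en g u b := by
        funext r; rw [en_rev]; congr 1; ring
      have := energy_le (u := u.rev (a + b)) hg cgf g0 (hu.rev (a + b)) hab (by rwa [e1])
      rwa [e1, e2] at this
  have h1 := key t0 t1 hi
  exact ⟨h1.1, le_antisymm h1.2 (key t1 t0 h1.1).2⟩

theorem energy_tail {g gf : ℝ → ℝ} (hg : ∀ x, HasDerivAt g (gf x) x) (cgf : Continuous gf)
    (g0 : ∀ x, 0 ≤ g x) {u : F2} (hu : Wv u (fun t r => gf (u.f t r)))
    (hi : Integrable (en g u 0)) {ε : ℝ} (hε : 0 < ε) :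
    ∃ M0 > 0, ∀ M ≥ M0, ∀ T ≥ 0, ∫ r in {r | T + M ≤ |r|}, en g u T r ≤ ε := by
  have cg : Continuous g := continuous_iff_continuousAt.2 fun r => (hg r).continuousAt
  have hc := smoothTransition.continuous
  -- the tail at time zero
  have hlim : Tendsto (fun M : ℝ => ∫ r, (1 - smoothTransition (M - q r)) * en g u 0 r) atTop (nhds 0) := by
    have h00 : nhds (0:ℝ) = nhds (∫ r : ℝ, (0:ℝ)) := by simp
    rw [h00]
    apply tendsto_integral_filter_of_dominated_convergence (en g u 0)
    · refine Eventually.of_forall fun M => Continuous.aestronglyMeasurable ?_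
      have := en_cont' cg u 0
      fun_prop
    · refine Eventually.of_forall fun M => Eventually.of_forall fun r => ?_
      have h1 := smoothTransition.le_one (M - q r)
      have h2 := smoothTransition.nonneg (M - q r)
      have h3 := en_nonneg g0 u 0 r
      rw [Real.norm_eq_abs, abs_of_nonneg (mul_nonneg (by linarith) h3)]
      exact mul_le_of_le_one_left h3 (by linarith)
    · exact hi
    · refine Eventually.of_forall fun r => ?_
      refine tendsto_const_nhds.congr' ?_
      filter_upwards [eventually_ge_atTop (q r + 1)] with M hM
      rw [smoothTransition.one_of_one_le (by linarith)]; simp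
  have hev := hlim.eventually (gt_mem_nhds hε)
  obtain ⟨M0, hM0⟩ := (hev.and (eventually_ge_atTop 1)).exists_forall_of_atTop
  refine ⟨max M0 1, by positivity, fun M hM T hT => ?_⟩
  have hMM := (hM0 M (le_trans (le_max_left _ _) hM)).1
  obtain ⟨iT, eT⟩ := energy_const hg cgf g0 hu hi T
  have e0 : en g (u.rev T) 0 = en g u T := by funext r; rw [en_rev]; congr 1; ring
  have e1 : en g (u.rev T) T = en g u 0 := by funext r; rw [en_rev]; congr 1; ring
  have hcut := cutoff_mono hg cgf g0 (hu.rev T) hT (M + T)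
  rw [e0, e1] at hcut
  have i0 := cut_integrable (en_cont' cg u 0) M
  have i1 := cut_integrable (en_cont' cg u T) (M + T)
  have s1 : M + T - T = M := by ring
  rw [s1, sub_zero] at hcut
  have h2 : ∫ r, (1 - smoothTransition (M + T - q r)) * en g u T r
      ≤ ∫ r, (1 - smoothTransition (M - q r)) * en g u 0 r := by
    have a1 : ∀ r, (1 - smoothTransition (M + T - q r)) * en g u T r
      = en g u T r - smoothTransition (M + T - q r) * en g u T r := fun r => by ring
    have a2 : ∀ r, (1 - smoothTransition (M - q r)) * en g u 0 r
      = en g u 0 r - smoothTransition (M - q r) * en g u 0 r := fun r => by ring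
    simp_rw [a1, a2]
    rw [integral_sub iT i1, integral_sub hi i0]
    linarith
  refine le_trans ?_ (h2.trans hMM.le)
  have iX : Integrable fun r => (1 - smoothTransition (M + T - q r)) * en g u T r := by
    have := iT.sub i1
    refine this.congr (Eventually.of_forall fun r => ?_)
    simp; ring
  have hm : MeasurableSet {r : ℝ | T + M ≤ |r|} := measurableSet_le measurable_const measurable_id.abs
  calc ∫ r in {r | T + M ≤ |r|}, en g u T r
      = ∫ r in {r | T + M ≤ |r|}, (1 - smoothTransition (M + T - q r)) * en g u T r := by
        apply setIntegral_congr_fun hm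
        intro r hr
        have := abs_le_q r
        simp only [Set.mem_ofPred_eq] at hr
        simp only
        rw [smoothTransition.zero_of_nonpos (by linarith)]; simp
    _ ≤ _ := by
        apply setIntegral_le_integral iX
        refine Eventually.of_forall fun r => ?_
        have := smoothTransition.le_one (M + T - q r)
        exact mul_nonneg (by linarith) (en_nonneg g0 u T r)
end WMS

namespace WMS

theorem sob_aux {y y' : ℝ → ℝ} (hy : ∀ r, HasDerivAt y (y' r) r) (cy' : Continuous y')
    (i1 : Integrable fun r => y r ^ 2 + (r ^ 2 + 1) * y' r ^ 2) {r : ℝ} (hr : 0 ≤ r) :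
    q r * y r ^ 2 ≤ ∫ r, (y r ^ 2 + (r ^ 2 + 1) * y' r ^ 2) := by
  have cy : Continuous y := continuous_iff_continuousAt.2 fun r => (hy r).continuousAt
  have hd : ∀ x, HasDerivAt (fun r => y r ^ 2) (2 * y x * y' x) x := fun x => by
    exact ((hy x).fun_pow 2).congr_deriv (by simp)
  have i2 : Integrable fun r => 2 * y r * y' r := by
    refine integrable_of_le i1 (by fun_prop) fun r => abs_le.2 ⟨?_, ?_⟩
    · nlinarith [sq_nonneg (y r + y' r), sq_nonneg (r * y' r)]
    · nlinarith [sq_nonneg (y r - y' r), sq_nonneg (r * y' r)]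
  have i3 : Integrable fun r => y r ^ 2 := by
    refine integrable_of_le i1 (by fun_prop) fun r => ?_
    rw [abs_of_nonneg (by positivity)]
    have : 0 ≤ (r ^ 2 + 1) * y' r ^ 2 := by positivity
    linarith
  have hlim : Tendsto (fun r => y r ^ 2) atTop (nhds 0) :=
    tendsto_zero_of_hasDerivAt_of_integrableOn_Ioi (a := 0) (fun x _ => hd x)
      i2.integrableOn i3.integrableOn
  have hFTC := integral_Ioi_of_hasDerivAt_of_tendsto (a := r) (f := fun r => y r ^ 2)
    (hd r).continuousAt.continuousWithinAt (fun x _ => hd x) i2.integrableOn hlim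
  have h1 : q r * y r ^ 2 = ∫ x in Set.Ioi r, q r * -(2 * y x * y' x) := by
    rw [integral_const_mul, integral_neg, hFTC]; ring
  rw [h1]
  refine le_trans (setIntegral_mono_on (i2.neg.const_mul _).integrableOn i1.integrableOn
    measurableSet_Ioi ?_) (setIntegral_le_integral i1 (Eventually.of_forall fun x => ?_))
  · intro x hx
    have hx : r < x := hx
    have hqx : q r ≤ q x := by
      unfold q; apply Real.sqrt_le_sqrt; nlinarith
    have h2 : -(2 * y x * y' x) ≤ 2 * (|y x| * |y' x|) := by
      have := neg_abs_le (y x * y' x); rw [abs_mul] at this; linarith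
    have h3 : q r * -(2 * y x * y' x) ≤ q x * (2 * (|y x| * |y' x|)) := by
      have := q_pos r
      have h0 : 0 ≤ 2 * (|y x| * |y' x|) := by positivity
      nlinarith
    refine h3.trans ?_
    have hq2 := q_sq x
    have : (q x) ^ 2 * y' x ^ 2 = (q x * |y' x|) ^ 2 := by rw [mul_pow, sq_abs]
    rw [← hq2, this, ← sq_abs (y x)]
    nlinarith [sq_nonneg (|y x| - q x * |y' x|)]
  · simp only [Pi.zero_apply]; positivity

theorem sob {y y' : ℝ → ℝ} (hy : ∀ r, HasDerivAt y (y' r) r) (cy' : Continuous y')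
    (i1 : Integrable fun r => y r ^ 2 + (r ^ 2 + 1) * y' r ^ 2) (r : ℝ) :
    q r * y r ^ 2 ≤ ∫ r, (y r ^ 2 + (r ^ 2 + 1) * y' r ^ 2) := by
  rcases le_total 0 r with hr | hr
  · exact sob_aux hy cy' i1 hr
  · have i2 := i1.comp_neg
    have := sob_aux (y := fun r => y (-r)) (y' := fun r => -y' (-r)) (fun r => dng (hy (-r)))
      (by fun_prop) (by simpa using i2) (r := -r) (by linarith)
    rw [q_neg] at this
    simp only [neg_neg] at this
    refine this.trans (le_of_eq ?_)
    rw [← integral_neg_eq_self]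
    simp

theorem sob_lim_aux {f f' : ℝ → ℝ} (hf : ∀ r, HasDerivAt f (f' r) r) (cf' : Continuous f')
    {K l : ℝ} (hi : Integrable fun r => (r ^ 2 + 1) * f' r ^ 2)
    (hK : ∫ r, (r ^ 2 + 1) * f' r ^ 2 ≤ K) (hl : Tendsto f atTop (nhds l)) {c : ℝ} (hc : 0 < c)
    (r B : ℝ) (hB : ∀ x ≥ r, ∫ s in r..x, 1 / (s ^ 2 + 1) ≤ B) :
    |f r - l| ≤ (c * K + c⁻¹ * B) / 2 := by
  have key : ∀ x ≥ r, |f r - f x| ≤ (c * K + c⁻¹ * B) / 2 := by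
    intro x hx
    have h1 : f x - f r = ∫ s in r..x, f' s :=
      (intervalIntegral.integral_eq_sub_of_hasDerivAt (fun x _ => hf x) (cf'.intervalIntegrable _ _)).symm
    rw [abs_sub_comm, h1]
    have cw : Continuous fun s : ℝ => 1 / (s ^ 2 + 1) := by
      apply continuous_const.div (by fun_prop); intro x; positivity
    calc |∫ s in r..x, f' s| ≤ ∫ s in r..x, |f' s| := intervalIntegral.abs_integral_le_integral_abs hx
      _ ≤ ∫ s in r..x, (c / 2 * ((s ^ 2 + 1) * f' s ^ 2) + c⁻¹ / 2 * (1 / (s ^ 2 + 1))) := by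
        apply intervalIntegral.integral_mono_on hx (cf'.abs.intervalIntegrable _ _)
          ((by fun_prop : Continuous _).intervalIntegrable _ _)
        intro s _
        have hw : 0 < s ^ 2 + 1 := by positivity
        rw [← sq_abs (f' s)]
        set a := |f' s|
        have : c / 2 * ((s ^ 2 + 1) * a ^ 2) + c⁻¹ / 2 * (1 / (s ^ 2 + 1)) - a
          = (c * (s ^ 2 + 1) * a - 1) ^ 2 / (2 * c * (s ^ 2 + 1)) := by
          field_simp; ring
        have h2 : 0 ≤ (c * (s ^ 2 + 1) * a - 1) ^ 2 / (2 * c * (s ^ 2 + 1)) := by positivity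
        linarith
      _ = c / 2 * (∫ s in r..x, (s ^ 2 + 1) * f' s ^ 2) + c⁻¹ / 2 * ∫ s in r..x, 1 / (s ^ 2 + 1) := by
        rw [intervalIntegral.integral_add, intervalIntegral.integral_const_mul,
          intervalIntegral.integral_const_mul]
        · exact (by fun_prop : Continuous _).intervalIntegrable _ _
        · exact (by fun_prop : Continuous _).intervalIntegrable _ _
      _ ≤ _ := by
        have h3 := (interval_le_integral hi (fun s => by positivity) hx).trans hK
        have h4 := hB x hx
        have : 0 < c⁻¹ := by positivity
        nlinarith
  have : Tendsto (fun x => |f r - f x|) atTop (nhds |f r - l|) := (tendsto_const_nhds.sub hl).abs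
  exact le_of_tendsto this (by filter_upwards [eventually_ge_atTop r] with x hx using key x hx)

theorem sob_lim {f f' : ℝ → ℝ} (hf : ∀ r, HasDerivAt f (f' r) r) (cf' : Continuous f')
    {K l : ℝ} (hi : Integrable fun r => (r ^ 2 + 1) * f' r ^ 2)
    (hK : ∫ r, (r ^ 2 + 1) * f' r ^ 2 ≤ K) (hl : Tendsto f atTop (nhds l)) :
    (∀ r, |f r - l| ≤ (K + π) / 2) ∧ ∀ r > 0, |f r - l| ≤ (K + 1) / 2 / √r := by
  constructor
  · intro r
    have := sob_lim_aux hf cf' hi hK hl one_pos r π (fun x hx => by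
      rw [← integral_inv_w]
      exact interval_le_integral integrable_inv_w (fun r => by positivity) hx)
    simpa using this
  · intro r hr
    have hs := Real.sqrt_pos.2 hr
    have := sob_lim_aux hf cf' hi hK hl (c := 1 / √r) (by positivity) r (1 / r) (fun x hx => by
      have h1 : ∫ s in r..x, 1 / (s ^ 2 + 1) ≤ ∫ s in r..x, 1 / s ^ 2 := by
        apply intervalIntegral.integral_mono_on hx
        · exact (Continuous.div continuous_const (by fun_prop) (fun x => by positivity)).intervalIntegrable _ _
        · apply ContinuousOn.intervalIntegrable
          rw [Set.uIcc_of_le hx]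
          intro s hs
          have : s ≠ 0 := (lt_of_lt_of_le hr hs.1).ne'
          have : ContinuousAt (fun s : ℝ => 1 / s ^ 2) s := by fun_prop (disch := positivity)
          exact this.continuousWithinAt
        · intro s hs
          have : 0 < s := lt_of_lt_of_le hr hs.1
          gcongr; linarith
      have h2 : ∫ s in r..x, 1 / s ^ 2 = (-(1 / x)) - (-(1 / r)) := by
        apply intervalIntegral.integral_eq_sub_of_hasDerivAt (f := fun s => -(1 / s))
        · intro s hs
          rw [Set.uIcc_of_le hx] at hs
          have : s ≠ 0 := by have := lt_of_lt_of_le hr hs.1; positivity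
          have := (hasDerivAt_inv this).fun_neg
          simpa using this
        · apply ContinuousOn.intervalIntegrable
          rw [Set.uIcc_of_le hx]
          intro s hs
          have : s ≠ 0 := (lt_of_lt_of_le hr hs.1).ne'
          have : ContinuousAt (fun s : ℝ => 1 / s ^ 2) s := by fun_prop (disch := positivity)
          exact this.continuousWithinAt
      have : 0 ≤ 1 / x := by have := lt_of_lt_of_le hr hx; positivity
      linarith)
    refine this.trans (le_of_eq ?_)
    have e : √r * √r = r := Real.mul_self_sqrt hr.le
    field_simp
    nlinarith
end WMS

namespace WMS

/-- the decay weight `(r²+1)^(-3/4)` -/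
noncomputable def m (r : ℝ) : ℝ := 1 / (q r * √(q r))
theorem m_pos (r : ℝ) : 0 < m r := by
  have := q_pos r; have := Real.sqrt_pos.2 this; unfold m; positivity
theorem m_le_one (r : ℝ) : m r ≤ 1 := by
  have h := one_le_q r
  have h2 : 1 ≤ √(q r) := Real.one_le_sqrt.2 h
  unfold m; rw [div_le_one (by positivity)]; nlinarith
@[fun_prop] theorem continuous_m : Continuous m := by
  unfold m
  apply continuous_const.div (by fun_prop)
  intro r
  have := q_pos r; have := Real.sqrt_pos.2 this; positivity
theorem m_neg (r : ℝ) : m (-r) = m r := by simp [m, q_neg]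

theorem inv_q2_le_m (r : ℝ) : 1 / (r ^ 2 + 1) ≤ m r := by
  have h := one_le_q r
  rw [← q_sq]; unfold m
  have h2 : √(q r) ≤ q r := by
    rw [Real.sqrt_le_left (by linarith)]; nlinarith
  have := Real.sqrt_pos.2 (q_pos r)
  gcongr; nlinarith
theorem q_lip (x y : ℝ) : q x ≤ q y + |x - y| := by
  have h1 := q_sq x; have h2 := q_sq y; have := q_pos y; have h3 := abs_nonneg (x - y)
  have h4 := abs_le_q y
  have h5 := sq_abs (x - y)
  apply le_of_sq_le_sq _ (by positivity) |> fun h => h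
  have : y * (x - y) ≤ |y| * |x - y| := by rw [← abs_mul]; exact le_abs_self _
  nlinarith
theorem m_shift {x y : ℝ} (h : |x - y| ≤ 1) : m x ≤ 4 * m y := by
  have h1 := one_le_q x; have h2 := one_le_q y
  have h3 : q y ≤ 2 * q x := by have := q_lip y x; rw [abs_sub_comm] at this; linarith
  have h4 : √(q y) ≤ 2 * √(q x) := by
    have : √(q y) ≤ √(4 * q x) := Real.sqrt_le_sqrt (by linarith)
    rwa [Real.sqrt_mul (by norm_num), show √(4:ℝ) = 2 by
      rw [show (4:ℝ) = 2 ^ 2 by norm_num]; exact Real.sqrt_sq (by norm_num)] at this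
  have h5 := Real.sqrt_pos.2 (q_pos x); have h6 := Real.sqrt_pos.2 (q_pos y)
  have := q_pos x; have := q_pos y
  unfold m
  rw [mul_one_div, div_le_div_iff₀ (by positivity) (by positivity)]
  nlinarith [mul_le_mul h3 h4 h6.le (by positivity)]
theorem integrable_m : Integrable m := by
  have h := (integrable_one_add_norm (E := ℝ) (μ := volume) (r := 3 / 2) (by norm_num)).const_mul 4
  refine integrable_of_le h continuous_m fun r => ?_
  rw [abs_of_pos (m_pos r)]
  have h1 := one_le_q r; have h2 := abs_le_q r; have := abs_nonneg r
  have h3 : 1 + |r| ≤ 2 * q r := by linarith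
  rw [Real.rpow_neg (by positivity), Real.norm_eq_abs]
  have e : (1 + |r|) ^ (3 / 2 : ℝ) = (1 + |r|) * √(1 + |r|) := by
    rw [Real.sqrt_eq_rpow, show (3 / 2 : ℝ) = 1 + 1 / 2 by norm_num, Real.rpow_add (by positivity),
      Real.rpow_one]
  rw [e]
  have h4 : √(1 + |r|) ≤ 2 * √(q r) := by
    have : √(1 + |r|) ≤ √(4 * q r) := Real.sqrt_le_sqrt (by linarith)
    rwa [Real.sqrt_mul (by norm_num), show √(4:ℝ) = 2 by
      rw [show (4:ℝ) = 2 ^ 2 by norm_num]; exact Real.sqrt_sq (by norm_num)] at this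
  have h5 := Real.sqrt_pos.2 (q_pos r)
  have h6 : 0 < √(1 + |r|) := by positivity
  have := q_pos r
  unfold m
  rw [← div_eq_mul_inv, div_le_div_iff₀ (by positivity) (by positivity)]
  nlinarith [mul_le_mul h3 h4 h6.le (by positivity)]

/-- total mass of `m` -/
noncomputable def Im : ℝ := ∫ r, m r
theorem Im_nonneg : 0 ≤ Im := integral_nonneg fun r => (m_pos r).le

theorem m_le_rpow {r : ℝ} (hr : 0 < r) : m r ≤ r ^ (-(3 / 2) : ℝ) := by
  have h2 := abs_le_q r
  rw [abs_of_pos hr] at h2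
  rw [Real.rpow_neg hr.le, show (3 / 2 : ℝ) = 1 + 1 / 2 by norm_num, Real.rpow_add hr,
      Real.rpow_one, ← Real.sqrt_eq_rpow, ← one_div]
  unfold m
  have := Real.sqrt_le_sqrt h2
  have := Real.sqrt_pos.2 hr
  have := (q_pos r).le
  gcongr

theorem m_int_shift (r : ℝ) {l : ℝ} (hl : l = 1 ∨ l = -1) :
    Integrable (fun s => m (r + l * s)) ∧ ∫ s, m (r + l * s) = Im := by
  rcases hl with rfl | rfl
  · simp only [one_mul]
    exact ⟨integrable_m.comp_add_left r, integral_add_left_eq_self m r⟩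
  · have e : (fun s => m (r + -1 * s)) = fun s => m (r - s) := by funext s; congr 1; ring
    rw [e]
    exact ⟨integrable_m.comp_sub_left r, integral_sub_left_eq_self m volume r⟩

theorem int_shift_Ioi (f : ℝ → ℝ) (x : ℝ) :
    ∫ s in Set.Ioi (0:ℝ), f (x + s) = ∫ s in Set.Ioi x, f s := by
  have := (measurePreserving_add_left volume x).setIntegral_preimage_emb
    (measurableEmbedding_addLeft x) f (Set.Ioi x)
  rw [← this]
  congr 2
  ext s; simp

theorem m_tail {r : ℝ} (hr : 0 < r) : ∫ s in Set.Ioi (0:ℝ), m (r + s) ≤ 2 / √r := by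
  have h1 : ∫ s in Set.Ioi (0:ℝ), m (r + s) = ∫ s in Set.Ioi r, m s := by
    exact int_shift_Ioi m r
  rw [h1]
  have h2 : ∫ s in Set.Ioi r, m s ≤ ∫ s in Set.Ioi r, s ^ (-(3 / 2) : ℝ) := by
    apply setIntegral_mono_on integrable_m.integrableOn
      (integrableOn_Ioi_rpow_of_lt (by norm_num) hr) measurableSet_Ioi
    intro s hs
    exact m_le_rpow (lt_trans hr hs)
  rw [integral_Ioi_rpow_of_lt (by norm_num) hr] at h2
  refine h2.trans (le_of_eq ?_)
  rw [show (-(3 / 2) + 1 : ℝ) = -(1 / 2) by norm_num, Real.rpow_neg hr.le, ← Real.sqrt_eq_rpow]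
  field_simp

/-- integral along the ray in direction `(k,l)` -/
noncomputable def Jd (F : ℝ → ℝ → ℝ) (k l t r : ℝ) : ℝ := ∫ s in Set.Ioi (0:ℝ), F (t + k * s) (r + l * s)

section
variable {F : ℝ → ℝ → ℝ} {C : ℝ}

theorem Jd_int (cF : Continuous fun p : ℝ × ℝ => F p.1 p.2) (hF : ∀ t r, |F t r| ≤ C * m r) (k : ℝ) {l : ℝ} (hl : l = 1 ∨ l = -1) (t r : ℝ) :
    Integrable fun s => F (t + k * s) (r + l * s) := by
  refine integrable_of_le ((m_int_shift r hl).1.const_mul C) ?_ fun s => hF _ _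
  exact cF.comp (f := fun s => (t + k * s, r + l * s)) (by fun_prop)

theorem Jd_bound (cF : Continuous fun p : ℝ × ℝ => F p.1 p.2) (hF : ∀ t r, |F t r| ≤ C * m r) (hC : 0 ≤ C) (k : ℝ) {l : ℝ} (hl : l = 1 ∨ l = -1) (t r : ℝ) : |Jd F k l t r| ≤ C * Im := by
  have h := m_int_shift r hl
  unfold Jd
  refine (abs_integral_le_integral_abs).trans ?_
  rw [← h.2, ← integral_const_mul]
  refine (setIntegral_mono (Jd_int cF hF k hl t r).abs.integrableOn (h.1.const_mul C).integrableOn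
    fun s => hF _ _).trans ?_
  exact setIntegral_le_integral (h.1.const_mul C) (Eventually.of_forall fun s =>
    mul_nonneg hC (m_pos _).le)

theorem Jd_bound' (cF : Continuous fun p : ℝ × ℝ => F p.1 p.2) (hF : ∀ t r, |F t r| ≤ C * m r) (hC : 0 ≤ C) (k : ℝ) (t : ℝ) {r : ℝ} (hr : 0 < r) : |Jd F k 1 t r| ≤ C * (2 / √r) := by
  have h := m_int_shift r (l := 1) (by simp)
  unfold Jd
  refine (abs_integral_le_integral_abs).trans ?_
  refine (setIntegral_mono (Jd_int cF hF k (by simp) t r).abs.integrableOn (h.1.const_mul C).integrableOn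
    fun s => hF _ _).trans ?_
  rw [integral_const_mul]
  have := m_tail hr
  simp only [one_mul]
  gcongr

theorem Jd_cont (cF : Continuous fun p : ℝ × ℝ => F p.1 p.2) (hF : ∀ t r, |F t r| ≤ C * m r) (hC : 0 ≤ C) (k : ℝ) {l : ℝ} (hl : l = 1 ∨ l = -1) :
    Continuous fun p : ℝ × ℝ => Jd F k l p.1 p.2 := by
  rw [continuous_iff_continuousAt]
  intro p
  unfold Jd
  apply continuousAt_of_dominated (bound := fun s => C * (4 * m (p.2 + l * s)))
  · refine Eventually.of_forall fun x => ?_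
    exact (Jd_int cF hF k hl x.1 x.2).aestronglyMeasurable.restrict
  · have : ∀ᶠ x : ℝ × ℝ in nhds p, |x.2 - p.2| < 1 := by
      have := (continuous_snd.tendsto p).eventually (Metric.ball_mem_nhds p.2 one_pos)
      simpa [Metric.mem_ball, Real.dist_eq] using this
    filter_upwards [this] with x hx
    refine Eventually.of_forall fun s => (hF _ _).trans ?_
    gcongr
    apply m_shift
    have : x.2 + l * s - (p.2 + l * s) = x.2 - p.2 := by ring
    rw [this]; exact hx.le
  · exact (((m_int_shift p.2 hl).1.const_mul 4).const_mul C).integrableOn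
  · refine Eventually.of_forall fun s => ?_
    exact (cF.comp (f := fun x : ℝ × ℝ => (x.1 + k * s, x.2 + l * s)) (by fun_prop)).continuousAt

theorem Jd_ray (cF : Continuous fun p : ℝ × ℝ => F p.1 p.2) (hF : ∀ t r, |F t r| ≤ C * m r) (k : ℝ) {l : ℝ} (hl : l = 1 ∨ l = -1) (t r x : ℝ) :
    Jd F k l (t + k * x) (r + l * x) = Jd F k l t r - ∫ s in (0:ℝ)..x, F (t + k * s) (r + l * s) := by
  have hi := Jd_int cF hF k hl t r
  have h1 : Jd F k l (t + k * x) (r + l * x) = ∫ s in Set.Ioi x, F (t + k * s) (r + l * s) := by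
    rw [← int_shift_Ioi (fun s => F (t + k * s) (r + l * s)) x]; unfold Jd
    congr 1; funext s; congr 1 <;> ring
  rw [h1]
  have := intervalIntegral.integral_Ioi_sub_Ioi' (a := 0) (b := x) hi.integrableOn hi.integrableOn
  unfold Jd
  linarith

theorem Jd_hasDeriv_ray (cF : Continuous fun p : ℝ × ℝ => F p.1 p.2) (hF : ∀ t r, |F t r| ≤ C * m r) (k : ℝ) {l : ℝ} (hl : l = 1 ∨ l = -1) (t r x : ℝ) :
    HasDerivAt (fun x => Jd F k l (t + k * x) (r + l * x)) (-F (t + k * x) (r + l * x)) x := by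
  have e : (fun x => Jd F k l (t + k * x) (r + l * x)) = fun x => Jd F k l t r
      - ∫ s in (0:ℝ)..x, F (t + k * s) (r + l * s) := funext fun x => Jd_ray cF hF k hl t r x
  rw [e]
  have c : Continuous fun s => F (t + k * s) (r + l * s) :=
    cF.comp (f := fun s => (t + k * s, r + l * s)) (by fun_prop)
  exact (c.integral_hasStrictDerivAt 0 x).hasDerivAt.const_sub _
end
end WMS

namespace WMS

theorem hasDerivAt_sinsq (x : ℝ) : HasDerivAt (fun x => sin x ^ 2) (sin (2 * x)) x := by
  refine ((Real.hasDerivAt_sin x).fun_pow 2).congr_deriv ?_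
  rw [Real.sin_two_mul]; norm_num

structure WM (n : ℕ) (u : F2) : Prop where
  eq : Wv u (fun t r => sin (2 * u.f t r))
  fin : ∀ t, Integrable (en (fun x => sin x ^ 2) u t)
  bot : ∀ t, Tendsto (u.f t) atBot (nhds 0)
  top : ∀ t, Tendsto (u.f t) atTop (nhds (n * π))

theorem WM.rev {n : ℕ} {u : F2} (h : WM n u) (T : ℝ) : WM n (u.rev T) where
  eq := h.eq.rev T
  fin t := by
    have : en (fun x => sin x ^ 2) (u.rev T) t = en (fun x => sin x ^ 2) u (T - t) := by
      funext r; exact en_rev _ _ _ _ _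
    rw [this]; exact h.fin _
  bot t := h.bot (T - t)
  top t := h.top (T - t)

theorem sin_two_npi_sub (n : ℕ) (x : ℝ) : sin (2 * (n * π - x)) = -sin (2 * x) := by
  rw [show 2 * (n * π - x) = n * (2 * π) - 2 * x by ring, Real.sin_nat_mul_two_pi_sub]
theorem sin_two_sub_npi (n : ℕ) (x : ℝ) : sin (2 * (x - n * π)) = sin (2 * x) := by
  rw [show 2 * (x - n * π) = 2 * x - n * (2 * π) by ring, Real.sin_sub_nat_mul_two_pi]
theorem sin_sq_npi_sub (n : ℕ) (x : ℝ) : sin (n * π - x) ^ 2 = sin x ^ 2 := by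
  have h1 := Real.cos_sq_add_sin_sq x
  have h2 := sin_two_npi_sub n x
  have e1 := Real.sin_sq_eq_half_sub (n * π - x)
  have e2 := Real.sin_sq_eq_half_sub x
  rw [e1, e2, show 2 * (n * π - x) = n * (2 * π) - 2 * x by ring, Real.cos_nat_mul_two_pi_sub]

theorem WM.mir {n : ℕ} {u : F2} (h : WM n u) : WM n (u.mir (n * π)) where
  eq := by
    intro t r
    have := h.eq t (-r)
    simp only [F2.mir, sin_two_npi_sub]
    rw [neg_sq] at this
    rw [← neg_eq_zero, ← this]; ring
  fin t := by
    have : en (fun x => sin x ^ 2) (u.mir (n * π)) t = fun r => en (fun x => sin x ^ 2) u t (-r) := by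
      funext r; simp only [en, F2.mir, sin_sq_npi_sub]; ring
    rw [this]; exact (h.fin t).comp_neg
  bot t := by
    have := ((h.top t).comp tendsto_neg_atBot_atTop).const_sub (n * π)
    simpa [F2.mir, Function.comp_def] using this
  top t := by
    have := ((h.bot t).comp tendsto_neg_atTop_atBot).const_sub (n * π)
    simpa [F2.mir, Function.comp_def] using this

/-- the conserved energy -/
noncomputable def Eng (u : F2) : ℝ := ∫ r, en (fun x => sin x ^ 2) u 0 r

theorem sinsq0 (x : ℝ) : 0 ≤ (fun x => sin x ^ 2) x := sq_nonneg _
theorem Eng_nonneg (u : F2) : 0 ≤ Eng u := integral_nonneg fun r => en_nonneg sinsq0 u 0 r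

theorem WM.energy {n : ℕ} {u : F2} (h : WM n u) (t : ℝ) : ∫ r, en (fun x => sin x ^ 2) u t r = Eng u :=
  (energy_const hasDerivAt_sinsq (by fun_prop) sinsq0 h.eq (h.fin 0) t).2

theorem WM.wr {n : ℕ} {u : F2} (h : WM n u) (t : ℝ) :
    Integrable (fun r => (r ^ 2 + 1) * u.r t r ^ 2) ∧ ∫ r, (r ^ 2 + 1) * u.r t r ^ 2 ≤ 2 * Eng u := by
  have hi := (h.fin t).const_mul 2
  have hp : ∀ r : ℝ, (r ^ 2 + 1) * u.r t r ^ 2 ≤ 2 * en (fun x => sin x ^ 2) u t r := by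
    intro r; unfold en
    have : 0 ≤ (r ^ 2 + 1) * u.t t r ^ 2 := by positivity
    nlinarith [sq_nonneg (sin (u.f t r))]
  have cr : Continuous (u.r t) := u.cr' continuous_const continuous_id
  have i1 := integrable_of_le hi (f := fun r => (r ^ 2 + 1) * u.r t r ^ 2) (by fun_prop) (fun r => by
    rw [abs_of_nonneg (by positivity)]; exact hp r)
  refine ⟨i1, ?_⟩
  rw [← h.energy t, ← integral_const_mul]
  exact integral_mono i1 hi hp

theorem WM.bd {n : ℕ} {u : F2} (h : WM n u) : ∃ C > 0, (∀ t r, |u.f t r - n * π| ≤ C) ∧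
    (∀ t, ∀ r > 0, |u.f t r - n * π| ≤ C / √r) ∧ (∀ t r, |sin (2 * u.f t r)| ≤ C / √(q r)) := by
  have hE := Eng_nonneg u
  refine ⟨2 * Eng u + π + 4, by positivity, fun t r => ?_, fun t r hr => ?_, fun t r => ?_⟩
  · have := (sob_lim (fun r => u.hr t r) (u.cr' continuous_const continuous_id) (h.wr t).1 (h.wr t).2
      (h.top t)).1 r
    have := Real.pi_pos
    linarith
  · have := (sob_lim (fun r => u.hr t r) (u.cr' continuous_const continuous_id) (h.wr t).1 (h.wr t).2
      (h.top t)).2 r hr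
    refine this.trans ?_
    have := Real.pi_pos
    gcongr; linarith
  · have cr : Continuous (u.r t) := u.cr' continuous_const continuous_id
    have cf : Continuous (u.f t) := u.cf' continuous_const continuous_id
    have hi := (h.fin t).const_mul 2
    have hp : ∀ r : ℝ, sin (u.f t r) ^ 2 + (r ^ 2 + 1) * (cos (u.f t r) * u.r t r) ^ 2
        ≤ 2 * en (fun x => sin x ^ 2) u t r := by
      intro r; unfold en
      have h1 : 0 ≤ (r ^ 2 + 1) * u.t t r ^ 2 := by positivity
      have h2 : cos (u.f t r) ^ 2 ≤ 1 := Real.cos_sq_le_one _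
      have h3 : (r ^ 2 + 1) * (cos (u.f t r) * u.r t r) ^ 2 ≤ (r ^ 2 + 1) * u.r t r ^ 2 := by
        have h4 : 0 ≤ (r ^ 2 + 1) * u.r t r ^ 2 := by positivity
        nlinarith [mul_le_mul_of_nonneg_right h2 h4]
      nlinarith [sq_nonneg (sin (u.f t r))]
    have i1 := integrable_of_le hi (f := fun r => sin (u.f t r) ^ 2 + (r ^ 2 + 1) * (cos (u.f t r) * u.r t r) ^ 2)
      (by fun_prop) (fun r => by rw [abs_of_nonneg (by positivity)]; exact hp r)
    have h1 := sob (y := fun r => sin (u.f t r)) (y' := fun r => cos (u.f t r) * u.r t r)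
      (fun r => (u.hr t r).sin) (by fun_prop) i1 r
    have h2 : ∫ r, (sin (u.f t r) ^ 2 + (r ^ 2 + 1) * (cos (u.f t r) * u.r t r) ^ 2) ≤ 2 * Eng u := by
      rw [← h.energy t, ← integral_const_mul]
      exact integral_mono i1 hi hp
    have h3 : |sin (2 * u.f t r)| ≤ 2 * |sin (u.f t r)| := by
      rw [Real.sin_two_mul, abs_mul, abs_mul]
      have := Real.abs_cos_le_one (u.f t r)
      have := abs_nonneg (sin (u.f t r))
      simp only [Nat.abs_ofNat]; nlinarith
    have hq := q_pos r
    have hs := Real.sqrt_pos.2 hq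
    rw [le_div_iff₀ hs]
    have h4 : (√(q r) * |sin (u.f t r)|) ^ 2 ≤ 2 * Eng u := by
      rw [mul_pow, Real.sq_sqrt hq.le, sq_abs]; linarith
    have h5 : √(q r) * |sin (u.f t r)| ≤ Eng u + 1 := by
      nlinarith [sq_nonneg (√(q r) * |sin (u.f t r)| - 1)]
    have := Real.pi_pos
    nlinarith

theorem hasDerivAt_q2 (r : ℝ) : HasDerivAt (fun r => r / q r) (1 / q r ^ 3) r := by
  refine ((hasDerivAt_id r).div (hasDerivAt_q r) (q_ne r)).congr_deriv ?_
  have h := q_sq r; have := q_ne r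
  simp only [id]
  field_simp
  rw [h]; ring

def F2.subc (u : F2) (c : ℝ) : F2 where
  f t r := u.f t r - c
  t := u.t
  r := u.r
  tt := u.tt
  tr := u.tr
  rr := u.rr
  ht a b := (u.ht a b).sub_const c
  hr a b := (u.hr a b).sub_const c
  htt := u.htt
  htr := u.htr
  hrt := u.hrt
  hrr := u.hrr
  ctt := u.ctt
  ctr := u.ctr
  crr := u.crr

noncomputable def F2.lift (u : F2) (c : ℝ) : F2 :=
  (u.subc c).mulr q (fun r => r / q r) (fun r => 1 / q r ^ 3) hasDerivAt_q hasDerivAt_q2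
    (continuous_const.div (by fun_prop) fun r => pow_ne_zero 3 (q_ne r))

theorem lift_f (u : F2) (c t r : ℝ) : (u.lift c).f t r = q r * (u.f t r - c) := rfl
theorem lift_t (u : F2) (c t r : ℝ) : (u.lift c).t t r = q r * u.t t r := rfl
theorem lift_r (u : F2) (c t r : ℝ) : (u.lift c).r t r = r / q r * (u.f t r - c) + q r * u.r t r := rfl

theorem lift_eq {u : F2} {S : ℝ → ℝ → ℝ} (h : Wv u S) (c t r : ℝ) :
    (u.lift c).tt t r = (u.lift c).rr t r - ((u.f t r - c) / q r ^ 3 + S t r / q r) := by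
  have h1 := h.eq t r
  have h2 := q_sq r; have h3 := q_ne r
  simp only [F2.lift, F2.mulr, F2.subc]
  rw [← h2] at h1
  have : q r * u.tt t r = q r * u.rr t r + 2 * (r / q r) * u.r t r - S t r / q r := by
    field_simp; linarith
  rw [this]; ring

/-- outgoing characteristic derivative -/
theorem char_out {U : F2} {F : ℝ → ℝ → ℝ} (h : ∀ t r, U.tt t r = U.rr t r - F t r) (t r x : ℝ) :
    HasDerivAt (fun x => U.t (t + 1 * x) (r + 1 * x) - U.r (t + 1 * x) (r + 1 * x))
      (-F (t + 1 * x) (r + 1 * x)) x := by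
  have d1 : HasDerivAt (fun x => t + 1 * x) 1 x := by
    simpa using ((hasDerivAt_id x).const_mul 1).const_add t
  have d2 : HasDerivAt (fun x => r + 1 * x) 1 x := by
    simpa using ((hasDerivAt_id x).const_mul 1).const_add r
  have e1 := chainC (f := U.t) U.htt U.htr U.ctt U.ctr d1 d2
  have e2 := chainC (f := U.r) U.hrt U.hrr U.ctr U.crr d1 d2
  refine (e1.sub e2).congr_deriv ?_
  rw [h]; ring

end WMS

namespace WMS

/-- the forcing term of the reduced equation -/
noncomputable def FF (n : ℕ) (u : F2) (t r : ℝ) : ℝ := (u.f t r - n * π) / q r ^ 3 + sin (2 * u.f t r) / q r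

theorem FF_cont (n : ℕ) (u : F2) : Continuous fun p : ℝ × ℝ => FF n u p.1 p.2 := by
  have := u.cf
  unfold FF
  refine Continuous.add (Continuous.div (by fun_prop) (by fun_prop) fun p => pow_ne_zero 3 (q_ne _))
    (Continuous.div (by fun_prop) (by fun_prop) fun p => q_ne _)

theorem inv_q3_le_m (r : ℝ) : 1 / q r ^ 3 ≤ m r := by
  have h1 := one_le_q r
  refine le_trans ?_ (inv_q2_le_m r)
  rw [← q_sq]
  exact one_div_le_one_div_of_le (by positivity) (pow_le_pow_right₀ h1 (by norm_num))

theorem f_bound {C r y s : ℝ} (hy : |y| ≤ C) (hs : |s| ≤ C / √(q r)) :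
    |y / q r ^ 3 + s / q r| ≤ 2 * C * m r := by
  have hq := q_pos r
  have h0 : 0 ≤ C := (abs_nonneg _).trans hy
  have h1 : |y / q r ^ 3| ≤ C * m r := by
    rw [abs_div, abs_of_pos (pow_pos hq 3), div_eq_mul_one_div]
    have := inv_q3_le_m r
    gcongr
  have h2 : |s / q r| ≤ C * m r := by
    rw [abs_div, abs_of_pos hq, m]
    calc |s| / q r ≤ C / √(q r) / q r := by gcongr
      _ = _ := by rw [div_div, mul_one_div, mul_comm]
  have := abs_add_le (y / q r ^ 3) (s / q r)
  linarith

theorem WM.bdF {n : ℕ} {u : F2} (h : WM n u) : ∃ C > 0, (∀ t r, |u.f t r - n * π| ≤ C) ∧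
    (∀ t, ∀ r > 0, |u.f t r - n * π| ≤ C / √r) ∧ (∀ t r, |sin (2 * u.f t r)| ≤ C / √(q r)) ∧
    (∀ t r, |FF n u t r| ≤ C * m r) := by
  obtain ⟨C, hC, h1, h2, h3⟩ := h.bd
  refine ⟨2 * C, by positivity, fun t r => (h1 t r).trans (by linarith), fun t r hr => (h2 t r hr).trans
    (by gcongr; linarith), fun t r => (h3 t r).trans (by gcongr; linarith), fun t r => ?_⟩
  exact f_bound (h1 t r) (h3 t r)

theorem const_of_deriv_zero {g : ℝ → ℝ} (h : ∀ x, HasDerivAt g 0 x) (a b : ℝ) : g a = g b :=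
  is_const_of_deriv_eq_zero (fun x => (h x).differentiableAt) (fun x => (h x).deriv) a b

theorem WM.rho {n : ℕ} {u : F2} (h : WM n u) : ∃ (K : ℝ) (ρ : ℝ → ℝ), Continuous ρ ∧
    (∀ R ≥ 0, ∫ x in (-R)..R, ρ x ^ 2 ≤ K) ∧
    ∀ t r, (u.lift (n * π)).t t r - (u.lift (n * π)).r t r = ρ (t - r) + Jd (FF n u) 1 1 t r := by
  obtain ⟨C, hC, h1, h2, -, hF⟩ := h.bdF
  set U := u.lift (n * π) with hU
  set ρ : ℝ → ℝ := fun v => U.t v 0 - U.r v 0 - Jd (FF n u) 1 1 v 0 with hρ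
  have cJ := Jd_cont (FF_cont n u) hF hC.le 1 (l := 1) (by simp)
  have cρ : Continuous ρ := by
    have e1 : Continuous fun v => U.t v 0 := U.ct' continuous_id continuous_const
    have e2 : Continuous fun v => U.r v 0 := U.cr' continuous_id continuous_const
    have e3 : Continuous fun v => Jd (FF n u) 1 1 v 0 := cJ.comp (f := fun v => (v, (0:ℝ))) (by fun_prop)
    fun_prop
  have hrep : ∀ t r, U.t t r - U.r t r = ρ (t - r) + Jd (FF n u) 1 1 t r := by
    intro t r
    have hd : ∀ x, HasDerivAt (fun x => (U.t ((t - r) + 1 * x) (0 + 1 * x) - U.r ((t - r) + 1 * x) (0 + 1 * x))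
        - Jd (FF n u) 1 1 ((t - r) + 1 * x) (0 + 1 * x)) 0 x := by
      intro x
      refine ((char_out (U := U) (F := FF n u) (fun t r => lift_eq h.eq _ t r) (t - r) 0 x).sub
        (Jd_hasDeriv_ray (FF_cont n u) hF 1 (by simp) (t - r) 0 x)).congr_deriv (by ring)
    have := const_of_deriv_zero hd r 0
    simp only [one_mul, zero_add, add_zero, sub_add_cancel] at this
    rw [hρ]; simp only; linarith
  refine ⟨12 * Eng u + 1, ρ, cρ, fun R hR => ?_, hrep⟩
  set T := R + 30 * C ^ 2 * R + 1 with hT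
  have e : ∫ x in (-R)..R, ρ x ^ 2 = ∫ r in (T - R)..(T + R), ρ (T - r) ^ 2 := by
    rw [intervalIntegral.integral_comp_sub_left (fun x => ρ x ^ 2)]
    congr 1 <;> ring
  rw [e]
  have hTR : 1 ≤ T - R := by rw [hT]; have : 0 ≤ 30 * C ^ 2 * R := by positivity
                             linarith
  have hpt : ∀ r, T - R ≤ r → ρ (T - r) ^ 2 ≤ 12 * en (fun x => sin x ^ 2) u T r + 15 * C ^ 2 / (T - R) := by
    intro r hr
    have r0 : 0 < r := by linarith
    have e1 : ρ (T - r) = q r * (u.t T r - u.r T r) - r / q r * (u.f T r - n * π) - Jd (FF n u) 1 1 T r := by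
      have := hrep T r
      rw [hU, lift_t, lift_r] at this
      linarith
    have hs := Real.sqrt_pos.2 r0
    have b1 : (r / q r * (u.f T r - n * π)) ^ 2 ≤ C ^ 2 / (T - R) := by
      have a1 := h2 T r r0
      have a2 : |r / q r| ≤ 1 := by
        rw [abs_div, abs_of_pos (q_pos r), div_le_one (q_pos r)]; exact abs_le_q r
      have a3 : |r / q r * (u.f T r - n * π)| ≤ C / √r := by
        rw [abs_mul]
        have := abs_nonneg (u.f T r - n * π)
        nlinarith
      calc _ = |r / q r * (u.f T r - n * π)| ^ 2 := (sq_abs _).symm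
        _ ≤ (C / √r) ^ 2 := by gcongr
        _ = C ^ 2 / r := by rw [div_pow, Real.sq_sqrt r0.le]
        _ ≤ _ := by gcongr
    have b2 : (Jd (FF n u) 1 1 T r) ^ 2 ≤ 4 * C ^ 2 / (T - R) := by
      have a1 := Jd_bound' (FF_cont n u) hF hC.le 1 T r0
      calc _ = |Jd (FF n u) 1 1 T r| ^ 2 := (sq_abs _).symm
        _ ≤ (C * (2 / √r)) ^ 2 := by gcongr
        _ = 4 * C ^ 2 / r := by rw [mul_pow, div_pow, Real.sq_sqrt r0.le]; ring
        _ ≤ _ := by gcongr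
    have b3 : (q r * (u.t T r - u.r T r)) ^ 2 ≤ 4 * en (fun x => sin x ^ 2) u T r := by
      rw [mul_pow, q_sq]; unfold en
      have : 0 ≤ (r ^ 2 + 1) * (u.t T r + u.r T r) ^ 2 := by positivity
      nlinarith [sq_nonneg (sin (u.f T r))]
    rw [e1]
    have b4 : ∀ x y z : ℝ, (x - y - z) ^ 2 ≤ 3 * (x ^ 2 + y ^ 2 + z ^ 2) := fun x y z => by
      nlinarith [sq_nonneg (x + y), sq_nonneg (x + z), sq_nonneg (y - z)]
    refine (b4 _ _ _).trans ?_
    have : 15 * C ^ 2 / (T - R) = 3 * (C ^ 2 / (T - R) + 4 * C ^ 2 / (T - R)) := by ring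
    linarith
  have hle : T - R ≤ T + R := by linarith
  have ce := en_cont' (g := fun x => sin x ^ 2) (by fun_prop) u T
  have s1 : ∫ r in (T - R)..(T + R), ρ (T - r) ^ 2
      ≤ ∫ r in (T - R)..(T + R), (12 * en (fun x => sin x ^ 2) u T r + 15 * C ^ 2 / (T - R)) := by
    apply intervalIntegral.integral_mono_on hle
    · exact Continuous.intervalIntegrable (by fun_prop) _ _
    · exact Continuous.intervalIntegrable (by fun_prop) _ _
    · intro r hr; exact hpt r hr.1
  refine s1.trans ?_
  rw [intervalIntegral.integral_add (Continuous.intervalIntegrable (by fun_prop) _ _)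
    (Continuous.intervalIntegrable (by fun_prop) _ _), intervalIntegral.integral_const_mul,
    intervalIntegral.integral_const]
  have s2 := interval_le_integral (h.fin T) (fun r => en_nonneg sinsq0 u T r) hle
  rw [h.energy] at s2
  have s3 : (T + R - (T - R)) • (15 * C ^ 2 / (T - R)) ≤ 1 := by
    rw [smul_eq_mul, mul_div_assoc', div_le_one (by linarith)]
    rw [hT]; nlinarith
  linarith

/-- full radiation representation -/
structure Rad (n : ℕ) (u : F2) (C K : ℝ) (ρ σ : ℝ → ℝ) : Prop where
  hC : 0 < C
  b1 : ∀ t r, |u.f t r - n * π| ≤ C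
  b2 : ∀ t, ∀ r > 0, |u.f t r - n * π| ≤ C / √r
  b3 : ∀ t r, |sin (2 * u.f t r)| ≤ C / √(q r)
  bF : ∀ t r, |FF n u t r| ≤ C * m r
  cρ : Continuous ρ
  cσ : Continuous σ
  iρ : ∀ R ≥ 0, ∫ x in (-R)..R, ρ x ^ 2 ≤ K
  iσ : ∀ R ≥ 0, ∫ x in (-R)..R, σ x ^ 2 ≤ K
  ha : ∀ t r, (u.lift (n * π)).t t r - (u.lift (n * π)).r t r = ρ (t - r) + Jd (FF n u) 1 1 t r
  hb : ∀ t r, (u.lift (n * π)).t t r + (u.lift (n * π)).r t r = σ (t + r) - Jd (FF n u) (-1) 1 t r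

theorem WM.rad {n : ℕ} {u : F2} (h : WM n u) : ∃ C K ρ σ, Rad n u C K ρ σ := by
  obtain ⟨C, hC, h1, h2, h3, hF⟩ := h.bdF
  obtain ⟨K, ρ, cρ, iρ, ha⟩ := h.rho
  obtain ⟨K2, σ, cσ, iσ, hb⟩ := (h.rev 0).rho
  refine ⟨C, max K K2, ρ, fun v => -σ (-v), hC, h1, h2, h3, hF, cρ, by fun_prop,
    fun R hR => (iρ R hR).trans (le_max_left _ _), fun R hR => ?_, ha, fun t r => ?_⟩
  · have : ∫ x in (-R)..R, (-σ (-x)) ^ 2 = ∫ x in (-R)..R, σ x ^ 2 := by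
      simp only [neg_sq]
      rw [intervalIntegral.integral_comp_neg (fun x => σ x ^ 2), neg_neg]
    rw [this]; exact (iσ R hR).trans (le_max_right _ _)
  · have := hb (-t) r
    have e1 : Jd (FF n (u.rev 0)) 1 1 (-t) r = Jd (FF n u) (-1) 1 t r := by
      unfold Jd FF F2.rev
      simp only [zero_sub, neg_add, neg_neg, neg_mul, one_mul]
    rw [e1] at this
    rw [lift_t, lift_r] at *
    simp only [F2.rev, zero_sub, neg_neg] at this
    have e2 : -(t + r) = -t - r := by ring
    simp only [e2]
    linarith
end WMS

namespace WMS

theorem ii {f : ℝ → ℝ} (h : Continuous f) (a b : ℝ) : IntervalIntegrable f volume a b := h.intervalIntegrable a b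

theorem hl_le {g : ℝ → ℝ} (cg : Continuous g) (a b : ℝ) {l : ℝ} (hl : 0 < l) :
    |∫ x in a..b, g x| ≤ (l * |b - a| + l⁻¹ * |∫ x in a..b, g x ^ 2|) / 2 := by
  wlog hab : a ≤ b generalizing a b
  · have := this b a (by linarith)
    rw [intervalIntegral.integral_symm, abs_neg, abs_sub_comm, intervalIntegral.integral_symm (f := fun x => g x ^ 2), abs_neg]
    exact this
  have h1 : ∀ x, |g x| ≤ (l + l⁻¹ * g x ^ 2) / 2 := by
    intro x
    have : 0 ≤ l⁻¹ * (l - |g x|) ^ 2 := by positivity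
    have e : l⁻¹ * (l - |g x|) ^ 2 = l - 2 * |g x| + l⁻¹ * g x ^ 2 := by
      rw [sub_sq, sq_abs]; field_simp
    linarith
  calc |∫ x in a..b, g x| ≤ ∫ x in a..b, |g x| := intervalIntegral.abs_integral_le_integral_abs hab
    _ ≤ ∫ x in a..b, (l + l⁻¹ * g x ^ 2) / 2 :=
        intervalIntegral.integral_mono_on hab (ii (by fun_prop) _ _) (ii (by fun_prop) _ _) fun x _ => h1 x
    _ = (l * (b - a) + l⁻¹ * ∫ x in a..b, g x ^ 2) / 2 := by
        rw [intervalIntegral.integral_div, intervalIntegral.integral_add (ii (by fun_prop) _ _) (ii (by fun_prop) _ _),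
          intervalIntegral.integral_const_mul, intervalIntegral.integral_const]
        simp [mul_comm]
    _ ≤ _ := by
        have := le_abs_self (b - a); have := le_abs_self (∫ x in a..b, g x ^ 2)
        gcongr

theorem hl_K {g : ℝ → ℝ} (cg : Continuous g) {K : ℝ} (hK : ∀ R ≥ 0, ∫ x in (-R)..R, g x ^ 2 ≤ K)
    (a b : ℝ) {l : ℝ} (hl : 0 < l) :
    |∫ x in a..b, g x| ≤ (l * |b - a| + l⁻¹ * K) / 2 := by
  refine (hl_le cg a b hl).trans ?_
  have hi := integrable_of_bdd (f := fun x => g x ^ 2) (by fun_prop) (fun r => sq_nonneg _) hK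
  have : |∫ x in a..b, g x ^ 2| ≤ K := by
    rcases le_total a b with hab | hab
    · rw [abs_of_nonneg (intervalIntegral.integral_nonneg hab fun x _ => sq_nonneg _)]
      exact (interval_le_integral hi.1 (fun r => sq_nonneg _) hab).trans hi.2
    · rw [intervalIntegral.integral_symm, abs_neg,
        abs_of_nonneg (intervalIntegral.integral_nonneg hab fun x _ => sq_nonneg _)]
      exact (interval_le_integral hi.1 (fun r => sq_nonneg _) hab).trans hi.2
  gcongr

theorem hl_tendsto {g : ℝ → ℝ} (cg : Continuous g) {K : ℝ} (hK : ∀ R ≥ 0, ∫ x in (-R)..R, g x ^ 2 ≤ K)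
    (a b : ℝ) : Tendsto (fun T => ∫ x in (T + a)..(T + b), g x) atTop (nhds 0) := by
  have hi := integrable_of_bdd (f := fun x => g x ^ 2) (by fun_prop) (fun r => sq_nonneg _) hK
  have h1 := intervalIntegral_tendsto_integral_Ioi (a := 0) (f := fun x => g x ^ 2) hi.1.integrableOn tendsto_id
  have h2 : Tendsto (fun T => ∫ x in (T + a)..(T + b), g x ^ 2) atTop (nhds 0) := by
    have ha : Tendsto (fun T : ℝ => T + a) atTop atTop := tendsto_atTop_add_const_right _ _ tendsto_id
    have hb : Tendsto (fun T : ℝ => T + b) atTop atTop := tendsto_atTop_add_const_right _ _ tendsto_id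
    have := (h1.comp hb).sub (h1.comp ha)
    rw [sub_self] at this
    refine this.congr fun T => ?_
    simp only [Function.comp, id]
    rw [intervalIntegral.integral_interval_sub_left (ii (by fun_prop) _ _) (ii (by fun_prop) _ _)]
  rw [Metric.tendsto_atTop] at *
  intro ε hε
  set l := ε / (|b - a| + 1) with hl
  have hl0 : 0 < l := by positivity
  obtain ⟨N, hN⟩ := h2 (l * ε) (by positivity)
  refine ⟨N, fun T hT => ?_⟩
  have := hN T hT
  rw [Real.dist_eq, sub_zero] at *
  have e := hl_le cg (T + a) (T + b) hl0
  rw [show T + b - (T + a) = b - a by ring] at e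
  have e2 : l * |b - a| ≤ ε := by
    rw [hl, div_mul_eq_mul_div, div_le_iff₀ (by positivity)]
    nlinarith [abs_nonneg (b - a)]
  have e3 : l⁻¹ * |∫ x in (T + a)..(T + b), g x ^ 2| < ε := by
    rw [inv_mul_lt_iff₀ hl0]; exact this
  linarith

theorem int_diff {f f' : ℝ → ℝ} (h : ∀ x, HasDerivAt f (f' x) x) (c : Continuous f') (a b : ℝ) :
    f b - f a = ∫ x in a..b, f' x :=
  (intervalIntegral.integral_eq_sub_of_hasDerivAt (fun x _ => h x) (ii c _ _)).symm

section
variable {n : ℕ} {u : F2} {C K : ℝ} {ρ σ : ℝ → ℝ}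

theorem Rad.cJ (H : Rad n u C K ρ σ) (k : ℝ) : Continuous fun p : ℝ × ℝ => Jd (FF n u) k 1 p.1 p.2 :=
  Jd_cont (FF_cont n u) H.bF H.hC.le k (by simp)
theorem Rad.cJr (H : Rad n u C K ρ σ) (k t : ℝ) : Continuous fun r => Jd (FF n u) k 1 t r :=
  (H.cJ k).comp (f := fun r => (t, r)) (by fun_prop)
theorem Rad.cJt (H : Rad n u C K ρ σ) (k r : ℝ) : Continuous fun t => Jd (FF n u) k 1 t r :=
  (H.cJ k).comp (f := fun t => (t, r)) (by fun_prop)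

theorem Rad.dr (H : Rad n u C K ρ σ) (t r1 r2 : ℝ) :
    (u.lift (n * π)).f t r2 - (u.lift (n * π)).f t r1 =
      ((∫ x in (t + r1)..(t + r2), σ x) - ∫ x in (t - r2)..(t - r1), ρ x) / 2
      - (∫ r in r1..r2, (Jd (FF n u) 1 1 t r + Jd (FF n u) (-1) 1 t r)) / 2 := by
  set U := u.lift (n * π)
  rw [int_diff (fun r => U.hr t r) (U.cr' continuous_const continuous_id)]
  have cρ := H.cρ; have cσ := H.cσ
  have c1 := H.cJr 1 t; have c2 := H.cJr (-1) t
  have e : ∀ r, U.r t r = (σ (t + r) - ρ (t - r)) / 2 - (Jd (FF n u) 1 1 t r + Jd (FF n u) (-1) 1 t r) / 2 := by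
    intro r
    have := H.ha t r; have := H.hb t r
    linarith
  simp only [e]
  rw [intervalIntegral.integral_sub (ii (by fun_prop) _ _) (ii (by fun_prop) _ _), intervalIntegral.integral_div,
    intervalIntegral.integral_div, intervalIntegral.integral_sub (ii (by fun_prop) _ _) (ii (by fun_prop) _ _),
    intervalIntegral.integral_comp_add_left, intervalIntegral.integral_comp_sub_left]

theorem Rad.dt (H : Rad n u C K ρ σ) (r t1 t2 : ℝ) :
    (u.lift (n * π)).f t2 r - (u.lift (n * π)).f t1 r =
      ((∫ x in (t1 + r)..(t2 + r), σ x) + ∫ x in (t1 - r)..(t2 - r), ρ x) / 2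
      + (∫ t in t1..t2, (Jd (FF n u) 1 1 t r - Jd (FF n u) (-1) 1 t r)) / 2 := by
  set U := u.lift (n * π)
  rw [int_diff (fun t => U.ht t r) (U.ct' continuous_id continuous_const)]
  have cρ := H.cρ; have cσ := H.cσ
  have c1 := H.cJt 1 r; have c2 := H.cJt (-1) r
  have e : ∀ t, U.t t r = (σ (t + r) + ρ (t - r)) / 2 + (Jd (FF n u) 1 1 t r - Jd (FF n u) (-1) 1 t r) / 2 := by
    intro t
    have := H.ha t r; have := H.hb t r
    linarith
  simp only [e]
  rw [intervalIntegral.integral_add (ii (by fun_prop) _ _) (ii (by fun_prop) _ _), intervalIntegral.integral_div,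
    intervalIntegral.integral_div, intervalIntegral.integral_add (ii (by fun_prop) _ _) (ii (by fun_prop) _ _),
    intervalIntegral.integral_comp_add_right, intervalIntegral.integral_comp_sub_right]

theorem abs_int_le {f : ℝ → ℝ} {B : ℝ} (h : ∀ x, |f x| ≤ B) (a b : ℝ) : |∫ x in a..b, f x| ≤ B * |b - a| :=
  intervalIntegral.norm_integral_le_of_norm_le_const (f := f) fun x _ => h x

theorem Rad.uc (H : Rad n u C K ρ σ) {ε : ℝ} (hε : 0 < ε) : ∃ δ > 0, ∀ t t' r r', |t' - t| < δ → |r' - r| < δ →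
    |(u.lift (n * π)).f t' r' - (u.lift (n * π)).f t r| < ε := by
  set U := u.lift (n * π)
  have hK : 0 ≤ K := by simpa using H.iρ 0 le_rfl
  have hIm := Im_nonneg
  have hC := H.hC
  set l := 4 * (K + 1) / ε with hl
  have hl0 : 0 < l := by positivity
  have hlK : l⁻¹ * K ≤ ε / 4 := by
    rw [hl, inv_div, div_mul_eq_mul_div, div_le_iff₀ (by positivity)]; nlinarith
  have bJ : ∀ k t r, |Jd (FF n u) k 1 t r| ≤ C * Im := fun k t r => Jd_bound (FF_cont n u) H.bF hC.le k (by simp) t r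
  set B := l + C * Im with hB
  have hB0 : 0 < B := by positivity
  refine ⟨ε / (4 * B), by positivity, fun t t' r r' ht hr => ?_⟩
  have hd : ∀ x : ℝ, |x| < ε / (4 * B) → B * |x| < ε / 4 := by
    intro x hx
    rw [lt_div_iff₀ (by positivity)] at hx; linarith
  have ht' := hd _ ht; have hr' := hd _ hr
  have e1 := H.dr t' r r'
  have e2 := H.dt r t t'
  have a1 := hl_K H.cσ H.iσ (t' + r) (t' + r') hl0
  have a2 := hl_K H.cρ H.iρ (t' - r') (t' - r) hl0
  have a3 := hl_K H.cσ H.iσ (t + r) (t' + r) hl0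
  have a4 := hl_K H.cρ H.iρ (t - r) (t' - r) hl0
  have a5 := abs_int_le (f := fun r => Jd (FF n u) 1 1 t' r + Jd (FF n u) (-1) 1 t' r) (B := 2 * (C * Im)) (fun r => by
    have := bJ 1 t' r; have := bJ (-1) t' r
    refine (abs_add_le _ _).trans (by linarith)) r r'
  have a6 := abs_int_le (f := fun t => Jd (FF n u) 1 1 t r - Jd (FF n u) (-1) 1 t r) (B := 2 * (C * Im)) (fun t => by
    have := bJ 1 t r; have := bJ (-1) t r
    refine (abs_sub _ _).trans (by linarith)) t t'
  rw [show t' + r' - (t' + r) = r' - r by ring] at a1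
  rw [show t' - r - (t' - r') = r' - r by ring] at a2
  rw [show t' + r - (t + r) = t' - t by ring] at a3
  rw [show t' - r - (t - r) = t' - t by ring] at a4
  rw [hB, add_mul] at ht' hr'
  have := abs_nonneg (r' - r); have := abs_nonneg (t' - t)
  rw [abs_le] at a1 a2 a3 a4 a5 a6
  rw [abs_lt]
  constructor <;> nlinarith
end

theorem subseq_lim {U : ℝ → ℝ → ℝ} (uc : ∀ ε > 0, ∃ δ > 0, ∀ t t' r r', |t' - t| < δ → |r' - r| < δ →
    |U t' r' - U t r| < ε) {B : ℝ → ℝ} (hB : ∀ t r, |U t r| ≤ B r) (T : ℕ → ℝ) :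
    ∃ φ : ℕ → ℕ, StrictMono φ ∧ ∃ V : ℝ → ℝ → ℝ, ∀ t r, Tendsto (fun k => U (T (φ k) + t) r) atTop (nhds (V t r)) := by
  have hc : IsCompact (Set.univ.pi fun p : ℚ × ℚ => Set.Icc (-B p.2) (B p.2)) :=
    isCompact_univ_pi fun p => isCompact_Icc
  obtain ⟨v, -, φ, hφ, hv⟩ := hc.tendsto_subseq (x := fun k (p : ℚ × ℚ) => U (T k + p.1) p.2)
    (fun k p _ => abs_le.1 (hB _ _))
  refine ⟨φ, hφ, ?_⟩
  suffices h : ∀ t r, ∃ v, Tendsto (fun k => U (T (φ k) + t) r) atTop (nhds v) by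
    choose V hV using h; exact ⟨V, hV⟩
  intro t r
  apply cauchySeq_tendsto_of_complete
  rw [Metric.cauchySeq_iff]
  intro ε hε
  obtain ⟨δ, hδ, h⟩ := uc (ε / 3) (by positivity)
  obtain ⟨x, hx1, hx2⟩ := exists_rat_btwn (show t < t + δ by linarith)
  obtain ⟨y, hy1, hy2⟩ := exists_rat_btwn (show r < r + δ by linarith)
  have hxy := (tendsto_pi_nhds.1 hv (x, y)).cauchySeq
  rw [Metric.cauchySeq_iff] at hxy
  obtain ⟨N, hN⟩ := hxy (ε / 3) (by positivity)
  refine ⟨N, fun a ha b hb => ?_⟩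
  have e1 := hN a ha b hb
  have e2 := h (T (φ a) + x) (T (φ a) + t) y r (by rw [abs_lt]; constructor <;> linarith)
    (by rw [abs_lt]; constructor <;> linarith)
  have e3 := h (T (φ b) + x) (T (φ b) + t) y r (by rw [abs_lt]; constructor <;> linarith)
    (by rw [abs_lt]; constructor <;> linarith)
  simp only [Real.dist_eq, Function.comp] at *
  rw [abs_lt] at *
  constructor <;> linarith
end WMS

namespace WMS

noncomputable def fU (r v : ℝ) : ℝ := v / q r ^ 4 + sin (2 * (v / q r)) / q r
noncomputable def fv (V : ℝ → ℝ → ℝ) (t r : ℝ) : ℝ := fU r (V t r)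

theorem fU_cont : Continuous fun p : ℝ × ℝ => fU p.1 p.2 := by
  unfold fU
  have h : Continuous fun p : ℝ × ℝ => p.2 / q p.1 := Continuous.div (by fun_prop) (by fun_prop) fun p => q_ne _
  refine Continuous.add (Continuous.div (by fun_prop) (by fun_prop) fun p => pow_ne_zero 4 (q_ne _))
    (Continuous.div (by fun_prop) (by fun_prop) fun p => q_ne _)

theorem FF_eq (n : ℕ) (u : F2) (t r : ℝ) : FF n u t r = fU r ((u.lift (n * π)).f t r) := by
  have := q_ne r
  unfold FF fU
  rw [lift_f, mul_div_cancel_left₀ _ this, sin_two_sub_npi]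
  congr 1
  field_simp

/-- nonradiating limits -/
structure NR (C : ℝ) (V : ℝ → ℝ → ℝ) : Prop where
  hC : 0 < C
  cV : Continuous fun p : ℝ × ℝ => V p.1 p.2
  b1 : ∀ t r, |V t r| ≤ C * q r
  b2 : ∀ t, ∀ r > 0, |V t r| ≤ C * q r / √r
  bF : ∀ t r, |fv V t r| ≤ C * m r
  hr : ∀ t r, HasDerivAt (fun r => V t r) (-(Jd (fv V) 1 1 t r + Jd (fv V) (-1) 1 t r) / 2) r
  ht : ∀ t r, HasDerivAt (fun t => V t r) ((Jd (fv V) 1 1 t r - Jd (fv V) (-1) 1 t r) / 2) t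

theorem Rad.limit {n : ℕ} {u : F2} {C K : ℝ} {ρ σ : ℝ → ℝ} (H : Rad n u C K ρ σ) {T : ℕ → ℝ}
    (hT : Tendsto T atTop atTop) {V : ℝ → ℝ → ℝ}
    (hV : ∀ t r, Tendsto (fun k => (u.lift (n * π)).f (T k + t) r) atTop (nhds (V t r))) : NR C V := by
  set U := u.lift (n * π) with hU
  have hC := H.hC
  have b1 : ∀ t r, |U.f t r| ≤ C * q r := fun t r => by
    rw [hU, lift_f, abs_mul, abs_of_pos (q_pos r), mul_comm]
    exact mul_le_mul_of_nonneg_right (H.b1 t r) (q_pos r).le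
  have b2 : ∀ t, ∀ r > 0, |U.f t r| ≤ C * q r / √r := fun t r hr => by
    rw [hU, lift_f, abs_mul, abs_of_pos (q_pos r), mul_comm, mul_div_right_comm]
    exact mul_le_mul_of_nonneg_right (H.b2 t r hr) (q_pos r).le
  have cV : Continuous fun p : ℝ × ℝ => V p.1 p.2 := by
    rw [Metric.continuous_iff]
    intro p ε hε
    obtain ⟨δ, hδ, h⟩ := H.uc (half_pos hε)
    refine ⟨δ, hδ, fun x hx => ?_⟩
    rw [Prod.dist_eq, max_lt_iff, Real.dist_eq, Real.dist_eq] at hx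
    have : Tendsto (fun k => |U.f (T k + x.1) x.2 - U.f (T k + p.1) p.2|) atTop
      (nhds |V x.1 x.2 - V p.1 p.2|) := ((hV _ _).sub (hV _ _)).abs
    have := le_of_tendsto' this (b := ε / 2) fun k => (h _ _ _ _ (by simpa using hx.1) hx.2).le
    rw [Real.dist_eq]; linarith
  have hF : ∀ t r, Tendsto (fun k => FF n u (T k + t) r) atTop (nhds (fv V t r)) := by
    intro t r
    simp only [FF_eq]
    have : Continuous fun v => fU r v := fU_cont.comp (f := fun v => (r, v)) (by fun_prop)
    exact (this.tendsto _).comp (hV t r)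
  have bF : ∀ t r, |fv V t r| ≤ C * m r := fun t r =>
    le_of_tendsto' (hF t r).abs fun k => H.bF _ _
  have cfv : Continuous fun p : ℝ × ℝ => fv V p.1 p.2 := fU_cont.comp (f := fun p : ℝ × ℝ => (p.2, V p.1 p.2)) (by fun_prop)
  have hJ : ∀ k t r, Tendsto (fun j => Jd (FF n u) k 1 (T j + t) r) atTop (nhds (Jd (fv V) k 1 t r)) := by
    intro k t r
    unfold Jd
    apply tendsto_integral_of_dominated_convergence (fun s => C * m (r + 1 * s))
    · intro j
      exact (Jd_int (FF_cont n u) H.bF k (by simp) (T j + t) r).aestronglyMeasurable.restrict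
    · exact ((m_int_shift r (by simp)).1.const_mul C).integrableOn
    · intro j; exact Eventually.of_forall fun s => H.bF _ _
    · refine Eventually.of_forall fun s => ?_
      have := hF (t + k * s) (r + 1 * s)
      simpa only [add_assoc] using this
  have bJ : ∀ k t r, |Jd (FF n u) k 1 t r| ≤ C * Im := fun k t r => Jd_bound (FF_cont n u) H.bF hC.le k (by simp) t r
  have cJ : ∀ k, Continuous fun p : ℝ × ℝ => Jd (fv V) k 1 p.1 p.2 := fun k => Jd_cont cfv bF hC.le k (by simp)
  have cJr : ∀ k t, Continuous fun r => Jd (fv V) k 1 t r := fun k t => (cJ k).comp (f := fun r => (t, r)) (by fun_prop)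
  have cJt : ∀ k r, Continuous fun t => Jd (fv V) k 1 t r := fun k r => (cJ k).comp (f := fun t => (t, r)) (by fun_prop)
  have Ir : ∀ t r, V t r = V t 0 - (∫ x in (0:ℝ)..r, (Jd (fv V) 1 1 t x + Jd (fv V) (-1) 1 t x)) / 2 := by
    intro t r
    have l1 : Tendsto (fun k => U.f (T k + t) r - U.f (T k + t) 0) atTop (nhds (V t r - V t 0)) := (hV t r).sub (hV t 0)
    have l2 : Tendsto (fun k => ∫ x in (T k + t + 0)..(T k + t + r), σ x) atTop (nhds 0) := by
      have := (hl_tendsto H.cσ H.iσ (t + 0) (t + r)).comp hT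
      simpa only [Function.comp_def, ← add_assoc] using this
    have l3 : Tendsto (fun k => ∫ x in (T k + t - r)..(T k + t - 0), ρ x) atTop (nhds 0) := by
      have := (hl_tendsto H.cρ H.iρ (t - r) (t - 0)).comp hT
      simpa only [Function.comp_def, ← add_sub_assoc] using this
    have l4 : Tendsto (fun k => ∫ x in (0:ℝ)..r, (Jd (FF n u) 1 1 (T k + t) x + Jd (FF n u) (-1) 1 (T k + t) x)) atTop
        (nhds (∫ x in (0:ℝ)..r, (Jd (fv V) 1 1 t x + Jd (fv V) (-1) 1 t x))) := by
      apply intervalIntegral.tendsto_integral_filter_of_dominated_convergence (fun _ => 2 * (C * Im))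
      · refine Eventually.of_forall fun k => Continuous.aestronglyMeasurable ?_
        have := H.cJr 1 (T k + t); have := H.cJr (-1) (T k + t)
        fun_prop
      · refine Eventually.of_forall fun k => Eventually.of_forall fun x _ => ?_
        have := bJ 1 (T k + t) x; have := bJ (-1) (T k + t) x
        refine (abs_add_le _ _).trans (by linarith)
      · exact intervalIntegrable_const
      · exact Eventually.of_forall fun x _ => (hJ 1 t x).add (hJ (-1) t x)
    have l5 := ((l2.sub l3).div_const 2).sub (l4.div_const 2)
    have := tendsto_nhds_unique l1 (l5.congr fun k => (H.dr (T k + t) 0 r).symm)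
    linarith
  have It : ∀ t r, V t r = V 0 r + (∫ x in (0:ℝ)..t, (Jd (fv V) 1 1 x r - Jd (fv V) (-1) 1 x r)) / 2 := by
    intro t r
    have l1 : Tendsto (fun k => U.f (T k + t) r - U.f (T k + 0) r) atTop (nhds (V t r - V 0 r)) := (hV t r).sub (hV 0 r)
    have l2 : Tendsto (fun k => ∫ x in (T k + 0 + r)..(T k + t + r), σ x) atTop (nhds 0) := by
      have := (hl_tendsto H.cσ H.iσ (0 + r) (t + r)).comp hT
      simpa only [Function.comp_def, ← add_assoc] using this
    have l3 : Tendsto (fun k => ∫ x in (T k + 0 - r)..(T k + t - r), ρ x) atTop (nhds 0) := by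
      have := (hl_tendsto H.cρ H.iρ (0 - r) (t - r)).comp hT
      simpa only [Function.comp_def, ← add_sub_assoc] using this
    have l4 : Tendsto (fun k => ∫ x in (0:ℝ)..t, (Jd (FF n u) 1 1 (T k + x) r - Jd (FF n u) (-1) 1 (T k + x) r)) atTop
        (nhds (∫ x in (0:ℝ)..t, (Jd (fv V) 1 1 x r - Jd (fv V) (-1) 1 x r))) := by
      apply intervalIntegral.tendsto_integral_filter_of_dominated_convergence (fun _ => 2 * (C * Im))
      · refine Eventually.of_forall fun k => Continuous.aestronglyMeasurable ?_
        have := (H.cJt 1 r).comp (f := fun x => T k + x) (by fun_prop)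
        have := (H.cJt (-1) r).comp (f := fun x => T k + x) (by fun_prop)
        simp only [Function.comp_def] at *
        fun_prop
      · refine Eventually.of_forall fun k => Eventually.of_forall fun x _ => ?_
        have := bJ 1 (T k + x) r; have := bJ (-1) (T k + x) r
        refine (abs_sub _ _).trans (by linarith)
      · exact intervalIntegrable_const
      · exact Eventually.of_forall fun x _ => (hJ 1 x r).sub (hJ (-1) x r)
    have e : ∀ k, ∫ s in (T k + 0)..(T k + t), (Jd (FF n u) 1 1 s r - Jd (FF n u) (-1) 1 s r) =
        ∫ x in (0:ℝ)..t, (Jd (FF n u) 1 1 (T k + x) r - Jd (FF n u) (-1) 1 (T k + x) r) := fun k =>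
      (intervalIntegral.integral_comp_add_left (fun s => Jd (FF n u) 1 1 s r - Jd (FF n u) (-1) 1 s r) (T k)).symm
    have l5 := ((l2.add l3).div_const 2).add (l4.div_const 2)
    have := tendsto_nhds_unique l1 (l5.congr fun k => by rw [← e]; exact (H.dt r (T k + 0) (T k + t)).symm)
    linarith
  refine ⟨hC, cV, fun t r => le_of_tendsto' (hV t r).abs fun k => b1 _ _, fun t r hr =>
    le_of_tendsto' (hV t r).abs fun k => b2 _ _ hr, bF, fun t r => ?_, fun t r => ?_⟩
  · have c : Continuous fun x => Jd (fv V) 1 1 t x + Jd (fv V) (-1) 1 t x := (cJr 1 t).add (cJr (-1) t)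
    have := (((c.integral_hasStrictDerivAt 0 r).hasDerivAt).div_const 2).const_sub (V t 0)
    refine (this.congr_of_eventuallyEq (Eventually.of_forall fun r => Ir t r)).congr_deriv (by ring)
  · have c : Continuous fun x => Jd (fv V) 1 1 x r - Jd (fv V) (-1) 1 x r := (cJt 1 r).sub (cJt (-1) r)
    have := (((c.integral_hasStrictDerivAt 0 t).hasDerivAt).div_const 2).const_add (V 0 r)
    exact this.congr_of_eventuallyEq (Eventually.of_forall fun t => It t r)
end WMS

namespace WMS

theorem hasDerivAt_rpow' {x : ℝ} (hx : 0 < x) (b : ℝ) : HasDerivAt (fun x : ℝ => x ^ b) (b * x ^ (b - 1)) x :=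
  Real.hasDerivAt_rpow_const (Or.inl hx.ne')

theorem grow {f f' : ℝ → ℝ} {r0 r K b : ℝ} (h0 : 0 < r0) (hr : r0 ≤ r) (hb : b ≠ 0)
    (hf : ∀ x ≥ r0, HasDerivAt f (f' x) x) (hK : ∀ x ≥ r0, |f' x| ≤ K * x ^ (b - 1)) :
    |f r - f r0| ≤ K / b * (r ^ b - r0 ^ b) := by
  have hd : ∀ x ≥ r0, HasDerivAt (fun x : ℝ => K / b * x ^ b) (K * x ^ (b - 1)) x := by
    intro x hx
    refine ((hasDerivAt_rpow' (lt_of_lt_of_le h0 hx) b).const_mul (K / b)).congr_deriv ?_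
    field_simp
  have m1 : MonotoneOn (fun x => K / b * x ^ b - f x) (Set.Ici r0) := by
    apply monotoneOn_of_deriv_nonneg (convex_Ici r0)
    · intro x hx; exact ((hd x hx).sub (hf x hx)).continuousAt.continuousWithinAt
    · intro x hx; rw [interior_Ici] at hx
      exact ((hd x (le_of_lt hx)).sub (hf x (le_of_lt hx))).differentiableAt.differentiableWithinAt
    · intro x hx; rw [interior_Ici] at hx
      rw [(HasDerivAt.fun_sub (hd x (le_of_lt hx)) (hf x (le_of_lt hx))).deriv]
      have := abs_le.1 (hK x (le_of_lt hx)); linarith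
  have m2 : MonotoneOn (fun x => K / b * x ^ b + f x) (Set.Ici r0) := by
    apply monotoneOn_of_deriv_nonneg (convex_Ici r0)
    · intro x hx; exact ((hd x hx).add (hf x hx)).continuousAt.continuousWithinAt
    · intro x hx; rw [interior_Ici] at hx
      exact ((hd x (le_of_lt hx)).add (hf x (le_of_lt hx))).differentiableAt.differentiableWithinAt
    · intro x hx; rw [interior_Ici] at hx
      rw [(HasDerivAt.fun_add (hd x (le_of_lt hx)) (hf x (le_of_lt hx))).deriv]
      have := abs_le.1 (hK x (le_of_lt hx)); linarith
  have e1 := m1 (Set.mem_Ici.2 le_rfl) (Set.mem_Ici.2 hr) hr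
  have e2 := m2 (Set.mem_Ici.2 le_rfl) (Set.mem_Ici.2 hr) hr
  simp only at e1 e2
  rw [abs_le, mul_sub]
  constructor <;> linarith

theorem decay {f f' : ℝ → ℝ} {r0 K a : ℝ} (h0 : 0 < r0) (ha : 0 < a)
    (hf : ∀ x ≥ r0, HasDerivAt f (f' x) x) (hK : ∀ x ≥ r0, |f' x| ≤ K * x ^ (-a - 1))
    (hl : Tendsto f atTop (nhds 0)) : |f r0| ≤ K / a * r0 ^ (-a) := by
  have h1 : Tendsto (fun r => |f r - f r0|) atTop (nhds |0 - f r0|) := (hl.sub_const _).abs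
  have h2 : Tendsto (fun r : ℝ => K / (-a) * (r ^ (-a) - r0 ^ (-a))) atTop (nhds (K / (-a) * (0 - r0 ^ (-a)))) :=
    ((tendsto_rpow_neg_atTop ha).sub_const _).const_mul _
  have := le_of_tendsto_of_tendsto h1 h2 (by
    filter_upwards [eventually_ge_atTop r0] with r hr
    exact grow h0 hr (by linarith) hf hK)
  rw [zero_sub, abs_neg] at this
  refine this.trans (le_of_eq ?_)
  field_simp; ring

/-- decay along a ray -/
theorem decay_ray {g g' : ℝ → ℝ} {r0 K a : ℝ} (h0 : 0 < r0) (ha : 0 < a)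
    (hf : ∀ s ≥ 0, HasDerivAt g (g' s) s) (hK : ∀ s ≥ 0, |g' s| ≤ K * (r0 + s) ^ (-a - 1))
    (hl : Tendsto g atTop (nhds 0)) : |g 0| ≤ K / a * r0 ^ (-a) := by
  have := decay (f := fun x => g (x - r0)) (f' := fun x => g' (x - r0)) h0 ha
    (fun x hx => by
      exact (hf (x - r0) (by linarith)).comp_sub_const x r0)
    (fun x hx => by
      have := hK (x - r0) (by linarith)
      rwa [add_sub_cancel] at this)
    (hl.comp (tendsto_atTop_add_const_right _ _ tendsto_id))
  simpa using this

theorem sin_sub_le (x : ℝ) : |sin x - x| ≤ 2 * |x| ^ 3 := by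
  wlog hx : 0 ≤ x generalizing x
  · have := this (-x) (by linarith)
    rw [Real.sin_neg, abs_neg] at this
    rwa [show -sin x - -x = -(sin x - x) by ring, abs_neg] at this
  rw [abs_of_nonneg hx]
  rcases hx.eq_or_lt with rfl | h0
  · simp
  have h1 := Real.sin_lt h0
  rw [abs_of_nonpos (by linarith)]
  rcases le_total x 1 with h | h
  · have := Real.sin_gt_sub_cube h0 
    have : 0 ≤ x ^ 3 := by positivity
    nlinarith
  · have := Real.neg_one_le_sin x
    nlinarith [sq_nonneg (x - 1), mul_nonneg h0.le (sub_nonneg.2 h)]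

theorem cos_sub_le (x : ℝ) : |cos x - 1| ≤ x ^ 2 / 2 := by
  have := Real.one_sub_sq_div_two_le_cos (x := x)
  have := Real.cos_le_one x
  rw [abs_of_nonpos (by linarith)]; linarith

theorem q_ge {r : ℝ} (hr : 0 < r) : r ≤ q r := (le_abs_self r).trans (abs_le_q r)


theorem pert_c1 {r q : ℝ} (hr : 1 ≤ r) (hq : q ^ 2 = r ^ 2 + 1) (hqp : 0 < q) :
    |1 / q ^ 4 + 2 / q ^ 2 - 2 / r ^ 2| ≤ 3 / r ^ 4 := by
  have hr0 : 0 < r := by linarith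
  have hrq : r ≤ q := by nlinarith
  have : 1 / q ^ 4 + 2 / q ^ 2 - 2 / r ^ 2 = -((r ^ 2 + 2) / (q ^ 4 * r ^ 2)) := by
    rw [show q ^ 4 = (q ^ 2) ^ 2 by ring, hq]; field_simp; ring
  rw [this, abs_neg, abs_of_nonneg (by positivity)]
  calc (r ^ 2 + 2) / (q ^ 4 * r ^ 2) ≤ (3 * r ^ 2) / (r ^ 4 * r ^ 2) := by
        gcongr; nlinarith
    _ = _ := by field_simp

theorem pert_c2 {r q : ℝ} (hr : 1 ≤ r) (hq : q ^ 2 = r ^ 2 + 1) (hqp : 0 < q) :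
    |4 / r ^ 3 - 4 * r / q ^ 4 - 4 * r / q ^ 6| ≤ 16 / r ^ 5 := by
  have hr0 : 0 < r := by linarith
  have hrq : r ≤ q := by nlinarith
  have h1 : 4 / r ^ 3 - 4 * r / q ^ 4 = 4 * (2 * r ^ 2 + 1) / (r ^ 3 * q ^ 4) := by
    rw [show q ^ 4 = (q ^ 2) ^ 2 by ring, hq]; field_simp; ring
  have h2 : 4 * (2 * r ^ 2 + 1) / (r ^ 3 * q ^ 4) ≤ 12 / r ^ 5 := by
    calc 4 * (2 * r ^ 2 + 1) / (r ^ 3 * q ^ 4) ≤ 4 * (3 * r ^ 2) / (r ^ 3 * r ^ 4) := by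
          gcongr; nlinarith
      _ = _ := by field_simp; norm_num
  have h3 : 4 * r / q ^ 6 ≤ 4 / r ^ 5 := by
    calc 4 * r / q ^ 6 ≤ 4 * r / r ^ 6 := by gcongr
      _ = _ := by field_simp
  have h4 : 0 ≤ 4 * (2 * r ^ 2 + 1) / (r ^ 3 * q ^ 4) := by positivity
  have h5 : 0 ≤ 4 * r / q ^ 6 := by positivity
  have h6 : 16 / r ^ 5 = 12 / r ^ 5 + 4 / r ^ 5 := by ring
  have h7 : 0 < 4 / r ^ 5 := by positivity
  have h8 : 0 < 12 / r ^ 5 := by positivity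
  rw [h1, h6, abs_le]; constructor <;> linarith

theorem abs_six {a b c d e f A B : ℝ} (h1 : |a| ≤ 3 * A) (h2 : |b| ≤ 16 * A) (h3 : |c| ≤ 16 * B)
    (h4 : |d| ≤ 16 * B) (h5 : |e| ≤ 3 * A) (h6 : |f| ≤ 16 * B) : |a + b + c - d + e + f| ≤ 22 * A + 48 * B := by
  rw [abs_le] at *
  constructor <;> linarith

/-- the coefficient estimates for the perturbation terms -/
theorem pert_bound0 {r q V v K X y cs sn : ℝ} (hr : 1 ≤ r) (hq : q ^ 2 = r ^ 2 + 1) (hqp : 0 < q) (hK : 0 ≤ K)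
    (hX : 0 ≤ X) (hX2 : X ^ 2 ≤ r) (hV : |V| ≤ K * X) (hv : |v| ≤ K * X / r)
    (hcsb : |cs| ≤ 2 * (K * X / r) ^ 2) (hsnb : |sn| ≤ 16 * (K * X / r) ^ 3) :
    |v * (1 / q ^ 4 + 2 / q ^ 2 - 2 / r ^ 2) + V * (4 / r ^ 3 - 4 * r / q ^ 4 - 4 * r / q ^ 6)
        + 2 * cs * (v / q ^ 2 - V * r / q ^ 4) - sn * (r / q ^ 3) + V * (1 / q ^ 4 + 2 / q ^ 2 - 2 / r ^ 2) / r
        + sn * (1 / (q * r))| ≤ 22 * (K * (X / r ^ 4)) + 48 * (K ^ 3 * (X / r ^ 4)) := by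
  have hr0 : 0 < r := by linarith
  have hrq : r ≤ q := by nlinarith
  have c1 := pert_c1 hr hq hqp
  have c2 := pert_c2 hr hq hqp
  have hX3 : X ^ 3 ≤ X * r := by
    calc X ^ 3 = X * X ^ 2 := by ring
      _ ≤ X * r := by gcongr
  have cube : (K * X / r) ^ 3 ≤ K ^ 3 * (X / r ^ 2) := by
    rw [div_pow, mul_pow, mul_div_assoc]
    apply mul_le_mul_of_nonneg_left _ (by positivity)
    calc X ^ 3 / r ^ 3 ≤ X * r / r ^ 3 := by gcongr
      _ = _ := by field_simp
  have hKX : 0 ≤ K * X := mul_nonneg hK hX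
  apply abs_six
  · rw [abs_mul]
    calc _ ≤ (K * X / r) * (3 / r ^ 4) := by gcongr
      _ ≤ (K * X / 1) * (3 / r ^ 4) := by gcongr
      _ = _ := by ring
  · rw [abs_mul]
    calc _ ≤ (K * X) * (16 / r ^ 5) := by gcongr
      _ ≤ (K * X) * (16 / r ^ 4) := by gcongr; norm_num
      _ = _ := by ring
  · have h1 : |v / q ^ 2 - V * r / q ^ 4| ≤ 2 * (K * X / r) / r ^ 2 := by
      have a1 : |v / q ^ 2| ≤ (K * X / r) / r ^ 2 := by
        rw [abs_div, abs_of_pos (by positivity : 0 < q ^ 2)]; gcongr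
      have a2 : |V * r / q ^ 4| ≤ (K * X / r) / r ^ 2 := by
        rw [abs_div, abs_mul, abs_of_pos hr0, abs_of_pos (by positivity : 0 < q ^ 4)]
        calc |V| * r / q ^ 4 ≤ (K * X) * r / r ^ 4 := by gcongr
          _ = _ := by field_simp
      have := abs_sub (v / q ^ 2) (V * r / q ^ 4)
      have e : 2 * (K * X / r) / r ^ 2 = K * X / r / r ^ 2 + K * X / r / r ^ 2 := by ring
      linarith
    rw [abs_mul, abs_mul]
    calc |2| * |cs| * |v / q ^ 2 - V * r / q ^ 4| ≤ 2 * (2 * (K * X / r) ^ 2) * (2 * (K * X / r) / r ^ 2) := by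
          rw [abs_of_pos (by norm_num : (0:ℝ) < 2)]; gcongr
      _ = 8 * (K * X / r) ^ 3 / r ^ 2 := by ring
      _ ≤ 8 * (K ^ 3 * (X / r ^ 2)) / r ^ 2 := by gcongr
      _ = 8 * (K ^ 3 * (X / r ^ 4)) := by field_simp
      _ ≤ _ := by have : 0 ≤ K ^ 3 * (X / r ^ 4) := by positivity
                  linarith
  · rw [abs_mul, abs_of_pos (by positivity : 0 < r / q ^ 3)]
    calc |sn| * (r / q ^ 3) ≤ (16 * (K ^ 3 * (X / r ^ 2))) * (r / r ^ 3) := by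
          gcongr; linarith
      _ = _ := by field_simp
  · rw [abs_div, abs_mul, abs_of_pos hr0]
    calc _ ≤ (K * X) * (3 / r ^ 4) / 1 := by gcongr
      _ = _ := by ring
  · rw [abs_mul, abs_of_pos (by positivity : 0 < 1 / (q * r))]
    calc |sn| * (1 / (q * r)) ≤ (16 * (K ^ 3 * (X / r ^ 2))) * (1 / (r * r)) := by
          gcongr; linarith
      _ = _ := by field_simp

theorem pert_bound {r q V v K X : ℝ} (hr : 1 ≤ r) (hq : q ^ 2 = r ^ 2 + 1) (hqp : 0 < q) (hK : 0 ≤ K)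
    (hX : 0 ≤ X) (hX2 : X ^ 2 ≤ r) (hV : |V| ≤ K * X) (hv : |v| ≤ K * X / r) :
    |((-4 * V * r / q ^ 6 - 2 * cos (2 * (V / q)) * V * r / q ^ 4 - sin (2 * (V / q)) * r / q ^ 3
      + (1 / q ^ 4 + 2 * cos (2 * (V / q)) / q ^ 2) * v) - 2 * v / r ^ 2 + 4 * V / r ^ 3)
      + (V / q ^ 4 + sin (2 * (V / q)) / q - 2 * V / r ^ 2) / r| ≤ (22 * K + 48 * K ^ 3) * (X / r ^ 4) := by
  have hr0 : 0 < r := by linarith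
  have hrq : r ≤ q := by nlinarith
  obtain ⟨y, hy⟩ : ∃ y, y = V / q := ⟨_, rfl⟩
  rw [← hy]
  have hVy : V = y * q := by rw [hy]; field_simp
  have e : ((-4 * V * r / q ^ 6 - 2 * cos (2 * y) * V * r / q ^ 4 - sin (2 * y) * r / q ^ 3
      + (1 / q ^ 4 + 2 * cos (2 * y) / q ^ 2) * v) - 2 * v / r ^ 2 + 4 * V / r ^ 3)
      + (V / q ^ 4 + sin (2 * y) / q - 2 * V / r ^ 2) / r
      = v * (1 / q ^ 4 + 2 / q ^ 2 - 2 / r ^ 2) + V * (4 / r ^ 3 - 4 * r / q ^ 4 - 4 * r / q ^ 6)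
        + 2 * (cos (2 * y) - 1) * (v / q ^ 2 - V * r / q ^ 4) - (sin (2 * y) - 2 * y) * (r / q ^ 3)
        + V * (1 / q ^ 4 + 2 / q ^ 2 - 2 / r ^ 2) / r
        + (sin (2 * y) - 2 * y) * (1 / (q * r)) := by
    generalize cos (2 * y) = c
    generalize sin (2 * y) = s
    clear hV hy
    subst hVy
    field_simp; ring
  rw [e]
  have hyb : |y| ≤ K * X / r := by
    rw [hy, abs_div, abs_of_pos hqp]; gcongr
  have hcsb : |cos (2 * y) - 1| ≤ 2 * (K * X / r) ^ 2 := by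
    refine (cos_sub_le _).trans ?_
    have : y ^ 2 ≤ (K * X / r) ^ 2 := by rw [← sq_abs]; gcongr
    linarith
  have hsnb : |sin (2 * y) - 2 * y| ≤ 16 * (K * X / r) ^ 3 := by
    refine (sin_sub_le _).trans ?_
    rw [abs_mul, mul_pow]
    have : |y| ^ 3 ≤ (K * X / r) ^ 3 := by gcongr
    norm_num; linarith
  refine (pert_bound0 (y := y) hr hq hqp hK hX hX2 hV hv hcsb hsnb).trans (le_of_eq (by ring))
end WMS

namespace WMS

theorem Jd_deriv {F G : ℝ → ℝ → ℝ} {B : ℝ} (cF : Continuous fun p : ℝ × ℝ => F p.1 p.2)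
    (cG : Continuous fun p : ℝ × ℝ => G p.1 p.2) {k l t r p1 p2 : ℝ} (hl : l = 1 ∨ l = -1)
    (iF : Integrable (fun s => F (t + k * s) (r + l * s)) (volume.restrict (Set.Ioi 0)))
    (hd : ∀ s x, HasDerivAt (fun x => F (t + p1 * x + k * s) (r + p2 * x + l * s))
      (G (t + p1 * x + k * s) (r + p2 * x + l * s)) x)
    (hB : ∀ s > 0, ∀ x, |x| < 1 → |G (t + p1 * x + k * s) (r + p2 * x + l * s)| ≤ B * m (r + l * s)) :
    HasDerivAt (fun x => Jd F k l (t + p1 * x) (r + p2 * x)) (Jd G k l t r) 0 := by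
  unfold Jd
  have := (hasDerivAt_integral_of_dominated_loc_of_deriv_le (μ := volume.restrict (Set.Ioi (0:ℝ)))
    (F := fun x s => F (t + p1 * x + k * s) (r + p2 * x + l * s))
    (F' := fun x s => G (t + p1 * x + k * s) (r + p2 * x + l * s))
    (x₀ := (0:ℝ)) (s := Metric.ball 0 1) (bound := fun s => B * m (r + l * s))
    (Metric.ball_mem_nhds _ one_pos) ?_ ?_ ?_ ?_ ?_ ?_).2
  · simpa using this
  · refine Eventually.of_forall fun x => Continuous.aestronglyMeasurable ?_
    exact cF.comp (f := fun s => (t + p1 * x + k * s, r + p2 * x + l * s)) (by fun_prop)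
  · simpa using iF
  · refine Continuous.aestronglyMeasurable ?_
    exact cG.comp (f := fun s => (t + p1 * 0 + k * s, r + p2 * 0 + l * s)) (by fun_prop)
  · refine (ae_restrict_iff' measurableSet_Ioi).2 (Eventually.of_forall fun s hs x hx => ?_)
    exact hB s hs x (by simpa using hx)
  · exact ((m_int_shift r hl).1.const_mul B).integrableOn
  · exact Eventually.of_forall fun s x hx => hd s x

theorem Jd_deriv_r {F G : ℝ → ℝ → ℝ} {C B : ℝ} (cF : Continuous fun p : ℝ × ℝ => F p.1 p.2)
    (cG : Continuous fun p : ℝ × ℝ => G p.1 p.2) (hF : ∀ t r, |F t r| ≤ C * m r) (hB : 0 ≤ B)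
    (hG : ∀ t r, |G t r| ≤ B * m r) (hd : ∀ t r, HasDerivAt (fun r => F t r) (G t r) r) (k t r : ℝ) :
    HasDerivAt (fun r => Jd F k 1 t r) (Jd G k 1 t r) r := by
  have := Jd_deriv (p1 := 0) (p2 := 1) (B := B * 4) cF cG (Or.inl rfl) (Jd_int cF hF k (Or.inl rfl) t r).integrableOn
    (fun s x => by
      have := hd (t + 0 * x + k * s) (r + 1 * x + 1 * s)
      have h2 : HasDerivAt (fun x => r + 1 * x + 1 * s) 1 x := by
        have := ((hasDerivAt_id x).const_mul 1).const_add r |>.add_const (1 * s)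
        simpa using this
      have := HasDerivAt.comp x this h2
      simp only [zero_mul, add_zero, Function.comp_def, mul_one] at this ⊢
      exact this) (fun s hs x hx => by
      refine (hG _ _).trans ?_
      rw [mul_assoc]
      gcongr
      exact m_shift (by rw [show r + 1 * x + 1 * s - (r + 1 * s) = x by ring]; exact hx.le))
  have h2 : HasDerivAt (fun y => Jd F k 1 (t + 0 * (y - r)) (r + 1 * (y - r))) (Jd G k 1 t r) r := by
    have h3 : HasDerivAt (fun x => Jd F k 1 (t + 0 * x) (r + 1 * x)) (Jd G k 1 t r) (r - r) := by rwa [sub_self]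
    exact h3.comp_sub_const r r
  refine h2.congr_of_eventuallyEq (Eventually.of_forall fun y => ?_)
  simp

noncomputable def gU (r V v : ℝ) : ℝ := -4 * V * r / q r ^ 6 - 2 * cos (2 * (V / q r)) * V * r / q r ^ 4
  - sin (2 * (V / q r)) * r / q r ^ 3 + (1 / q r ^ 4 + 2 * cos (2 * (V / q r)) / q r ^ 2) * v

theorem fU_deriv {V : ℝ → ℝ} {v r : ℝ} (h : HasDerivAt V v r) :
    HasDerivAt (fun r => fU r (V r)) (gU r (V r) v) r := by
  have hq := hasDerivAt_q r
  have q0 := q_ne r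
  have h1 := h.fun_div (hq.fun_pow 4) (pow_ne_zero 4 q0)
  have h2 := (((h.fun_div hq q0).const_mul 2).sin).fun_div hq q0
  refine (h1.fun_add h2).congr_deriv ?_
  unfold gU
  push_cast
  field_simp
  ring

theorem gU_cont : Continuous fun p : ℝ × ℝ × ℝ => gU p.1 p.2.1 p.2.2 := by
  unfold gU
  have h : Continuous fun p : ℝ × ℝ × ℝ => p.2.1 / q p.1 := Continuous.div (by fun_prop) (by fun_prop) fun p => q_ne _
  have hq : ∀ k : ℕ, ∀ p : ℝ × ℝ × ℝ, q p.1 ^ k ≠ 0 := fun k p => pow_ne_zero k (q_ne _)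
  refine ((Continuous.sub (Continuous.sub ?_ ?_) ?_).add (Continuous.mul (Continuous.add ?_ ?_) (by fun_prop)))
  all_goals exact Continuous.div (by fun_prop) (by fun_prop) (hq _)

theorem gU_bound {C A V v r : ℝ} (hV : |V| ≤ C * q r) (hv : |v| ≤ A) (hC : 0 ≤ C) :
    |gU r V v| ≤ (6 * C + 1 + 3 * A) * m r := by
  have q0 := q_pos r
  have q1 := one_le_q r
  have hrq := abs_le_q r
  have hA : 0 ≤ A := (abs_nonneg v).trans hv
  have hm := inv_q2_le_m r
  rw [← q_sq] at hm
  have hc := abs_cos_le_one (2 * (V / q r))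
  have hs := abs_sin_le_one (2 * (V / q r))
  unfold gU
  have t1 : |-4 * V * r / q r ^ 6| ≤ 4 * C * (1 / q r ^ 2) := by
    rw [abs_div, abs_mul, abs_mul, abs_of_pos (by positivity : 0 < q r ^ 6), abs_neg, abs_of_pos (by norm_num : (0:ℝ) < 4)]
    calc 4 * |V| * |r| / q r ^ 6 ≤ 4 * (C * q r) * q r / q r ^ 6 := by gcongr
      _ = 4 * C * (1 / q r ^ 4) := by field_simp
      _ ≤ _ := by gcongr <;> norm_num
  have t2 : |2 * cos (2 * (V / q r)) * V * r / q r ^ 4| ≤ 2 * C * (1 / q r ^ 2) := by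
    rw [abs_div, abs_mul, abs_mul, abs_mul, abs_of_pos (by positivity : 0 < q r ^ 4), abs_of_pos (by norm_num : (0:ℝ) < 2)]
    calc 2 * |cos (2 * (V / q r))| * |V| * |r| / q r ^ 4 ≤ 2 * 1 * (C * q r) * q r / q r ^ 4 := by gcongr
      _ = _ := by field_simp
  have t3 : |sin (2 * (V / q r)) * r / q r ^ 3| ≤ 1 * (1 / q r ^ 2) := by
    rw [abs_div, abs_mul, abs_of_pos (by positivity : 0 < q r ^ 3)]
    calc |sin (2 * (V / q r))| * |r| / q r ^ 3 ≤ 1 * q r / q r ^ 3 := by gcongr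
      _ = _ := by field_simp
  have t4 : |(1 / q r ^ 4 + 2 * cos (2 * (V / q r)) / q r ^ 2) * v| ≤ 3 * A * (1 / q r ^ 2) := by
    rw [abs_mul]
    have h1 : |1 / q r ^ 4| ≤ 1 / q r ^ 2 := by
      rw [abs_of_pos (by positivity)]
      gcongr <;> norm_num
    have h2 : |2 * cos (2 * (V / q r)) / q r ^ 2| ≤ 2 * 1 / q r ^ 2 := by
      rw [abs_div, abs_mul, abs_of_pos (by positivity : 0 < q r ^ 2), abs_of_pos (by norm_num : (0:ℝ) < 2)]
      gcongr
    calc _ ≤ (1 / q r ^ 2 + 2 * 1 / q r ^ 2) * A := by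
          gcongr; exact (abs_add_le _ _).trans (add_le_add h1 h2)
      _ = _ := by ring
  calc _ ≤ (6 * C + 1 + 3 * A) * (1 / q r ^ 2) := by
        rw [abs_le] at *
        constructor <;> linarith
    _ ≤ _ := by gcongr

end WMS

namespace WMS

section
variable {C : ℝ} {V : ℝ → ℝ → ℝ}

noncomputable def Vr (V : ℝ → ℝ → ℝ) (t r : ℝ) : ℝ := -(Jd (fv V) 1 1 t r + Jd (fv V) (-1) 1 t r) / 2
noncomputable def gv (V : ℝ → ℝ → ℝ) (t r : ℝ) : ℝ := gU r (V t r) (Vr V t r)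

theorem NR.cfv (H : NR C V) : Continuous fun p : ℝ × ℝ => fv V p.1 p.2 := by
  have := H.cV
  exact fU_cont.comp (f := fun p : ℝ × ℝ => (p.2, V p.1 p.2)) (by fun_prop)

theorem NR.cJ (H : NR C V) (k : ℝ) : Continuous fun p : ℝ × ℝ => Jd (fv V) k 1 p.1 p.2 :=
  Jd_cont H.cfv H.bF H.hC.le k (Or.inl rfl)

theorem NR.cgv (H : NR C V) : Continuous fun p : ℝ × ℝ => gv V p.1 p.2 := by
  have := H.cV; have := H.cJ 1; have := H.cJ (-1)
  have h : Continuous fun p : ℝ × ℝ => Vr V p.1 p.2 := by unfold Vr; fun_prop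
  exact gU_cont.comp (f := fun p : ℝ × ℝ => (p.2, V p.1 p.2, Vr V p.1 p.2)) (by fun_prop)

theorem NR.bVr (H : NR C V) (t r : ℝ) : |Vr V t r| ≤ C * Im := by
  have h1 := Jd_bound H.cfv H.bF H.hC.le 1 (Or.inl rfl) t r
  have h2 := Jd_bound H.cfv H.bF H.hC.le (-1) (Or.inl rfl) t r
  unfold Vr
  rw [abs_le] at *
  constructor <;> linarith

theorem NR.bVr' (H : NR C V) (t : ℝ) {r : ℝ} (hr : 0 < r) : |Vr V t r| ≤ C * (2 / √r) := by
  have h1 := Jd_bound' H.cfv H.bF H.hC.le 1 t hr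
  have h2 := Jd_bound' H.cfv H.bF H.hC.le (-1) t hr
  unfold Vr
  rw [abs_le] at *
  constructor <;> linarith

theorem NR.bgv (H : NR C V) (t r : ℝ) : |gv V t r| ≤ (6 * C + 1 + 3 * (C * Im)) * m r :=
  gU_bound (H.b1 t r) (H.bVr t r) H.hC.le

theorem NR.Bpos (H : NR C V) : 0 ≤ 6 * C + 1 + 3 * (C * Im) := by
  have := H.hC; have := Im_nonneg; positivity

theorem NR.dfv (H : NR C V) (t r : ℝ) : HasDerivAt (fun r => fv V t r) (gv V t r) r :=
  fU_deriv (H.hr t r)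

theorem NR.dJ (H : NR C V) (k t r : ℝ) : HasDerivAt (fun r => Jd (fv V) k 1 t r) (Jd (gv V) k 1 t r) r :=
  Jd_deriv_r H.cfv H.cgv H.bF H.Bpos H.bgv H.dfv k t r

theorem NR.b2' (H : NR C V) (t : ℝ) {r : ℝ} (hr : 1 ≤ r) : |V t r| ≤ 2 * C * √r := by
  have h0 : 0 < r := by linarith
  refine (H.b2 t r h0).trans ?_
  have : q r ≤ 2 * r := by
    have := q_sq r; have := q_pos r; nlinarith
  have hC := H.hC
  have h1 : 0 < √r := Real.sqrt_pos.2 h0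
  rw [div_le_iff₀ h1]
  have : √r * √r = r := Real.mul_self_sqrt h0.le
  calc C * q r ≤ C * (2 * r) := by gcongr
    _ = 2 * C * √r * √r := by rw [mul_assoc, this]; ring

/-- derivative of V along rays -/
theorem NR.ray (H : NR C V) {k : ℝ} (hk : k = 1 ∨ k = -1) (t r s : ℝ) :
    HasDerivAt (fun s => V (t + k * s) (r + s)) (-Jd (fv V) (-k) 1 (t + k * s) (r + s)) s := by
  have hx : HasDerivAt (fun s => t + k * s) k s := by
    simpa using ((hasDerivAt_id s).const_mul k).const_add t
  have hy : HasDerivAt (fun s => r + s) 1 s := by simpa using (hasDerivAt_id s).const_add r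
  have c1 := H.cJ 1
  have c2 := H.cJ (-1)
  have := chainC (f := V) (fun t r => H.ht t r) (fun t r => H.hr t r) (by fun_prop) (by fun_prop) hx hy
  refine this.congr_deriv ?_
  rcases hk with rfl | rfl
  · ring
  · simp only [neg_neg]; ring

noncomputable def Ak (V : ℝ → ℝ → ℝ) (k t r : ℝ) : ℝ := Jd (gv V) k 1 t r + Jd (fv V) k 1 t r / r + V t r / r ^ 2

theorem NR.Ak_ray (H : NR C V) {k : ℝ} (hk : k = 1 ∨ k = -1) (t : ℝ) {r s : ℝ} (hr : 0 < r + s) :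
    HasDerivAt (fun s => Ak V k (t + k * s) (r + s))
      (-((gv V (t + k * s) (r + s) - 2 * Vr V (t + k * s) (r + s) / (r + s) ^ 2 + 4 * V (t + k * s) (r + s) / (r + s) ^ 3)
      + (fv V (t + k * s) (r + s) - 2 * V (t + k * s) (r + s) / (r + s) ^ 2) / (r + s))) s := by
  have hy : HasDerivAt (fun s => r + s) 1 s := by simpa using (hasDerivAt_id s).const_add r
  have h1 := Jd_hasDeriv_ray H.cgv H.bgv k (Or.inl rfl) t r s
  have h2 := Jd_hasDeriv_ray H.cfv H.bF k (Or.inl rfl) t r s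
  simp only [one_mul] at h1 h2
  have h3 := H.ray hk t r s
  have := (h1.fun_add (h2.fun_div hy hr.ne')).fun_add (h3.fun_div (hy.fun_pow 2) (pow_ne_zero 2 hr.ne'))
  refine this.congr_deriv ?_
  have e : Jd (fv V) k 1 (t + k * s) (r + s) + Jd (fv V) (-k) 1 (t + k * s) (r + s) = -2 * Vr V (t + k * s) (r + s) := by
    unfold Vr
    rcases hk with rfl | rfl
    · ring
    · simp only [neg_neg]; ring
  have e' : Jd (fv V) k 1 (t + k * s) (r + s) = -2 * Vr V (t + k * s) (r + s) - Jd (fv V) (-k) 1 (t + k * s) (r + s) := by linarith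
  rw [e']
  have := hr.ne'
  field_simp
  ring

theorem tend_inv_sqrt (C : ℝ) : Tendsto (fun r : ℝ => C * (2 / √r)) atTop (nhds 0) := by
  have : Tendsto (fun r : ℝ => √r) atTop atTop := Real.tendsto_sqrt_atTop
  simpa using ((tendsto_const_nhds (x := (2:ℝ))).div_atTop this).const_mul C

theorem NR.Ak_lim (H : NR C V) (k t : ℝ) {r : ℝ} (hr : 0 < r) :
    Tendsto (fun s => Ak V k (t + k * s) (r + s)) atTop (nhds 0) := by
  have hs : Tendsto (fun s : ℝ => r + s) atTop atTop := tendsto_atTop_add_const_left _ _ tendsto_id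
  have hb : Tendsto (fun x : ℝ => (6 * C + 1 + 3 * (C * Im)) * (2 / √x) + C * (2 / √x) + C * (2 / √x)) atTop (nhds 0) := by
    simpa using ((tend_inv_sqrt _).add (tend_inv_sqrt C)).add (tend_inv_sqrt C)
  refine squeeze_zero_norm' ?_ (hb.comp hs)
  filter_upwards [eventually_ge_atTop (1:ℝ)] with s hs1
  have h1 : 1 ≤ r + s := by linarith
  have h0 : 0 < r + s := by linarith
  have a1 := Jd_bound' H.cgv H.bgv H.Bpos k (t + k * s) h0
  have a2 := Jd_bound' H.cfv H.bF H.hC.le k (t + k * s) h0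
  have a3 := H.b2' (t + k * s) h1
  rw [Real.norm_eq_abs]
  unfold Ak
  refine (abs_add_le _ _).trans (add_le_add ((abs_add_le _ _).trans (add_le_add a1 ?_)) ?_)
  · rw [abs_div, abs_of_pos h0]
    exact (div_le_self (abs_nonneg _) h1).trans a2
  · rw [abs_div, abs_of_pos (by positivity : 0 < (r + s) ^ 2)]
    simp only [Function.comp]
    have hq : 0 < √(r + s) := Real.sqrt_pos.2 h0
    have hq2 : √(r + s) ^ 2 = r + s := Real.sq_sqrt h0.le
    generalize √(r + s) = y at *
    generalize V (t + k * s) (r + s) = vv at *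
    rw [← hq2] at h1 ⊢
    have hC := H.hC
    calc |vv| / (y ^ 2) ^ 2 ≤ (2 * C * y) / (y ^ 2) ^ 2 := by gcongr
      _ = C * (2 / y) / y ^ 2 := by field_simp
      _ ≤ C * (2 / y) := div_le_self (by positivity) h1

/-- one improvement step -/
theorem NR.step (H : NR C V) {p K : ℝ} (hp : p ≠ 0) (hp2 : p ≤ 1 / 2) (hK : 0 ≤ K)
    (hV : ∀ t, ∀ r ≥ 1, |V t r| ≤ K * r ^ p) (hv : ∀ t, ∀ r ≥ 1, |Vr V t r| ≤ K * r ^ (p - 1)) :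
    ∃ K' : ℝ, ∀ t, ∀ r ≥ 1, |Vr V t r + V t r / r| ≤ K' * r ^ (p - 2) ∧
      |r * V t r - V t 1| ≤ K' / p * (r ^ p - 1) := by
  set K1 := 22 * K + 48 * K ^ 3 with hK1
  have hA : ∀ k, (k = 1 ∨ k = -1) → ∀ t, ∀ r ≥ 1, |Ak V k t r| ≤ K1 / (3 - p) * r ^ (p - 3) := by
    intro k hk t r hr
    have := decay_ray (g := fun s => Ak V k (t + k * s) (r + s)) (r0 := r) (K := K1) (a := 3 - p) (by linarith)
      (by linarith) (fun s hs => H.Ak_ray hk t (by linarith)) (fun s hs => ?_) (H.Ak_lim k t (by linarith))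
    · simpa using this
    rw [abs_neg]
    have h1 : 1 ≤ r + s := by linarith
    have h0 : 0 < r + s := by linarith
    have := pert_bound (V := V (t + k * s) (r + s)) (v := Vr V (t + k * s) (r + s)) (K := K) (X := (r + s) ^ p)
      h1 (q_sq (r + s)) (q_pos _) hK (by positivity) (by
        rw [← Real.rpow_natCast, ← Real.rpow_mul h0.le]
        calc (r + s) ^ (p * ((2:ℕ):ℝ)) ≤ (r + s) ^ (1:ℝ) := Real.rpow_le_rpow_of_exponent_le h1 (by push_cast; linarith)
          _ = r + s := Real.rpow_one _) (hV _ _ h1) (by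
        have := hv (t + k * s) _ h1
        rwa [Real.rpow_sub_one h0.ne', ← mul_div_assoc] at this)
    unfold gv gU fv fU
    refine this.trans (le_of_eq ?_)
    rw [show (-(3 - p) - 1) = p - (4:ℕ) by push_cast; ring, Real.rpow_sub_natCast h0.ne']
  set K2 := K1 / (3 - p)
  have dZ : ∀ t, ∀ r > 0, HasDerivAt (fun r => Vr V t r + V t r / r) (-(Ak V 1 t r + Ak V (-1) t r) / 2) r := by
    intro t r hr
    have h1 : HasDerivAt (fun r => Vr V t r) (-(Jd (gv V) 1 1 t r + Jd (gv V) (-1) 1 t r) / 2) r :=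
      ((H.dJ 1 t r).fun_add (H.dJ (-1) t r)).fun_neg.div_const 2
    have h2 := (H.hr t r).fun_div (hasDerivAt_id' r) hr.ne'
    refine (h1.fun_add h2).congr_deriv ?_
    unfold Ak
    have := hr.ne'
    field_simp
    ring
  have lZ : ∀ t, Tendsto (fun r => Vr V t r + V t r / r) atTop (nhds 0) := by
    intro t
    have hb : Tendsto (fun x : ℝ => C * (2 / √x) + C * (2 / √x)) atTop (nhds 0) := by
      simpa using (tend_inv_sqrt C).add (tend_inv_sqrt C)
    refine squeeze_zero_norm' ?_ hb
    filter_upwards [eventually_ge_atTop (1:ℝ)] with r hr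
    have h0 : 0 < r := by linarith
    refine (abs_add_le _ _).trans (add_le_add (H.bVr' t h0) ?_)
    rw [abs_div, abs_of_pos h0]
    have hq : 0 < √r := Real.sqrt_pos.2 h0
    have hq2 : √r ^ 2 = r := Real.sq_sqrt h0.le
    calc |V t r| / r ≤ (2 * C * √r) / r := by gcongr; exact H.b2' t hr
      _ = (2 * C * √r) / √r ^ 2 := by rw [hq2]
      _ = _ := by field_simp
  have hZ : ∀ t, ∀ r ≥ 1, |Vr V t r + V t r / r| ≤ K2 / (2 - p) * r ^ (p - 2) := by
    intro t r hr
    have := decay (f := fun r => Vr V t r + V t r / r) (r0 := r) (K := K2) (a := 2 - p) (by linarith) (by linarith)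
      (fun x hx => dZ t x (by linarith)) (fun x hx => ?_) (lZ t)
    · simpa using this
    have e1 := hA 1 (Or.inl rfl) t x (by linarith)
    have e2 := hA (-1) (Or.inr rfl) t x (by linarith)
    rw [show -(2 - p) - 1 = p - 3 by ring]
    rw [abs_le] at *
    constructor <;> linarith
  refine ⟨K2 / (2 - p), fun t r hr => ⟨hZ t r hr, ?_⟩⟩
  have := grow (f := fun r => r * V t r) (f' := fun r => r * (Vr V t r + V t r / r)) (K := K2 / (2 - p)) one_pos hr hp
    (fun x hx => ?_) (fun x hx => ?_)
  · simpa using this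
  · have h0 : x ≠ 0 := by linarith
    refine ((hasDerivAt_id' x).fun_mul (H.hr t x)).congr_deriv ?_
    have : (-(Jd (fv V) 1 1 t x + Jd (fv V) (-1) 1 t x) / 2) = Vr V t x := rfl
    rw [this]; field_simp; ring
  · have h0 : 0 < x := by linarith
    rw [abs_mul, abs_of_pos h0]
    calc x * _ ≤ x * (K2 / (2 - p) * x ^ (p - 2)) := by gcongr; exact hZ t x hx
      _ = K2 / (2 - p) * x ^ (p - 1) := by
        rw [show p - 1 = (p - 2) + 1 by ring, Real.rpow_add_one h0.ne']; ring
end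
end WMS

namespace WMS

section
variable {C : ℝ} {V : ℝ → ℝ → ℝ}

theorem NR.decay1 (H : NR C V) : ∃ K : ℝ, 0 ≤ K ∧ ∀ t, ∀ r ≥ 1, |V t r| ≤ K * r ^ (-1 : ℝ) := by
  have hC := H.hC
  have h1 : ∀ t, ∀ r ≥ 1, |V t r| ≤ (2 * C) * r ^ (1 / 2 : ℝ) := fun t r hr => by
    rw [← Real.sqrt_eq_rpow]; exact H.b2' t hr
  have h2 : ∀ t, ∀ r ≥ 1, |Vr V t r| ≤ (2 * C) * r ^ (1 / 2 - 1 : ℝ) := fun t r hr => by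
    have h0 : 0 < r := by linarith
    refine (H.bVr' t h0).trans (le_of_eq ?_)
    rw [Real.rpow_sub_one h0.ne', ← Real.sqrt_eq_rpow]
    have hq : 0 < √r := Real.sqrt_pos.2 h0
    have hq2 : √r ^ 2 = r := Real.sq_sqrt h0.le
    field_simp
    rw [hq2]
  obtain ⟨K1, hK1⟩ := H.step (by norm_num) le_rfl (by positivity) h1 h2
  have K1n : 0 ≤ K1 := by
    have := (hK1 0 1 le_rfl).1
    simp only [Real.one_rpow, mul_one] at this
    exact (abs_nonneg _).trans this
  have hV1 : ∀ t, |V t 1| ≤ 2 * C := fun t => by simpa using h1 t 1 le_rfl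
  have g1 : ∀ t, ∀ r ≥ 1, |V t r| ≤ (2 * C + 2 * K1) * r ^ (-(1 / 2) : ℝ) := fun t r hr => by
    have h0 : 0 < r := by linarith
    have a := (hK1 t r hr).2
    have b := hV1 t
    have hx : 1 ≤ r ^ (1 / 2 : ℝ) := Real.one_le_rpow hr (by norm_num)
    have c : |r * V t r| ≤ (2 * C + 2 * K1) * r ^ (1 / 2 : ℝ) := by
      have : |r * V t r| ≤ |r * V t r - V t 1| + |V t 1| := by
        simpa using abs_add_le (r * V t r - V t 1) (V t 1)
      have e : K1 / (1 / 2) * (r ^ (1 / 2 : ℝ) - 1) = 2 * K1 * r ^ (1 / 2 : ℝ) - 2 * K1 := by ring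
      nlinarith
    rw [abs_mul, abs_of_pos h0] at c
    rw [show (-(1/2) : ℝ) = 1 / 2 - 1 by norm_num, Real.rpow_sub_one h0.ne', ← mul_div_assoc, le_div_iff₀ h0]
    linarith
  have g2 : ∀ t, ∀ r ≥ 1, |Vr V t r| ≤ (2 * C + 3 * K1) * r ^ (-(1 / 2) - 1 : ℝ) := fun t r hr => by
    have h0 : 0 < r := by linarith
    have a := (hK1 t r hr).1
    rw [show (1 / 2 - 2 : ℝ) = -(1/2) - 1 by norm_num] at a
    have b : |V t r / r| ≤ (2 * C + 2 * K1) * r ^ (-(1 / 2) - 1 : ℝ) := by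
      rw [abs_div, abs_of_pos h0, Real.rpow_sub_one h0.ne', ← mul_div_assoc]
      gcongr; exact g1 t r hr
    have e : (2 * C + 3 * K1) * r ^ (-(1 / 2) - 1 : ℝ) = K1 * r ^ (-(1 / 2) - 1 : ℝ) + (2 * C + 2 * K1) * r ^ (-(1 / 2) - 1 : ℝ) := by ring
    rw [e]
    rw [abs_le] at *
    constructor <;> linarith
  obtain ⟨K2, hK2⟩ := H.step (p := -(1/2)) (K := 2 * C + 3 * K1) (by norm_num) (by norm_num) (by positivity)
    (fun t r hr => (g1 t r hr).trans (by gcongr; norm_num)) g2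
  have K2n : 0 ≤ K2 := by
    have := (hK2 0 1 le_rfl).1
    simp only [Real.one_rpow, mul_one] at this
    exact (abs_nonneg _).trans this
  refine ⟨2 * C + 2 * K2, by positivity, fun t r hr => ?_⟩
  have h0 : 0 < r := by linarith
  have a := (hK2 t r hr).2
  have b := hV1 t
  have hx : 0 ≤ r ^ (-(1 / 2) : ℝ) := by positivity
  rw [Real.rpow_neg_one, ← div_eq_mul_inv, le_div_iff₀ h0]
  have : |r * V t r| ≤ |r * V t r - V t 1| + |V t 1| := by
    simpa using abs_add_le (r * V t r - V t 1) (V t 1)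
  rw [abs_mul, abs_of_pos h0] at this
  have e : K2 / (-(1 / 2)) * (r ^ (-(1 / 2) : ℝ) - 1) = 2 * K2 - 2 * K2 * r ^ (-(1 / 2) : ℝ) := by ring
  nlinarith

theorem fU_diff {r a b : ℝ} (hr : 0 < r) : |fU r a - fU r b| ≤ 2 * |a - b| * r ^ (-2 : ℝ) := by
  have hq := q_pos r
  have hs : |sin (2 * (a / q r)) - sin (2 * (b / q r))| ≤ 2 * |a - b| / q r := by
    have h1 := Real.abs_sin_sub_sin_le (x := 2 * (a / q r)) (y := 2 * (b / q r))
    refine h1.trans (le_of_eq ?_)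
    rw [show 2 * (a / q r) - 2 * (b / q r) = 2 * (a - b) / q r by ring, abs_div, abs_mul, abs_of_pos hq, abs_two]
  have : fU r a - fU r b = (a - b) / q r ^ 4 + (sin (2 * (a / q r)) - sin (2 * (b / q r))) / q r := by unfold fU; ring
  rw [this]
  have e1 : |(a - b) / q r ^ 4| = |a - b| / q r ^ 4 := by rw [abs_div, abs_of_pos (by positivity : 0 < q r ^ 4)]
  have e2 : |(sin (2 * (a / q r)) - sin (2 * (b / q r))) / q r| ≤ 2 * |a - b| / q r / q r := by
    rw [abs_div, abs_of_pos hq]; gcongr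
  have e3 : 1 / q r ^ 4 + 2 / q r ^ 2 ≤ 2 / r ^ 2 := by
    rw [show q r ^ 4 = (q r ^ 2) ^ 2 by ring, q_sq, div_add_div _ _ (by positivity) (by positivity), div_le_div_iff₀ (by positivity) (by positivity)]
    nlinarith [sq_nonneg r, sq_nonneg (r ^ 2)]
  have e4 : (r : ℝ) ^ (-2 : ℝ) = 1 / r ^ 2 := by
    rw [Real.rpow_neg hr.le]; norm_num
  calc _ ≤ |a - b| / q r ^ 4 + 2 * |a - b| / q r / q r := (abs_add_le _ _).trans (by rw [e1]; gcongr)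
    _ = |a - b| * (1 / q r ^ 4 + 2 / q r ^ 2) := by field_simp
    _ ≤ |a - b| * (2 / r ^ 2) := by gcongr
    _ = _ := by rw [e4]; ring

theorem fU_zero (r : ℝ) : fU r 0 = 0 := by simp [fU]

theorem NR.Jlim (H : NR C V) (k t r : ℝ) : Tendsto (fun s => Jd (fv V) k 1 (t + k * s) (r + s)) atTop (nhds 0) := by
  have hs : Tendsto (fun s : ℝ => r + s) atTop atTop := tendsto_atTop_add_const_left _ _ tendsto_id
  refine squeeze_zero_norm' ?_ ((tend_inv_sqrt C).comp hs)
  filter_upwards [hs.eventually_gt_atTop 0] with s h0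
  exact Jd_bound' H.cfv H.bF H.hC.le k (t + k * s) h0

theorem NR.Jray (H : NR C V) (k t r s : ℝ) :
    HasDerivAt (fun s => Jd (fv V) k 1 (t + k * s) (r + s)) (-fv V (t + k * s) (r + s)) s := by
  have := Jd_hasDeriv_ray H.cfv H.bF k (Or.inl rfl) t r s
  simpa only [one_mul] using this

/-- bounds on time differences contract -/
theorem NR.contract (H : NR C V) {h M : ℝ} (hM : 0 ≤ M)
    (hD : ∀ t, ∀ r > 0, |V (t + h) r - V t r| ≤ M * r ^ (-(3/2) : ℝ)) :
    ∀ t, ∀ r > 0, |V (t + h) r - V t r| ≤ (8 / 15 * M) * r ^ (-(3/2) : ℝ) := by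
  have hJ : ∀ k t, ∀ r > 0, |Jd (fv V) k 1 (t + h) r - Jd (fv V) k 1 t r| ≤ (2 * M / (5/2)) * r ^ (-(5/2) : ℝ) := by
    intro k t r hr
    have := decay_ray (g := fun s => Jd (fv V) k 1 (t + h + k * s) (r + s) - Jd (fv V) k 1 (t + k * s) (r + s))
      (a := 5/2) (K := 2 * M) hr (by norm_num) (fun s hs => (H.Jray k (t + h) r s).fun_sub (H.Jray k t r s)) (fun s hs => ?_)
      (by simpa using (H.Jlim k (t + h) r).sub (H.Jlim k t r))
    · simpa using this
    have h0 : 0 < r + s := by linarith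
    have e : -fv V (t + h + k * s) (r + s) - -fv V (t + k * s) (r + s) =
       -(fU (r + s) (V (t + k * s + h) (r + s)) - fU (r + s) (V (t + k * s) (r + s))) := by
      unfold fv; rw [show t + h + k * s = t + k * s + h by ring]; ring
    rw [e, abs_neg]
    calc _ ≤ 2 * |V (t + k * s + h) (r + s) - V (t + k * s) (r + s)| * (r + s) ^ (-2 : ℝ) := fU_diff h0
      _ ≤ 2 * (M * (r + s) ^ (-(3/2) : ℝ)) * (r + s) ^ (-2 : ℝ) := by gcongr; exact hD _ _ h0
      _ = 2 * M * ((r + s) ^ (-(3/2) : ℝ) * (r + s) ^ (-2 : ℝ)) := by ring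
      _ = _ := by rw [← Real.rpow_add h0]; norm_num
  intro t r hr
  have := decay (f := fun r => V (t + h) r - V t r) (a := 3/2) (K := 2 * M / (5/2)) hr (by norm_num)
    (fun x _ => (H.hr (t + h) x).fun_sub (H.hr t x)) (fun x hx => ?_) ?_
  · refine this.trans (le_of_eq ?_); ring
  · have e1 := hJ 1 t x (by linarith)
    have e2 := hJ (-1) t x (by linarith)
    rw [show (-(3/2) - 1 : ℝ) = -(5/2) by norm_num]
    rw [abs_le] at *
    constructor <;> linarith
  · refine squeeze_zero_norm' (a := fun r : ℝ => M * r ^ (-(3/2) : ℝ)) ?_ (by simpa using (tendsto_rpow_neg_atTop (by norm_num : (0:ℝ) < 3/2)).const_mul M)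
    filter_upwards [eventually_gt_atTop 0] with x hx using hD t x hx

theorem NR.static (H : NR C V) (t : ℝ) {r : ℝ} (hr : 0 < r) : V t r = V 0 r := by
  obtain ⟨K, hK, hV⟩ := H.decay1
  have hC := H.hC
  have hf : ∀ t, ∀ r ≥ 1, |fv V t r| ≤ 2 * K * r ^ (-(2:ℝ) - 1) := by
    intro t r hr
    have h0 : 0 < r := by linarith
    have := fU_diff (a := V t r) (b := 0) h0
    rw [fU_zero, sub_zero, sub_zero] at this
    calc _ ≤ 2 * |V t r| * r ^ (-2 : ℝ) := this
      _ ≤ 2 * (K * r ^ (-1 : ℝ)) * r ^ (-2 : ℝ) := by gcongr; exact hV t r hr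
      _ = 2 * K * (r ^ (-1 : ℝ) * r ^ (-2 : ℝ)) := by ring
      _ = _ := by rw [← Real.rpow_add h0]; norm_num
  have hJ : ∀ k t, ∀ r ≥ 1, |Jd (fv V) k 1 t r| ≤ 2 * K / 2 * r ^ (-2 : ℝ) := by
    intro k t r hr
    have := decay_ray (g := fun s => Jd (fv V) k 1 (t + k * s) (r + s)) (r0 := r) (a := 2) (K := 2 * K) (by linarith) (by norm_num)
      (fun s hs => H.Jray k t r s) (fun s hs => by rw [abs_neg]; exact hf _ _ (by linarith)) (H.Jlim k t r)
    simpa using this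
  have hD : ∀ h t, ∀ r ≥ 1, |V (t + h) r - V t r| ≤ K * |h| * r ^ (-2 : ℝ) := by
    intro h t r hr
    have := Convex.norm_image_sub_le_of_norm_hasDerivWithin_le (𝕜 := ℝ) (f := fun t => V t r) (s := Set.univ) (C := K * r ^ (-2 : ℝ))
      (x := t) (y := t + h)
      (fun x _ => (H.ht x r).hasDerivWithinAt) (fun x _ => by
        have e1 := hJ 1 x r hr; have e2 := hJ (-1) x r hr
        rw [Real.norm_eq_abs]
        rw [abs_le] at *
        constructor <;> linarith) convex_univ trivial trivial
    simp only [Real.norm_eq_abs, add_sub_cancel_left] at this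
    linarith
  have key : ∀ j : ℕ, ∀ t', ∀ r > 0, |V (t' + t) r - V t' r| ≤ ((8/15) ^ j * (K * |t| + 4 * C)) * r ^ (-(3/2) : ℝ) := by
    intro j
    induction j with
    | zero =>
      intro t' r hr
      rw [pow_zero, one_mul]
      rcases le_total 1 r with h1 | h1
      · refine (hD t t' r h1).trans ?_
        have : r ^ (-2 : ℝ) ≤ r ^ (-(3/2) : ℝ) := Real.rpow_le_rpow_of_exponent_le h1 (by norm_num)
        calc _ ≤ K * |t| * r ^ (-(3/2) : ℝ) := by gcongr
          _ ≤ _ := by gcongr; linarith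
      · have a1 := H.b1 (t' + t) r
        have a2 := H.b1 t' r
        have a3 : q r ≤ 2 := by have := q_sq r; have := q_pos r; nlinarith
        have a4 : |V (t' + t) r - V t' r| ≤ 4 * C := by
          refine (abs_sub _ _).trans ?_
          nlinarith
        have a5 : 1 ≤ r ^ (-(3/2) : ℝ) := Real.one_le_rpow_of_pos_of_le_one_of_nonpos hr h1 (by norm_num)
        have a6 : 0 ≤ K * |t| := by positivity
        nlinarith
    | succ j ih =>
      intro t' r hr
      have := H.contract (h := t) (by positivity) ih t' r hr
      rw [pow_succ]
      refine this.trans (le_of_eq (by ring))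
  have l : Tendsto (fun j : ℕ => ((8/15 : ℝ) ^ j * (K * |t| + 4 * C)) * r ^ (-(3/2) : ℝ)) atTop (nhds 0) := by
    simpa using ((tendsto_pow_atTop_nhds_zero_of_lt_one (by norm_num : (0:ℝ) ≤ 8/15) (by norm_num)).mul_const _).mul_const _
  have := ge_of_tendsto' l fun j => key j 0 r hr
  rw [zero_add] at this
  have := abs_nonpos_iff.1 this
  linarith
end
end WMS

namespace WMS

/-- harmonic maps -/
structure HM (n : ℕ) (F F1 : ℝ → ℝ) : Prop where
  d1 : ∀ r, HasDerivAt F (F1 r) r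
  d2 : ∀ r, HasDerivAt F1 ((sin (2 * F r) - 2 * r * F1 r) / (r ^ 2 + 1)) r
  bot : Tendsto F atBot (nhds 0)
  top : Tendsto F atTop (nhds (n * π))

theorem inv_sqrt_lim (C : ℝ) : Tendsto (fun r : ℝ => C / √r) atTop (nhds 0) :=
  tendsto_const_nhds.div_atTop Real.tendsto_sqrt_atTop

theorem WM.subseq {n : ℕ} {u : F2} (h : WM n u) {T : ℕ → ℝ} (hT : Tendsto T atTop atTop) :
    ∃ φ : ℕ → ℕ, StrictMono φ ∧ ∃ F F1, HM n F F1 ∧ ∀ r, Tendsto (fun k => u.f (T (φ k)) r) atTop (nhds (F r)) := by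
  obtain ⟨C, K, ρ, σ, H⟩ := h.rad
  obtain ⟨C', K', ρ', σ', H'⟩ := h.mir.rad
  obtain ⟨φ, hφ, V, hV⟩ := subseq_lim (U := (u.lift (n * π)).f) (fun ε hε => H.uc hε) (B := fun r => C * q r)
    (fun t r => by
      rw [lift_f, abs_mul, abs_of_pos (q_pos r), mul_comm]
      exact mul_le_mul_of_nonneg_right (H.b1 t r) (q_pos r).le) T
  have hT' : Tendsto (fun k => T (φ k)) atTop atTop := hT.comp hφ.tendsto_atTop
  have N := H.limit hT' hV
  have N' : NR C' (fun t r => -(V t (-r) + n * π * q r)) := by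
    refine H'.limit hT' fun t r => ?_
    refine (((hV t (-r)).add_const (n * π * q r)).neg).congr fun k => ?_
    rw [lift_f, lift_f, q_neg]
    simp only [F2.mir]
    ring
  have stat : ∀ t r, V t r = V 0 r := by
    have hpos : ∀ t, ∀ r > 0, V t r = V 0 r := fun t r hr => N.static t hr
    intro t r
    rcases lt_trichotomy r 0 with hr | rfl | hr
    · have := N'.static t (r := -r) (by linarith)
      simp only [neg_neg] at this
      linarith
    · have c1 : Continuous fun r => V t r := N.cV.comp (f := fun r => (t, r)) (by fun_prop)
      have c2 : Continuous fun r => V 0 r := N.cV.comp (f := fun r => ((0:ℝ), r)) (by fun_prop)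
      have l1 : Tendsto (fun r => V t r) (nhdsWithin 0 (Set.Ioi 0)) (nhds (V t 0)) := (c1.tendsto 0).mono_left nhdsWithin_le_nhds
      have l2 : Tendsto (fun r => V 0 r) (nhdsWithin 0 (Set.Ioi 0)) (nhds (V 0 0)) := (c2.tendsto 0).mono_left nhdsWithin_le_nhds
      refine tendsto_nhds_unique (l1.congr' ?_) l2
      filter_upwards [self_mem_nhdsWithin] with r hr using hpos t r hr
    · exact hpos t r hr
  have hf : ∀ t r, fv V t r = fv V 0 r := fun t r => by unfold fv; rw [stat]
  have hJ : ∀ k t r, Jd (fv V) k 1 t r = Jd (fv V) 0 1 0 r := by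
    intro k t r
    unfold Jd
    congr 1; funext s
    rw [hf, hf (0 + 0 * s)]
  have dv : ∀ r, HasDerivAt (fun r => V 0 r) (-Jd (fv V) 0 1 0 r) r := fun r => by
    refine (N.hr 0 r).congr_deriv ?_
    rw [hJ 1, hJ (-1)]; ring
  have dj : ∀ r, HasDerivAt (fun r => Jd (fv V) 0 1 0 r) (-fv V 0 r) r := fun r => by
    have := Jd_hasDeriv_ray N.cfv N.bF 0 (Or.inl rfl) 0 0 r
    simpa using this
  refine ⟨φ, hφ, fun r => V 0 r / q r + n * π, fun r => -Jd (fv V) 0 1 0 r / q r - V 0 r * r / q r ^ 3, ⟨?_, ?_, ?_, ?_⟩, ?_⟩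
  · intro r
    have q0 := q_ne r
    refine (((dv r).fun_div (hasDerivAt_q r) q0).add_const (n * π)).congr_deriv ?_
    field_simp
  · intro r
    have q0 := q_ne r
    have hq := hasDerivAt_q r
    have e1 := (dj r).fun_neg.fun_div hq q0
    have e2 := ((dv r).fun_mul (hasDerivAt_id' r)).fun_div (hq.fun_pow 3) (pow_ne_zero 3 q0)
    refine (e1.fun_sub e2).congr_deriv ?_
    have hs : sin (2 * (V 0 r / q r + n * π)) = sin (2 * (V 0 r / q r)) := by
      have := sin_two_sub_npi n (V 0 r / q r + n * π)
      rw [← this]; congr 1; ring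
    rw [hs, ← q_sq]
    unfold fv fU
    have hq2 : r ^ 2 = q r ^ 2 - 1 := by rw [q_sq]; ring
    push_cast
    generalize sin (2 * (V 0 r / q r)) = S
    generalize Jd _ _ _ _ _ = J
    generalize V 0 r = v
    generalize q r = y at *
    field_simp
    ring_nf
    simp only [hq2, show r ^ 3 = r * r ^ 2 by ring]
    ring
  · have : Tendsto (fun r : ℝ => V 0 (-r) / q (-r) + n * π) atTop (nhds 0) := by
      refine squeeze_zero_norm' ?_ (inv_sqrt_lim C')
      filter_upwards [eventually_gt_atTop (0:ℝ)] with r hr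
      have := N'.b2 0 r hr
      have q0 := q_pos r
      rw [q_neg]
      rw [abs_neg] at this
      rw [Real.norm_eq_abs, show V 0 (-r) / q r + n * π = (V 0 (-r) + n * π * q r) / q r by field_simp, abs_div, abs_of_pos q0, div_le_iff₀ q0]
      refine this.trans (le_of_eq (by ring))
    have := this.comp tendsto_neg_atBot_atTop
    simpa [Function.comp_def] using this
  · have : Tendsto (fun r : ℝ => V 0 r / q r) atTop (nhds 0) := by
      refine squeeze_zero_norm' ?_ (inv_sqrt_lim C)
      filter_upwards [eventually_gt_atTop (0:ℝ)] with r hr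
      have := N.b2 0 r hr
      have q0 := q_pos r
      rw [Real.norm_eq_abs, abs_div, abs_of_pos q0, div_le_iff₀ q0]
      refine this.trans (le_of_eq (by ring))
    simpa using this.add_const (n * π)
  · intro r
    have q0 := q_ne r
    have := ((hV 0 r).div_const (q r)).add_const (n * π)
    refine this.congr fun k => ?_
    rw [lift_f, add_zero]; field_simp; ring
end WMS

namespace WMS

theorem zero_of_deriv_le {y y' : ℝ → ℝ} {C x0 : ℝ} (hd : ∀ x, HasDerivAt y (y' x) x) (h0 : ∀ x, 0 ≤ y x)
    (hC : ∀ x, |y' x| ≤ C * y x) (hx : y x0 = 0) (x : ℝ) : y x = 0 := by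
  have d1 : ∀ c x, HasDerivAt (fun x => y x * rexp (c * x)) ((y' x + c * y x) * rexp (c * x)) x := by
    intro c x
    have : HasDerivAt (fun x => rexp (c * x)) (rexp (c * x) * c) x := by
      have := ((hasDerivAt_id' x).const_mul c).exp
      simpa using this
    refine ((hd x).fun_mul this).congr_deriv (by ring)
  have m1 : Monotone fun x => y x * rexp (C * x) := monotone_of_deriv_nonneg (fun x => (d1 C x).differentiableAt) fun x => by
    rw [(d1 C x).deriv]
    have := abs_le.1 (hC x)
    exact mul_nonneg (by linarith) (exp_pos _).le
  have m2 : Antitone fun x => y x * rexp (-C * x) := antitone_of_deriv_nonpos (fun x => (d1 (-C) x).differentiableAt) fun x => by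
    rw [(d1 (-C) x).deriv]
    have := abs_le.1 (hC x)
    exact mul_nonpos_of_nonpos_of_nonneg (by linarith) (exp_pos _).le
  rcases le_total x x0 with h | h
  · have := m1 h
    simp only [hx, zero_mul] at this
    have h1 := exp_pos (C * x)
    have := h0 x
    nlinarith
  · have := m2 h
    simp only [hx, zero_mul] at this
    have h1 := exp_pos (-C * x)
    have := h0 x
    nlinarith

theorem no_min {D D1 : ℝ → ℝ} {d x1 : ℝ} (hD : ∀ x, HasDerivAt D (D1 x) x) (h1 : HasDerivAt D1 d x1) (hd : d < 0)
    (hm : IsLocalMin D x1) : False := by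
  have e : deriv D = D1 := funext fun x => (hD x).deriv
  have hz : D1 x1 = 0 := by rw [← e]; exact hm.deriv_eq_zero
  have hM : IsLocalMax D x1 := isLocalMax_of_deriv_deriv_neg (by rw [e, h1.deriv]; exact hd) (by rw [e, hz]) (hD x1).continuousAt
  have hc : D =ᶠ[nhds x1] fun _ => D x1 := by
    filter_upwards [hm, hM] with x a b using le_antisymm b a
  have h2 := hc.deriv
  rw [e] at h2
  have h3 := h2.deriv_eq
  simp only [deriv_const', h1.deriv] at h3
  linarith

/-- harmonic maps in the variable `r = sinh x` -/
structure HX (n : ℕ) (f g : ℝ → ℝ) : Prop where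
  d1 : ∀ x, HasDerivAt f (g x) x
  d2 : ∀ x, HasDerivAt g (sin (2 * f x) - tanh x * g x) x
  bot : Tendsto f atBot (nhds 0)
  top : Tendsto f atTop (nhds (n * π))

variable {n : ℕ} {f g : ℝ → ℝ}

theorem abs_tanh_le (x : ℝ) : |tanh x| ≤ 1 := by
  rw [tanh_eq_sinh_div_cosh, abs_div, abs_of_pos (cosh_pos x), div_le_one (cosh_pos x), abs_le]
  have h1 := cosh_add_sinh x; have h2 := cosh_sub_sinh x
  have := exp_pos x; have := exp_pos (-x)
  constructor <;> linarith

theorem tanh_nonneg' {x : ℝ} (h : 0 ≤ x) : 0 ≤ tanh x := by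
  rw [tanh_eq_sinh_div_cosh]; exact div_nonneg (sinh_nonneg_iff.2 h) (cosh_pos x).le

theorem tanh_lt {x y : ℝ} (h : x < y) : tanh x < tanh y := by
  rw [tanh_eq_sinh_div_cosh, tanh_eq_sinh_div_cosh, div_lt_div_iff₀ (cosh_pos x) (cosh_pos y)]
  have := sinh_pos_iff.2 (sub_pos.2 h)
  rw [sinh_sub] at this
  linarith

theorem HX.dh (H : HX n f g) (x : ℝ) : HasDerivAt (fun x => g x ^ 2 / 2 - sin (f x) ^ 2) (-tanh x * g x ^ 2) x := by
  refine (((H.d2 x).fun_pow 2).div_const 2 |>.fun_sub ((H.d1 x).sin.fun_pow 2)).congr_deriv ?_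
  rw [sin_two_mul]; push_cast; ring

theorem sin_lim {c : ℕ} {l : Filter ℕ} {z : ℕ → ℝ} (h : Tendsto z l (nhds (c * π))) : Tendsto (fun k => sin (z k) ^ 2) l (nhds 0) := by
  have := ((Real.continuous_sin.tendsto _).comp h).pow 2
  simpa [Real.sin_nat_mul_pi] using this

theorem HX.seq (H : HX n f g) {s : ℝ} {c : ℕ} {l : Filter ℝ} (hl : Tendsto (fun x => s * x) atTop l) (hf : Tendsto f l (nhds (c * π))) (hs : s = 1 ∨ s = -1) :
    ∃ y : ℕ → ℝ, (∀ k : ℕ, (k:ℝ) ≤ s * y k) ∧ Tendsto (fun k => g (y k) ^ 2 / 2 - sin (f (y k)) ^ 2) atTop (nhds 0) := by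
  have hm : ∀ k : ℕ, ∃ y, (k:ℝ) < y ∧ y < k + 1 ∧ s * g (s * y) = f (s * (k + 1)) - f (s * k) := by
    intro k
    have hd : ∀ x, HasDerivAt (fun x => f (s * x)) (s * g (s * x)) x := fun x => by
      have h2 : HasDerivAt (fun x => s * x) s x := by simpa using (hasDerivAt_id x).const_mul s
      have h3 : HasDerivAt (fun x => f (s * x)) (g (s * x) * s) x := (H.d1 (s * x)).comp x h2
      exact h3.congr_deriv (by ring)
    obtain ⟨y, hy, e⟩ := exists_hasDerivAt_eq_slope (fun x => f (s * x)) (fun x => s * g (s * x)) (show (k:ℝ) < k + 1 by linarith)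
      (fun x _ => (hd x).continuousAt.continuousWithinAt) (fun x _ => hd x)
    exact ⟨y, hy.1, hy.2, by rw [e]; simp⟩
  choose y hy1 hy2 hy3 using hm
  have s2 : s * s = 1 := by rcases hs with rfl | rfl <;> norm_num
  refine ⟨fun k => s * y k, fun k => by rw [← mul_assoc, s2, one_mul]; exact (hy1 k).le, ?_⟩
  have ty : Tendsto y atTop atTop := tendsto_atTop_mono (fun k : ℕ => (hy1 k).le) tendsto_natCast_atTop_atTop
  have tf : Tendsto (fun x => f (s * x)) atTop (nhds (c * π)) := hf.comp hl
  have t1 : Tendsto (fun k : ℕ => f (s * ((k:ℝ) + 1)) - f (s * k)) atTop (nhds 0) := by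
    have a1 := tf.comp (tendsto_natCast_atTop_atTop (R := ℝ))
    have a2 := tf.comp (tendsto_atTop_add_const_right atTop (1:ℝ) (tendsto_natCast_atTop_atTop (R := ℝ)))
    simpa [Function.comp_def] using a2.sub a1
  have t2 : Tendsto (fun k => g (s * y k) ^ 2) atTop (nhds 0) := by
    have := t1.pow 2
    rw [zero_pow two_ne_zero] at this
    refine this.congr fun k => ?_
    rw [← hy3, mul_pow]
    have : s ^ 2 = 1 := by rw [sq, s2]
    rw [this, one_mul]
  have t3 := sin_lim (tf.comp ty)
  simpa [Function.comp_def] using (t2.div_const 2).sub t3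

theorem HX.h_nonneg (H : HX n f g) (x : ℝ) : sin (f x) ^ 2 ≤ g x ^ 2 / 2 := by
  have key : 0 ≤ g x ^ 2 / 2 - sin (f x) ^ 2 := by
    rcases le_total 0 x with hx | hx
    · obtain ⟨y, hy, hl⟩ := H.seq (s := 1) (l := atTop) (by simp only [one_mul]; exact tendsto_id) H.top (Or.inl rfl)
      refine le_of_tendsto hl ?_
      filter_upwards [eventually_ge_atTop ⌈x⌉₊] with k hk
      have h1 : x ≤ y k := by
        have := hy k; have := Nat.ceil_le.1 hk; linarith
      have m1 : AntitoneOn (fun x => g x ^ 2 / 2 - sin (f x) ^ 2) (Set.Ici 0) := by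
        apply antitoneOn_of_deriv_nonpos (convex_Ici 0)
        · intro x hx; exact (H.dh x).continuousAt.continuousWithinAt
        · intro x hx; exact (H.dh x).differentiableAt.differentiableWithinAt
        · intro x hx; rw [interior_Ici] at hx; rw [(H.dh x).deriv]
          have := tanh_nonneg' (le_of_lt hx)
          nlinarith [mul_nonneg this (sq_nonneg (g x))]
      exact m1 hx (hx.trans h1) h1
    · obtain ⟨y, hy, hl⟩ := H.seq (s := -1) (c := 0) (l := atBot) (by simpa using tendsto_neg_atTop_atBot) (by simpa using H.bot) (Or.inr rfl)
      refine le_of_tendsto hl ?_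
      filter_upwards [eventually_ge_atTop ⌈-x⌉₊] with k hk
      have h1 : y k ≤ x := by
        have := hy k; have := Nat.ceil_le.1 hk; linarith
      have m1 : MonotoneOn (fun x => g x ^ 2 / 2 - sin (f x) ^ 2) (Set.Iic 0) := by
        apply monotoneOn_of_deriv_nonneg (convex_Iic 0)
        · intro x hx; exact (H.dh x).continuousAt.continuousWithinAt
        · intro x hx; exact (H.dh x).differentiableAt.differentiableWithinAt
        · intro x hx; rw [interior_Iic] at hx; rw [(H.dh x).deriv]
          have := tanh_nonneg' (x := -x) (by have : x < 0 := hx; linarith)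
          rw [tanh_neg] at this
          nlinarith [mul_nonneg this (sq_nonneg (g x))]
      exact m1 (Set.mem_Iic.2 (h1.trans hx)) (Set.mem_Iic.2 hx) h1
  linarith

theorem HX.const (H : HX n f g) {x0 : ℝ} (h0 : g x0 = 0) : (∀ x, f x = 0) ∧ (∀ x, g x = 0) ∧ n = 0 := by
  have hs : sin (f x0) ^ 2 = 0 := by
    have := H.h_nonneg x0; rw [h0] at this
    have := sq_nonneg (sin (f x0)); linarith
  have hz := zero_of_deriv_le (y := fun x => sin (f x) ^ 2 + g x ^ 2)
    (y' := fun x => 2 * sin (f x) * cos (f x) * g x + 2 * g x * (sin (2 * f x) - tanh x * g x)) (C := 5) (x0 := x0)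
    (fun x => (((H.d1 x).sin.fun_pow 2).fun_add ((H.d2 x).fun_pow 2)).congr_deriv (by push_cast; ring))
    (fun x => by positivity) (fun x => ?_) (by rw [hs, h0]; simp)
  · have gz : ∀ x, g x = 0 := fun x => by
      have := hz x
      have := sq_nonneg (sin (f x)); nlinarith [sq_nonneg (g x)]
    have fc : ∀ x, f x = f 0 := fun x => is_const_of_deriv_eq_zero (fun x => (H.d1 x).differentiableAt)
      (fun x => by rw [(H.d1 x).deriv, gz]) x 0
    have f0 : f 0 = 0 := tendsto_nhds_unique (tendsto_const_nhds.congr fun x => (fc x).symm) H.bot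
    have fn : f 0 = n * π := tendsto_nhds_unique (tendsto_const_nhds.congr fun x => (fc x).symm) H.top
    refine ⟨fun x => by rw [fc, f0], gz, ?_⟩
    rw [f0] at fn
    have := mul_eq_zero.1 fn.symm
    rcases this with h | h
    · exact_mod_cast h
    · exact absurd h pi_ne_zero
  · rw [sin_two_mul, show 2 * sin (f x) * cos (f x) * g x + 2 * g x * (2 * sin (f x) * cos (f x) - tanh x * g x)
      = 6 * (sin (f x) * g x) * cos (f x) - 2 * g x ^ 2 * tanh x by ring]
    have a1 := abs_cos_le_one (f x)
    have a2 := abs_tanh_le x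
    have a3 : |sin (f x) * g x| ≤ (sin (f x) ^ 2 + g x ^ 2) / 2 := by
      rw [abs_le]; constructor <;> nlinarith [sq_nonneg (sin (f x) + g x), sq_nonneg (sin (f x) - g x)]
    refine (abs_sub _ _).trans ?_
    rw [abs_mul, abs_mul, abs_mul (2 * g x ^ 2), abs_of_pos (by norm_num : (0:ℝ) < 6), abs_of_nonneg (by positivity : 0 ≤ 2 * g x ^ 2)]
    have b1 : 6 * |sin (f x) * g x| * |cos (f x)| ≤ 6 * ((sin (f x) ^ 2 + g x ^ 2) / 2) * 1 := by gcongr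
    have b2 : 2 * g x ^ 2 * |tanh x| ≤ 2 * g x ^ 2 * 1 := by gcongr
    nlinarith [sq_nonneg (sin (f x))]

theorem HX.pos (H : HX n f g) (hn : n ≠ 0) : ∀ x, 0 < g x := by
  have h0 : ∀ x, g x ≠ 0 := fun x hx => hn (H.const hx).2.2
  have cg : Continuous g := continuous_iff_continuousAt.2 fun x => (H.d2 x).continuousAt
  by_contra! hc
  obtain ⟨x1, hx1⟩ := hc
  have hneg : ∀ x, g x < 0 := by
    intro x
    by_contra! hx
    have : (0:ℝ) ∈ g '' Set.uIcc x1 x := intermediate_value_uIcc cg.continuousOn (by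
      rw [Set.uIcc_of_le (hx1.trans hx)]; exact ⟨hx1, hx⟩)
    obtain ⟨z, _, hz⟩ := this
    exact h0 z hz
  have ha : Antitone f := antitone_of_deriv_nonpos (fun x => (H.d1 x).differentiableAt) fun x => by
    rw [(H.d1 x).deriv]; exact (hneg x).le
  have h1 : f 0 ≤ 0 := ha.ge_of_tendsto H.bot 0
  have h2 : n * π ≤ f 0 := ha.le_of_tendsto H.top 0
  have : 0 < (n:ℝ) * π := by have := Nat.pos_of_ne_zero hn; positivity
  linarith

theorem HX.mono (H : HX n f g) (hn : n ≠ 0) : StrictMono f := strictMono_of_deriv_pos fun x => by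
  rw [(H.d1 x).deriv]; exact H.pos hn x

theorem HX.range (H : HX n f g) (hn : n ≠ 0) (x : ℝ) : 0 < f x ∧ f x < n * π := by
  have m := H.mono hn
  constructor
  · exact (m.monotone.le_of_tendsto H.bot (x - 1)).trans_lt (m (by linarith))
  · exact (m (by linarith : x < x + 1)).trans_le (m.monotone.ge_of_tendsto H.top _)

end WMS

namespace WMS

variable {n : ℕ} {f g f2 g2 : ℝ → ℝ}

/-- negative value on a half line forces an interior minimum -/
theorem min_top {D : ℝ → ℝ} (cD : Continuous D) (hl : Tendsto D atTop (nhds 0)) {L x0 : ℝ} (hL : 0 ≤ D L)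
    (hx : L ≤ x0) (h0 : D x0 < 0) : ∃ x1, L < x1 ∧ D x1 < 0 ∧ IsLocalMin D x1 := by
  obtain ⟨R, hR⟩ := eventually_atTop.1 (hl.eventually (lt_mem_nhds h0))
  have hR' := hR (max R x0) (le_max_left _ _)
  set R' := max R x0
  obtain ⟨x1, hx1, hm⟩ := isCompact_Icc.exists_isMinOn (⟨x0, hx, le_max_right _ _⟩ : (Set.Icc L R').Nonempty) cD.continuousOn
  have h1 : D x1 ≤ D x0 := hm ⟨hx, le_max_right _ _⟩
  have a1 : x1 ≠ L := by rintro rfl; linarith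
  have a2 : x1 ≠ R' := by rintro h; rw [h] at h1; linarith
  have b1 : L < x1 := lt_of_le_of_ne hx1.1 (Ne.symm a1)
  have b2 : x1 < R' := lt_of_le_of_ne hx1.2 a2
  exact ⟨x1, b1, by linarith, hm.isLocalMin (Icc_mem_nhds b1 b2)⟩

theorem min_bot {D : ℝ → ℝ} (cD : Continuous D) (hl : Tendsto D atBot (nhds 0)) {L x0 : ℝ} (hL : 0 ≤ D L)
    (hx : x0 ≤ L) (h0 : D x0 < 0) : ∃ x1, x1 < L ∧ D x1 < 0 ∧ IsLocalMin D x1 := by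
  obtain ⟨R, hR⟩ := eventually_atBot.1 (hl.eventually (lt_mem_nhds h0))
  have hR' := hR (min R x0) (min_le_left _ _)
  set R' := min R x0
  obtain ⟨x1, hx1, hm⟩ := isCompact_Icc.exists_isMinOn (⟨x0, min_le_right _ _, hx⟩ : (Set.Icc R' L).Nonempty) cD.continuousOn
  have h1 : D x1 ≤ D x0 := hm ⟨min_le_right _ _, hx⟩
  have a1 : x1 ≠ L := by rintro rfl; linarith
  have a2 : x1 ≠ R' := by rintro h; rw [h] at h1; linarith
  have b1 : x1 < L := lt_of_le_of_ne hx1.2 a1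
  have b2 : R' < x1 := lt_of_le_of_ne hx1.1 (Ne.symm a2)
  exact ⟨x1, b1, by linarith, hm.isLocalMin (Icc_mem_nhds b2 b1)⟩

theorem HX.shift (H2 : HX n f2 g2) (τ x : ℝ) : HasDerivAt (fun x => f2 (x + τ)) (g2 (x + τ)) x ∧
    HasDerivAt (fun x => g2 (x + τ)) (sin (2 * f2 (x + τ)) - tanh (x + τ) * g2 (x + τ)) x :=
  ⟨(H2.d1 (x + τ)).comp_add_const x τ, (H2.d2 (x + τ)).comp_add_const x τ⟩

/-- no minimum where `sin 2f2 ≤ sin 2 f1` -/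
theorem HX.nomin (H : HX n f g) (H2 : HX n f2 g2) (hn : n ≠ 0) {τ x1 : ℝ} (hτ : 0 < τ)
    (hm : IsLocalMin (fun x => f2 (x + τ) - f x) x1) (hs : sin (2 * f2 (x1 + τ)) ≤ sin (2 * f x1)) : False := by
  have d : ∀ x, HasDerivAt (fun x => f2 (x + τ) - f x) (g2 (x + τ) - g x) x := fun x => (H2.shift τ x).1.fun_sub (H.d1 x)
  have hz : g2 (x1 + τ) - g x1 = 0 := by rw [← (d x1).deriv]; exact hm.deriv_eq_zero
  refine no_min d ((H2.shift τ x1).2.fun_sub (H.d2 x1)) ?_ hm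
  have h1 := tanh_lt (show x1 < x1 + τ by linarith)
  have h2 := H2.pos hn (x1 + τ)
  have h3 : g x1 = g2 (x1 + τ) := by linarith
  rw [h3]
  nlinarith

theorem sin_mono_near {n : ℕ} {a b : ℝ} (ha : n * π - π / 4 < a) (hab : a < b) (hb : b < n * π) : sin (2 * a) ≤ sin (2 * b) := by
  rw [← sin_two_sub_npi n a, ← sin_two_sub_npi n b]
  apply (Real.strictMonoOn_sin.monotoneOn) <;> [constructor; constructor; skip] <;> linarith [pi_pos]

theorem HX.extend (H : HX n f g) (H2 : HX n f2 g2) (hn : n ≠ 0) {L τ : ℝ} (hτ : 0 < τ)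
    (h1 : ∀ x ≤ -L, f x < π / 4) (h2 : ∀ x ≥ L, n * π - π / 4 < f2 x) (hL : 0 < L)
    (hD : ∀ x, -L ≤ x → x ≤ L → f x ≤ f2 (x + τ)) : ∀ x, f x ≤ f2 (x + τ) := by
  have cD : Continuous fun x => f2 (x + τ) - f x :=
    continuous_iff_continuousAt.2 fun x => ((H2.shift τ x).1.fun_sub (H.d1 x)).continuousAt
  intro x
  by_contra! hx
  rcases le_or_gt x (-L) with a | a
  · obtain ⟨x1, b1, b2, b3⟩ := min_bot cD (x0 := x) (L := -L) (by
      have := (H2.bot.comp (tendsto_atBot_add_const_right _ τ tendsto_id)).sub H.bot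
      simpa using this) (by have := hD (-L) le_rfl (by linarith); linarith) a (by linarith)
    refine H.nomin H2 hn hτ b3 ?_
    have := h1 x1 b1.le
    have := (H2.range hn (x1 + τ)).1
    apply (Real.strictMonoOn_sin.monotoneOn) <;> [constructor; constructor; skip] <;> linarith [pi_pos]
  · rcases le_or_gt L x with a' | a'
    · obtain ⟨x1, b1, b2, b3⟩ := min_top cD (x0 := x) (L := L) (by
        have := (H2.top.comp (tendsto_atTop_add_const_right _ τ tendsto_id)).sub H.top
        simpa using this) (by have := hD L (by linarith) le_rfl; linarith) a' (by linarith)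
      refine H.nomin H2 hn hτ b3 ?_
      exact sin_mono_near (h2 _ (by linarith)) (by linarith) (H.range hn x1).2
    · exact absurd (hD x a.le a'.le) (by linarith)

theorem HX.le (H : HX n f g) (H2 : HX n f2 g2) (hn : n ≠ 0) (x : ℝ) : f x ≤ f2 x := by
  have hnp : 0 < (n:ℝ) * π := by have := Nat.pos_of_ne_zero hn; positivity
  have cf : Continuous f := continuous_iff_continuousAt.2 fun x => (H.d1 x).continuousAt
  have cf2 : Continuous f2 := continuous_iff_continuousAt.2 fun x => (H2.d1 x).continuousAt
  have m := (H.mono hn).monotone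
  have m2 := (H2.mono hn).monotone
  obtain ⟨L1, hL1⟩ := eventually_atBot.1 (H.bot.eventually (gt_mem_nhds (show (0:ℝ) < π / 4 by positivity)))
  obtain ⟨L2, hL2⟩ := eventually_atTop.1 (H2.top.eventually (lt_mem_nhds (show n * π - π / 4 < n * π by linarith [pi_pos])))
  obtain ⟨L, h1, h2, hL⟩ : ∃ L : ℝ, (∀ x ≤ -L, f x < π / 4) ∧ (∀ x ≥ L, n * π - π / 4 < f2 x) ∧ 0 < L :=
    ⟨|L1| + |L2| + 1, fun x hx => hL1 x (by have := neg_abs_le L1; have := abs_nonneg L2; linarith),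
      fun x hx => hL2 x (by have := le_abs_self L2; have := abs_nonneg L1; linarith), by positivity⟩
  set S : Set ℝ := {τ | 0 < τ ∧ ∀ x, f x ≤ f2 (x + τ)} with hS
  have hne : S.Nonempty := by
    obtain ⟨R, hR⟩ := eventually_atTop.1 (H2.top.eventually (lt_mem_nhds (H.range hn L).2))
    refine ⟨|R| + L + 1, by positivity, H.extend H2 hn (by positivity) h1 h2 hL fun x a b => ?_⟩
    have := hR (x + (|R| + L + 1)) (by have := le_abs_self R; linarith)
    exact (m b).trans this.le
  have hbd : BddBelow S := ⟨0, fun τ hτ => hτ.1.le⟩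
  have hi0 : 0 ≤ sInf S := le_csInf hne fun τ hτ => hτ.1.le
  have hup : ∀ τ, sInf S < τ → ∀ x, f x ≤ f2 (x + τ) := by
    intro τ hτ x
    obtain ⟨σ, hσ, hlt⟩ := exists_lt_of_csInf_lt hne hτ
    exact (hσ.2 x).trans (m2 (by linarith))
  have hcl : ∀ x, f x ≤ f2 (x + sInf S) := by
    intro x
    have c : Continuous fun τ => f2 (x + τ) := cf2.comp (by fun_prop)
    have : Tendsto (fun τ => f2 (x + τ)) (nhdsWithin (sInf S) (Set.Ioi (sInf S))) (nhds (f2 (x + sInf S))) :=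
      (c.tendsto _).mono_left nhdsWithin_le_nhds
    exact ge_of_tendsto this (by filter_upwards [self_mem_nhdsWithin] with τ hτ using hup τ hτ x)
  rcases hi0.eq_or_lt with h0 | hpos
  · have := hcl x; rwa [← h0, add_zero] at this
  exfalso
  set τ := sInf S with hτ
  have hst : ∀ x, f x < f2 (x + τ) := by
    intro x
    refine lt_of_le_of_ne (hcl x) fun e => ?_
    refine H.nomin H2 hn hpos (x1 := x) (Eventually.of_forall fun y => ?_) (by rw [e])
    have := hcl y
    simp only [← e]; linarith
  -- compactness
  have cD : Continuous fun x => f2 (x + τ) - f x := (cf2.comp (by fun_prop)).sub cf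
  obtain ⟨x1, hx1, hm⟩ := isCompact_Icc.exists_isMinOn (⟨0, by linarith, hL.le⟩ : (Set.Icc (-L) L).Nonempty) cD.continuousOn
  have hδ : 0 < f2 (x1 + τ) - f x1 := by linarith [hst x1]
  have uc : UniformContinuousOn f2 (Set.Icc (-L) (L + τ)) := isCompact_Icc.uniformContinuousOn_of_continuous cf2.continuousOn
  obtain ⟨δ, hδ0, hδ1⟩ := Metric.uniformContinuousOn_iff.1 uc _ hδ
  set η := min (δ / 2) (τ / 2)
  have hη : 0 < η := lt_min (by linarith) (by linarith)
  have hη1 : η ≤ δ / 2 := min_le_left _ _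
  have hη2 : η ≤ τ / 2 := min_le_right _ _
  have hmem : τ - η ∈ S := by
    refine ⟨by linarith, H.extend H2 hn (by linarith) h1 h2 hL fun x a b => ?_⟩
    have e1 : f2 (x1 + τ) - f x1 ≤ f2 (x + τ) - f x := hm ⟨a, b⟩
    have e2 := hδ1 (x + τ) ⟨by linarith, by linarith⟩ (x + (τ - η)) ⟨by linarith, by linarith⟩ (by
      rw [Real.dist_eq, show x + τ - (x + (τ - η)) = η by ring, abs_of_pos hη]; linarith)
    rw [Real.dist_eq] at e2
    have := (abs_lt.1 e2).2
    linarith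
  have := csInf_le hbd hmem
  linarith

theorem HM.toHX {F F1 : ℝ → ℝ} (H : HM n F F1) : HX n (fun x => F (sinh x)) (fun x => F1 (sinh x) * cosh x) where
  d1 x := (H.d1 (sinh x)).comp x (Real.hasDerivAt_sinh x)
  d2 x := by
    have h1 : HasDerivAt (fun x => F1 (sinh x)) _ x := (H.d2 (sinh x)).comp x (Real.hasDerivAt_sinh x)
    refine (h1.fun_mul (Real.hasDerivAt_cosh x)).congr_deriv ?_
    have hc := cosh_pos x
    rw [tanh_eq_sinh_div_cosh, show sinh x ^ 2 + 1 = cosh x ^ 2 from (cosh_sq x).symm]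
    field_simp
    ring
  bot := H.bot.comp (by
    refine tendsto_atBot_mono' _ ?_ tendsto_id
    filter_upwards [eventually_le_atBot 0] with x hx using sinh_le_self_iff.2 hx)
  top := H.top.comp (by
    refine tendsto_atTop_mono' _ ?_ tendsto_id
    filter_upwards [eventually_ge_atTop 0] with x hx using self_le_sinh_iff.2 hx)

theorem HM.unique {F F1 Q Q1 : ℝ → ℝ} (H : HM n F F1) (H2 : HM n Q Q1) (r : ℝ) : F r = Q r := by
  have e : ∀ x, F (sinh x) = Q (sinh x) := by
    intro x
    by_cases hn : n = 0
    · have key : ∀ {F F1 : ℝ → ℝ}, HM n F F1 → F (sinh x) = 0 := by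
        intro F F1 H
        have h := H.toHX
        by_cases hz : ∃ x0, F1 (sinh x0) * cosh x0 = 0
        · obtain ⟨x0, hx0⟩ := hz
          exact (h.const hx0).1 x
        · exfalso
          have he : ∃ c, c ∈ Set.Ioo (0:ℝ) 1 ∧ True := ⟨1/2, by norm_num, trivial⟩
          have cg : Continuous fun x => F1 (sinh x) * cosh x := continuous_iff_continuousAt.2 fun x => (h.d2 x).continuousAt
          have hl := h.bot
          have ht := h.top
          rw [hn, Nat.cast_zero, zero_mul] at ht
          push Not at hz
          rcases lt_or_gt_of_ne (hz 0) with h0 | h0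
          · have hs : ∀ y, F1 (sinh y) * cosh y < 0 := by
              intro y
              by_contra! hy
              obtain ⟨z, _, hz'⟩ := intermediate_value_uIcc (a := 0) (b := y) cg.continuousOn (by
                rw [Set.uIcc_of_le (h0.le.trans hy)]; exact ⟨h0.le, hy⟩ : (0:ℝ) ∈ _)
              exact hz z hz'
            have ma : StrictAnti fun x => F (sinh x) := strictAnti_of_deriv_neg fun y => by rw [(h.d1 y).deriv]; exact hs y
            have a1 := ma.antitone.ge_of_tendsto hl 0
            have a2 := ma.antitone.le_of_tendsto ht 1
            have a3 := ma (show (0:ℝ) < 1 by norm_num)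
            linarith
          · have hs : ∀ y, 0 < F1 (sinh y) * cosh y := by
              intro y
              by_contra! hy
              obtain ⟨z, _, hz'⟩ := intermediate_value_uIcc (a := 0) (b := y) cg.continuousOn (by
                rw [Set.uIcc_of_ge (hy.trans h0.le)]; exact ⟨hy, h0.le⟩ : (0:ℝ) ∈ _)
              exact hz z hz'
            have ma : StrictMono fun x => F (sinh x) := strictMono_of_deriv_pos fun y => by rw [(h.d1 y).deriv]; exact hs y
            have a1 := ma.monotone.le_of_tendsto hl 0
            have a2 := ma.monotone.ge_of_tendsto ht 1
            have a3 := ma (show (0:ℝ) < 1 by norm_num)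
            linarith
      rw [key H, key H2]
    · exact le_antisymm (H.toHX.le H2.toHX hn x) (H2.toHX.le H.toHX hn x)
  have := e (arsinh r)
  rwa [sinh_arsinh] at this
end WMS

namespace WMS
variable {n : ℕ}

theorem HM.c1 {F F1 : ℝ → ℝ} (H : HM n F F1) : Continuous F1 :=
  continuous_iff_continuousAt.2 fun x => (H.d2 x).continuousAt
theorem HM.c0 {F F1 : ℝ → ℝ} (H : HM n F F1) : Continuous F :=
  continuous_iff_continuousAt.2 fun x => (H.d1 x).continuousAt

theorem HM.wd {F F1 : ℝ → ℝ} (H : HM n F F1) (r : ℝ) :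
    HasDerivAt (fun r => (r ^ 2 + 1) * F1 r) (sin (2 * F r)) r := by
  refine ((hasDerivAt_w r).fun_mul (H.d2 r)).congr_deriv ?_
  have : (r ^ 2 + 1) ≠ 0 := by positivity
  field_simp
  ring

theorem HM.decay {Q Q1 : ℝ → ℝ} (H : HM n Q Q1) : ∃ C > 0, ∀ r, |Q1 r| ≤ C / (r ^ 2 + 1) ∧
    sin (Q r) ^ 2 ≤ C / (r ^ 2 + 1) := by
  by_cases hn : n = 0
  · subst hn
    have H0 : HM 0 (fun _ => (0:ℝ)) (fun _ => 0) :=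
      ⟨fun r => hasDerivAt_const r 0, fun r => (hasDerivAt_const r 0).congr_deriv (by simp),
        tendsto_const_nhds, by simp⟩
    have e : Q = fun _ => (0:ℝ) := funext fun r => H.unique H0 r
    have e1 : ∀ r, Q1 r = 0 := fun r => by
      have := H.d1 r
      rw [e] at this
      exact this.unique (hasDerivAt_const r 0)
    exact ⟨1, one_pos, fun r => by rw [e1, e]; simp; positivity⟩
  have hx := H.toHX
  have hpos : ∀ r, 0 < Q1 r := by
    intro r
    have := hx.pos hn (arsinh r)
    rw [sinh_arsinh] at this
    exact pos_of_mul_pos_left this (cosh_pos _).le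
  have hr : ∀ r, 0 < Q r ∧ Q r < n * π := by
    intro r
    have := hx.range hn (arsinh r)
    rwa [sinh_arsinh] at this
  have cG : Continuous fun r => (r ^ 2 + 1) * Q1 r := by have := H.c1; fun_prop
  obtain ⟨R1, hR1⟩ := eventually_atTop.1 (H.top.eventually (lt_mem_nhds (show n * π - π / 2 < n * π by linarith [pi_pos])))
  obtain ⟨R2, hR2⟩ := eventually_atBot.1 (H.bot.eventually (gt_mem_nhds (show (0:ℝ) < π / 2 by positivity)))
  set R := |R1| + |R2|
  obtain ⟨C, hC⟩ := isCompact_Icc.exists_bound_of_continuousOn (cG.continuousOn (s := Set.Icc (-R) R))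
  have hRp : 0 ≤ R := by positivity
  have hup : ∀ r, (r ^ 2 + 1) * Q1 r ≤ C := by
    intro r
    rcases le_or_gt r (-R) with a | a
    · have hm : MonotoneOn (fun r => (r ^ 2 + 1) * Q1 r) (Set.Iic (-R)) := by
        refine monotoneOn_of_deriv_nonneg (convex_Iic _) cG.continuousOn
          (fun x _ => (H.wd x).differentiableAt.differentiableWithinAt) fun x hx => ?_
        rw [(H.wd x).deriv]
        rw [interior_Iic] at hx
        have h1 := hR2 x (by have := neg_abs_le R2; have := abs_nonneg R1; have : x < -R := hx; simp only [R] at this; linarith)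
        exact sin_nonneg_of_nonneg_of_le_pi (by linarith [(hr x).1]) (by linarith)
      exact (hm a (Set.mem_Iic.2 le_rfl) a).trans ((le_abs_self _).trans (hC _ ⟨le_rfl, by linarith⟩))
    · rcases le_or_gt R r with b | b
      · have hm : AntitoneOn (fun r => (r ^ 2 + 1) * Q1 r) (Set.Ici R) := by
          refine antitoneOn_of_deriv_nonpos (convex_Ici _) cG.continuousOn
            (fun x _ => (H.wd x).differentiableAt.differentiableWithinAt) fun x hx => ?_
          rw [(H.wd x).deriv]
          rw [interior_Ici] at hx
          have h1 := hR1 x (by have := le_abs_self R1; have := abs_nonneg R2; have : R < x := hx; simp only [R] at this; linarith)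
          rw [← sin_two_sub_npi n]
          exact sin_nonpos_of_nonpos_of_neg_pi_le (by linarith [(hr x).2]) (by linarith)
        exact (hm (Set.mem_Ici.2 le_rfl) b b).trans ((le_abs_self _).trans (hC _ ⟨by linarith, le_rfl⟩))
      · exact (le_abs_self _).trans (hC _ ⟨a.le, b.le⟩)
  have C0 : 0 < C := lt_of_lt_of_le (by have := hpos 0; positivity) (hup 0)
  refine ⟨C + C ^ 2, by positivity, fun r => ⟨?_, ?_⟩⟩
  · rw [abs_of_pos (hpos r), le_div_iff₀ (by positivity)]
    nlinarith [hup r]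
  · have h1 := hx.h_nonneg (arsinh r)
    simp only [sinh_arsinh, mul_pow, cosh_sq] at h1
    rw [le_div_iff₀ (by positivity)]
    have h2 := hup r
    have h3 : ((r ^ 2 + 1) * Q1 r) ^ 2 ≤ C ^ 2 := pow_le_pow_left₀ (by have := hpos r; positivity) h2 2
    have h4 := mul_le_mul_of_nonneg_right h1 (show 0 ≤ r ^ 2 + 1 by positivity)
    nlinarith [sq_nonneg ((r ^ 2 + 1) * Q1 r)]

theorem WM.pointwise {u : F2} (h : WM n u) {Q Q1 : ℝ → ℝ} (H : HM n Q Q1) (r : ℝ) :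
    Tendsto (fun t => u.f t r) atTop (nhds (Q r)) := by
  refine tendsto_of_seq_tendsto fun T hT => ?_
  refine tendsto_of_subseq_tendsto fun ns hns => ?_
  obtain ⟨φ, hφ, F, F1, HF, hl⟩ := h.subseq (hT.comp hns)
  refine ⟨φ, ?_⟩
  have := hl r
  rwa [HF.unique H r] at this
end WMS

namespace WMS
variable {n : ℕ} {u : F2} {Q Q1 : ℝ → ℝ}

theorem HM.c2 (H : HM n Q Q1) : Continuous fun r => (sin (2 * Q r) - 2 * r * Q1 r) / (r ^ 2 + 1) := by
  have := H.c0; have := H.c1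
  exact Continuous.div (by fun_prop) (by fun_prop) fun r => by positivity

noncomputable def HM.st (H : HM n Q Q1) : F2 :=
  F2.stat Q Q1 (fun r => (sin (2 * Q r) - 2 * r * Q1 r) / (r ^ 2 + 1)) H.d1 H.d2 H.c2

theorem HM.wm (H : HM n Q Q1) : WM n H.st where
  eq := by
    refine Wv.of_eq fun t r => ?_
    have : (r ^ 2 + 1) ≠ 0 := by positivity
    simp only [HM.st, F2.stat]
    field_simp
    ring
  fin t := by
    obtain ⟨C, hC, h⟩ := H.decay
    refine integrable_of_le (integrable_inv_w.const_mul (C ^ 2 + C)) (en_cont' (by fun_prop) _ _) fun r => ?_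
    rw [abs_of_nonneg (en_nonneg sinsq0 _ _ _)]
    simp only [en, HM.st, F2.stat]
    obtain ⟨h1, h2⟩ := h r
    have hw : 0 < r ^ 2 + 1 := by positivity
    have h3 : Q1 r ^ 2 ≤ (C / (r ^ 2 + 1)) ^ 2 := by rw [← sq_abs]; exact pow_le_pow_left₀ (abs_nonneg _) h1 2
    have h4 := mul_le_mul_of_nonneg_left h3 hw.le
    have e : (r ^ 2 + 1) * (C / (r ^ 2 + 1)) ^ 2 = C ^ 2 * (1 / (r ^ 2 + 1)) := by field_simp
    have e2 : (C ^ 2 + C) * (1 / (r ^ 2 + 1)) = C ^ 2 * (1 / (r ^ 2 + 1)) + C / (r ^ 2 + 1) := by ring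
    have : 0 ≤ C ^ 2 * (1 / (r ^ 2 + 1)) := by positivity
    rw [e2]; nlinarith
  bot t := H.bot
  top t := H.top

theorem abs_le_sin {x : ℝ} (hx : |x| ≤ 1) : x ^ 2 ≤ 4 * sin x ^ 2 := by
  wlog h : 0 ≤ x generalizing x
  · have := this (x := -x) (by simpa using hx) (by linarith)
    simpa using this
  have h1 := Real.mul_le_sin h (by rw [abs_of_nonneg h] at hx; linarith [pi_gt_three])
  have h2 : 1 / 2 ≤ 2 / π := by rw [div_le_div_iff₀ (by norm_num) pi_pos]; linarith [pi_lt_four]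
  have h3 : x / 2 ≤ sin x := by nlinarith
  nlinarith

theorem WM.sq_top (h : WM n u) : ∃ C > 0, ∀ t, ∀ r ≥ 0, (u.f t r - n * π) ^ 2 ≤
    C * (1 / (r ^ 2 + 1) + sin (u.f t r) ^ 2) := by
  obtain ⟨C, hC, h1, h2, -⟩ := h.bd
  refine ⟨C ^ 2 * (C ^ 4 + 1) + 4, by positivity, fun t r hr => ?_⟩
  have hs := sq_nonneg (sin (u.f t r))
  have hw : 0 < 1 / (r ^ 2 + 1) := by positivity
  rcases le_or_gt (C ^ 2) r with a | a
  · have hr0 : 0 < r := lt_of_lt_of_le (by positivity) a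
    have e := h2 t r hr0
    have e2 : |n * π - u.f t r| ≤ 1 := by
      rw [abs_sub_comm]
      refine e.trans ?_
      rw [div_le_one (Real.sqrt_pos.2 hr0)]
      exact Real.le_sqrt_of_sq_le a
    have e3 := abs_le_sin e2
    rw [sin_sq_npi_sub] at e3
    have : 0 ≤ C ^ 2 * (C ^ 4 + 1) * (1 / (r ^ 2 + 1) + sin (u.f t r) ^ 2) := by positivity
    nlinarith
  · have e := h1 t r
    have e1 : (u.f t r - n * π) ^ 2 ≤ C ^ 2 := by rw [← sq_abs]; exact pow_le_pow_left₀ (abs_nonneg _) e 2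
    have e2 : 1 ≤ (C ^ 4 + 1) * (1 / (r ^ 2 + 1)) := by
      rw [mul_one_div, one_le_div (by positivity)]
      nlinarith
    have e3 : C ^ 2 * 1 ≤ C ^ 2 * ((C ^ 4 + 1) * (1 / (r ^ 2 + 1))) := mul_le_mul_of_nonneg_left e2 (by positivity)
    have : 0 ≤ C ^ 2 * (C ^ 4 + 1) * sin (u.f t r) ^ 2 := by positivity
    nlinarith

theorem WM.sq_bot (h : WM n u) : ∃ C > 0, ∀ t, ∀ r ≤ 0, (u.f t r) ^ 2 ≤
    C * (1 / (r ^ 2 + 1) + sin (u.f t r) ^ 2) := by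
  obtain ⟨C, hC, h1⟩ := h.mir.sq_top
  refine ⟨C, hC, fun t r hr => ?_⟩
  have := h1 t (-r) (by linarith)
  simp only [F2.mir, neg_neg, sin_sq_npi_sub, neg_sq] at this
  nlinarith

noncomputable def ph (u : F2) (H : HM n Q Q1) : F2 := u.sub H.st
theorem ph_f (H : HM n Q Q1) (t r : ℝ) : (ph u H).f t r = u.f t r - Q r := rfl
theorem ph_t (H : HM n Q Q1) (t r : ℝ) : (ph u H).t t r = u.t t r := by simp [ph, F2.sub, HM.st, F2.stat]
theorem ph_r (H : HM n Q Q1) (t r : ℝ) : (ph u H).r t r = u.r t r - Q1 r := rfl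
theorem ph_eq (h : WM n u) (H : HM n Q Q1) : Wv (ph u H) (fun t r => sin (2 * u.f t r) - sin (2 * Q r)) := by
  intro t r
  have h1 := h.eq t r
  have h2 := H.wm.eq t r
  simp only [ph, F2.sub]
  have e : H.st.f t r = Q r := rfl
  simp only [e] at h2
  rw [← sub_zero (0:ℝ)]
  nth_rw 1 [← h1]; rw [← h2]; ring

/-- linear energy -/
noncomputable abbrev enl (v : F2) (t r : ℝ) : ℝ := en (fun x => x ^ 2) v t r

theorem enl_cont (v : F2) (t : ℝ) : Continuous (enl v t) := en_cont' (by fun_prop) v t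
theorem enl_nonneg (v : F2) (t r : ℝ) : 0 ≤ enl v t r := en_nonneg (fun x => sq_nonneg x) v t r

theorem ph_bound (h : WM n u) (H : HM n Q Q1) : ∃ C > 0, ∀ t r, enl (ph u H) t r ≤
    C * (en (fun x => sin x ^ 2) u t r + 1 / (r ^ 2 + 1)) := by
  obtain ⟨C1, p1, h1⟩ := h.sq_top
  obtain ⟨C2, p2, h2⟩ := h.sq_bot
  obtain ⟨C3, p3, h3⟩ := H.wm.sq_top
  obtain ⟨C4, p4, h4⟩ := H.wm.sq_bot
  obtain ⟨C5, p5, h5⟩ := H.decay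
  set D := C1 + C2 + C3 + C4 with hD
  have key : ∀ t r, (u.f t r - Q r) ^ 2 ≤ 2 * D * (1 / (r ^ 2 + 1) + sin (u.f t r) ^ 2) + 2 * D * (1 / (r ^ 2 + 1) + sin (Q r) ^ 2) := by
    intro t r
    have a1 : 0 ≤ 1 / (r ^ 2 + 1) + sin (u.f t r) ^ 2 := by positivity
    have a2 : 0 ≤ 1 / (r ^ 2 + 1) + sin (Q r) ^ 2 := by positivity
    set X := 1 / (r ^ 2 + 1) + sin (u.f t r) ^ 2
    set Y := 1 / (r ^ 2 + 1) + sin (Q r) ^ 2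
    have b1 : C1 * X ≤ D * X := mul_le_mul_of_nonneg_right (by linarith) a1
    have b2 : C2 * X ≤ D * X := mul_le_mul_of_nonneg_right (by linarith) a1
    have b3 : C3 * Y ≤ D * Y := mul_le_mul_of_nonneg_right (by linarith) a2
    have b4 : C4 * Y ≤ D * Y := mul_le_mul_of_nonneg_right (by linarith) a2
    rcases le_total 0 r with hr | hr
    · have e1 := h1 t r hr
      have e2 : (Q r - n * π) ^ 2 ≤ C3 * Y := h3 t r hr
      nlinarith [sq_nonneg (u.f t r - n * π + (Q r - n * π))]
    · have e1 := h2 t r hr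
      have e2 : (Q r) ^ 2 ≤ C4 * Y := h4 t r hr
      nlinarith [sq_nonneg (u.f t r + Q r)]
  refine ⟨2 + 4 * D + 2 * D * C5 + C5 ^ 2, by positivity, fun t r => ?_⟩
  have k := key t r
  obtain ⟨e1, e2⟩ := h5 r
  have hw : 0 < r ^ 2 + 1 := by positivity
  have e3 : Q1 r ^ 2 ≤ (C5 / (r ^ 2 + 1)) ^ 2 := by rw [← sq_abs]; exact pow_le_pow_left₀ (abs_nonneg _) e1 2
  have e4 := mul_le_mul_of_nonneg_left e3 hw.le
  have e5 : (r ^ 2 + 1) * (C5 / (r ^ 2 + 1)) ^ 2 = C5 ^ 2 * (1 / (r ^ 2 + 1)) := by field_simp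
  rw [e5] at e4
  unfold enl en
  simp only [ph_f, ph_t, ph_r]
  have e6 : (r ^ 2 + 1) * (u.r t r - Q1 r) ^ 2 ≤ 2 * ((r ^ 2 + 1) * u.r t r ^ 2) + 2 * ((r ^ 2 + 1) * Q1 r ^ 2) := by
    nlinarith [mul_nonneg hw.le (sq_nonneg (u.r t r + Q1 r))]
  have e7 : C5 / (r ^ 2 + 1) = C5 * (1 / (r ^ 2 + 1)) := by ring
  rw [e7] at e2
  have f1 : 0 ≤ (r ^ 2 + 1) * u.r t r ^ 2 := by positivity
  have f2 : 0 ≤ (r ^ 2 + 1) * u.t t r ^ 2 := by positivity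
  have f3 : 0 < 1 / (r ^ 2 + 1) := by positivity
  set z := 1 / (r ^ 2 + 1)
  set s := sin (u.f t r) ^ 2
  have f4 : 0 ≤ s := sq_nonneg _
  set A := (r ^ 2 + 1) * u.r t r ^ 2
  set B := (r ^ 2 + 1) * u.t t r ^ 2
  have hDp : 0 ≤ D := by positivity
  have g1 : 2 * D * (sin (Q r) ^ 2) ≤ 2 * D * (C5 * z) := mul_le_mul_of_nonneg_left e2 (by positivity)
  have g2 : (r ^ 2 + 1) * (u.t t r ^ 2 + (u.r t r - Q1 r) ^ 2) / 2 ≤ B / 2 + (A + C5 ^ 2 * z) := by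
    have : (r ^ 2 + 1) * (u.t t r ^ 2 + (u.r t r - Q1 r) ^ 2) = B + (r ^ 2 + 1) * (u.r t r - Q1 r) ^ 2 := by simp only [B]; ring
    rw [this]; linarith
  have g3 : (r ^ 2 + 1) * (u.t t r ^ 2 + u.r t r ^ 2) / 2 = A / 2 + B / 2 := by simp only [A, B]; ring
  rw [g3]
  have m1 : 0 ≤ D * A := by positivity
  have m2 : 0 ≤ D * B := by positivity
  have m3 : 0 ≤ D * s := by positivity
  have m4 : 0 ≤ D * C5 * A := by positivity
  have m5 : 0 ≤ D * C5 * B := by positivity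
  have m6 : 0 ≤ D * C5 * s := by positivity
  have m7 : 0 ≤ C5 ^ 2 * A := by positivity
  have m8 : 0 ≤ C5 ^ 2 * B := by positivity
  have m9 : 0 ≤ C5 ^ 2 * s := by positivity
  nlinarith
end WMS

namespace WMS
variable {n : ℕ} {u : F2} {Q Q1 : ℝ → ℝ}

theorem tail_small {f : ℝ → ℝ} (hf : Integrable f) :
    Tendsto (fun M : ℝ => ∫ r in {r | M ≤ |r|}, f r) atTop (nhds 0) := by
  have h00 : nhds (0:ℝ) = nhds (∫ r : ℝ, (0:ℝ)) := by simp
  rw [h00]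
  have hm : ∀ M : ℝ, MeasurableSet {r : ℝ | M ≤ |r|} := fun M => measurableSet_le measurable_const (by fun_prop)
  simp_rw [fun M => (integral_indicator (μ := volume) (f := f) (hm M)).symm]
  refine tendsto_integral_filter_of_dominated_convergence (fun r => ‖f r‖) (Eventually.of_forall fun M => hf.1.indicator (hm M)) (Eventually.of_forall fun M => Eventually.of_forall fun r => norm_indicator_le_norm_self _ _) hf.norm (Eventually.of_forall fun r => ?_)
  refine tendsto_const_nhds.congr' ?_
  filter_upwards [eventually_gt_atTop |r|] with M hM
  rw [Set.indicator_of_notMem]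
  simpa using hM

theorem meas_tail (M : ℝ) : MeasurableSet {r : ℝ | M ≤ |r|} := measurableSet_le measurable_const (by fun_prop)

theorem ph_int (h : WM n u) (H : HM n Q Q1) (t : ℝ) : Integrable (enl (ph u H) t) := by
  obtain ⟨C, hC, hb⟩ := ph_bound h H
  refine integrable_of_le (((h.fin t).add integrable_inv_w).const_mul C) (enl_cont _ _) fun r => ?_
  rw [abs_of_nonneg (enl_nonneg _ _ _)]
  exact hb t r

theorem ph_energy (h : WM n u) (H : HM n Q Q1) : ∃ K > 0, ∀ t, ∫ r, enl (ph u H) t r ≤ K := by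
  obtain ⟨C, hC, hb⟩ := ph_bound h H
  have := Eng_nonneg u
  refine ⟨C * (Eng u + π), by have := pi_pos; positivity, fun t => ?_⟩
  refine (integral_mono (ph_int h H t) (((h.fin t).add integrable_inv_w).const_mul C) (hb t)).trans ?_
  simp only [Pi.add_apply]
  rw [integral_const_mul, integral_add (h.fin t) integrable_inv_w, h.energy, integral_inv_w]

theorem ph_tail (h : WM n u) (H : HM n Q Q1) {ε : ℝ} (hε : 0 < ε) :
    ∃ M0 > 0, ∀ M ≥ M0, ∀ T ≥ 0, ∫ r in {r | T + M ≤ |r|}, enl (ph u H) T r ≤ ε := by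
  obtain ⟨C, hC, hb⟩ := ph_bound h H
  obtain ⟨M0, hM0, h0⟩ := energy_tail hasDerivAt_sinsq (by fun_prop) sinsq0 h.eq (h.fin 0) (show 0 < ε / (2 * C) by positivity)
  obtain ⟨M1, h1⟩ := eventually_atTop.1 ((tail_small integrable_inv_w).eventually (gt_mem_nhds (show 0 < ε / (2 * C) by positivity)))
  refine ⟨max M0 M1, lt_max_of_lt_left hM0, fun M hM T hT => ?_⟩
  have a1 := h0 M ((le_max_left _ _).trans hM) T hT
  have a2 := h1 (T + M) (by have := (le_max_right M0 M1).trans hM; linarith)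
  refine (setIntegral_mono (ph_int h H T).integrableOn (((h.fin T).add integrable_inv_w).const_mul C).integrableOn (hb T)).trans ?_
  simp only [Pi.add_apply]
  rw [integral_const_mul, integral_add (h.fin T).integrableOn integrable_inv_w.integrableOn]
  have : C * (ε / (2 * C) + ε / (2 * C)) = ε := by field_simp; ring
  rw [← this]
  exact mul_le_mul_of_nonneg_left (by linarith) hC.le

theorem enl_parts (v : F2) (t r : ℝ) : v.f t r ^ 2 ≤ enl v t r ∧ (r ^ 2 + 1) * v.r t r ^ 2 ≤ 2 * enl v t r
    ∧ (r ^ 2 + 1) * v.t t r ^ 2 ≤ 2 * enl v t r ∧ v.f t r ^ 2 + (r ^ 2 + 1) * v.r t r ^ 2 ≤ 2 * enl v t r := by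
  unfold enl en
  have h1 : 0 ≤ (r ^ 2 + 1) * v.t t r ^ 2 := by positivity
  have h2 : 0 ≤ (r ^ 2 + 1) * v.r t r ^ 2 := by positivity
  have h3 := sq_nonneg (v.f t r)
  refine ⟨?_, ?_, ?_, ?_⟩ <;> nlinarith

theorem F2.cf1 (v : F2) (t : ℝ) : Continuous (v.f t) := v.cf' continuous_const continuous_id
theorem F2.ct1 (v : F2) (t : ℝ) : Continuous (v.t t) := v.ct' continuous_const continuous_id
theorem F2.cr1 (v : F2) (t : ℝ) : Continuous (v.r t) := v.cr' continuous_const continuous_id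

theorem enl_sob {v : F2} {t : ℝ} (hi : Integrable (enl v t)) (r : ℝ) : q r * v.f t r ^ 2 ≤ 2 * ∫ r, enl v t r := by
  have := v.cf1 t; have := v.cr1 t
  have i1 : Integrable fun r => v.f t r ^ 2 + (r ^ 2 + 1) * v.r t r ^ 2 :=
    integrable_of_le (hi.const_mul 2) (by fun_prop) fun r => by
      rw [abs_of_nonneg (by positivity)]; exact (enl_parts v t r).2.2.2
  refine (sob (fun r => v.hr t r) (v.cr1 t) i1 r).trans ?_
  rw [← integral_const_mul]
  exact integral_mono i1 (hi.const_mul 2) fun r => (enl_parts v t r).2.2.2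

theorem div_w_le {a r : ℝ} (h : 0 ≤ a) : a / (r ^ 2 + 1) ≤ a := div_le_self h (by nlinarith [sq_nonneg r])

theorem ph_w (h : WM n u) (H : HM n Q Q1) :
    Tendsto (fun t => ∫ r, (ph u H).f t r ^ 2 / (r ^ 2 + 1)) atTop (nhds 0) := by
  obtain ⟨K, hK, h1⟩ := ph_energy h H
  have h00 : nhds (0:ℝ) = nhds (∫ r : ℝ, (0:ℝ)) := by simp
  rw [h00]
  refine tendsto_integral_filter_of_dominated_convergence (fun r => 2 * K * (1 / (r ^ 2 + 1))) (Eventually.of_forall fun t => ?_) (Eventually.of_forall fun t => Eventually.of_forall fun r => ?_) (integrable_inv_w.const_mul _) (Eventually.of_forall fun r => ?_)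
  · have := (ph u H).cf1 t
    exact (Continuous.div (by fun_prop) (by fun_prop) fun r => by positivity).aestronglyMeasurable
  · rw [Real.norm_of_nonneg (by positivity), mul_one_div]
    refine div_le_div_of_nonneg_right ?_ (by positivity)
    have := enl_sob (ph_int h H t) r
    have := one_le_q r
    nlinarith [sq_nonneg ((ph u H).f t r), h1 t]
  · have := ((h.pointwise H r).sub_const (Q r)).pow 2 |>.div_const (r ^ 2 + 1)
    simpa [ph_f] using this

theorem ph_lim (h : WM n u) (H : HM n Q Q1) (t : ℝ) : Tendsto ((ph u H).f t) atTop (nhds 0) ∧ Tendsto ((ph u H).f t) atBot (nhds 0) := by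
  constructor
  · have := (h.top t).sub H.top
    rw [sub_self] at this; exact this
  · have := (h.bot t).sub H.bot
    rw [sub_self] at this; exact this

theorem sup_bound {v : F2} {t : ℝ} (hi : Integrable (enl v t)) (hb : Tendsto (v.f t) atBot (nhds 0)) {c : ℝ} (hc : 0 < c) (r : ℝ) :
    v.f t r ^ 2 ≤ (1 / c) * (∫ r, v.f t r ^ 2 / (r ^ 2 + 1)) + c * (2 * ∫ r, enl v t r) := by
  have c0 := v.cf1 t; have cr := v.cr1 t
  have cw : Continuous fun r => v.f t r ^ 2 / (r ^ 2 + 1) := Continuous.div (by fun_prop) (by fun_prop) fun r => by positivity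
  have i0 : Integrable fun r => v.f t r ^ 2 / (r ^ 2 + 1) :=
    integrable_of_le hi cw fun r => by
      rw [abs_of_nonneg (by positivity)]; exact (div_w_le (sq_nonneg _)).trans (enl_parts v t r).1
  have i1 := (i0.const_mul (1 / c)).add ((hi.const_mul 2).const_mul c)
  have hd : ∀ x, HasDerivAt (fun r => v.f t r ^ 2) (2 * v.f t x * v.r t x) x := fun x =>
    ((v.hr t x).fun_pow 2).congr_deriv (by simp)
  have hle : ∀ r, |2 * v.f t r * v.r t r| ≤ (1 / c) * (v.f t r ^ 2 / (r ^ 2 + 1)) + c * (2 * enl v t r) := by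
    intro r
    have hw : 0 < r ^ 2 + 1 := by positivity
    have a := (enl_parts v t r).2.1
    have b := mul_le_mul_of_nonneg_left a hc.le
    refine le_trans ?_ (add_le_add_right b _)
    have hq := q_sq r; have hqp := q_pos r
    rw [← hq]
    have e : (1 / c) * (v.f t r ^ 2 / q r ^ 2) + c * (q r ^ 2 * v.r t r ^ 2) = (1 / c) * ((v.f t r / q r) ^ 2 + (c * (q r * v.r t r)) ^ 2) := by
      field_simp
    rw [e]
    have e2 : |2 * v.f t r * v.r t r| = (1 / c) * (2 * |v.f t r / q r| * |c * (q r * v.r t r)|) := by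
      rw [abs_mul, abs_mul, abs_div, abs_mul c, abs_mul (q r), abs_of_pos hc, abs_of_pos hqp, abs_two]
      field_simp
    rw [e2]
    refine mul_le_mul_of_nonneg_left ?_ (by positivity)
    rw [← sq_abs (v.f t r / q r), ← sq_abs (c * (q r * v.r t r))]
    nlinarith [sq_nonneg (|v.f t r / q r| - |c * (q r * v.r t r)|)]
  have i2 : Integrable fun r => 2 * v.f t r * v.r t r := integrable_of_le i1 (by fun_prop) hle
  have e := integral_Iic_of_hasDerivAt_of_tendsto (a := r) (m := 0) (hd r).continuousAt.continuousWithinAt (fun x _ => hd x) i2.integrableOn (by simpa using hb.pow 2)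
  rw [sub_zero] at e
  rw [← e, ← integral_const_mul, ← integral_const_mul, ← integral_const_mul, ← integral_add (i0.const_mul _) ((hi.const_mul 2).const_mul c)]
  refine (setIntegral_mono i2.integrableOn i1.integrableOn fun x => (le_abs_self _).trans (hle x)).trans ?_
  refine setIntegral_le_integral i1 (Eventually.of_forall fun x => ?_)
  exact (abs_nonneg _).trans (hle x)

theorem ph_sup (h : WM n u) (H : HM n Q Q1) {ε : ℝ} (hε : 0 < ε) : ∃ T0 ≥ 0, ∀ t ≥ T0, (∀ r, |(ph u H).f t r| ≤ ε) ∧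
    ∫ r, (ph u H).f t r ^ 2 / (r ^ 2 + 1) ≤ ε := by
  obtain ⟨K, hK, h1⟩ := ph_energy h H
  set c := ε ^ 2 / (4 * K) with hc
  have c0 : 0 < c := by positivity
  obtain ⟨T, hT⟩ := eventually_atTop.1 ((ph_w h H).eventually (gt_mem_nhds (show 0 < min ε (c * ε ^ 2 / 2) by positivity)))
  refine ⟨max T 0, le_max_right _ _, fun t ht => ⟨fun r => ?_, ?_⟩⟩
  · have a := hT t ((le_max_left _ _).trans ht)
    have b := sup_bound (ph_int h H t) (ph_lim h H t).2 c0 r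
    have d := lt_of_lt_of_le a (min_le_right _ _)
    have e : (1 / c) * (∫ r, (ph u H).f t r ^ 2 / (r ^ 2 + 1)) ≤ ε ^ 2 / 2 := by
      rw [one_div, inv_mul_le_iff₀ c0]; linarith
    have e2 : c * (2 * ∫ r, enl (ph u H) t r) ≤ c * (2 * K) := mul_le_mul_of_nonneg_left (by linarith [h1 t]) c0.le
    have e3 : c * (2 * K) = ε ^ 2 / 2 := by rw [hc]; field_simp; ring
    exact abs_le_of_sq_le_sq (by linarith) hε.le
  · exact ((hT t ((le_max_left _ _).trans ht)).trans_le (min_le_left _ _)).le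
end WMS

namespace WMS
variable {n : ℕ} {u : F2} {Q Q1 : ℝ → ℝ}

noncomputable def Rem (u : F2) (Q : ℝ → ℝ) (t r : ℝ) : ℝ :=
  sin (u.f t r) ^ 2 - sin (Q r) ^ 2 - sin (2 * Q r) * (u.f t r - Q r) - (u.f t r - Q r) ^ 2

theorem rem_bound (Q φ : ℝ) : |sin (Q + φ) ^ 2 - sin Q ^ 2 - sin (2 * Q) * φ - φ ^ 2| ≤
    2 * φ ^ 2 * sin Q ^ 2 + 8 * |φ| ^ 3 + 4 * |φ| ^ 3 * |φ| := by
  have e : sin (Q + φ) ^ 2 - sin Q ^ 2 - sin (2 * Q) * φ - φ ^ 2 =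
      -2 * sin Q ^ 2 * sin φ ^ 2 + (sin φ - φ) * (sin φ + φ) + (sin (2 * Q) / 2) * (sin (2 * φ) - 2 * φ) := by
    rw [Real.sin_add, Real.sin_two_mul, Real.sin_two_mul]
    have h1 := Real.sin_sq_add_cos_sq Q
    have h2 := Real.sin_sq_add_cos_sq φ
    have h3 : cos Q ^ 2 = 1 - sin Q ^ 2 := by linarith
    have h4 : cos φ ^ 2 = 1 - sin φ ^ 2 := by linarith
    ring_nf
    rw [h3, h4]; ring
  rw [e]
  have hs : |sin φ| ≤ |φ| := Real.abs_sin_le_abs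
  have hs2 : sin φ ^ 2 ≤ φ ^ 2 := by rw [← sq_abs, ← sq_abs φ]; exact pow_le_pow_left₀ (abs_nonneg _) hs 2
  have a1 : |-2 * sin Q ^ 2 * sin φ ^ 2| ≤ 2 * φ ^ 2 * sin Q ^ 2 := by
    rw [show -2 * sin Q ^ 2 * sin φ ^ 2 = -(2 * sin Q ^ 2 * sin φ ^ 2) by ring, abs_neg, abs_of_nonneg (by positivity)]
    nlinarith [sq_nonneg (sin Q)]
  have a2 : |(sin φ - φ) * (sin φ + φ)| ≤ 4 * |φ| ^ 3 * |φ| := by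
    rw [abs_mul]
    have b1 := sin_sub_le φ
    have b2 : |sin φ + φ| ≤ 2 * |φ| := (abs_add_le _ _).trans (by linarith)
    calc _ ≤ (2 * |φ| ^ 3) * (2 * |φ|) := mul_le_mul b1 b2 (abs_nonneg _) (by positivity)
      _ = _ := by ring
  have a3 : |(sin (2 * Q) / 2) * (sin (2 * φ) - 2 * φ)| ≤ 8 * |φ| ^ 3 := by
    rw [abs_mul]
    have b1 := sin_sub_le (2 * φ)
    rw [abs_mul, abs_two] at b1
    have b2 : |sin (2 * Q) / 2| ≤ 1 / 2 := by rw [abs_div, abs_two]; linarith [Real.abs_sin_le_one (2 * Q)]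
    calc _ ≤ (1 / 2) * (2 * (2 * |φ|) ^ 3) := mul_le_mul b2 b1 (abs_nonneg _) (by positivity)
      _ = _ := by ring
  refine (abs_add_le _ _).trans ?_
  have := abs_add_le (-2 * sin Q ^ 2 * sin φ ^ 2) ((sin φ - φ) * (sin φ + φ))
  linarith

theorem ph_expand (h : WM n u) (H : HM n Q Q1) (t : ℝ) : Integrable (Rem u Q t) ∧
    ∫ r, enl (ph u H) t r = Eng u - Eng H.st - ∫ r, Rem u Q t r := by
  have cQ := H.c0; have cQ1 := H.c1
  obtain ⟨C, hC, hd⟩ := H.decay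
  have c0 := (ph u H).cf1 t
  have c1 := (ph u H).cr1 t
  have i1 := ph_int h H t
  have i2 := H.wm.fin 0
  have dd : ∀ r, HasDerivAt (fun r => (r ^ 2 + 1) * Q1 r * (ph u H).f t r)
      (sin (2 * Q r) * (ph u H).f t r + (r ^ 2 + 1) * Q1 r * (ph u H).r t r) r := fun r =>
    (H.wd r).fun_mul ((ph u H).hr t r)
  have i3 : Integrable fun r => sin (2 * Q r) * (ph u H).f t r + (r ^ 2 + 1) * Q1 r * (ph u H).r t r := by
    refine integrable_of_le ((i1.const_mul 2).add (i2.const_mul 4)) (by fun_prop) fun r => ?_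
    have e1 := (enl_parts (ph u H) t r)
    simp only [Pi.add_apply]
    have e2 : en (fun x => sin x ^ 2) H.st 0 r = (r ^ 2 + 1) * Q1 r ^ 2 / 2 + sin (Q r) ^ 2 := by
      simp [en, HM.st, F2.stat]
    rw [e2]
    have hs : sin (2 * Q r) ^ 2 ≤ 4 * sin (Q r) ^ 2 := by
      rw [Real.sin_two_mul]
      nlinarith [Real.sin_sq_add_cos_sq (Q r), sq_nonneg (sin (Q r)), mul_nonneg (sq_nonneg (sin (Q r))) (sq_nonneg (sin (Q r)))]
    have hw : 0 < r ^ 2 + 1 := by positivity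
    have k1 := mul_nonneg hw.le (sq_nonneg (Q1 r + (ph u H).r t r))
    have k2 := mul_nonneg hw.le (sq_nonneg (Q1 r - (ph u H).r t r))
    have k3 := mul_nonneg hw.le (sq_nonneg (Q1 r))
    refine abs_le.2 ⟨?_, ?_⟩
    · nlinarith [sq_nonneg (sin (2 * Q r) + (ph u H).f t r)]
    · nlinarith [sq_nonneg (sin (2 * Q r) - (ph u H).f t r)]
  have bdd : ∀ r, |(r ^ 2 + 1) * Q1 r| ≤ C := by
    intro r
    have := (hd r).1
    rw [le_div_iff₀ (by positivity)] at this
    rw [abs_mul, abs_of_pos (show 0 < r ^ 2 + 1 by positivity)]; linarith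
  have z : ∀ l : Filter ℝ, Tendsto ((ph u H).f t) l (nhds 0) → Tendsto (fun r => (r ^ 2 + 1) * Q1 r * (ph u H).f t r) l (nhds 0) := by
    intro l hl
    refine squeeze_zero_norm (a := fun r => C * |(ph u H).f t r|) (fun r => ?_) (by simpa using hl.abs.const_mul C)
    rw [Real.norm_eq_abs, abs_mul]
    exact mul_le_mul_of_nonneg_right (bdd r) (abs_nonneg _)
  have e0 := integral_of_hasDerivAt_of_tendsto dd i3 (z _ (ph_lim h H t).2) (z _ (ph_lim h H t).1)
  rw [sub_zero] at e0
  have id : ∀ r, Rem u Q t r = en (fun x => sin x ^ 2) u t r - enl (ph u H) t r - en (fun x => sin x ^ 2) H.st 0 r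
      - (sin (2 * Q r) * (ph u H).f t r + (r ^ 2 + 1) * Q1 r * (ph u H).r t r) := by
    intro r
    have e2 : en (fun x => sin x ^ 2) H.st 0 r = (r ^ 2 + 1) * Q1 r ^ 2 / 2 + sin (Q r) ^ 2 := by
      simp [en, HM.st, F2.stat]
    rw [e2]
    simp only [Rem, enl, en, ph_f, ph_t, ph_r]
    ring
  have ee : Rem u Q t = fun r => en (fun x => sin x ^ 2) u t r - enl (ph u H) t r - en (fun x => sin x ^ 2) H.st 0 r
      - (sin (2 * Q r) * (ph u H).f t r + (r ^ 2 + 1) * Q1 r * (ph u H).r t r) := funext id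
  rw [ee]
  have j1 := (h.fin t).sub i1
  have j2 := j1.sub i2
  have j3 := j2.sub i3
  refine ⟨j3, ?_⟩
  have k1 : ∫ r, (en (fun x => sin x ^ 2) u t r - enl (ph u H) t r - en (fun x => sin x ^ 2) H.st 0 r
      - (sin (2 * Q r) * (ph u H).f t r + (r ^ 2 + 1) * Q1 r * (ph u H).r t r)) = _ := integral_sub j2 i3
  have k2 : ∫ r, (en (fun x => sin x ^ 2) u t r - enl (ph u H) t r - en (fun x => sin x ^ 2) H.st 0 r) = _ := integral_sub j1 i2
  have k3 : ∫ r, (en (fun x => sin x ^ 2) u t r - enl (ph u H) t r) = _ := integral_sub (h.fin t) i1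
  rw [k1, e0]
  rw [k2]
  rw [k3, h.energy]
  simp only [Eng]; ring

theorem ph_conv (h : WM n u) (H : HM n Q Q1) {ε : ℝ} (hε : 0 < ε) : ∃ T0 ≥ 0, ∀ t ≥ T0,
    |(∫ r, enl (ph u H) t r) - (Eng u - Eng H.st)| ≤ ε := by
  obtain ⟨C, hC, hd⟩ := H.decay
  obtain ⟨K, hK, hKb⟩ := ph_energy h H
  set c := min 1 (ε / (2 * C + 12 * K)) with hc
  have c0 : 0 < c := by positivity
  obtain ⟨T0, hT0, hs⟩ := ph_sup h H c0
  refine ⟨T0, hT0, fun t ht => ?_⟩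
  obtain ⟨s1, s2⟩ := hs t ht
  obtain ⟨iR, eR⟩ := ph_expand h H t
  rw [eR, show Eng u - Eng H.st - (∫ r, Rem u Q t r) - (Eng u - Eng H.st) = -∫ r, Rem u Q t r by ring, abs_neg]
  have cf := (ph u H).cf1 t
  have cw : Continuous fun r => (ph u H).f t r ^ 2 / (r ^ 2 + 1) := Continuous.div (by fun_prop) (by fun_prop) fun r => by positivity
  have i0 : Integrable fun r => (ph u H).f t r ^ 2 / (r ^ 2 + 1) :=
    integrable_of_le (ph_int h H t) cw fun r => by
      rw [abs_of_nonneg (by positivity)]; exact (div_w_le (sq_nonneg _)).trans (enl_parts _ t r).1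
  have i1 := (i0.const_mul (2 * C)).add ((ph_int h H t).const_mul (12 * c))
  have hb : ∀ r, ‖Rem u Q t r‖ ≤ 2 * C * ((ph u H).f t r ^ 2 / (r ^ 2 + 1)) + 12 * c * enl (ph u H) t r := by
    intro r
    have b := rem_bound (Q r) ((ph u H).f t r)
    rw [show Q r + (ph u H).f t r = u.f t r by rw [ph_f]; ring] at b
    refine le_trans b ?_
    have a := s1 r
    have p := (enl_parts (ph u H) t r).1
    have a0 := abs_nonneg ((ph u H).f t r)
    have a2 : |(ph u H).f t r| ^ 2 = (ph u H).f t r ^ 2 := sq_abs _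
    have hc1 : c ≤ 1 := min_le_left _ _
    have q1 : |(ph u H).f t r| ^ 3 ≤ c * enl (ph u H) t r := by
      rw [pow_succ, a2, mul_comm]
      exact mul_le_mul a p (sq_nonneg _) c0.le
    have q2 : |(ph u H).f t r| ^ 3 * |(ph u H).f t r| ≤ |(ph u H).f t r| ^ 3 := mul_le_of_le_one_right (by positivity) (a.trans hc1)
    have q3 : 2 * (ph u H).f t r ^ 2 * sin (Q r) ^ 2 ≤ 2 * (ph u H).f t r ^ 2 * (C / (r ^ 2 + 1)) :=
      mul_le_mul_of_nonneg_left (hd r).2 (by positivity)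
    have q4 : 2 * (ph u H).f t r ^ 2 * (C / (r ^ 2 + 1)) = 2 * C * ((ph u H).f t r ^ 2 / (r ^ 2 + 1)) := by ring
    linarith
  refine (norm_integral_le_of_norm_le i1 (Eventually.of_forall hb)).trans ?_
  have e : ∫ r, (2 * C * ((ph u H).f t r ^ 2 / (r ^ 2 + 1)) + 12 * c * enl (ph u H) t r) = _ := integral_add (i0.const_mul (2 * C)) ((ph_int h H t).const_mul (12 * c))
  simp only [Pi.add_apply]
  rw [e, integral_const_mul, integral_const_mul]
  have f1 : 2 * C * (∫ r, (ph u H).f t r ^ 2 / (r ^ 2 + 1)) ≤ 2 * C * c := mul_le_mul_of_nonneg_left s2 (by positivity)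
  have f2 : 12 * c * ∫ r, enl (ph u H) t r ≤ 12 * c * K := mul_le_mul_of_nonneg_left (hKb t) (by positivity)
  have f3 : c * (2 * C + 12 * K) ≤ ε := by
    rw [← le_div_iff₀ (by positivity)]; exact min_le_right _ _
  linarith
end WMS

namespace WMS

noncomputable def V (r : ℝ) : ℝ := 1 / (r ^ 2 + 1) ^ 2 + 2 / (r ^ 2 + 1)
noncomputable def V1 (r : ℝ) : ℝ := -(4 * r) / (r ^ 2 + 1) ^ 3 - 4 * r / (r ^ 2 + 1) ^ 2

@[fun_prop] theorem continuous_V : Continuous V :=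
  (Continuous.div (by fun_prop) (by fun_prop) fun r => by positivity).add
    (Continuous.div (by fun_prop) (by fun_prop) fun r => by positivity)
@[fun_prop] theorem continuous_V1 : Continuous V1 :=
  (Continuous.div (by fun_prop) (by fun_prop) fun r => by positivity).sub
    (Continuous.div (by fun_prop) (by fun_prop) fun r => by positivity)
theorem hasDerivAt_V (r : ℝ) : HasDerivAt V (V1 r) r := by
  have hw : r ^ 2 + 1 ≠ 0 := by positivity
  have a1 := (hasDerivAt_const r (1:ℝ)).fun_div ((hasDerivAt_w r).fun_pow 2) (pow_ne_zero 2 hw)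
  have a2 := (hasDerivAt_const r (2:ℝ)).fun_div (hasDerivAt_w r) hw
  refine (a1.fun_add a2).congr_deriv ?_
  unfold V1
  field_simp
  ring
theorem V_pos (r : ℝ) : 0 < V r := by unfold V; positivity
theorem inv_w_le_one (r : ℝ) : 1 / (r ^ 2 + 1) ≤ 1 := div_w_le zero_le_one
theorem V_lower (r : ℝ) : 2 / (r ^ 2 + 1) ≤ V r := by
  unfold V
  have : 0 < 1 / (r ^ 2 + 1) ^ 2 := by positivity
  linarith
theorem V_upper (r : ℝ) : V r ≤ 3 / (r ^ 2 + 1) := by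
  unfold V
  have h := inv_w_le_one r
  have h0 : 0 < 1 / (r ^ 2 + 1) := by positivity
  have e : 1 / (r ^ 2 + 1) ^ 2 = 1 / (r ^ 2 + 1) * (1 / (r ^ 2 + 1)) := by field_simp
  rw [e, show 3 / (r ^ 2 + 1) = 1 / (r ^ 2 + 1) + 2 / (r ^ 2 + 1) by ring]
  nlinarith
theorem V_le (r : ℝ) : V r ≤ 3 := (V_upper r).trans (div_w_le (by norm_num))
theorem V_q (r : ℝ) : V r = 1 / q r ^ 4 + 2 / q r ^ 2 := by
  unfold V; rw [show q r ^ 4 = (q r ^ 2) ^ 2 by ring, q_sq]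
theorem V1_bound (r : ℝ) : |V1 r| ≤ 8 / (r ^ 2 + 1) := by
  unfold V1
  have hw : 0 < r ^ 2 + 1 := by positivity
  have hr : |r| ≤ r ^ 2 + 1 := by
    have := sq_abs r
    nlinarith [sq_nonneg (|r| - 1), abs_nonneg r]
  have e1 : |4 * r / (r ^ 2 + 1) ^ 2| ≤ 4 / (r ^ 2 + 1) := by
    rw [abs_div, abs_mul, abs_of_pos (show (0:ℝ) < 4 by norm_num), abs_of_pos (show 0 < (r ^ 2 + 1) ^ 2 by positivity), div_le_div_iff₀ (by positivity) hw]
    nlinarith [mul_le_mul_of_nonneg_right hr hw.le]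
  have e2 : |-(4 * r) / (r ^ 2 + 1) ^ 3| ≤ 4 / (r ^ 2 + 1) := by
    have : -(4 * r) / (r ^ 2 + 1) ^ 3 = -((4 * r / (r ^ 2 + 1) ^ 2) / (r ^ 2 + 1)) := by field_simp
    rw [this, abs_neg, abs_div, abs_of_pos hw]
    exact (div_w_le (abs_nonneg _)).trans e1
  have := abs_sub (-(4 * r) / (r ^ 2 + 1) ^ 3) (4 * r / (r ^ 2 + 1) ^ 2)
  have e3 : 8 / (r ^ 2 + 1) = 4 / (r ^ 2 + 1) + 4 / (r ^ 2 + 1) := by ring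
  rw [e3]; linarith

noncomputable def ef (U : F2) (t r : ℝ) : ℝ := (U.t t r ^ 2 + U.r t r ^ 2 + V r * U.f t r ^ 2) / 2
theorem ef_nonneg (U : F2) (t r : ℝ) : 0 ≤ ef U t r := by unfold ef; have := V_pos r; positivity
theorem ef_cont (U : F2) : Continuous fun p : ℝ × ℝ => ef U p.1 p.2 := by
  unfold ef; have := U.cf; have := U.ct; have := U.cr; fun_prop
theorem ef_cont' (U : F2) (t : ℝ) : Continuous (ef U t) := (ef_cont U).comp (Continuous.prodMk_right t)

theorem ef_lift (v : F2) (t r : ℝ) : ef (v.lift 0) t r = enl v t r + (v.f t r ^ 2 + r * (2 * v.f t r * v.r t r)) / 2 := by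
  unfold ef enl en
  rw [lift_f, lift_t, lift_r, V_q]
  have h := q_sq r; have h0 := q_ne r
  have e : r ^ 2 = q r ^ 2 - 1 := by linarith
  simp only [sub_zero]
  rw [← h]
  field_simp
  ring_nf
  rw [e]
  ring

theorem ef_lift_le (v : F2) (t r : ℝ) : ef (v.lift 0) t r ≤ 2 * enl v t r := by
  rw [ef_lift]
  unfold enl en
  nlinarith [sq_nonneg (v.f t r - r * v.r t r), sq_nonneg (v.r t r), sq_nonneg (v.t t r), sq_nonneg (r * v.t t r)]

theorem lim_zero {f : ℝ → ℝ} {l : ℝ} (h0 : ∀ r > 0, 0 ≤ f r) (hf : Integrable f) (hl : Tendsto (fun r => r * f r) atTop (nhds l)) : l = 0 := by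
  by_contra hne
  have l0 : 0 ≤ l := ge_of_tendsto hl (by filter_upwards [eventually_gt_atTop 0] with r hr using mul_nonneg hr.le (h0 r hr))
  have lp : 0 < l := lt_of_le_of_ne l0 (Ne.symm hne)
  obtain ⟨R, hR⟩ := eventually_atTop.1 (hl.eventually (lt_mem_nhds (show l / 2 < l by linarith)))
  have : IntegrableOn (fun r : ℝ => r⁻¹) (Set.Ioi (max R 1)) := by
    refine Integrable.mono' (hf.const_mul (2 / l)).integrableOn (by fun_prop) ?_
    filter_upwards [ae_restrict_mem measurableSet_Ioi] with r hr
    have r1 : 1 < r := lt_of_le_of_lt (le_max_right _ _) hr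
    have := hR r ((le_max_left R 1).trans hr.le)
    rw [Real.norm_of_nonneg (by positivity), inv_le_iff_one_le_mul₀ (by linarith)]
    rw [show 2 / l * f r * r = (r * f r) / (l / 2) by field_simp, one_le_div (by positivity)]
    exact this.le
  exact not_integrableOn_Ioi_inv this

theorem flat_int {v : F2} {t : ℝ} (hi : Integrable (enl v t)) : Integrable (ef (v.lift 0) t) ∧
    ∫ r, ef (v.lift 0) t r = ∫ r, enl v t r := by
  have c0 := v.cf1 t; have c1 := v.cr1 t
  have i0 : Integrable fun r => v.f t r ^ 2 := integrable_of_le hi (by fun_prop) fun r => by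
    rw [abs_of_nonneg (by positivity)]; exact (enl_parts v t r).1
  have dd : ∀ r, HasDerivAt (fun r => r * v.f t r ^ 2) (v.f t r ^ 2 + r * (2 * v.f t r * v.r t r)) r := fun r => by
    refine ((hasDerivAt_id r).fun_mul ((v.hr t r).fun_pow 2)).congr_deriv ?_
    simp
  have i1 : Integrable fun r => v.f t r ^ 2 + r * (2 * v.f t r * v.r t r) := by
    refine integrable_of_le (hi.const_mul 4) (by fun_prop) fun r => ?_
    have := enl_nonneg v t r
    unfold enl en at *
    refine abs_le.2 ⟨?_, ?_⟩
    · nlinarith [sq_nonneg (v.f t r + r * v.r t r), sq_nonneg (v.r t r), sq_nonneg (v.t t r), sq_nonneg (r * v.t t r), sq_nonneg (v.f t r)]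
    · nlinarith [sq_nonneg (v.f t r - r * v.r t r), sq_nonneg (v.r t r), sq_nonneg (v.t t r), sq_nonneg (r * v.t t r)]
  have l1 := tendsto_limUnder_of_hasDerivAt_of_integrableOn_Ioi (a := 0) (fun x _ => dd x) i1.integrableOn
  have l2 := tendsto_limUnder_of_hasDerivAt_of_integrableOn_Iic (a := 0) (fun x _ => dd x) i1.integrableOn
  have z1 := lim_zero (fun r _ => sq_nonneg _) i0 l1
  have z2 := lim_zero (f := fun r => v.f t (-r) ^ 2) (fun r _ => sq_nonneg _) i0.comp_neg (by
    have := (l2.comp tendsto_neg_atTop_atBot).neg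
    simpa [Function.comp_def] using this)
  rw [neg_eq_zero] at z2
  rw [z1] at l1; rw [z2] at l2
  have e0 := integral_of_hasDerivAt_of_tendsto dd i1 l2 l1
  rw [sub_zero] at e0
  have ee : ef (v.lift 0) t = fun r => enl v t r + (v.f t r ^ 2 + r * (2 * v.f t r * v.r t r)) / 2 := funext fun r => ef_lift v t r
  rw [ee]
  refine ⟨hi.add (i1.div_const 2), ?_⟩
  have : ∫ r, (enl v t r + (v.f t r ^ 2 + r * (2 * v.f t r * v.r t r)) / 2) = _ := integral_add hi (i1.div_const 2)
  rw [this, integral_div, e0]; simp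
end WMS

namespace WMS
variable {n : ℕ} {u : F2} {Q Q1 : ℝ → ℝ}

structure Sc (U : F2) (N Nt Nr : ℝ → ℝ → ℝ) (C E : ℝ) : Prop where
  hC : 0 < C
  eq : ∀ t r, U.tt t r = U.rr t r - V r * U.f t r + N t r
  hNt : ∀ t r, HasDerivAt (fun t => N t r) (Nt t r) t
  hNr : ∀ t r, HasDerivAt (N t) (Nr t r) r
  cNt : Continuous fun p : ℝ × ℝ => Nt p.1 p.2
  cNr : Continuous fun p : ℝ × ℝ => Nr p.1 p.2
  bU : ∀ t r, |U.f t r| ≤ C * √(q r)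
  bN : ∀ t r, |N t r| ≤ C * m r
  bNm : ∀ t r, |Nt t r - Nr t r| ≤ C * (|U.t t r - U.r t r| + 1) * m r
  bNp : ∀ t r, |Nt t r + Nr t r| ≤ C * (|U.t t r + U.r t r| + 1) * m r
  int : ∀ t, Integrable (ef U t)
  bE : ∀ t, ∫ r, ef U t r ≤ C
  tail : ∀ ε > 0, ∃ M0 > 0, ∀ M ≥ M0, ∀ T ≥ 0, ∫ r in {r | T + M ≤ |r|}, ef U T r ≤ ε
  conv : ∀ ε > 0, ∃ T0 ≥ 0, ∀ t ≥ T0, |(∫ r, ef U t r) - E| ≤ ε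
  small : ∀ ε > 0, ∃ T0 ≥ 0, ∀ t ≥ T0, (∫ r, U.f t r ^ 2 / (r ^ 2 + 1) ^ 2 ≤ ε) ∧
    ∀ L > 0, ∫ r in (-L)..L, |r * N t r * U.r t r| ≤ ε

noncomputable def NN (u : F2) (Q : ℝ → ℝ) (t r : ℝ) : ℝ :=
  -((sin (2 * u.f t r) - sin (2 * Q r) - 2 * (u.f t r - Q r)) / q r)
noncomputable def NNt (u : F2) (t r : ℝ) : ℝ :=
  -((2 * cos (2 * u.f t r) - 2) * u.t t r / q r)
noncomputable def NNr (u : F2) (Q Q1 : ℝ → ℝ) (t r : ℝ) : ℝ :=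
  -((2 * cos (2 * u.f t r) - 2) * (u.r t r - Q1 r) / q r) - 2 * (cos (2 * u.f t r) - cos (2 * Q r)) * Q1 r / q r
   + (sin (2 * u.f t r) - sin (2 * Q r) - 2 * (u.f t r - Q r)) * r / q r ^ 3

theorem NNt_d (u : F2) (Q : ℝ → ℝ) (t r : ℝ) : HasDerivAt (fun t => NN u Q t r) (NNt u t r) t := by
  have h1 : HasDerivAt (fun t => sin (2 * u.f t r)) _ t := ((u.ht t r).const_mul 2).sin
  refine ((((h1.fun_sub (hasDerivAt_const t (sin (2 * Q r)))).fun_sub (((u.ht t r).sub_const (Q r)).const_mul 2)).div_const (q r)).fun_neg).congr_deriv ?_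
  unfold NNt
  ring

theorem NNr_d (H : HM n Q Q1) (t r : ℝ) : HasDerivAt (NN u Q t) (NNr u Q Q1 t r) r := by
  have h1 : HasDerivAt (fun r => sin (2 * u.f t r)) _ r := ((u.hr t r).const_mul 2).sin
  have h2 : HasDerivAt (fun r => sin (2 * Q r)) _ r := ((H.d1 r).const_mul 2).sin
  refine ((((h1.fun_sub h2).fun_sub (((u.hr t r).fun_sub (H.d1 r)).const_mul 2)).fun_div (hasDerivAt_q r) (q_ne r)).fun_neg).congr_deriv ?_
  unfold NNr
  have := q_ne r
  field_simp
  ring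

theorem NN_abs (u : F2) (Q : ℝ → ℝ) (t r : ℝ) : |sin (2 * u.f t r) - sin (2 * Q r) - 2 * (u.f t r - Q r)| ≤ 4 * |u.f t r - Q r| := by
  have h1 : |sin (2 * u.f t r) - sin (2 * Q r)| ≤ |2 * u.f t r - 2 * Q r| := by
    simpa [Real.dist_eq] using Real.lipschitzWith_sin.dist_le_mul (2 * u.f t r) (2 * Q r)
  rw [← mul_sub, abs_mul, abs_two] at h1
  have h2 := abs_sub (sin (2 * u.f t r) - sin (2 * Q r)) (2 * (u.f t r - Q r))
  rw [abs_mul, abs_two] at h2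
  linarith

theorem H_abs (Q φ : ℝ) : |sin (2 * (Q + φ)) - sin (2 * Q) - 2 * φ| ≤ 2 * φ ^ 2 + 16 * |φ| ^ 3 + 4 * |φ| * sin Q ^ 2 := by
  have e : sin (2 * (Q + φ)) - sin (2 * Q) - 2 * φ = sin (2 * Q) * (cos (2 * φ) - 1) + cos (2 * Q) * (sin (2 * φ) - 2 * φ) + 2 * φ * (-2 * sin Q ^ 2) := by
    rw [show 2 * (Q + φ) = 2 * Q + 2 * φ by ring, Real.sin_add]
    have : cos (2 * Q) = 1 - 2 * sin Q ^ 2 := by rw [Real.cos_two_mul]; have := Real.sin_sq_add_cos_sq Q; linarith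
    have e2 : (-2 : ℝ) * sin Q ^ 2 = cos (2 * Q) - 1 := by linarith
    rw [e2]; ring
  rw [e]
  have b1 : |sin (2 * Q) * (cos (2 * φ) - 1)| ≤ 2 * φ ^ 2 := by
    rw [abs_mul]
    have := cos_sub_le (2 * φ)
    nlinarith [Real.abs_sin_le_one (2 * Q), abs_nonneg (sin (2 * Q)), abs_nonneg (cos (2 * φ) - 1)]
  have b2 : |cos (2 * Q) * (sin (2 * φ) - 2 * φ)| ≤ 16 * |φ| ^ 3 := by
    rw [abs_mul]
    have := sin_sub_le (2 * φ)
    rw [abs_mul, abs_two, mul_pow] at this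
    nlinarith [Real.abs_cos_le_one (2 * Q), abs_nonneg (cos (2 * Q)), abs_nonneg (sin (2 * φ) - 2 * φ)]
  have b3 : |2 * φ * (-2 * sin Q ^ 2)| = 4 * |φ| * sin Q ^ 2 := by
    rw [abs_mul, abs_mul, abs_mul, abs_of_nonneg (sq_nonneg (sin Q))]
    simp; ring
  have := abs_add_le (sin (2 * Q) * (cos (2 * φ) - 1) + cos (2 * Q) * (sin (2 * φ) - 2 * φ)) (2 * φ * (-2 * sin Q ^ 2))
  have := abs_add_le (sin (2 * Q) * (cos (2 * φ) - 1)) (cos (2 * Q) * (sin (2 * φ) - 2 * φ))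
  linarith

noncomputable def UU (u : F2) (H : HM n Q Q1) : F2 := (ph u H).lift 0
theorem UU_f (H : HM n Q Q1) (t r : ℝ) : (UU u H).f t r = q r * (u.f t r - Q r) := by
  unfold UU; rw [lift_f, ph_f, sub_zero]
theorem UU_t (H : HM n Q Q1) (t r : ℝ) : (UU u H).t t r = q r * u.t t r := by
  unfold UU; rw [lift_t, ph_t]
theorem UU_r (H : HM n Q Q1) (t r : ℝ) : (UU u H).r t r = r / q r * (u.f t r - Q r) + q r * (u.r t r - Q1 r) := by
  unfold UU; rw [lift_r, ph_f, sub_zero, ph_r]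

/-- pointwise control of the derivatives of the nonlinearity in a null direction -/
theorem NN_null (H : HM n Q Q1) {K C : ℝ} (hK : 0 ≤ K) (hC : 0 ≤ C) {s : ℝ} (hs : |s| = 1) (t r : ℝ) (h1 : |u.f t r - Q r| ≤ K / √(q r))
    (h2 : |Q1 r| ≤ C / (r ^ 2 + 1)) :
    |NNt u t r + s * NNr u Q Q1 t r| ≤ (4 + 8 * K + 4 * C) * (|(UU u H).t t r + s * (UU u H).r t r| + 1) * m r := by
  have hq := q_pos r; have hq1 := one_le_q r; have hq2 := q_sq r
  have hsq : 0 < √(q r) := Real.sqrt_pos.2 hq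
  have hm : m r = 1 / (q r * √(q r)) := rfl
  have mp := m_pos r
  have i2 := inv_q2_le_m r
  rw [← hq2] at i2
  have i3 := inv_q3_le_m r
  set φ := u.f t r - Q r with hφ
  set Hh := sin (2 * u.f t r) - sin (2 * Q r) - 2 * (u.f t r - Q r) with hH
  have hHb : |Hh| ≤ 4 * |φ| := NN_abs u Q t r
  set k := 2 * cos (2 * u.f t r) - 2 with hk
  have kb : |k| ≤ 4 := by
    have := Real.abs_cos_le_one (2 * u.f t r)
    rw [abs_le] at this ⊢; constructor <;> linarith
  have lb : |2 * (cos (2 * u.f t r) - cos (2 * Q r))| ≤ 4 := by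
    have a := Real.abs_cos_le_one (2 * u.f t r)
    have b := Real.abs_cos_le_one (2 * Q r)
    rw [abs_le] at a b ⊢; constructor <;> linarith
  set l := 2 * (cos (2 * u.f t r) - cos (2 * Q r)) with hl
  have e : NNt u t r + s * NNr u Q Q1 t r = -(k * ((UU u H).t t r + s * (UU u H).r t r) / q r ^ 2) + s * (k * φ * r / q r ^ 3) - s * (l * Q1 r / q r)
      + s * (Hh * r / q r ^ 3) := by
    rw [UU_t, UU_r]
    unfold NNt NNr
    rw [← hφ, ← hk, ← hl]
    field_simp
    ring
  rw [e]
  have phm : |φ| / q r ≤ K * m r := by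
    rw [hm, mul_one_div, div_le_div_iff₀ hq (by positivity)]
    rw [le_div_iff₀ hsq] at h1
    nlinarith
  have rq : |r| / q r ≤ 1 := by rw [div_le_one hq]; exact abs_le_q r
  have iq : 1 / q r ≤ 1 := by rw [div_le_one hq]; exact hq1
  have p3 : |φ| * |r| / q r ^ 3 ≤ K * m r := by
    have : |φ| * |r| / q r ^ 3 = |φ| / q r * (|r| / q r * (1 / q r)) := by field_simp
    rw [this]
    refine le_trans (mul_le_of_le_one_right (by positivity) ?_) phm
    exact mul_le_one₀ rq (by positivity) iq
  set A := (UU u H).t t r + s * (UU u H).r t r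
  have t1 : |-(k * A / q r ^ 2)| ≤ 4 * |A| * m r := by
    rw [abs_neg, abs_div, abs_mul, abs_of_pos (pow_pos hq 2), mul_div_assoc]
    have : |A| / q r ^ 2 ≤ |A| * m r := by
      rw [div_eq_mul_one_div]; exact mul_le_mul_of_nonneg_left i2 (abs_nonneg _)
    calc |k| * (|A| / q r ^ 2) ≤ 4 * (|A| * m r) := mul_le_mul kb this (by positivity) (by norm_num)
      _ = _ := by ring
  have t2 : |s * (k * φ * r / q r ^ 3)| ≤ 4 * K * m r := by
    rw [abs_mul, hs, one_mul, abs_div, abs_mul, abs_mul, abs_of_pos (pow_pos hq 3), mul_assoc, mul_div_assoc]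
    calc |k| * (|φ| * |r| / q r ^ 3) ≤ 4 * (K * m r) := mul_le_mul kb p3 (by positivity) (by norm_num)
      _ = _ := by ring
  have t3 : |s * (l * Q1 r / q r)| ≤ 4 * C * m r := by
    rw [abs_mul, hs, one_mul, abs_div, abs_mul, abs_of_pos hq, mul_div_assoc]
    have : |Q1 r| / q r ≤ C * m r := by
      calc |Q1 r| / q r ≤ (C / (r ^ 2 + 1)) / q r := div_le_div_of_nonneg_right h2 hq.le
        _ = C * (1 / q r ^ 3) := by rw [← hq2]; field_simp
        _ ≤ _ := mul_le_mul_of_nonneg_left i3 hC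
    calc |l| * (|Q1 r| / q r) ≤ 4 * (C * m r) := mul_le_mul lb this (by positivity) (by norm_num)
      _ = _ := by ring
  have t4 : |s * (Hh * r / q r ^ 3)| ≤ 4 * K * m r := by
    rw [abs_mul, hs, one_mul, abs_div, abs_mul, abs_of_pos (pow_pos hq 3)]
    calc |Hh| * |r| / q r ^ 3 ≤ (4 * |φ|) * |r| / q r ^ 3 := by gcongr
      _ = 4 * (|φ| * |r| / q r ^ 3) := by ring
      _ ≤ 4 * (K * m r) := by linarith
      _ = _ := by ring
  have s1 := abs_add_le (-(k * A / q r ^ 2) + s * (k * φ * r / q r ^ 3) - s * (l * Q1 r / q r)) (s * (Hh * r / q r ^ 3))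
  have s2 := abs_sub (-(k * A / q r ^ 2) + s * (k * φ * r / q r ^ 3)) (s * (l * Q1 r / q r))
  have s3 := abs_add_le (-(k * A / q r ^ 2)) (s * (k * φ * r / q r ^ 3))
  have z1 : 0 ≤ (8 * K + 4 * C) * |A| * m r := by positivity
  nlinarith
end WMS

namespace WMS
variable {n : ℕ} {u : F2} {Q Q1 : ℝ → ℝ}

theorem ph_pt (h : WM n u) (H : HM n Q Q1) : ∃ K > 0, ∀ t r, |u.f t r - Q r| ≤ K / √(q r) := by
  obtain ⟨K, hK, hb⟩ := ph_energy h H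
  refine ⟨√(2 * K), Real.sqrt_pos.2 (by positivity), fun t r => ?_⟩
  have h1 := enl_sob (ph_int h H t) r
  rw [ph_f] at h1
  have h2 := hb t
  have hq := q_pos r
  rw [le_div_iff₀ (Real.sqrt_pos.2 hq)]
  apply Real.le_sqrt_of_sq_le
  rw [mul_pow, sq_abs, Real.sq_sqrt hq.le]
  linarith

theorem small_aux (h : WM n u) (H : HM n Q Q1) {C : ℝ} (hC : 0 < C) (hd : ∀ r, sin (Q r) ^ 2 ≤ C / (r ^ 2 + 1))
    {c δ : ℝ} (hδ : 0 < δ) (hc1 : c ≤ 1) (t r : ℝ) (hc : |u.f t r - Q r| ≤ c) :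
    |r * NN u Q t r * (UU u H).r t r| ≤ 18 * c * ef (UU u H) t r + 4 * C * (1 / δ * ((ph u H).f t r ^ 2 / (r ^ 2 + 1)) + δ * ef (UU u H) t r) := by
  have hq := q_pos r; have hq2 := q_sq r; have hqn := q_ne r
  rw [ph_f]
  have hN : |r * NN u Q t r| ≤ |sin (2 * u.f t r) - sin (2 * Q r) - 2 * (u.f t r - Q r)| := by
    unfold NN
    rw [abs_mul, abs_neg, abs_div, abs_of_pos hq]
    have : |r| / q r ≤ 1 := by rw [div_le_one hq]; exact abs_le_q r
    calc _ = (|r| / q r) * |sin (2 * u.f t r) - sin (2 * Q r) - 2 * (u.f t r - Q r)| := by ring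
      _ ≤ _ := mul_le_of_le_one_left (abs_nonneg _) this
  have hH := H_abs (Q r) (u.f t r - Q r)
  rw [show Q r + (u.f t r - Q r) = u.f t r by ring] at hH
  set φ := u.f t r - Q r with hφ
  have hUf : (UU u H).f t r = q r * φ := UU_f H t r
  set y := (UU u H).r t r
  have c0 : 0 ≤ c := (abs_nonneg _).trans hc
  have hf2 : |φ| ^ 2 = φ ^ 2 := sq_abs φ
  -- ef lower bounds
  have E1 : φ ^ 2 + y ^ 2 / 2 ≤ ef (UU u H) t r := by
    unfold ef
    rw [hUf]
    have hv := V_lower r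
    have : 2 * φ ^ 2 ≤ V r * (q r * φ) ^ 2 := by
      rw [mul_pow, hq2]
      have := mul_le_mul_of_nonneg_right hv (show 0 ≤ (r ^ 2 + 1) * φ ^ 2 by positivity)
      have e : 2 / (r ^ 2 + 1) * ((r ^ 2 + 1) * φ ^ 2) = 2 * φ ^ 2 := by field_simp
      linarith
    have := sq_nonneg ((UU u H).t t r)
    linarith
  have hy := abs_nonneg y
  have hy2 : |y| ^ 2 = y ^ 2 := sq_abs y
  have a1 : |r * NN u Q t r * y| ≤ (2 * φ ^ 2 + 16 * |φ| ^ 3 + 4 * |φ| * sin (Q r) ^ 2) * |y| := by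
    rw [abs_mul]; exact mul_le_mul_of_nonneg_right (hN.trans hH) hy
  have a2 : |φ| ^ 3 ≤ φ ^ 2 := by
    rw [pow_succ, hf2]; exact mul_le_of_le_one_right (sq_nonneg _) (hc.trans hc1)
  have a3 : φ ^ 2 * |y| ≤ c * ef (UU u H) t r := by
    rw [← hf2]
    have : |φ| * |y| ≤ ef (UU u H) t r := by nlinarith [sq_nonneg (|φ| - |y|), sq_nonneg φ]
    calc |φ| ^ 2 * |y| = |φ| * (|φ| * |y|) := by ring
      _ ≤ _ := mul_le_mul hc this (by positivity) c0
  have a4 : |φ| * sin (Q r) ^ 2 * |y| ≤ C * (1 / δ * (φ ^ 2 / (r ^ 2 + 1)) + δ * ef (UU u H) t r) := by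
    have b1 : |φ| * sin (Q r) ^ 2 * |y| ≤ |φ| * (C / (r ^ 2 + 1)) * |y| := by
      gcongr; exact hd r
    have b2 : |φ| * (C / (r ^ 2 + 1)) * |y| = C * ((|φ| / (r ^ 2 + 1)) * |y|) := by ring
    refine b1.trans ?_
    rw [b2]
    refine mul_le_mul_of_nonneg_left ?_ hC.le
    have b3 : (|φ| / (r ^ 2 + 1)) ^ 2 ≤ φ ^ 2 / (r ^ 2 + 1) := by
      rw [div_pow, hf2, sq (r ^ 2 + 1), ← div_div]
      exact div_w_le (by positivity)
    set z := |φ| / (r ^ 2 + 1)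
    have b4 : z * |y| ≤ 1 / δ * z ^ 2 + δ * (y ^ 2 / 2) := by
      have : 0 ≤ 1 / δ * (z - δ * |y| / 2) ^ 2 := by positivity
      have e : 1 / δ * (z - δ * |y| / 2) ^ 2 = 1 / δ * z ^ 2 - z * |y| + δ * |y| ^ 2 / 4 := by field_simp; ring
      rw [e, hy2] at this
      have : 0 ≤ δ * y ^ 2 := by positivity
      linarith
    have b5 : 1 / δ * z ^ 2 ≤ 1 / δ * (φ ^ 2 / (r ^ 2 + 1)) := mul_le_mul_of_nonneg_left b3 (by positivity)
    have b6 : δ * (y ^ 2 / 2) ≤ δ * ef (UU u H) t r := mul_le_mul_of_nonneg_left (by nlinarith [sq_nonneg φ]) hδ.le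
    linarith
  have a5 : (2 * φ ^ 2 + 16 * |φ| ^ 3 + 4 * |φ| * sin (Q r) ^ 2) * |y| ≤ 18 * (φ ^ 2 * |y|) + 4 * (|φ| * sin (Q r) ^ 2 * |y|) := by
    nlinarith [mul_le_mul_of_nonneg_right a2 hy]
  linarith

theorem WM.sc (h : WM n u) (H : HM n Q Q1) : ∃ C E, Sc (UU u H) (NN u Q) (NNt u) (NNr u Q Q1) C E := by
  obtain ⟨K, hK, hb⟩ := ph_pt h H
  obtain ⟨K2, hK2, hE⟩ := ph_energy h H
  obtain ⟨C, hC, hd⟩ := H.decay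
  have cQ := H.c0; have cQ1 := H.c1
  have cf := u.cf; have ct := u.ct; have cr := u.cr
  set D := 4 + 8 * K + 4 * C + K2 with hD
  have fi := fun t => flat_int (ph_int h H t)
  have hqn : ∀ p : ℝ × ℝ, q p.2 ≠ 0 := fun p => q_ne _
  refine ⟨D, Eng u - Eng H.st, ⟨by positivity, ?_, NNt_d u Q, NNr_d H, ?_, ?_, ?_, ?_, ?_, ?_, fun t => (fi t).1, ?_, ?_, ?_, ?_⟩⟩
  · intro t r
    have := lift_eq (ph_eq h H) 0 t r
    unfold UU
    rw [this, V_q, lift_f, ph_f, sub_zero]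
    unfold NN
    have := q_ne r
    field_simp
    ring
  · unfold NNt
    exact (Continuous.div (by fun_prop) (by fun_prop) hqn).neg
  · unfold NNr
    refine (((Continuous.div (by fun_prop) (by fun_prop) hqn).neg).sub (Continuous.div (by fun_prop) (by fun_prop) hqn)).add (Continuous.div (by fun_prop) (by fun_prop) fun p => pow_ne_zero 3 (hqn p))
  · intro t r
    rw [UU_f, abs_mul, abs_of_pos (q_pos r)]
    have := hb t r
    have hs : 0 < √(q r) := Real.sqrt_pos.2 (q_pos r)
    have e : q r = √(q r) * √(q r) := (Real.mul_self_sqrt (q_pos r).le).symm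
    calc q r * |u.f t r - Q r| ≤ q r * (K / √(q r)) := mul_le_mul_of_nonneg_left this (q_pos r).le
      _ = K * √(q r) := by nth_rw 1 [e]; field_simp
      _ ≤ D * √(q r) := mul_le_mul_of_nonneg_right (by linarith) hs.le
  · intro t r
    unfold NN
    rw [abs_neg, abs_div, abs_of_pos (q_pos r)]
    have hs : 0 < √(q r) := Real.sqrt_pos.2 (q_pos r)
    calc _ ≤ 4 * (K / √(q r)) / q r := div_le_div_of_nonneg_right ((NN_abs u Q t r).trans (by linarith [hb t r])) (q_pos r).le
      _ = 4 * K * m r := by unfold m; field_simp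
      _ ≤ D * m r := mul_le_mul_of_nonneg_right (by linarith) (m_pos r).le
  · intro t r
    have := NN_null H hK.le hC.le (s := -1) (by simp) t r (hb t r) (hd r).1
    simp only [neg_one_mul, ← sub_eq_add_neg] at this
    refine this.trans ?_
    have := m_pos r
    gcongr; linarith
  · intro t r
    have := NN_null H hK.le hC.le (s := 1) (by simp) t r (hb t r) (hd r).1
    simp only [one_mul] at this
    refine this.trans ?_
    have := m_pos r
    gcongr; linarith
  · intro t
    have := (fi t).2
    unfold UU
    rw [this]
    linarith [hE t]
  · intro ε hε
    obtain ⟨M0, hM0, h0⟩ := ph_tail h H (half_pos hε)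
    refine ⟨M0, hM0, fun M hM T hT => ?_⟩
    have := h0 M hM T hT
    refine (setIntegral_mono (fi T).1.integrableOn ((ph_int h H T).const_mul 2).integrableOn (ef_lift_le _ T)).trans ?_
    rw [integral_const_mul]; linarith
  · intro ε hε
    obtain ⟨T0, hT0, h0⟩ := ph_conv h H hε
    refine ⟨T0, hT0, fun t ht => ?_⟩
    have := h0 t ht
    rwa [← (fi t).2] at this
  · intro ε hε
    set δ := ε / (16 * C * K2) with hδ
    have δ0 : 0 < δ := by positivity
    set c := min (min 1 ε) (min (ε / (54 * K2)) (ε * δ / (12 * C))) with hc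
    have c0 : 0 < c := by positivity
    have c1 : c ≤ 1 := (min_le_left _ _).trans (min_le_left _ _)
    have c2 : c ≤ ε := (min_le_left _ _).trans (min_le_right _ _)
    have c3 : c ≤ ε / (54 * K2) := (min_le_right _ _).trans (min_le_left _ _)
    have c4 : c ≤ ε * δ / (12 * C) := (min_le_right _ _).trans (min_le_right _ _)
    obtain ⟨T0, hT0, hs⟩ := ph_sup h H c0
    refine ⟨T0, hT0, fun t ht => ?_⟩
    obtain ⟨s1, s2⟩ := hs t ht
    constructor
    · have e : ∀ r, (UU u H).f t r ^ 2 / (r ^ 2 + 1) ^ 2 = (ph u H).f t r ^ 2 / (r ^ 2 + 1) := by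
        intro r
        rw [UU_f, mul_pow, q_sq, ph_f]; field_simp
      simp_rw [e]; linarith
    · intro L hL
      have cf := (ph u H).cf1 t
      have cw : Continuous fun r => (ph u H).f t r ^ 2 / (r ^ 2 + 1) := Continuous.div (by fun_prop) (by fun_prop) fun r => by positivity
      have i0 : Integrable fun r => (ph u H).f t r ^ 2 / (r ^ 2 + 1) :=
        integrable_of_le (ph_int h H t) cw fun r => by
          rw [abs_of_nonneg (by positivity)]; exact (div_w_le (sq_nonneg _)).trans (enl_parts _ t r).1
      have ie := (fi t).1
      have i1 := (ie.const_mul (18 * c)).add (((i0.const_mul (1 / δ)).add (ie.const_mul δ)).const_mul (4 * C))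
      have hp := fun r => small_aux h H hC (fun r => (hd r).2) δ0 c1 t r (s1 r)
      have cN : Continuous (NN u Q t) := continuous_iff_continuousAt.2 fun r => (NNr_d H t r).continuousAt
      have cU := (UU u H).cr1 t
      calc _ ≤ ∫ r in (-L)..L, (18 * c * ef (UU u H) t r + 4 * C * (1 / δ * ((ph u H).f t r ^ 2 / (r ^ 2 + 1)) + δ * ef (UU u H) t r)) := by
            apply intervalIntegral.integral_mono (by linarith) (Continuous.intervalIntegrable (by fun_prop) _ _) i1.intervalIntegrable hp
        _ ≤ ∫ r, (18 * c * ef (UU u H) t r + 4 * C * (1 / δ * ((ph u H).f t r ^ 2 / (r ^ 2 + 1)) + δ * ef (UU u H) t r)) :=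
            interval_le_integral i1 (fun r => (abs_nonneg _).trans (hp r)) (by linarith)
        _ = 18 * c * (∫ r, ef (UU u H) t r) + 4 * C * (1 / δ * (∫ r, (ph u H).f t r ^ 2 / (r ^ 2 + 1)) + δ * ∫ r, ef (UU u H) t r) := by
            have k1 : ∫ r, (18 * c * ef (UU u H) t r + 4 * C * (1 / δ * ((ph u H).f t r ^ 2 / (r ^ 2 + 1)) + δ * ef (UU u H) t r)) = _ :=
              integral_add (ie.const_mul (18 * c)) (((i0.const_mul (1 / δ)).add (ie.const_mul δ)).const_mul (4 * C))
            have k2 : ∫ r, (1 / δ * ((ph u H).f t r ^ 2 / (r ^ 2 + 1)) + δ * ef (UU u H) t r) = _ := integral_add (i0.const_mul (1 / δ)) (ie.const_mul δ)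
            rw [k1]
            rw [integral_const_mul, integral_const_mul, k2, integral_const_mul, integral_const_mul]
        _ ≤ 18 * c * K2 + 4 * C * (1 / δ * c + δ * K2) := by
            have k3 : ∫ r, ef (UU u H) t r ≤ K2 := by
              have := (fi t).2
              unfold UU
              rw [this]; exact hE t
            gcongr
        _ ≤ ε := by
            have k1 : 18 * c * K2 ≤ ε / 3 := by
              rw [le_div_iff₀ (by positivity)] at c3; linarith
            have k2 : 4 * C * (1 / δ * c) ≤ ε / 3 := by
              rw [le_div_iff₀ (by positivity)] at c4
              rw [show 4 * C * (1 / δ * c) = (4 * C * c) / δ by ring, div_le_iff₀ δ0]; linarith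
            have k3 : 4 * C * (δ * K2) = ε / 4 := by rw [hδ]; field_simp; ring
            linarith
end WMS

namespace WMS
variable {U : F2} {N Nt Nr : ℝ → ℝ → ℝ} {C E : ℝ}

theorem Sc.cN (S : Sc U N Nt Nr C E) : Continuous fun p : ℝ × ℝ => N p.1 p.2 :=
  cont_of_partials S.hNt S.hNr S.cNt S.cNr
theorem Sc.cN1 (S : Sc U N Nt Nr C E) (t : ℝ) : Continuous (N t) :=
  S.cN.comp (Continuous.prodMk_right t)

noncomputable def vA (L r : ℝ) : ℝ := r * (1 - r ^ 2 / L ^ 2) ^ 2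
noncomputable def vA1 (L r : ℝ) : ℝ := (1 - r ^ 2 / L ^ 2) * (1 - 5 * (r ^ 2 / L ^ 2))

theorem hasDerivAt_vA (L r : ℝ) : HasDerivAt (vA L) (vA1 L r) r := by
  have h := (hasDerivAt_id r).fun_mul ((((hasDerivAt_pow 2 r).div_const (L ^ 2)).const_sub 1).fun_pow 2)
  refine h.congr_deriv ?_
  unfold vA1
  simp
  ring

@[fun_prop] theorem continuous_vA (L : ℝ) : Continuous (vA L) := by unfold vA; fun_prop
@[fun_prop] theorem continuous_vA1 (L : ℝ) : Continuous (vA1 L) := by unfold vA1; fun_prop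

theorem vA_end {L : ℝ} (hL : 0 < L) : vA L L = 0 ∧ vA L (-L) = 0 := by
  unfold vA; constructor <;> field_simp <;> ring

theorem sq_div_le {L r : ℝ} (hL : 0 < L) (h : |r| ≤ L) : r ^ 2 / L ^ 2 ≤ 1 := by
  rw [div_le_one (by positivity)]
  exact sq_le_sq' (by linarith [neg_abs_le r]) (by linarith [le_abs_self r])

theorem vA_abs {L r : ℝ} (hL : 0 < L) (h : |r| ≤ L) : |vA L r| ≤ |r| := by
  have h1 := sq_div_le hL h
  have h0 : 0 ≤ r ^ 2 / L ^ 2 := by positivity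
  unfold vA
  have hs := abs_of_nonneg (sq_nonneg (1 - r ^ 2 / L ^ 2))
  rw [abs_mul, hs]
  have : (1 - r ^ 2 / L ^ 2) ^ 2 ≤ 1 := by nlinarith
  nlinarith [abs_nonneg r]

noncomputable def vX (U : F2) (L t : ℝ) : ℝ := ∫ r in (-L)..L, vA L r * (U.t t r * U.r t r)

theorem vX_pt (S : Sc U N Nt Nr C E) {L : ℝ} (hL : 0 < L) (t : ℝ) {r : ℝ} (hr : |r| ≤ L) :
    -(vA1 L r * (U.t t r ^ 2 + U.r t r ^ 2) / 2) + (vA1 L r * V r + vA L r * V1 r) * U.f t r ^ 2 / 2 + vA L r * N t r * U.r t r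
     ≤ -ef U t r + 6 * (r ^ 2 / L ^ 2 * ef U t r) + 3 * (U.f t r ^ 2 / (r ^ 2 + 1) ^ 2) + |r * N t r * U.r t r| := by
  have h1 := sq_div_le hL hr
  have h0 : 0 ≤ r ^ 2 / L ^ 2 := by positivity
  have hA := vA_abs hL hr
  have a1 : vA L r * N t r * U.r t r ≤ |r * N t r * U.r t r| := by
    refine (le_abs_self _).trans ?_
    rw [abs_mul, abs_mul, abs_mul, abs_mul]
    gcongr
  have hw : 0 < r ^ 2 + 1 := by positivity
  have eV : r * V1 r = -(2 * V r) + 2 / (r ^ 2 + 1) ^ 2 + 4 / (r ^ 2 + 1) ^ 3 := by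
    unfold V V1; field_simp; ring
  have eA : vA L r * V1 r = (1 - r ^ 2 / L ^ 2) ^ 2 * (r * V1 r) := by unfold vA; ring
  have b3 : 4 / (r ^ 2 + 1) ^ 3 ≤ 4 * (1 / (r ^ 2 + 1) ^ 2) := by
    rw [show (4:ℝ) / (r ^ 2 + 1) ^ 3 = 4 * (1 / (r ^ 2 + 1) ^ 2) * (1 / (r ^ 2 + 1)) by field_simp]
    exact mul_le_of_le_one_right (by positivity) (inv_w_le_one r)
  have p3 : 0 < 1 / (r ^ 2 + 1) ^ 2 := by positivity
  have e2 : 2 / (r ^ 2 + 1) ^ 2 = 2 * (1 / (r ^ 2 + 1) ^ 2) := by ring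
  have e3 : U.f t r ^ 2 / (r ^ 2 + 1) ^ 2 = U.f t r ^ 2 * (1 / (r ^ 2 + 1) ^ 2) := by ring
  rw [eA, eV, e3]
  unfold vA1 ef
  have hV := V_pos r
  set x := r ^ 2 / L ^ 2
  set z := 1 / (r ^ 2 + 1) ^ 2
  set y := 4 / (r ^ 2 + 1) ^ 3
  have k2 : (1 - x) ^ 2 ≤ 1 := by nlinarith
  have c1 : (1 - x) * (1 - 5 * x) * V r + (1 - x) ^ 2 * (-(2 * V r) + 2 / (r ^ 2 + 1) ^ 2 + y) ≤ - V r + 2 * x * V r + 6 * z := by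
    have : (1 - x) ^ 2 * (2 / (r ^ 2 + 1) ^ 2 + y) ≤ 6 * z := by
      rw [e2]
      have y0 : 0 < y := by positivity
      nlinarith
    have h3 : (1 - x) * (1 - 5 * x) * V r - (1 - x) ^ 2 * (2 * V r) ≤ - V r + 2 * x * V r := by
      have : 0 ≤ V r * x := by positivity
      have : 0 ≤ V r * x * (1 - x) := mul_nonneg this (by linarith)
      nlinarith
    linarith
  have c2 : 1 - 6 * x ≤ (1 - x) * (1 - 5 * x) := by nlinarith
  have u0 := sq_nonneg (U.f t r)
  have k0 : 0 ≤ U.t t r ^ 2 + U.r t r ^ 2 := by positivity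
  have d1 := mul_le_mul_of_nonneg_right c1 u0
  have d2 := mul_le_mul_of_nonneg_right c2 k0
  have d3 : 0 ≤ x * (V r * U.f t r ^ 2) := by positivity
  nlinarith

theorem vX_deriv (S : Sc U N Nt Nr C E) {L : ℝ} (hL : 0 < L) (t : ℝ) :
    ∃ D, HasDerivAt (vX U L) D t ∧ D ≤ ∫ r in (-L)..L, (-ef U t r + 6 * (r ^ 2 / L ^ 2 * ef U t r) + 3 * (U.f t r ^ 2 / (r ^ 2 + 1) ^ 2) + |r * N t r * U.r t r|) := by
  have ct := U.ct; have cr := U.cr; have ctt := U.ctt; have ctr := U.ctr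
  have ct1 := U.ct1 t; have cr1 := U.cr1 t; have cf1 := U.cf1 t
  have cN := S.cN1 t
  have ctr1 : Continuous (U.tr t) := U.ctr.comp (Continuous.prodMk_right t)
  have crr1 : Continuous (U.rr t) := U.crr.comp (Continuous.prodMk_right t)
  have ce := ef_cont' U t
  refine ⟨_, leibniz (f := fun t r => vA L r * (U.t t r * U.r t r)) (ft := fun t r => vA L r * (U.tt t r * U.r t r + U.t t r * U.tr t r)) (-L) L
    (fun t r => ((U.htt t r).fun_mul (U.hrt t r)).const_mul _) (fun t => ?_) (by fun_prop) t, ?_⟩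
  · have := U.ct1 t; have := U.cr1 t; fun_prop
  have hd : ∀ r, HasDerivAt (fun r => vA L r * (U.t t r ^ 2 + U.r t r ^ 2) / 2 - vA L r * V r * U.f t r ^ 2 / 2)
     (vA1 L r * (U.t t r ^ 2 + U.r t r ^ 2) / 2 + vA L r * (U.t t r * U.tr t r + U.r t r * U.rr t r)
       - (vA1 L r * V r + vA L r * V1 r) * U.f t r ^ 2 / 2 - vA L r * V r * (U.f t r * U.r t r)) r := by
    intro r
    have h1 : HasDerivAt (U.t t) (U.tr t r) r := U.htr t r
    have h2 : HasDerivAt (U.r t) (U.rr t r) r := U.hrr t r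
    have h3 : HasDerivAt (U.f t) (U.r t r) r := U.hr t r
    refine ((((hasDerivAt_vA L r).fun_mul ((h1.fun_pow 2).fun_add (h2.fun_pow 2))).div_const 2).fun_sub
      ((((hasDerivAt_vA L r).fun_mul (hasDerivAt_V r)).fun_mul (h3.fun_pow 2)).div_const 2)).congr_deriv ?_
    push_cast; ring
  have cD : Continuous fun r => (vA1 L r * (U.t t r ^ 2 + U.r t r ^ 2) / 2 + vA L r * (U.t t r * U.tr t r + U.r t r * U.rr t r)
       - (vA1 L r * V r + vA L r * V1 r) * U.f t r ^ 2 / 2 - vA L r * V r * (U.f t r * U.r t r)) := by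
    have := continuous_V1; fun_prop
  have ft := intervalIntegral.integral_eq_sub_of_hasDerivAt (a := -L) (b := L) (fun r _ => hd r) (cD.intervalIntegrable _ _)
  rw [(vA_end hL).1, (vA_end hL).2] at ft
  have e : ∀ r, vA L r * (U.tt t r * U.r t r + U.t t r * U.tr t r) =
      (vA1 L r * (U.t t r ^ 2 + U.r t r ^ 2) / 2 + vA L r * (U.t t r * U.tr t r + U.r t r * U.rr t r)
       - (vA1 L r * V r + vA L r * V1 r) * U.f t r ^ 2 / 2 - vA L r * V r * (U.f t r * U.r t r)) +
      (-(vA1 L r * (U.t t r ^ 2 + U.r t r ^ 2) / 2) + (vA1 L r * V r + vA L r * V1 r) * U.f t r ^ 2 / 2 + vA L r * N t r * U.r t r) := by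
    intro r; rw [S.eq]; ring
  simp only [e]
  have cD2 : Continuous fun r => (-(vA1 L r * (U.t t r ^ 2 + U.r t r ^ 2) / 2) + (vA1 L r * V r + vA L r * V1 r) * U.f t r ^ 2 / 2 + vA L r * N t r * U.r t r) := by
    have := continuous_V1; fun_prop
  rw [intervalIntegral.integral_add (cD.intervalIntegrable _ _) (cD2.intervalIntegrable _ _), ft]
  simp only [zero_mul, zero_div, sub_zero, zero_add]
  refine intervalIntegral.integral_mono_on (by linarith) (cD2.intervalIntegrable _ _) (Continuous.intervalIntegrable ?_ _ _) fun r hr => vX_pt S hL t (abs_le.2 hr)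
  have : Continuous fun r => U.f t r ^ 2 / (r ^ 2 + 1) ^ 2 := cf1.pow 2 |>.div (by fun_prop) fun r => by positivity
  fun_prop

/-- splitting off the tail -/
theorem ind_integral {f : ℝ → ℝ} (hf : Integrable f) (R : ℝ) :
    Integrable (fun r => if R ≤ |r| then f r else 0) ∧ ∫ r, (if R ≤ |r| then f r else 0) = ∫ r in {r | R ≤ |r|}, f r := by
  have e : (fun r => if R ≤ |r| then f r else 0) = Set.indicator {r | R ≤ |r|} f := by
    ext r; simp [Set.indicator_apply]
  rw [e]
  exact ⟨hf.indicator (meas_tail R), integral_indicator (meas_tail R)⟩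

theorem Sc.tail_le (S : Sc U N Nt Nr C E) {T R ε : ℝ} (t : ℝ) (h : ∫ r in {r | T ≤ |r|}, ef U t r ≤ ε) (hTR : T ≤ R) :
    ∫ r in {r | R ≤ |r|}, ef U t r ≤ ε := by
  refine (setIntegral_mono_set (S.int t).integrableOn (Eventually.of_forall fun r => ef_nonneg _ _ _) (Eventually.of_forall fun r hr => ?_)).trans h
  exact hTR.trans hr

theorem int_split {f : ℝ → ℝ} (hf : Integrable f) {L : ℝ} (hL : 0 < L) (h0 : ∀ r, 0 ≤ f r) :
    ∫ r, f r ≤ (∫ r in (-L)..L, f r) + ∫ r in {r | L ≤ |r|}, f r := by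
  rw [intervalIntegral.integral_of_le (by linarith), ← integral_indicator measurableSet_Ioc, ← integral_indicator (meas_tail L),
    ← integral_add (hf.indicator measurableSet_Ioc) (hf.indicator (meas_tail L))]
  refine integral_mono hf ((hf.indicator measurableSet_Ioc).add (hf.indicator (meas_tail L))) fun r => ?_
  simp only [Set.indicator_apply, Set.mem_Ioc, Set.mem_ofPred_eq]
  have := h0 r
  by_cases h : L ≤ |r|
  · rw [if_pos h]; split_ifs <;> linarith
  · rw [if_neg h, if_pos ⟨(abs_lt.1 (not_le.1 h)).1, (abs_lt.1 (not_le.1 h)).2.le⟩]; linarith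

/-- weighted integral bound: `∫_{-L}^L g ef ≤ a ∫ ef + b ∫_{tail} ef`. -/
theorem Sc.wt (S : Sc U N Nt Nr C E) (t : ℝ) {g : ℝ → ℝ} (cg : Continuous g) {L R a b ε : ℝ} (hL : 0 < L) (ha : 0 ≤ a) (hb : 0 ≤ b)
    (h1 : ∀ r, |r| ≤ L → |r| ≤ R → g r ≤ a) (h2 : ∀ r, |r| ≤ L → g r ≤ b) (h : ∫ r in {r | R ≤ |r|}, ef U t r ≤ ε) :
    ∫ r in (-L)..L, g r * ef U t r ≤ a * C + b * ε := by
  have hi := S.int t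
  have k := ind_integral hi R
  have i2 : Integrable fun r => a * ef U t r + b * (if R ≤ |r| then ef U t r else 0) := (hi.const_mul a).add (k.1.const_mul b)
  have ce := ef_cont' U t
  calc _ ≤ ∫ r in (-L)..L, (a * ef U t r + b * (if R ≤ |r| then ef U t r else 0)) := by
        refine intervalIntegral.integral_mono_on (by linarith) (Continuous.intervalIntegrable (by fun_prop) _ _) i2.intervalIntegrable fun r hr => ?_
        have e0 := ef_nonneg U t r
        have hr' := abs_le.2 hr
        by_cases hc : R ≤ |r|
        · rw [if_pos hc]; nlinarith [h2 r hr']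
        · rw [if_neg hc]; nlinarith [h1 r hr' (not_le.1 hc).le]
    _ ≤ ∫ r, (a * ef U t r + b * (if R ≤ |r| then ef U t r else 0)) := by
        refine interval_le_integral i2 (fun r => ?_) (by linarith)
        have e0 := ef_nonneg U t r
        split_ifs <;> positivity
    _ = a * (∫ r, ef U t r) + b * ∫ r in {r | R ≤ |r|}, ef U t r := by
        have e := integral_add (hi.const_mul a) (k.1.const_mul b)
        rw [integral_const_mul, integral_const_mul, k.2] at e
        exact e
    _ ≤ _ := by gcongr; exact S.bE t
end WMS

namespace WMS
variable {U : F2} {N Nt Nr : ℝ → ℝ → ℝ} {C E : ℝ}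

noncomputable def bad (l : ℝ) (U : F2) (T r : ℝ) : ℝ :=
  V r * U.f T r ^ 2 + if |r| < l * T ∨ 2 * T ≤ |r| then ef U T r else if 0 < r then (U.t T r + U.r T r) ^ 2 else (U.t T r - U.r T r) ^ 2

theorem bad_nonneg (l : ℝ) (U : F2) (T r : ℝ) : 0 ≤ bad l U T r := by
  unfold bad
  have := ef_nonneg U T r
  have := V_pos r
  split_ifs <;> positivity

theorem bad_le (l : ℝ) (U : F2) (T r : ℝ) : bad l U T r ≤ 6 * ef U T r := by
  unfold bad
  have h0 := ef_nonneg U T r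
  have h1 : V r * U.f T r ^ 2 ≤ 2 * ef U T r := by unfold ef; nlinarith [sq_nonneg (U.t T r), sq_nonneg (U.r T r)]
  have h2 : U.t T r ^ 2 + U.r T r ^ 2 ≤ 2 * ef U T r := by
    unfold ef; have := V_pos r; have : 0 ≤ V r * U.f T r ^ 2 := by positivity
    linarith
  split_ifs <;> nlinarith [sq_nonneg (U.t T r - U.r T r), sq_nonneg (U.t T r + U.r T r)]

theorem bad_meas (l : ℝ) (U : F2) (T : ℝ) : Measurable (bad l U T) := by
  unfold bad
  have h1 := (U.cf1 T).measurable; have h2 := (U.ct1 T).measurable; have h3 := (U.cr1 T).measurable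
  have h4 := (ef_cont' U T).measurable
  have h5 := continuous_V.measurable
  refine (h5.mul (h1.pow_const 2)).add (Measurable.ite ?_ h4 (Measurable.ite measurableSet_Ioi ((h2.add h3).pow_const 2) ((h2.sub h3).pow_const 2)))
  exact (isOpen_lt continuous_abs continuous_const).measurableSet.union (isClosed_le continuous_const continuous_abs).measurableSet

theorem bad_int (S : Sc U N Nt Nr C E) (l T : ℝ) : Integrable (bad l U T) := by
  refine ((S.int T).const_mul 6).mono' (bad_meas l U T).aestronglyMeasurable (Eventually.of_forall fun r => ?_)
  rw [Real.norm_eq_abs, abs_of_nonneg (bad_nonneg _ _ _ _)]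
  exact bad_le _ _ _ _

theorem bad_pt (U : F2) {l T M K c : ℝ} (l1 : l < 1) (hT : 0 < T) (hM : 0 ≤ M) (hMT : M ≤ T) (hK : 4 ≤ K)
    (c0 : 0 < c) (c1 : c ≤ (1 - l) / 3) (c2 : c ≤ l / 4) (r : ℝ) :
    c * T * bad l U T r ≤ T * ef U T r + (if |r| ≤ K * T then vA (K * T) r * (U.t T r * U.r T r) else 0) + M * ef U T r
      + (K * T + 3 * T) * (if T + M ≤ |r| then ef U T r else 0) := by
  have l0 : 0 < l := by linarith
  have hL : 0 < K * T := by positivity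
  have hKT : 4 * T ≤ K * T := by gcongr
  have e0 := ef_nonneg U T r
  have hV : 0 ≤ V r * U.f T r ^ 2 := by have := V_pos r; positivity
  have h1 : V r * U.f T r ^ 2 ≤ 2 * ef U T r := by unfold ef; nlinarith [sq_nonneg (U.t T r), sq_nonneg (U.r T r)]
  have h2 : |U.t T r * U.r T r| ≤ (U.t T r ^ 2 + U.r T r ^ 2) / 2 := by
    rw [abs_le]; constructor <;> nlinarith [sq_nonneg (U.t T r - U.r T r), sq_nonneg (U.t T r + U.r T r)]
  have ee : ef U T r = (U.t T r ^ 2 + U.r T r ^ 2) / 2 + V r * U.f T r ^ 2 / 2 := by unfold ef; ring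
  have hA : ∀ h : |r| ≤ K * T, |vA (K * T) r * (U.t T r * U.r T r)| ≤ |r| * ((U.t T r ^ 2 + U.r T r ^ 2) / 2) := fun h => by
    rw [abs_mul]; exact mul_le_mul (vA_abs hL h) h2 (abs_nonneg _) (abs_nonneg _)
  set k := (U.t T r ^ 2 + U.r T r ^ 2) / 2 with hk
  have k0 : 0 ≤ k := by positivity
  have ke : k ≤ ef U T r := by linarith
  by_cases ha : 2 * T ≤ |r|
  · unfold bad
    rw [if_pos (Or.inr ha), if_pos (by linarith : T + M ≤ |r|)]
    have b1 : c * T * (V r * U.f T r ^ 2 + ef U T r) ≤ T * (3 * ef U T r) := by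
      have : c * T ≤ T := by nlinarith
      calc _ ≤ T * (V r * U.f T r ^ 2 + ef U T r) := by gcongr
        _ ≤ _ := by gcongr; linarith
    have b2 : -(K * T * ef U T r) ≤ (if |r| ≤ K * T then vA (K * T) r * (U.t T r * U.r T r) else 0) := by
      have p : 0 ≤ K * T * ef U T r := by positivity
      split_ifs with h
      · have := (abs_le.1 (hA h)).1
        have : |r| * k ≤ K * T * ef U T r := by gcongr
        linarith
      · linarith
    have : 0 ≤ M * ef U T r := by positivity
    have : 0 ≤ T * ef U T r := by positivity
    nlinarith
  push Not at ha
  have hrL : |r| ≤ K * T := by linarith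
  rw [if_pos hrL]
  have p4 : 0 ≤ (K * T + 3 * T) * (if T + M ≤ |r| then ef U T r else 0) := by split_ifs <;> positivity
  have pM : 0 ≤ M * ef U T r := by positivity
  by_cases hb : |r| < l * T
  · unfold bad
    rw [if_pos (Or.inl hb)]
    have := (abs_le.1 (hA hrL)).1
    have q1 : |r| * k ≤ l * T * ef U T r := by gcongr
    have q2 : c * T * (V r * U.f T r ^ 2 + ef U T r) ≤ (1 - l) / 3 * T * (3 * ef U T r) := by
      gcongr
      linarith
    linarith
  push Not at hb
  unfold bad
  rw [if_neg (by push Not; exact ⟨hb, ha⟩)]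
  -- shell
  have x1 : r ^ 2 / (K * T) ^ 2 ≤ 1 / 4 := by
    rw [div_le_iff₀ (by positivity)]
    have : |r| ^ 2 ≤ (2 * T) ^ 2 := by gcongr
    rw [sq_abs] at this
    nlinarith
  have x0 : 0 ≤ r ^ 2 / (K * T) ^ 2 := by positivity
  have eA : |vA (K * T) r| = |r| * (1 - r ^ 2 / (K * T) ^ 2) ^ 2 := by
    have hs := abs_of_nonneg (sq_nonneg (1 - r ^ 2 / (K * T) ^ 2))
    unfold vA; rw [abs_mul, hs]
  have A1 : l * T / 2 ≤ |vA (K * T) r| := by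
    rw [eA]
    have : 9 / 16 ≤ (1 - r ^ 2 / (K * T) ^ 2) ^ 2 := by nlinarith
    have lT : 0 < l * T := by positivity
    nlinarith
  have A2 := vA_abs hL hrL
  set B := (if 0 < r then (U.t T r + U.r T r) ^ 2 else (U.t T r - U.r T r) ^ 2) with hB
  have B0 : 0 ≤ B := by rw [hB]; split_ifs <;> positivity
  have eX : vA (K * T) r * (U.t T r * U.r T r) = |vA (K * T) r| * (B / 2 - k) := by
    by_cases h : 0 < r
    · have : 0 ≤ vA (K * T) r := by unfold vA; positivity
      rw [abs_of_nonneg this, hB, if_pos h, hk]; ring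
    · have : vA (K * T) r ≤ 0 := by unfold vA; exact mul_nonpos_of_nonpos_of_nonneg (not_lt.1 h) (sq_nonneg _)
      rw [abs_of_nonpos this, hB, if_neg h, hk]; ring
  rw [eX]
  have s1 : c * T * B ≤ |vA (K * T) r| * (B / 2) := by
    have h1 : c * T ≤ l / 4 * T := by gcongr
    have h2 : c * T ≤ |vA (K * T) r| / 2 := by linarith
    calc c * T * B ≤ |vA (K * T) r| / 2 * B := by gcongr
      _ = _ := by ring
  have s2 : c * T * (V r * U.f T r ^ 2) ≤ T * (V r * U.f T r ^ 2 / 2) := by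
    have h2 : c * T ≤ T / 2 := by nlinarith
    calc c * T * (V r * U.f T r ^ 2) ≤ T / 2 * (V r * U.f T r ^ 2) := by gcongr
      _ = _ := by ring
  have s3 : |vA (K * T) r| * k ≤ T * k + M * ef U T r + (K * T + 3 * T) * (if T + M ≤ |r| then ef U T r else 0) := by
    by_cases h : T + M ≤ |r|
    · rw [if_pos h]
      have : |vA (K * T) r| * k ≤ K * T * ef U T r := by gcongr; linarith
      have : 0 ≤ T * ef U T r := by positivity
      have : 0 ≤ T * k := by positivity
      linarith
    · rw [if_neg h]
      push Not at h
      have : |vA (K * T) r| * k ≤ (T + M) * k := by gcongr; linarith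
      have : M * k ≤ M * ef U T r := by gcongr
      linarith
  have e9 : T * ef U T r = T * k + T * (V r * U.f T r ^ 2 / 2) := by rw [ee]; ring
  linarith

theorem bad_integral (S : Sc U N Nt Nr C E) {l T M K c : ℝ} (l1 : l < 1) (hT : 0 < T) (hM : 0 ≤ M) (hMT : M ≤ T) (hK : 4 ≤ K)
    (c0 : 0 < c) (c1 : c ≤ (1 - l) / 3) (c2 : c ≤ l / 4) :
    c * T * (∫ r, bad l U T r) ≤ T * (∫ r, ef U T r) + vX U (K * T) T + M * (∫ r, ef U T r)
      + (K * T + 3 * T) * ∫ r in {r | T + M ≤ |r|}, ef U T r := by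
  have hi := S.int T
  have k := ind_integral hi (T + M)
  have hL : 0 < K * T := by positivity
  have cA : Continuous fun r => vA (K * T) r * (U.t T r * U.r T r) := by
    have := U.ct1 T; have := U.cr1 T; fun_prop
  have eX : Integrable (fun r => if |r| ≤ K * T then vA (K * T) r * (U.t T r * U.r T r) else 0) ∧
     ∫ r, (if |r| ≤ K * T then vA (K * T) r * (U.t T r * U.r T r) else 0) = vX U (K * T) T := by
    have e : (fun r => if |r| ≤ K * T then vA (K * T) r * (U.t T r * U.r T r) else 0) = Set.indicator (Set.Icc (-(K * T)) (K * T)) (fun r => vA (K * T) r * (U.t T r * U.r T r)) := by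
      ext r; simp [Set.indicator_apply, abs_le]
    rw [e]
    refine ⟨(integrable_indicator_iff measurableSet_Icc).2 (cA.integrableOn_Icc), ?_⟩
    rw [integral_indicator measurableSet_Icc, integral_Icc_eq_integral_Ioc, vX, intervalIntegral.integral_of_le (by linarith)]
  have i1 := (hi.const_mul T).add eX.1
  have i2 := i1.add (hi.const_mul M)
  have i3 := i2.add (k.1.const_mul (K * T + 3 * T))
  have h := integral_mono ((bad_int S l T).const_mul (c * T)) i3 fun r => bad_pt U l1 hT hM hMT hK c0 c1 c2 r
  rw [integral_const_mul] at h
  refine h.trans (le_of_eq ?_)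
  have e1 := integral_add (hi.const_mul T) eX.1
  have e2 := integral_add i1 (hi.const_mul M)
  have e3 := integral_add i2 (k.1.const_mul (K * T + 3 * T))
  rw [eX.2, integral_const_mul] at e1
  rw [integral_const_mul] at e2
  rw [integral_const_mul, k.2] at e3
  refine e3.trans ?_
  congr 1
  refine e2.trans ?_
  congr 1

theorem Sc.u2 (S : Sc U N Nt Nr C E) (t : ℝ) : Integrable fun r => U.f t r ^ 2 / (r ^ 2 + 1) ^ 2 := by
  refine integrable_of_le (S.int t) ((U.cf1 t).pow 2 |>.div (by fun_prop) fun r => by positivity) fun r => ?_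
  rw [abs_of_nonneg (by positivity)]
  unfold ef
  have h := V_lower r
  have hw : 0 < r ^ 2 + 1 := by positivity
  have h2 : 2 * (1 / (r ^ 2 + 1) ^ 2) ≤ V r := by
    refine le_trans ?_ h
    rw [show 2 / (r ^ 2 + 1) = 2 * (1 / (r ^ 2 + 1)) by ring]
    rw [show 1 / (r ^ 2 + 1) ^ 2 = 1 / (r ^ 2 + 1) * (1 / (r ^ 2 + 1)) by field_simp]
    gcongr
    exact mul_le_of_le_one_right (by positivity) (inv_w_le_one r)
  rw [show U.f t r ^ 2 / (r ^ 2 + 1) ^ 2 = U.f t r ^ 2 * (1 / (r ^ 2 + 1) ^ 2) by ring]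
  nlinarith [sq_nonneg (U.t t r), sq_nonneg (U.r t r), sq_nonneg (U.f t r)]

theorem Sc.bad_small (S : Sc U N Nt Nr C E) {l : ℝ} (l0 : 0 < l) (l1 : l < 1) {δ : ℝ} (hδ : 0 < δ) :
    ∃ T1 > 0, ∀ T ≥ T1, ∫ r, bad l U T r ≤ δ := by
  have hC := S.hC
  obtain ⟨c, c0, c1, c2⟩ : ∃ c > 0, c ≤ (1 - l) / 3 ∧ c ≤ l / 4 :=
    ⟨min ((1 - l) / 3) (l / 4), lt_min (by linarith) (by linarith), min_le_left _ _, min_le_right _ _⟩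
  obtain ⟨d, d0, hd⟩ : ∃ d > 0, 6 * d = c * δ := ⟨c * δ / 6, by positivity, by ring⟩
  obtain ⟨K, K4, hK⟩ : ∃ K : ℝ, 4 ≤ K ∧ 6 * (4 / K ^ 2 * C) ≤ d := by
    have p : 0 < 24 * C / d := by positivity
    refine ⟨4 + 24 * C / d, by linarith, ?_⟩
    rw [show 6 * (4 / (4 + 24 * C / d) ^ 2 * C) = 24 * C / (4 + 24 * C / d) ^ 2 by ring, div_le_iff₀ (by positivity)]
    have : 24 * C = d * (24 * C / d) := by field_simp
    nlinarith
  obtain ⟨ε, ε0, hε⟩ : ∃ ε > 0, ε * (K + 8) = d := ⟨d / (K + 8), by positivity, by field_simp⟩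
  obtain ⟨M, M0, hM⟩ := S.tail ε ε0
  obtain ⟨Ta, a0, ha⟩ := S.conv ε ε0
  obtain ⟨Tb, b0, hb⟩ := S.small ε ε0
  set T0 := max Ta Tb
  have T00 : 0 ≤ T0 := a0.trans (le_max_left _ _)
  set W := ((T0 + M) * C + T0 * |E| + M * C) / d with hW
  have W0 : 0 ≤ W := by positivity
  refine ⟨T0 + M + W, by positivity, fun T hT => ?_⟩
  have hT0 : 0 < T := by linarith
  have hTT : T0 ≤ T := by linarith
  have hWd : (T0 + M) * C + T0 * |E| + M * C ≤ d * T := by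
    have : (T0 + M) * C + T0 * |E| + M * C = d * W := by rw [hW]; field_simp
    rw [this]; gcongr; linarith
  have hL : 0 < K * T := by positivity
  have hKT : 4 * T ≤ K * T := by gcongr
  have main := bad_integral S l1 hT0 M0.le (by linarith : M ≤ T) K4 c0 c1 c2
  have tl : ∀ t, T0 ≤ t → ∫ r in {r | t + M ≤ |r|}, ef U t r ≤ ε := fun t ht => hM M le_rfl t (by linarith)
  -- derivative bound
  have hder : ∀ t, T0 ≤ t → t ≤ T → ∀ D, HasDerivAt (vX U (K * T)) D t → D ≤ -E + d + 12 * ε := by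
    intro t ht htT D hD
    obtain ⟨D', h1, h2⟩ := vX_deriv S hL t
    rw [hD.unique h1]
    refine h2.trans ?_
    have ce := ef_cont' U t; have cf1 := U.cf1 t; have cN := S.cN1 t; have cr := U.cr1 t
    have cu : Continuous fun r => U.f t r ^ 2 / (r ^ 2 + 1) ^ 2 := cf1.pow 2 |>.div (by fun_prop) fun r => by positivity
    have g1 : IntervalIntegrable (fun r => -ef U t r) volume (-(K * T)) (K * T) := Continuous.intervalIntegrable (by fun_prop) _ _
    have g2 : IntervalIntegrable (fun r => 6 * (r ^ 2 / (K * T) ^ 2 * ef U t r)) volume (-(K * T)) (K * T) := Continuous.intervalIntegrable (by fun_prop) _ _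
    have g3 : IntervalIntegrable (fun r => 3 * (U.f t r ^ 2 / (r ^ 2 + 1) ^ 2)) volume (-(K * T)) (K * T) := Continuous.intervalIntegrable (by fun_prop) _ _
    have g4 : IntervalIntegrable (fun r => |r * N t r * U.r t r|) volume (-(K * T)) (K * T) := Continuous.intervalIntegrable (by fun_prop) _ _
    rw [intervalIntegral.integral_add ((g1.add g2).add g3) g4, intervalIntegral.integral_add (g1.add g2) g3, intervalIntegral.integral_add g1 g2, intervalIntegral.integral_neg,
      intervalIntegral.integral_const_mul, intervalIntegral.integral_const_mul]
    have s := hb t ((le_max_right _ _).trans ht)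
    have s1 := (interval_le_integral (S.u2 t) (fun r => by positivity) (by linarith : -(K * T) ≤ K * T)).trans s.1
    have s2 := s.2 _ hL
    have s3 := int_split (S.int t) hL (ef_nonneg U t)
    have s4 := S.tail_le t (tl t ht) (by linarith : t + M ≤ K * T)
    have s5 := (abs_le.1 (ha t ((le_max_left _ _).trans ht))).1
    have s6 := S.wt t (g := fun r => r ^ 2 / (K * T) ^ 2) (by fun_prop) (a := 4 / K ^ 2) (b := 1) hL (by positivity) (by norm_num) (fun r _ h => ?_) (fun r h => sq_div_le hL h) (tl t ht)
    · linarith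
    · rw [mul_pow, div_le_div_iff₀ (by positivity) (by positivity)]
      have : |r| ^ 2 ≤ (2 * T) ^ 2 := by gcongr; linarith
      rw [sq_abs] at this
      nlinarith [sq_nonneg K]
  have hdiff : Differentiable ℝ (vX U (K * T)) := fun t => let ⟨_, h, _⟩ := vX_deriv S hL t; h.differentiableAt
  have mv := (convex_Icc T0 T).image_sub_le_mul_sub_of_deriv_le hdiff.continuous.continuousOn hdiff.differentiableOn
    (fun t ht => by rw [interior_Icc] at ht; exact hder t ht.1.le ht.2.le _ (hdiff t).hasDerivAt) T0 (Set.left_mem_Icc.2 hTT) T (Set.right_mem_Icc.2 hTT) hTT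
  have hX0 : vX U (K * T) T0 ≤ (T0 + M) * C + K * T * ε := by
    refine le_trans ?_ (S.wt T0 (g := fun r => |r|) (by fun_prop) hL (by positivity) hL.le (fun r _ h => h) (fun r h => h) (tl T0 le_rfl))
    have := U.ct1 T0; have := U.cr1 T0; have := ef_cont' U T0
    refine intervalIntegral.integral_mono_on (by linarith) (Continuous.intervalIntegrable (by fun_prop) _ _) (Continuous.intervalIntegrable (by fun_prop) _ _) fun r hr => ?_
    refine (le_abs_self _).trans ?_
    rw [abs_mul]
    have h2 : |U.t T0 r * U.r T0 r| ≤ ef U T0 r := by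
      have : 0 ≤ V r * U.f T0 r ^ 2 := by have := V_pos r; positivity
      unfold ef
      rw [abs_le]; constructor <;> nlinarith [sq_nonneg (U.t T0 r - U.r T0 r), sq_nonneg (U.t T0 r + U.r T0 r)]
    exact mul_le_mul (vA_abs hL (abs_le.2 hr)) h2 (abs_nonneg _) (abs_nonneg _)
  have hE := (abs_le.1 (ha T ((le_max_left _ _).trans hTT))).2
  have q1 : T * (∫ r, ef U T r) ≤ T * (E + ε) := by gcongr; linarith
  have q2 : M * (∫ r, ef U T r) ≤ M * C := by gcongr; exact S.bE T
  have q3 : (K * T + 3 * T) * (∫ r in {r | T + M ≤ |r|}, ef U T r) ≤ (K * T + 3 * T) * ε := by gcongr; exact tl T hTT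
  have q4 : T0 * E ≤ T0 * |E| := by gcongr; exact le_abs_self E
  have q5 : 0 ≤ T0 * (d + 12 * ε) := by positivity
  have q6 : 2 * T * (ε * (K + 8)) = 2 * T * d := by rw [hε]
  have q7 : T * (6 * d) = T * (c * δ) := by rw [hd]
  have q8 : 0 ≤ T * d := by positivity
  have fin : c * T * (∫ r, bad l U T r) ≤ c * T * δ := by linarith
  exact le_of_mul_le_mul_left fin (by positivity)
end WMS

namespace WMS

noncomputable def Tv (σ : ℝ) (h : ℝ → ℝ → ℝ) (t r : ℝ) : ℝ := ∫ s in (0:ℝ)..t, h s (r + σ * (t - s))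

theorem Tv_cont {h : ℝ → ℝ → ℝ} (ch : Continuous fun p : ℝ × ℝ => h p.1 p.2) (σ : ℝ) :
    Continuous fun p : ℝ × ℝ => Tv σ h p.1 p.2 := by
  unfold Tv
  refine intervalIntegral.continuous_parametric_intervalIntegral_of_continuous (f := fun (p : ℝ × ℝ) s => h s (p.2 + σ * (p.1 - s))) ?_ continuous_fst
  exact ch.comp (f := fun x : (ℝ × ℝ) × ℝ => (x.2, x.1.2 + σ * (x.1.1 - x.2))) (by fun_prop)

theorem Tv_dr {h h1 : ℝ → ℝ → ℝ} (ch : Continuous fun p : ℝ × ℝ => h p.1 p.2) (ch1 : Continuous fun p : ℝ × ℝ => h1 p.1 p.2)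
    (hd : ∀ t r, HasDerivAt (h t) (h1 t r) r) (σ t r : ℝ) : HasDerivAt (fun r => Tv σ h t r) (Tv σ h1 t r) r := by
  unfold Tv
  refine leibniz (f := fun r s => h s (r + σ * (t - s))) (ft := fun r s => h1 s (r + σ * (t - s))) 0 t (fun r s => (hd s _).comp_add_const _ _) (fun r => ?_) ?_ r
  · exact ch.comp (f := fun s : ℝ => (s, r + σ * (t - s))) (by fun_prop)
  · exact ch1.comp (f := fun x : ℝ × ℝ => (x.2, x.1 + σ * (t - x.2))) (by fun_prop)

theorem Tv_dt {h h1 : ℝ → ℝ → ℝ} (ch : Continuous fun p : ℝ × ℝ => h p.1 p.2) (ch1 : Continuous fun p : ℝ × ℝ => h1 p.1 p.2)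
    (hd : ∀ t r, HasDerivAt (h t) (h1 t r) r) (σ t r : ℝ) : HasDerivAt (fun t => Tv σ h t r) (h t r + σ * Tv σ h1 t r) t := by
  have cc : ∀ y : ℝ, Continuous fun s => h s (r + σ * (y - s)) := fun y => ch.comp (f := fun s : ℝ => (s, r + σ * (y - s))) (by fun_prop)
  have hdy : ∀ s y, HasDerivAt (fun y => h s (r + σ * (y - s))) (σ * h1 s (r + σ * (y - s))) y := fun s y => by
    have e : HasDerivAt (fun y => r + σ * (y - s)) σ y := by
      simpa using (((hasDerivAt_id y).sub_const s).const_mul σ).const_add r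
    refine ((hd s (r + σ * (y - s))).comp y e).congr_deriv (by ring)
  have := chainC (f := fun x y => ∫ s in (0:ℝ)..x, h s (r + σ * (y - s))) (ft := fun x y => h x (r + σ * (y - x)))
    (fr := fun x y => ∫ s in (0:ℝ)..x, σ * h1 s (r + σ * (y - s)))
    (fun x y => intervalIntegral.integral_hasDerivAt_right ((cc y).intervalIntegrable _ _) ((cc y).stronglyMeasurableAtFilter _ _) (cc y).continuousAt)
    (fun x y => leibniz (f := fun y s => h s (r + σ * (y - s))) (ft := fun y s => σ * h1 s (r + σ * (y - s))) 0 x (fun y s => hdy s y) cc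
      (continuous_const.mul (ch1.comp (f := fun z : ℝ × ℝ => (z.2, r + σ * (z.1 - z.2))) (by fun_prop))) y)
    (ch.comp (f := fun z : ℝ × ℝ => (z.1, r + σ * (z.2 - z.1))) (by fun_prop))
    (intervalIntegral.continuous_parametric_intervalIntegral_of_continuous (f := fun (p : ℝ × ℝ) s => σ * h1 s (r + σ * (p.2 - s)))
      (continuous_const.mul (ch1.comp (f := fun x : (ℝ × ℝ) × ℝ => (x.2, r + σ * (x.1.2 - x.2))) (by fun_prop))) continuous_fst)
    (hasDerivAt_id t) (hasDerivAt_id t)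
  refine this.congr_deriv ?_
  unfold Tv
  simp

noncomputable def Pm (g : ℝ → ℝ → ℝ) (s x : ℝ) : ℝ := ∫ y in (0:ℝ)..x, g s y

theorem Pm_cont {g : ℝ → ℝ → ℝ} (cg : Continuous fun p : ℝ × ℝ => g p.1 p.2) : Continuous fun p : ℝ × ℝ => Pm g p.1 p.2 := by
  unfold Pm
  refine intervalIntegral.continuous_parametric_intervalIntegral_of_continuous (f := fun (p : ℝ × ℝ) y => g p.1 y) ?_ continuous_snd
  exact cg.comp (f := fun x : (ℝ × ℝ) × ℝ => (x.1.1, x.2)) (by fun_prop)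

theorem Pm_d {g : ℝ → ℝ → ℝ} (cg : Continuous fun p : ℝ × ℝ => g p.1 p.2) (s x : ℝ) : HasDerivAt (Pm g s) (g s x) x := by
  have cc : Continuous (g s) := cg.comp (Continuous.prodMk_right s)
  exact intervalIntegral.integral_hasDerivAt_right (cc.intervalIntegrable _ _) (cc.stronglyMeasurableAtFilter _ _) cc.continuousAt

/-- d'Alembert/Duhamel operator -/
noncomputable def Du (g : ℝ → ℝ → ℝ) (t r : ℝ) : ℝ := (Tv 1 (Pm g) t r - Tv (-1) (Pm g) t r) / 2

theorem Du_cont {g : ℝ → ℝ → ℝ} (cg : Continuous fun p : ℝ × ℝ => g p.1 p.2) : Continuous fun p : ℝ × ℝ => Du g p.1 p.2 :=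
  ((Tv_cont (Pm_cont cg) 1).sub (Tv_cont (Pm_cont cg) (-1))).div_const 2

theorem Du_dr {g : ℝ → ℝ → ℝ} (cg : Continuous fun p : ℝ × ℝ => g p.1 p.2) (t r : ℝ) :
    HasDerivAt (fun r => Du g t r) ((Tv 1 g t r - Tv (-1) g t r) / 2) r :=
  ((Tv_dr (Pm_cont cg) cg (Pm_d cg) 1 t r).fun_sub (Tv_dr (Pm_cont cg) cg (Pm_d cg) (-1) t r)).div_const 2

theorem Du_dt {g : ℝ → ℝ → ℝ} (cg : Continuous fun p : ℝ × ℝ => g p.1 p.2) (t r : ℝ) :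
    HasDerivAt (fun t => Du g t r) ((Tv 1 g t r + Tv (-1) g t r) / 2) t :=
  (((Tv_dt (Pm_cont cg) cg (Pm_d cg) 1 t r).fun_sub (Tv_dt (Pm_cont cg) cg (Pm_d cg) (-1) t r)).div_const 2).congr_deriv (by ring)

noncomputable def DuF (g g1 : ℝ → ℝ → ℝ) (cg : Continuous fun p : ℝ × ℝ => g p.1 p.2) (cg1 : Continuous fun p : ℝ × ℝ => g1 p.1 p.2)
    (hd : ∀ t r, HasDerivAt (g t) (g1 t r) r) : F2 where
  f := Du g
  t := fun t r => (Tv 1 g t r + Tv (-1) g t r) / 2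
  r := fun t r => (Tv 1 g t r - Tv (-1) g t r) / 2
  tt := fun t r => g t r + (Tv 1 g1 t r - Tv (-1) g1 t r) / 2
  tr := fun t r => (Tv 1 g1 t r + Tv (-1) g1 t r) / 2
  rr := fun t r => (Tv 1 g1 t r - Tv (-1) g1 t r) / 2
  ht := Du_dt cg
  hr := Du_dr cg
  htt := fun t r => (((Tv_dt cg cg1 hd 1 t r).fun_add (Tv_dt cg cg1 hd (-1) t r)).div_const 2).congr_deriv (by ring)
  htr := fun t r => ((Tv_dr cg cg1 hd 1 t r).fun_add (Tv_dr cg cg1 hd (-1) t r)).div_const 2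
  hrt := fun t r => (((Tv_dt cg cg1 hd 1 t r).fun_sub (Tv_dt cg cg1 hd (-1) t r)).div_const 2).congr_deriv (by ring)
  hrr := fun t r => ((Tv_dr cg cg1 hd 1 t r).fun_sub (Tv_dr cg cg1 hd (-1) t r)).div_const 2
  ctt := cg.add (((Tv_cont cg1 1).sub (Tv_cont cg1 (-1))).div_const 2)
  ctr := ((Tv_cont cg1 1).add (Tv_cont cg1 (-1))).div_const 2
  crr := ((Tv_cont cg1 1).sub (Tv_cont cg1 (-1))).div_const 2

theorem exp_int (t : ℝ) : |∫ s in (0:ℝ)..t, rexp (6 * |s|)| ≤ rexp (6 * |t|) / 6 := by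
  have key : ∀ t : ℝ, 0 ≤ t → |∫ s in (0:ℝ)..t, rexp (6 * |s|)| ≤ rexp (6 * |t|) / 6 := by
    intro t ht
    have e : ∫ s in (0:ℝ)..t, rexp (6 * |s|) = ∫ s in (0:ℝ)..t, rexp (6 * s) := by
      refine intervalIntegral.integral_congr fun s hs => ?_
      rw [Set.uIcc_of_le ht] at hs
      simp only [abs_of_nonneg hs.1]
    have hd : ∀ s ∈ Set.uIcc 0 t, HasDerivAt (fun s => rexp (6 * s) / 6) (rexp (6 * s)) s := fun s _ =>
      ((((hasDerivAt_id s).const_mul 6).exp).div_const 6).congr_deriv (by simp)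
    rw [e, intervalIntegral.integral_eq_sub_of_hasDerivAt hd (Continuous.intervalIntegrable (by fun_prop) _ _), abs_of_nonneg ht]
    have h1 : 1 ≤ rexp (6 * t) := Real.one_le_exp (by linarith)
    simp only [mul_zero, Real.exp_zero]
    rw [abs_of_nonneg (by linarith)]
    linarith
  rcases le_total 0 t with h | h
  · exact key t h
  · have := key (-t) (by linarith)
    have e := intervalIntegral.integral_comp_neg (a := 0) (b := t) (fun s => rexp (6 * |s|))
    simp only [abs_neg, neg_zero] at e this
    rw [e, intervalIntegral.integral_symm, abs_neg]
    exact this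

theorem Du_bound {g : ℝ → ℝ → ℝ} (cg : Continuous fun p : ℝ × ℝ => g p.1 p.2) {B : ℝ} (hB : 0 ≤ B)
    (hg : ∀ t r, |g t r| ≤ B * rexp (7 * |t|)) (t r : ℝ) : |Du g t r| ≤ B / 6 * rexp (7 * |t|) := by
  have cP := Pm_cont cg
  have cc : ∀ σ : ℝ, Continuous fun s => Pm g s (r + σ * (t - s)) := fun σ => cP.comp (f := fun s : ℝ => (s, r + σ * (t - s))) (by fun_prop)
  have e : Du g t r = ∫ s in (0:ℝ)..t, (Pm g s (r + 1 * (t - s)) - Pm g s (r + (-1) * (t - s))) / 2 := by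
    unfold Du Tv
    rw [← intervalIntegral.integral_sub ((cc 1).intervalIntegrable _ _) ((cc (-1)).intervalIntegrable _ _), intervalIntegral.integral_div]
  have hp : ∀ s ∈ Set.uIoc 0 t, ‖(Pm g s (r + 1 * (t - s)) - Pm g s (r + (-1) * (t - s))) / 2‖ ≤ B * rexp |t| * rexp (6 * |s|) := by
    intro s hs
    have ci : Continuous (g s) := cg.comp (Continuous.prodMk_right s)
    have e1 : Pm g s (r + 1 * (t - s)) - Pm g s (r + (-1) * (t - s)) = ∫ y in (r + (-1) * (t - s))..(r + 1 * (t - s)), g s y :=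
      intervalIntegral.integral_interval_sub_left (ci.intervalIntegrable _ _) (ci.intervalIntegrable _ _)
    have h1 := intervalIntegral.norm_integral_le_of_norm_le_const (a := r + (-1) * (t - s)) (b := r + 1 * (t - s)) (f := g s) (C := B * rexp (7 * |s|)) (fun y _ => hg s y)
    rw [← e1, show r + 1 * (t - s) - (r + (-1) * (t - s)) = 2 * (t - s) by ring, abs_mul, abs_two] at h1
    rw [norm_div, Real.norm_two]
    have hts : |t - s| = |t| - |s| := by
      rcases le_total 0 t with h | h
      · rw [Set.uIoc_of_le h] at hs
        rw [abs_of_nonneg h, abs_of_nonneg hs.1.le, abs_of_nonneg (by linarith [hs.2])]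
      · rw [Set.uIoc_of_ge h] at hs
        rw [abs_of_nonpos h, abs_of_nonpos hs.2, abs_of_nonpos (by linarith [hs.1])]; ring
    have h2 : |t - s| ≤ rexp (|t| - |s|) := by rw [hts]; linarith [Real.add_one_le_exp (|t| - |s|)]
    have e3 : rexp |t| * rexp (6 * |s|) = rexp (7 * |s|) * rexp (|t| - |s|) := by rw [← Real.exp_add, ← Real.exp_add]; congr 1; ring
    calc _ ≤ B * rexp (7 * |s|) * (2 * |t - s|) / 2 := by gcongr
      _ = B * (rexp (7 * |s|) * |t - s|) := by ring
      _ ≤ B * (rexp (7 * |s|) * rexp (|t| - |s|)) := by gcongr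
      _ = _ := by rw [← e3]; ring
  rw [e]
  refine (intervalIntegral.norm_integral_le_abs_of_norm_le (g := fun s => B * rexp |t| * rexp (6 * |s|)) ((ae_restrict_mem measurableSet_uIoc).mono hp) (Continuous.intervalIntegrable (by fun_prop) _ _)).trans ?_
  rw [intervalIntegral.integral_const_mul, abs_mul, abs_of_nonneg (by positivity)]
  calc _ ≤ B * rexp |t| * (rexp (6 * |t|) / 6) := by gcongr; exact exp_int t
    _ = B / 6 * (rexp |t| * rexp (6 * |t|)) := by ring
    _ = _ := by rw [← Real.exp_add]; congr 2; ring

theorem Du_sub {g h : ℝ → ℝ → ℝ} (cg : Continuous fun p : ℝ × ℝ => g p.1 p.2) (ch : Continuous fun p : ℝ × ℝ => h p.1 p.2) (t r : ℝ) :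
    Du g t r - Du h t r = Du (fun t r => g t r - h t r) t r := by
  have cP := Pm_cont cg
  have cQ := Pm_cont ch
  have cc : ∀ σ : ℝ, Continuous fun s => Pm g s (r + σ * (t - s)) := fun σ => cP.comp (f := fun s : ℝ => (s, r + σ * (t - s))) (by fun_prop)
  have cd : ∀ σ : ℝ, Continuous fun s => Pm h s (r + σ * (t - s)) := fun σ => cQ.comp (f := fun s : ℝ => (s, r + σ * (t - s))) (by fun_prop)
  have eP : Pm (fun t r => g t r - h t r) = fun s x => Pm g s x - Pm h s x := by
    ext s x
    exact intervalIntegral.integral_sub ((cg.comp (Continuous.prodMk_right s)).intervalIntegrable _ _) ((ch.comp (Continuous.prodMk_right s)).intervalIntegrable _ _)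
  unfold Du
  rw [eP]
  have eT : ∀ σ, Tv σ (fun s x => Pm g s x - Pm h s x) t r = Tv σ (Pm g) t r - Tv σ (Pm h) t r := fun σ =>
    intervalIntegral.integral_sub ((cc σ).intervalIntegrable _ _) ((cd σ).intervalIntegrable _ _)
  rw [eT, eT]; ring

open BoundedContinuousFunction in
theorem lin_fix {N : ℝ → ℝ → ℝ} (cN : Continuous fun p : ℝ × ℝ => N p.1 p.2) {C : ℝ} (hC : 0 ≤ C) (hN : ∀ t r, |N t r| ≤ C) :
    ∃ W : ℝ → ℝ → ℝ, (Continuous fun p : ℝ × ℝ => W p.1 p.2) ∧ ∀ t r, W t r = Du (fun t r => N t r - V r * W t r) t r := by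
  have cG : ∀ Y : ℝ × ℝ →ᵇ ℝ, Continuous fun p : ℝ × ℝ => N p.1 p.2 - V p.2 * (rexp (7 * |p.1|) * Y (p.1, p.2)) := fun Y => by
    have := Y.continuous; fun_prop
  have he : ∀ t : ℝ, 1 ≤ rexp (7 * |t|) := fun t => Real.one_le_exp (by positivity)
  have bG : ∀ (Y : ℝ × ℝ →ᵇ ℝ) t r, |N t r - V r * (rexp (7 * |t|) * Y (t, r))| ≤ (C + 3 * ‖Y‖) * rexp (7 * |t|) := fun Y t r => by
    have h1 := Y.norm_coe_le_norm (t, r)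
    rw [Real.norm_eq_abs] at h1
    refine (abs_sub _ _).trans ?_
    rw [abs_mul, abs_mul, abs_of_pos (V_pos r), abs_of_pos (Real.exp_pos _)]
    have h2 : V r * (rexp (7 * |t|) * |Y (t, r)|) ≤ 3 * (rexp (7 * |t|) * ‖Y‖) := by gcongr; exact V_le r
    have h3 : |N t r| ≤ C * rexp (7 * |t|) := (hN t r).trans (le_mul_of_one_le_right hC (he t))
    linarith
  have inv : ∀ t x : ℝ, |rexp (-(7 * |t|)) * x| = rexp (-(7 * |t|)) * |x| := fun t x => by rw [abs_mul, abs_of_pos (Real.exp_pos _)]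
  have one : ∀ t : ℝ, rexp (-(7 * |t|)) * rexp (7 * |t|) = 1 := fun t => by rw [← Real.exp_add]; simp
  let Ψ : (ℝ × ℝ →ᵇ ℝ) → (ℝ × ℝ →ᵇ ℝ) := fun Y => BoundedContinuousFunction.ofNormedAddCommGroup
    (fun p : ℝ × ℝ => rexp (-(7 * |p.1|)) * Du (fun t r => N t r - V r * (rexp (7 * |t|) * Y (t, r))) p.1 p.2)
    (by have := Du_cont (g := fun t r => N t r - V r * (rexp (7 * |t|) * Y (t, r))) (cG Y); fun_prop) ((C + 3 * ‖Y‖) / 6) (fun p => by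
      rw [Real.norm_eq_abs, inv]
      have := Du_bound (cG Y) (by positivity) (bG Y) p.1 p.2
      calc _ ≤ rexp (-(7 * |p.1|)) * ((C + 3 * ‖Y‖) / 6 * rexp (7 * |p.1|)) := by gcongr
        _ = (C + 3 * ‖Y‖) / 6 * (rexp (-(7 * |p.1|)) * rexp (7 * |p.1|)) := by ring
        _ = _ := by rw [one, mul_one])
  have hΨ : ContractingWith (1/2) Ψ := by
    refine ⟨by rw [← NNReal.coe_lt_coe]; norm_num, LipschitzWith.of_dist_le_mul fun Y Z => ?_⟩
    rw [BoundedContinuousFunction.dist_le (by positivity)]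
    intro p
    change dist (rexp (-(7 * |p.1|)) * Du (fun t r => N t r - V r * (rexp (7 * |t|) * Y (t, r))) p.1 p.2) (rexp (-(7 * |p.1|)) * Du (fun t r => N t r - V r * (rexp (7 * |t|) * Z (t, r))) p.1 p.2) ≤ _
    rw [Real.dist_eq, ← mul_sub, inv, Du_sub (cG Y) (cG Z)]
    have := Du_bound (g := fun t r => N t r - V r * (rexp (7 * |t|) * Y (t, r)) - (N t r - V r * (rexp (7 * |t|) * Z (t, r)))) ((cG Y).sub (cG Z)) (B := 3 * dist Y Z) (by positivity) (fun t r => by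
      have h1 := BoundedContinuousFunction.dist_coe_le_dist (f := Y) (g := Z) (t, r)
      rw [show N t r - V r * (rexp (7 * |t|) * Y (t, r)) - (N t r - V r * (rexp (7 * |t|) * Z (t, r))) = -(V r * (rexp (7 * |t|) * (Y (t, r) - Z (t, r)))) by ring, abs_neg,
        abs_mul, abs_mul, abs_of_pos (V_pos r), abs_of_pos (Real.exp_pos _), ← Real.dist_eq]
      calc _ ≤ 3 * (rexp (7 * |t|) * dist Y Z) := by gcongr; exact V_le r
        _ = _ := by ring) p.1 p.2
    calc _ ≤ rexp (-(7 * |p.1|)) * (3 * dist Y Z / 6 * rexp (7 * |p.1|)) := by gcongr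
      _ = 3 * dist Y Z / 6 * (rexp (-(7 * |p.1|)) * rexp (7 * |p.1|)) := by ring
      _ = _ := by rw [one]; push_cast; ring
  let Y := hΨ.fixedPoint Ψ
  have hY : Ψ Y = Y := hΨ.fixedPoint_isFixedPt
  refine ⟨fun t r => rexp (7 * |t|) * Y (t, r), by have := Y.continuous; fun_prop, fun t r => ?_⟩
  have h1 : rexp (-(7 * |t|)) * Du (fun t r => N t r - V r * (rexp (7 * |t|) * Y (t, r))) t r = Y (t, r) := congrArg (fun Z : ℝ × ℝ →ᵇ ℝ => Z (t, r)) hY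
  change rexp (7 * |t|) * Y (t, r) = Du (fun t r => N t r - V r * (rexp (7 * |t|) * Y (t, r))) t r
  nth_rw 1 [← h1]
  rw [← mul_assoc, mul_comm (rexp (7 * |t|)), one, one_mul]

theorem lin_cauchy {N N1 : ℝ → ℝ → ℝ} (cN : Continuous fun p : ℝ × ℝ => N p.1 p.2) (cN1 : Continuous fun p : ℝ × ℝ => N1 p.1 p.2)
    (hd : ∀ t r, HasDerivAt (N t) (N1 t r) r) {C : ℝ} (hC : 0 ≤ C) (hN : ∀ t r, |N t r| ≤ C) :
    ∃ W : F2, (∀ t r, W.tt t r = W.rr t r - V r * W.f t r + N t r) ∧ (∀ r, W.f 0 r = 0) ∧ (∀ r, W.t 0 r = 0) ∧ ∀ r, W.r 0 r = 0 := by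
  obtain ⟨W, cW, hW⟩ := lin_fix cN hC hN
  have cg : Continuous fun p : ℝ × ℝ => N p.1 p.2 - V p.2 * W p.1 p.2 := by fun_prop
  have eW : Du (fun t r => N t r - V r * W t r) = W := by ext t r; exact (hW t r).symm
  have dW := Du_dr (g := fun t r => N t r - V r * W t r) cg
  rw [eW] at dW
  have cWr : Continuous fun p : ℝ × ℝ => (Tv 1 (fun t r => N t r - V r * W t r) p.1 p.2 - Tv (-1) (fun t r => N t r - V r * W t r) p.1 p.2) / 2 :=
    ((Tv_cont cg 1).sub (Tv_cont cg (-1))).div_const 2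
  have cg1 : Continuous fun p : ℝ × ℝ => N1 p.1 p.2 - (V1 p.2 * W p.1 p.2 + V p.2 * ((Tv 1 (fun t r => N t r - V r * W t r) p.1 p.2 - Tv (-1) (fun t r => N t r - V r * W t r) p.1 p.2) / 2)) := by
    have := continuous_V1; fun_prop
  refine ⟨DuF (fun t r => N t r - V r * W t r) (fun t r => N1 t r - (V1 r * W t r + V r * ((Tv 1 (fun t r => N t r - V r * W t r) t r - Tv (-1) (fun t r => N t r - V r * W t r) t r) / 2))) cg cg1
    (fun t r => (hd t r).fun_sub ((hasDerivAt_V r).fun_mul (dW t r))), fun t r => ?_, fun r => ?_, fun r => ?_, fun r => ?_⟩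
  · simp only [DuF]
    rw [eW]; ring
  · simp [DuF, Du, Tv]
  · simp [DuF, Tv]
  · simp [DuF, Tv]
end WMS

namespace WMS

theorem hasDerivAt_qi (r : ℝ) : HasDerivAt (fun r => 1 / q r) (-(r / q r ^ 3)) r := by
  refine ((hasDerivAt_const r (1:ℝ)).fun_div (hasDerivAt_q r) (q_ne r)).congr_deriv ?_
  have := q_ne r
  field_simp
  ring
theorem hasDerivAt_qi2 (r : ℝ) : HasDerivAt (fun r => -(r / q r ^ 3)) (-(1 / q r ^ 3) + 3 * r ^ 2 / q r ^ 5) r := by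
  refine (((hasDerivAt_id r).fun_div ((hasDerivAt_q r).fun_pow 3) (pow_ne_zero 3 (q_ne r))).fun_neg).congr_deriv ?_
  have := q_ne r
  simp only [id]
  field_simp
  ring

noncomputable def F2.unlift (X : F2) : F2 :=
  X.mulr (fun r => 1 / q r) (fun r => -(r / q r ^ 3)) (fun r => -(1 / q r ^ 3) + 3 * r ^ 2 / q r ^ 5) hasDerivAt_qi hasDerivAt_qi2
    ((continuous_const.div (by fun_prop) fun r => pow_ne_zero 3 (q_ne r)).neg.add (Continuous.div (by fun_prop) (by fun_prop) fun r => pow_ne_zero 5 (q_ne r)))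

theorem unlift_f (X : F2) (t r : ℝ) : X.unlift.f t r = 1 / q r * X.f t r := rfl
theorem unlift_t (X : F2) (t r : ℝ) : X.unlift.t t r = 1 / q r * X.t t r := rfl
theorem unlift_r (X : F2) (t r : ℝ) : X.unlift.r t r = -(r / q r ^ 3) * X.f t r + 1 / q r * X.r t r := rfl

theorem unlift_wv {X : F2} (h : ∀ t r, X.tt t r = X.rr t r - V r * X.f t r) : Wv X.unlift (fun t r => 2 * X.unlift.f t r) := by
  refine Wv.of_eq fun t r => ?_
  have h2 := q_sq r; have h3 := q_ne r
  simp only [F2.unlift, F2.mulr]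
  rw [h t r, V_q]
  have h4 : r ^ 2 = q r ^ 2 - 1 := by linarith
  rw [← h2]
  field_simp
  rw [h4]
  ring_nf
  rw [h4]
  ring

theorem ef_unlift (X : F2) (t : ℝ) : ef (X.unlift.lift 0) t = ef X t := by
  ext r
  have h3 := q_ne r
  unfold ef
  rw [lift_f, lift_t, lift_r, unlift_f, unlift_t, unlift_r]
  have e1 : q r * (1 / q r * X.f t r - 0) = X.f t r := by field_simp; ring
  have e2 : q r * (1 / q r * X.t t r) = X.t t r := by field_simp
  have e3 : r / q r * (1 / q r * X.f t r - 0) + q r * (-(r / q r ^ 3) * X.f t r + 1 / q r * X.r t r) = X.r t r := by field_simp; ring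
  rw [e1, e2, e3]

theorem enl_unlift_le (X : F2) (t r : ℝ) : enl X.unlift t r ≤ 2 * ef X t r := by
  have h2 := q_sq r; have h3 := q_pos r
  unfold enl en ef
  rw [unlift_f, unlift_t, unlift_r, ← h2]
  have e1 : q r ^ 2 * ((1 / q r * X.t t r) ^ 2 + (-(r / q r ^ 3) * X.f t r + 1 / q r * X.r t r) ^ 2) / 2 + (1 / q r * X.f t r) ^ 2
    = (X.t t r ^ 2 + (X.r t r - r / q r ^ 2 * X.f t r) ^ 2) / 2 + X.f t r ^ 2 / q r ^ 2 := by field_simp; ring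
  rw [e1]
  have e2 : r ^ 2 / q r ^ 2 ≤ 1 := by rw [div_le_one (by positivity)]; linarith
  have e3 : (r / q r ^ 2 * X.f t r) ^ 2 ≤ X.f t r ^ 2 / q r ^ 2 := by
    rw [show (r / q r ^ 2 * X.f t r) ^ 2 = r ^ 2 / q r ^ 2 * (X.f t r ^ 2 / q r ^ 2) by field_simp]
    exact mul_le_of_le_one_left (by positivity) e2
  have e4 : 2 * (X.f t r ^ 2 / q r ^ 2) ≤ V r * X.f t r ^ 2 := by
    have := V_lower r
    rw [← h2] at this
    calc _ = 2 / q r ^ 2 * X.f t r ^ 2 := by ring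
      _ ≤ _ := by gcongr
  nlinarith [sq_nonneg (X.r t r + r / q r ^ 2 * X.f t r), sq_nonneg (X.t t r)]

theorem enl_unlift_int {X : F2} {t : ℝ} (hi : Integrable (ef X t)) : Integrable (enl X.unlift t) := by
  refine integrable_of_le (hi.const_mul 2) (enl_cont _ _) fun r => ?_
  rw [abs_of_nonneg (enl_nonneg _ _ _)]
  exact enl_unlift_le X t r

theorem flat_eq {X : F2} {t : ℝ} (hi : Integrable (ef X t)) : ∫ r, ef X t r = ∫ r, enl X.unlift t r := by
  have := (flat_int (enl_unlift_int hi)).2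
  rwa [ef_unlift] at this

theorem flat_const {X : F2} (h : ∀ t r, X.tt t r = X.rr t r - V r * X.f t r) {t0 : ℝ} (hi : Integrable (ef X t0)) (t : ℝ) :
    Integrable (ef X t) ∧ ∫ r, ef X t r = ∫ r, ef X t0 r := by
  have hc := energy_const (g := fun x => x ^ 2) (gf := fun x => 2 * x) (fun x => by simpa using hasDerivAt_pow 2 x) (by fun_prop) (fun x => sq_nonneg x)
    (unlift_wv h) (enl_unlift_int hi) t
  have h1 := (flat_int hc.1).1
  rw [ef_unlift] at h1
  exact ⟨h1, by rw [flat_eq h1, flat_eq hi]; exact hc.2⟩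

theorem ef_sob {X : F2} {t : ℝ} (hi : Integrable (ef X t)) (r : ℝ) : X.f t r ^ 2 ≤ 2 * (∫ r, ef X t r) * q r := by
  have h := enl_sob (enl_unlift_int hi) r
  rw [← flat_eq hi, unlift_f] at h
  have h3 := q_pos r
  have e : q r * (1 / q r * X.f t r) ^ 2 = X.f t r ^ 2 / q r := by field_simp
  rwa [e, div_le_iff₀ h3] at h
end WMS

namespace WMS
variable {U : F2} {N Nt Nr : ℝ → ℝ → ℝ} {C E : ℝ}

theorem sqrtq_m (r : ℝ) : √(q r) / (r ^ 2 + 1) = m r := by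
  have h := q_pos r
  have hs := Real.sqrt_pos.2 h
  have h2 := Real.mul_self_sqrt h.le
  rw [← q_sq]; unfold m
  rw [div_eq_div_iff (by positivity) (by positivity)]
  calc √(q r) * (q r * √(q r)) = q r * (√(q r) * √(q r)) := by ring
    _ = _ := by rw [h2]; ring
theorem V_sqrt (r : ℝ) : V r * √(q r) ≤ 3 * m r := by
  rw [← sqrtq_m]
  calc _ ≤ 3 / (r ^ 2 + 1) * √(q r) := by gcongr; exact V_upper r
    _ = _ := by ring
theorem V1_sqrt (r : ℝ) : |V1 r| * √(q r) ≤ 8 * m r := by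
  rw [← sqrtq_m]
  calc _ ≤ 8 / (r ^ 2 + 1) * √(q r) := by gcongr; exact V1_bound r
    _ = _ := by ring

/-- approximate wave operators: equation with source `N`, zero data at time `T` -/
structure Ap (N : ℝ → ℝ → ℝ) (T : ℝ) (W : F2) : Prop where
  eq : ∀ t r, W.tt t r = W.rr t r - V r * W.f t r + N t r
  f0 : ∀ r, W.f T r = 0
  t0 : ∀ r, W.t T r = 0
  r0 : ∀ r, W.r T r = 0

theorem Sc.ap_ex (S : Sc U N Nt Nr C E) (T : ℝ) : ∃ W, Ap N T W := by
  obtain ⟨W, h, h0, h1, h2⟩ := lin_cauchy (N := fun t r => N (T - t) r) (N1 := fun t r => Nr (T - t) r)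
    (S.cN.comp (f := fun p : ℝ × ℝ => (T - p.1, p.2)) (by fun_prop)) (S.cNr.comp (f := fun p : ℝ × ℝ => (T - p.1, p.2)) (by fun_prop))
    (fun t r => S.hNr (T - t) r) S.hC.le (fun t r => (S.bN _ _).trans (by have := m_le_one r; have := S.hC; nlinarith))
  refine ⟨W.rev T, ⟨fun t r => ?_, fun r => ?_, fun r => ?_, fun r => ?_⟩⟩
  · have := h (T - t) r
    simpa [F2.rev] using this
  · simpa [F2.rev] using h0 r
  · simpa [F2.rev] using h1 r
  · simpa [F2.rev] using h2 r

theorem ef_sub_le (X Y : F2) (t r : ℝ) : ef (X.sub Y) t r ≤ 2 * ef X t r + 2 * ef Y t r := by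
  have hV := (V_pos r).le
  have e : 2 * ef X t r + 2 * ef Y t r - ef (X.sub Y) t r = ((X.t t r + Y.t t r) ^ 2 + (X.r t r + Y.r t r) ^ 2 + V r * (X.f t r + Y.f t r) ^ 2) / 2 := by
    simp only [ef, F2.sub]; ring
  have : 0 ≤ ((X.t t r + Y.t t r) ^ 2 + (X.r t r + Y.r t r) ^ 2 + V r * (X.f t r + Y.f t r) ^ 2) / 2 := by positivity
  linarith

theorem ef_sub_int {X Y : F2} {t : ℝ} (hX : Integrable (ef X t)) (hY : Integrable (ef Y t)) :
    Integrable (ef (X.sub Y) t) ∧ ∫ r, ef (X.sub Y) t r ≤ 2 * (∫ r, ef X t r) + 2 * ∫ r, ef Y t r := by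
  have i := integrable_of_le ((hX.const_mul 2).add (hY.const_mul 2)) (ef_cont' (X.sub Y) t) fun r => by
    rw [abs_of_nonneg (ef_nonneg _ _ _)]; exact ef_sub_le X Y t r
  refine ⟨i, ?_⟩
  have e := integral_add (hX.const_mul 2) (hY.const_mul 2)
  rw [integral_const_mul, integral_const_mul] at e
  rw [← e]
  exact integral_mono i ((hX.const_mul 2).add (hY.const_mul 2)) (ef_sub_le X Y t)

section
variable {T : ℝ} {W : F2}

theorem Ap.sub_eq (S : Sc U N Nt Nr C E) (A : Ap N T W) (t r : ℝ) : (U.sub W).tt t r = (U.sub W).rr t r - V r * (U.sub W).f t r := by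
  have h1 := S.eq t r; have h2 := A.eq t r
  simp only [F2.sub]; rw [h1, h2]; ring

theorem Ap.X (S : Sc U N Nt Nr C E) (A : Ap N T W) (t : ℝ) : Integrable (ef (U.sub W) t) ∧ ∫ r, ef (U.sub W) t r = ∫ r, ef U T r := by
  have e : ef (U.sub W) T = ef U T := by
    ext r; simp only [ef, F2.sub]; rw [A.f0, A.t0, A.r0]; ring
  have := flat_const (A.sub_eq S) (t0 := T) (by rw [e]; exact S.int T) t
  rwa [e] at this

theorem Ap.En (S : Sc U N Nt Nr C E) (A : Ap N T W) (t : ℝ) : Integrable (ef W t) ∧ ∫ r, ef W t r ≤ 4 * C := by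
  have h := ef_sub_int (S.int t) (A.X S t).1
  have e : ef (U.sub (U.sub W)) t = ef W t := by
    ext r; simp only [ef, F2.sub]; ring
  rw [e, (A.X S t).2] at h
  have h1 := S.bE t; have h2 := S.bE T
  exact ⟨h.1, by linarith [h.2]⟩

theorem abs_le_of_sob {x e q : ℝ} (h : x ^ 2 ≤ e * q) (he : 0 ≤ e) : |x| ≤ √e * √q := by
  rw [← Real.sqrt_mul he, ← Real.sqrt_sq_eq_abs]
  exact Real.sqrt_le_sqrt h

theorem Ap.bW (S : Sc U N Nt Nr C E) (A : Ap N T W) (t r : ℝ) : |W.f t r| ≤ √(8 * C) * √(q r) := by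
  have h := A.En S t
  refine abs_le_of_sob ((ef_sob h.1 r).trans ?_) (by linarith [S.hC])
  have := q_pos r
  exact mul_le_mul_of_nonneg_right (by linarith [h.2]) this.le

theorem Ap.bF (S : Sc U N Nt Nr C E) (A : Ap N T W) (t r : ℝ) : |V r * W.f t r - N t r| ≤ (3 * √(8 * C) + C) * m r := by
  have h1 := A.bW S t r; have h2 := S.bN t r
  have h3 := V_sqrt r
  have h4 := V_pos r
  calc |V r * W.f t r - N t r| ≤ |V r * W.f t r| + |N t r| := abs_sub _ _
    _ = V r * |W.f t r| + |N t r| := by rw [abs_mul, abs_of_pos h4]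
    _ ≤ V r * (√(8 * C) * √(q r)) + C * m r := by gcongr
    _ = √(8 * C) * (V r * √(q r)) + C * m r := by ring
    _ ≤ √(8 * C) * (3 * m r) + C * m r := by gcongr
    _ = _ := by ring

theorem char_l {W : F2} {F : ℝ → ℝ → ℝ} (h : ∀ t r, W.tt t r = W.rr t r - F t r) {l : ℝ} (hl : l = 1 ∨ l = -1) (t r x : ℝ) :
    HasDerivAt (fun x => W.t (t + 1 * x) (r + l * x) - l * W.r (t + 1 * x) (r + l * x)) (-F (t + 1 * x) (r + l * x)) x := by
  have d1 : HasDerivAt (fun x => t + 1 * x) 1 x := by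
    simpa using ((hasDerivAt_id x).const_mul 1).const_add t
  have d2 : HasDerivAt (fun x => r + l * x) l x := by
    simpa using ((hasDerivAt_id x).const_mul l).const_add r
  have e1 := chainC W.htt W.htr W.ctt W.ctr d1 d2
  have e2 := chainC W.hrt W.hrr W.ctr W.crr d1 d2
  refine (e1.fun_sub (e2.const_mul l)).congr_deriv ?_
  have := h (t + 1 * x) (r + l * x)
  rcases hl with rfl | rfl <;> linarith

theorem Sc.cFW (S : Sc U N Nt Nr C E) (W : F2) : Continuous fun p : ℝ × ℝ => V p.2 * W.f p.1 p.2 - N p.1 p.2 := by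
  have := S.cN; have := W.cf; fun_prop

theorem ray_ftc {W : F2} {F : ℝ → ℝ → ℝ} (h : ∀ t r, W.tt t r = W.rr t r - F t r) (cF : Continuous fun p : ℝ × ℝ => F p.1 p.2)
    {l : ℝ} (hl : l = 1 ∨ l = -1) (t r y : ℝ) :
    W.t t r - l * W.r t r = W.t (t + y) (r + l * y) - l * W.r (t + y) (r + l * y) + ∫ s in (0:ℝ)..y, F (t + 1 * s) (r + l * s) := by
  have cc : Continuous fun s => -F (t + 1 * s) (r + l * s) := (cF.comp (f := fun s : ℝ => (t + 1 * s, r + l * s)) (by fun_prop)).neg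
  have := intervalIntegral.integral_eq_sub_of_hasDerivAt (a := 0) (b := y) (fun x _ => char_l h hl t r x) (cc.intervalIntegrable _ _)
  rw [intervalIntegral.integral_neg] at this
  simp only [one_mul, mul_zero, add_zero] at this ⊢
  linarith

theorem Ap.ray (S : Sc U N Nt Nr C E) (A : Ap N T W) {l : ℝ} (hl : l = 1 ∨ l = -1) (t r : ℝ) :
    W.t t r - l * W.r t r = ∫ s in (0:ℝ)..(T - t), (V (r + l * s) * W.f (t + 1 * s) (r + l * s) - N (t + 1 * s) (r + l * s)) := by
  have h := ray_ftc (F := fun t r => V r * W.f t r - N t r) (fun t r => by rw [A.eq]; ring) (S.cFW W) hl t r (T - t)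
  rw [show t + (T - t) = T by ring, A.t0, A.r0] at h
  rw [h]; ring

theorem ray_bd {F : ℝ → ℝ → ℝ} {K : ℝ} (hK : 0 ≤ K) (hF : ∀ t r, |F t r| ≤ K * m r) {l : ℝ} (hl : l = 1 ∨ l = -1) (t r : ℝ) {y : ℝ} (hy : 0 ≤ y) :
    |∫ s in (0:ℝ)..y, F (t + 1 * s) (r + l * s)| ≤ K * ∫ s in Set.Ioi (0:ℝ), m (r + l * s) := by
  have h := (m_int_shift r hl).1
  have h1 : |∫ s in (0:ℝ)..y, F (t + 1 * s) (r + l * s)| ≤ ∫ s in (0:ℝ)..y, K * m (r + l * s) := by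
    rw [← Real.norm_eq_abs]
    exact intervalIntegral.norm_integral_le_of_norm_le hy (Eventually.of_forall fun s _ => hF _ _) (h.const_mul K).intervalIntegrable
  refine h1.trans ?_
  rw [intervalIntegral.integral_const_mul, intervalIntegral.integral_of_le hy]
  refine mul_le_mul_of_nonneg_left ?_ hK
  exact setIntegral_mono_set h.integrableOn (Eventually.of_forall fun s => (m_pos _).le) (Eventually.of_forall fun s (hs : s ∈ Set.Ioc 0 y) => hs.1)

theorem m_half (r : ℝ) {l : ℝ} (hl : l = 1 ∨ l = -1) : ∫ s in Set.Ioi (0:ℝ), m (r + l * s) ≤ Im := by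
  have h := m_int_shift r hl
  rw [← h.2]
  exact setIntegral_le_integral h.1 (Eventually.of_forall fun s => (m_pos _).le)

theorem m_tail' {r l : ℝ} (hl : l = 1 ∨ l = -1) (hr : 0 < l * r) : ∫ s in Set.Ioi (0:ℝ), m (r + l * s) ≤ 2 / √|r| := by
  rcases hl with rfl | rfl
  · rw [one_mul] at hr
    simpa [abs_of_pos hr] using m_tail hr
  · have hr' : 0 < -r := by linarith
    have e : ∀ s, m (r + -1 * s) = m (-r + s) := fun s => by rw [← m_neg]; congr 1; ring
    simp only [e]
    rw [abs_of_neg (by linarith)]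
    exact m_tail hr'

noncomputable def KK (C : ℝ) : ℝ := 3 * √(8 * C) + C
theorem Sc.K0 (S : Sc U N Nt Nr C E) : 0 ≤ KK C := by have := S.hC; unfold KK; positivity

theorem Ap.ab (S : Sc U N Nt Nr C E) (A : Ap N T W) {l : ℝ} (hl : l = 1 ∨ l = -1) {t : ℝ} (ht : t ≤ T) (r : ℝ) :
    |W.t t r - l * W.r t r| ≤ KK C * ∫ s in Set.Ioi (0:ℝ), m (r + l * s) := by
  rw [A.ray S hl]
  exact ray_bd (F := fun t r => V r * W.f t r - N t r) S.K0 (A.bF S) hl t r (by linarith)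

theorem Ap.ab1 (S : Sc U N Nt Nr C E) (A : Ap N T W) {l : ℝ} (hl : l = 1 ∨ l = -1) {t : ℝ} (ht : t ≤ T) (r : ℝ) :
    |W.t t r - l * W.r t r| ≤ KK C * Im := (A.ab S hl ht r).trans (mul_le_mul_of_nonneg_left (m_half r hl) S.K0)
theorem Ap.ab2 (S : Sc U N Nt Nr C E) (A : Ap N T W) {l : ℝ} (hl : l = 1 ∨ l = -1) {t : ℝ} (ht : t ≤ T) {r : ℝ} (hr : 0 < l * r) :
    (W.t t r - l * W.r t r) ^ 2 ≤ 4 * KK C ^ 2 / |r| := by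
  have h := (A.ab S hl ht r).trans (mul_le_mul_of_nonneg_left (m_tail' hl hr) S.K0)
  have hr0 : 0 < |r| := abs_pos.2 (by rintro rfl; simp at hr)
  calc _ = |W.t t r - l * W.r t r| ^ 2 := (sq_abs _).symm
    _ ≤ (KK C * (2 / √|r|)) ^ 2 := by gcongr
    _ = 4 * KK C ^ 2 / √|r| ^ 2 := by ring
    _ = _ := by rw [Real.sq_sqrt hr0.le]
end
end WMS

namespace WMS
variable {U : F2} {N Nt Nr : ℝ → ℝ → ℝ} {C E : ℝ}

theorem yg {η : ℝ} (h : 0 < η) (x y : ℝ) : |x * y| ≤ (1 / η * x ^ 2 + η * y ^ 2) / 2 := by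
  have e : 1 / η * x ^ 2 + η * y ^ 2 - 2 * (|x| * |y|) = (|x| - η * |y|) ^ 2 / η := by
    rw [sub_sq, mul_pow, sq_abs, sq_abs]; field_simp; ring
  have : 0 ≤ (|x| - η * |y|) ^ 2 / η := by positivity
  rw [abs_mul]; linarith

theorem yg3 {η v : ℝ} (h : 0 < η) (hv : 0 ≤ v) (a b c x y z : ℝ) :
    |a * x + b * y + v * c * z| ≤ 1 / η * ((a ^ 2 + b ^ 2 + v * c ^ 2) / 2) + η * ((x ^ 2 + y ^ 2 + v * z ^ 2) / 2) := by
  have h1 := yg h a x; have h2 := yg h b y; have h3 := mul_le_mul_of_nonneg_left (yg h c z) hv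
  have e : |v * c * z| = v * |c * z| := by rw [mul_assoc, abs_mul, abs_of_nonneg hv]
  have h4 := (abs_add_le (a * x + b * y) (v * c * z)).trans (add_le_add_left (abs_add_le _ _) _)
  rw [e] at h4
  refine h4.trans ((add_le_add (add_le_add h1 h2) h3).trans (le_of_eq ?_))
  ring

theorem yg4 {η v G l : ℝ} (h : 0 < η) (hv : 0 ≤ v) (hl : l = 1 ∨ l = -1) {ut ur u wt wr w : ℝ} (hG : (wt - l * wr) ^ 2 ≤ G) :
    |ut * wt + ur * wr + v * u * w| ≤ 1 / η * (v * u ^ 2 + (ut + l * ur) ^ 2 + G) + η * ((wt ^ 2 + wr ^ 2 + v * w ^ 2) / 2)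
      + η * ((ut ^ 2 + ur ^ 2 + v * u ^ 2) / 2) := by
  have l2 : l ^ 2 = 1 := by rcases hl with rfl | rfl <;> norm_num
  have h1 := yg h (ut + l * ur) (wt + l * wr)
  have h2 := yg h (wt - l * wr) (ut - l * ur)
  have h3 := mul_le_mul_of_nonneg_left (yg h u w) hv
  have e : |v * u * w| = v * |u * w| := by rw [mul_assoc, abs_mul, abs_of_nonneg hv]
  have e2 : ut * wt + ur * wr + v * u * w = ((ut + l * ur) * (wt + l * wr) + (wt - l * wr) * (ut - l * ur)) / 2 + v * u * w := by
    have : ((ut + l * ur) * (wt + l * wr) + (wt - l * wr) * (ut - l * ur)) / 2 = ut * wt + l ^ 2 * (ur * wr) := by ring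
    rw [this, l2]; ring
  have h4 : |ut * wt + ur * wr + v * u * w| ≤ (|(ut + l * ur) * (wt + l * wr)| + |(wt - l * wr) * (ut - l * ur)|) / 2 + v * |u * w| := by
    rw [e2, ← e]
    refine (abs_add_le _ _).trans (add_le_add_left ?_ _)
    rw [abs_div, abs_two]
    gcongr; exact abs_add_le _ _
  have h5 : (wt + l * wr) ^ 2 ≤ 2 * (wt ^ 2 + wr ^ 2) := by
    have : 2 * (wt ^ 2 + wr ^ 2) - (wt + l * wr) ^ 2 = (wt - l * wr) ^ 2 + 2 * (1 - l ^ 2) * wr ^ 2 := by ring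
    rw [l2] at this; nlinarith [sq_nonneg (wt - l * wr)]
  have h6 : (ut - l * ur) ^ 2 ≤ 2 * (ut ^ 2 + ur ^ 2) := by
    have : 2 * (ut ^ 2 + ur ^ 2) - (ut - l * ur) ^ 2 = (ut + l * ur) ^ 2 + 2 * (1 - l ^ 2) * ur ^ 2 := by ring
    rw [l2] at this; nlinarith [sq_nonneg (ut + l * ur)]
  have hi : 0 < 1 / η := by positivity
  have h7 := mul_le_mul_of_nonneg_left h5 h.le
  have h8 := mul_le_mul_of_nonneg_left h6 h.le
  have h9 := mul_le_mul_of_nonneg_left hG hi.le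
  have p1 : 0 ≤ 1 / η * (ut + l * ur) ^ 2 := by positivity
  have p2 : 0 ≤ 1 / η * (v * u ^ 2) := by positivity
  have p3 : 0 ≤ η * (v * u ^ 2) := by positivity
  have p4 : 0 ≤ 1 / η * G := mul_nonneg hi.le ((sq_nonneg _).trans hG)
  have e3 : v * ((1 / η * u ^ 2 + η * w ^ 2) / 2) = (1 / η * (v * u ^ 2) + η * (v * w ^ 2)) / 2 := by ring
  rw [e3] at h3
  linarith

noncomputable def pr (U W : F2) (t r : ℝ) : ℝ := U.t t r * W.t t r + U.r t r * W.r t r + V r * U.f t r * W.f t r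

/-- the shell contribution -/
noncomputable def sh (a b c r : ℝ) : ℝ := (Set.Icc a b).indicator (fun _ => c) r + (Set.Icc (-b) (-a)).indicator (fun _ => c) r

theorem sh_int {a b c : ℝ} (hab : a ≤ b) : Integrable (sh a b c) ∧ ∫ r, sh a b c r = 2 * (c * (b - a)) := by
  have i1 : ∀ x y : ℝ, Integrable ((Set.Icc x y).indicator fun _ => c) := fun x y =>
    (integrable_indicator_iff measurableSet_Icc).2 (by simp [IntegrableOn])
  have i2 : ∀ x y : ℝ, x ≤ y → ∫ r, (Set.Icc x y).indicator (fun _ => c) r = c * (y - x) := fun x y h => by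
    rw [integral_indicator measurableSet_Icc, setIntegral_const, Real.volume_real_Icc_of_le h]; simp [mul_comm]
  refine ⟨(i1 _ _).add (i1 _ _), ?_⟩
  have e := integral_add (i1 a b) (i1 (-b) (-a))
  rw [i2 _ _ hab, i2 _ _ (by linarith)] at e
  refine e.trans (by ring)

theorem sh_nonneg {a b c : ℝ} (hc : 0 ≤ c) (r : ℝ) : 0 ≤ sh a b c r :=
  add_nonneg (Set.indicator_nonneg (fun _ _ => hc) r) (Set.indicator_nonneg (fun _ _ => hc) r)

theorem sh_ge {a b c r : ℝ} (hc : 0 ≤ c) (h1 : a ≤ |r|) (h2 : |r| ≤ b) : c ≤ sh a b c r := by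
  unfold sh
  rcases le_total 0 r with h | h
  · rw [abs_of_nonneg h] at h1 h2
    rw [Set.indicator_of_mem (show r ∈ Set.Icc a b from ⟨h1, h2⟩)]
    have := Set.indicator_nonneg (s := Set.Icc (-b) (-a)) (f := fun _ => c) (fun _ _ => hc) r
    linarith
  · rw [abs_of_nonpos h] at h1 h2
    rw [Set.indicator_of_mem (show r ∈ Set.Icc (-b) (-a) from ⟨by linarith, by linarith⟩)]
    have := Set.indicator_nonneg (s := Set.Icc a b) (f := fun _ => c) (fun _ _ => hc) r
    linarith

section
variable {T' : ℝ} {W : F2}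

theorem Ap.pr_pt (S : Sc U N Nt Nr C E) (A : Ap N T' W) {T M l η : ℝ} (hT : 0 < T) (hTT : T ≤ T') (hη : 0 < η) (l0 : 0 < l) (hMT : M ≤ T) (r : ℝ) :
    |pr U W T r| ≤ 1 / η * (bad l U T r + (if T + M ≤ |r| then ef U T r else 0) + sh (l * T) (T + M) (4 * KK C ^ 2 / (l * T)) r)
      + η * ef W T r + η * ef U T r := by
  have hV := (V_pos r).le
  have e0 := ef_nonneg U T r
  have b0 := bad_nonneg l U T r
  have s0 : 0 ≤ sh (l * T) (T + M) (4 * KK C ^ 2 / (l * T)) r := sh_nonneg (by positivity) r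
  have i0 : 0 ≤ (if T + M ≤ |r| then ef U T r else 0) := by split_ifs <;> simp [e0]
  have hi : 0 < 1 / η := by positivity
  have hu : 0 ≤ V r * U.f T r ^ 2 := by positivity
  by_cases hc : ef U T r ≤ bad l U T r + (if T + M ≤ |r| then ef U T r else 0)
  · have h := yg3 hη hV (U.t T r) (U.r T r) (U.f T r) (W.t T r) (W.r T r) (W.f T r)
    have h2 : 1 / η * ef U T r ≤ 1 / η * (bad l U T r + (if T + M ≤ |r| then ef U T r else 0) + sh (l * T) (T + M) (4 * KK C ^ 2 / (l * T)) r) := by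
      gcongr; linarith
    have h3 : 0 ≤ η * ef U T r := by positivity
    unfold pr
    have h4 : |U.t T r * W.t T r + U.r T r * W.r T r + V r * U.f T r * W.f T r| ≤ 1 / η * ef U T r + η * ef W T r := h
    linarith
  have c1 : ¬ T + M ≤ |r| := fun h => hc (by rw [if_pos h]; linarith)
  have c2 : ¬ (|r| < l * T ∨ 2 * T ≤ |r|) := fun h => hc (by unfold bad; rw [if_pos h]; linarith)
  push Not at c1 c2
  have hlT : 0 < l * T := by positivity
  have hr0 : 0 < |r| := by linarith [c2.1]
  have key : ∀ l' : ℝ, (l' = 1 ∨ l' = -1) → 0 < l' * r → bad l U T r = V r * U.f T r ^ 2 + (U.t T r + l' * U.r T r) ^ 2 →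
      |pr U W T r| ≤ 1 / η * (bad l U T r + (if T + M ≤ |r| then ef U T r else 0) + sh (l * T) (T + M) (4 * KK C ^ 2 / (l * T)) r)
      + η * ef W T r + η * ef U T r := by
    intro l' hl' hlr hb
    have hG : (W.t T r - l' * W.r T r) ^ 2 ≤ 4 * KK C ^ 2 / (l * T) := by
      refine (A.ab2 S hl' hTT hlr).trans ?_
      gcongr; exact c2.1
    have h := yg4 hη hV hl' (ut := U.t T r) (ur := U.r T r) (u := U.f T r) (w := W.f T r) hG
    have hs := sh_ge (a := l * T) (b := T + M) (c := 4 * KK C ^ 2 / (l * T)) (r := r) (by positivity) c2.1 c1.le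
    have h2 : |pr U W T r| ≤ 1 / η * (bad l U T r + 4 * KK C ^ 2 / (l * T)) + η * ef W T r + η * ef U T r := by
      rw [hb]; exact h
    have h3 : 1 / η * (bad l U T r + 4 * KK C ^ 2 / (l * T)) ≤ 1 / η * (bad l U T r + (if T + M ≤ |r| then ef U T r else 0) + sh (l * T) (T + M) (4 * KK C ^ 2 / (l * T)) r) := by
      refine mul_le_mul_of_nonneg_left ?_ hi.le
      linarith
    linarith
  have c2' : ¬ (|r| < l * T ∨ 2 * T ≤ |r|) := by push Not; exact c2
  rcases lt_or_ge 0 r with h | h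
  · refine key 1 (Or.inl rfl) (by linarith) ?_
    unfold bad; rw [if_neg c2', if_pos h, one_mul]
  · have h' : r < 0 := lt_of_le_of_ne h (by rintro rfl; simp at hr0)
    refine key (-1) (Or.inr rfl) (by linarith) ?_
    unfold bad; rw [if_neg c2', if_neg (by linarith)]; ring

theorem Ap.pr_int (S : Sc U N Nt Nr C E) (A : Ap N T' W) {T M l η : ℝ} (hT : 0 < T) (hTT : T ≤ T') (hη : 0 < η) (l0 : 0 < l) (hMT : M ≤ T)
    (hab : l * T ≤ T + M) :
    ∫ r, ef W T r ≤ (∫ r, ef U T' r) - (∫ r, ef U T r) + (1 / η * ((∫ r, bad l U T r) + (∫ r in {r | T + M ≤ |r|}, ef U T r)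
      + 2 * (4 * KK C ^ 2 / (l * T) * (T + M - l * T))) + η * (4 * C) + η * C) := by
  have iU := S.int T
  have iW := A.En S T
  have iX := A.X S T
  have iB := bad_int S l T
  have iT := ind_integral iU (T + M)
  have iS := sh_int (c := 4 * KK C ^ 2 / (l * T)) hab
  have j1 := ((iB.add iT.1).add iS.1).const_mul (1 / η)
  have j2 := (j1.add (iW.1.const_mul η)).add (iU.const_mul η)
  have hp := A.pr_pt S hT hTT hη l0 hMT
  have cp : Continuous (pr U W T) := by
    unfold pr
    have := U.cf1 T; have := U.ct1 T; have := U.cr1 T; have := W.cf1 T; have := W.ct1 T; have := W.cr1 T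
    fun_prop
  have ip : Integrable (pr U W T) := integrable_of_le j2 cp hp
  have e1 : ∫ r, ef W T r = (∫ r, ef (U.sub W) T r) - (∫ r, ef U T r) + ∫ r, pr U W T r := by
    have a := integral_sub iX.1 iU
    have b := integral_add (iX.1.sub iU) ip
    simp only [Pi.sub_apply] at b
    rw [a] at b
    refine Eq.trans ?_ b
    congr 1; ext r; simp only [ef, pr, F2.sub]; ring
  have e2 : ∫ r, pr U W T r ≤ 1 / η * ((∫ r, bad l U T r) + (∫ r in {r | T + M ≤ |r|}, ef U T r)
      + 2 * (4 * KK C ^ 2 / (l * T) * (T + M - l * T))) + η * (∫ r, ef W T r) + η * ∫ r, ef U T r := by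
    have h := integral_mono ip j2 (fun r => (le_abs_self _).trans (hp r))
    refine h.trans (le_of_eq ?_)
    have a1 := integral_add (j1.add (iW.1.const_mul η)) (iU.const_mul η)
    have a2 := integral_add j1 (iW.1.const_mul η)
    have a3 := integral_add (iB.add iT.1) iS.1
    have a4 := integral_add iB iT.1
    simp only [Pi.add_apply, integral_const_mul] at a1 a2 a3 a4 ⊢
    rw [a1, a2, a3, a4, iT.2, iS.2]
  rw [e1, iX.2]
  have k1 := S.bE T
  have k2 := mul_le_mul_of_nonneg_left iW.2 hη.le
  have k3 := mul_le_mul_of_nonneg_left k1 hη.le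
  linarith
end

theorem Sc.unif (S : Sc U N Nt Nr C E) {ε : ℝ} (hε : 0 < ε) :
    ∃ T0 > 0, ∀ T ≥ T0, ∀ T' ≥ T, ∀ W, Ap N T' W → ∫ r, ef W T r ≤ ε := by
  have hC := S.hC
  set K := KK C with hK
  set η := ε / (20 * C) with hη
  have η0 : 0 < η := by positivity
  set δ := η * ε / 12 with hδ
  have δ0 : 0 < δ := by positivity
  set c := 16 * K ^ 2 + 1 with hc
  have c0 : 0 < c := by positivity
  set d := min (1 / 2) (δ / (2 * c)) with hd
  have d0 : 0 < d := by positivity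
  have d1 : d ≤ 1 / 2 := min_le_left _ _
  have d2 : d ≤ δ / (2 * c) := min_le_right _ _
  obtain ⟨M, M0, hM⟩ := S.tail δ δ0
  obtain ⟨T1, T10, hT1⟩ := S.bad_small (l := 1 - d) (by linarith) (by linarith) δ0
  obtain ⟨T2, T20, hT2⟩ := S.conv (ε / 8) (by positivity)
  refine ⟨max (max T1 T2) (max M (2 * c * M / δ)), by positivity, fun T hT T' hT' W A => ?_⟩
  simp only [ge_iff_le, max_le_iff] at hT
  obtain ⟨⟨t1, t2⟩, t3, t4⟩ := hT
  have T0 : 0 < T := by linarith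
  have h := A.pr_int S T0 hT' η0 (l := 1 - d) (by linarith) t3 (by nlinarith)
  have h1 := hT1 T t1
  have h2 := hM M le_rfl T T0.le
  have h3 := abs_le.1 (hT2 T t2)
  have h4 := abs_le.1 (hT2 T' (by linarith))
  have h5 : 2 * (4 * K ^ 2 / ((1 - d) * T) * (T + M - (1 - d) * T)) ≤ δ := by
    have hMT : M ≤ δ / (2 * c) * T := by
      rw [div_le_iff₀ δ0] at t4
      rw [div_mul_eq_mul_div, le_div_iff₀ (by positivity)]; linarith
    have hdT : d * T ≤ δ / (2 * c) * T := by gcongr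
    have hx : T + M - (1 - d) * T ≤ δ / c * T := by
      have : δ / c * T = δ / (2 * c) * T + δ / (2 * c) * T := by field_simp; ring
      rw [this]; linarith
    have hy : 4 * K ^ 2 / ((1 - d) * T) ≤ 4 * K ^ 2 / (1 / 2 * T) := by gcongr; linarith
    calc 2 * (4 * K ^ 2 / ((1 - d) * T) * (T + M - (1 - d) * T)) ≤ 2 * (4 * K ^ 2 / (1 / 2 * T) * (δ / c * T)) := by
          have : 0 ≤ T + M - (1 - d) * T := by nlinarith
          gcongr
      _ = 16 * K ^ 2 * δ / c := by field_simp; ring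
      _ ≤ c * δ / c := by gcongr; rw [hc]; linarith
      _ = δ := by field_simp
  have h6 : 1 / η * ((∫ r, bad (1 - d) U T r) + (∫ r in {r | T + M ≤ |r|}, ef U T r) + 2 * (4 * K ^ 2 / ((1 - d) * T) * (T + M - (1 - d) * T))) ≤ 1 / η * (3 * δ) := by
    refine mul_le_mul_of_nonneg_left ?_ (by positivity)
    linarith
  have h7 : 1 / η * (3 * δ) = ε / 4 := by rw [hδ]; field_simp; ring
  have h8 : η * (4 * C) + η * C = ε / 4 := by rw [hη]; field_simp; ring
  linarith [h3.1, h4.2]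
end WMS

namespace WMS
variable {U : F2} {N Nt Nr : ℝ → ℝ → ℝ} {C E : ℝ}

theorem shift0 {f g : ℝ → ℝ → ℝ} {p : ℝ} (h : ∀ t r, HasDerivAt (fun x => f (t + 1 * x) (r + p * x)) (g t r) 0) (t r x : ℝ) :
    HasDerivAt (fun x => f (t + 1 * x) (r + p * x)) (g (t + 1 * x) (r + p * x)) x := by
  have h1 := h (t + 1 * x) (r + p * x)
  have h2 : HasDerivAt (fun y : ℝ => y - x) 1 x := (hasDerivAt_id x).sub_const x
  have h3 := HasDerivAt.comp (h := fun y : ℝ => y - x) x (by simpa only [sub_self] using h1) h2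
  rw [mul_one] at h3
  refine h3.congr_of_eventuallyEq (Eventually.of_forall fun y => ?_)
  simp only [Function.comp]
  congr 1 <;> ring

theorem partials_of_char {f P M : ℝ → ℝ → ℝ} (hP : ∀ t r, HasDerivAt (fun x => f (t + 1 * x) (r + 1 * x)) (P t r) 0)
    (hM : ∀ t r, HasDerivAt (fun x => f (t + 1 * x) (r + -1 * x)) (M t r) 0)
    (cP : Continuous fun p : ℝ × ℝ => P p.1 p.2) (cM : Continuous fun p : ℝ × ℝ => M p.1 p.2) (t r : ℝ) :
    HasDerivAt (fun s => f s r) ((P t r + M t r) / 2) t ∧ HasDerivAt (fun s => f t s) ((P t r - M t r) / 2) r := by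
  have key : ∀ {x y : ℝ → ℝ} {x' y' s : ℝ}, HasDerivAt x x' s → HasDerivAt y y' s →
      HasDerivAt (fun s => f (x s + y s) (x s - y s)) (P (x s + y s) (x s - y s) * x' + M (x s + y s) (x s - y s) * y') s := by
    intro x y x' y' s hx hy
    refine chainC (f := fun a b => f (a + b) (a - b)) (ft := fun a b => P (a + b) (a - b)) (fr := fun a b => M (a + b) (a - b))
      (fun a b => ?_) (fun a b => ?_) (cP.comp (f := fun p : ℝ × ℝ => (p.1 + p.2, p.1 - p.2)) (by fun_prop))
      (cM.comp (f := fun p : ℝ × ℝ => (p.1 + p.2, p.1 - p.2)) (by fun_prop)) hx hy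
    · have := shift0 hP b (-b) a
      convert this using 2 <;> first | (congr 1 <;> ring) | ring
    · have := shift0 hM a a b
      convert this using 2 <;> first | (congr 1 <;> ring) | ring
  constructor
  · have := key (x := fun s => (s + r) / 2) (y := fun s => (s - r) / 2) (((hasDerivAt_id t).add_const r).div_const 2) (((hasDerivAt_id t).sub_const r).div_const 2)
    have e1 : (t + r) / 2 + (t - r) / 2 = t := by ring
    have e2 : (t + r) / 2 - (t - r) / 2 = r := by ring
    simp only [id, e1, e2] at this
    refine (this.congr_of_eventuallyEq (Eventually.of_forall fun s => ?_)).congr_deriv (by ring)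
    simp only; congr 1 <;> ring
  · have := key (x := fun s => (t + s) / 2) (y := fun s => (t - s) / 2) (((hasDerivAt_id r).const_add t).div_const 2) (((hasDerivAt_id r).const_sub t).div_const 2)
    have e1 : (t + r) / 2 + (t - r) / 2 = t := by ring
    have e2 : (t + r) / 2 - (t - r) / 2 = r := by ring
    simp only [id, e1, e2] at this
    refine (this.congr_of_eventuallyEq (Eventually.of_forall fun s => ?_)).congr_deriv (by ring)
    simp only; congr 1 <;> ring

theorem Jd_cont_loc {G : ℝ → ℝ → ℝ} (cG : Continuous fun p : ℝ × ℝ => G p.1 p.2) {l : ℝ} (hl : l = 1 ∨ l = -1)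
    (hB : ∀ t r, ∃ B, ∀ t1 r1, |t1 - t| ≤ 1 → |r1 - r| ≤ 1 → ∀ s > 0, |G (t1 + 1 * s) (r1 + l * s)| ≤ B * m (r + l * s)) :
    Continuous fun p : ℝ × ℝ => Jd G 1 l p.1 p.2 := by
  rw [continuous_iff_continuousAt]
  intro p
  obtain ⟨B, hB⟩ := hB p.1 p.2
  unfold Jd
  apply continuousAt_of_dominated (bound := fun s => B * m (p.2 + l * s))
  · refine Eventually.of_forall fun x => ?_
    exact (cG.comp (f := fun s => (x.1 + 1 * s, x.2 + l * s)) (by fun_prop)).aestronglyMeasurable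
  · have h2 : ∀ᶠ x : ℝ × ℝ in nhds p, |x.2 - p.2| < 1 := by
      have := (continuous_snd.tendsto p).eventually (Metric.ball_mem_nhds p.2 one_pos)
      simpa [Metric.mem_ball, Real.dist_eq] using this
    have h1 : ∀ᶠ x : ℝ × ℝ in nhds p, |x.1 - p.1| < 1 := by
      have := (continuous_fst.tendsto p).eventually (Metric.ball_mem_nhds p.1 one_pos)
      simpa [Metric.mem_ball, Real.dist_eq] using this
    filter_upwards [h1, h2] with x hx hx2
    refine (ae_restrict_iff' measurableSet_Ioi).2 (Eventually.of_forall fun s hs => ?_)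
    exact hB _ _ hx.le hx2.le s hs
  · exact ((m_int_shift p.2 hl).1.const_mul B).integrableOn
  · refine Eventually.of_forall fun s => ?_
    exact (cG.comp (f := fun x : ℝ × ℝ => (x.1 + 1 * s, x.2 + l * s)) (by fun_prop)).continuousAt

theorem Sc.Uray (S : Sc U N Nt Nr C E) {l : ℝ} (hl : l = 1 ∨ l = -1) (t r : ℝ) : ∃ D, 0 ≤ D ∧
    ∀ t1 r1, |t1 - t| ≤ 1 → |r1 - r| ≤ 1 → ∀ s > 0, |U.t (t1 + 1 * s) (r1 + l * s) - l * U.r (t1 + 1 * s) (r1 + l * s)| ≤ D := by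
  have hC := S.hC
  have cc : Continuous fun p : ℝ × ℝ => |U.t p.1 p.2 - l * U.r p.1 p.2| := by
    have := U.ct; have := U.cr; fun_prop
  obtain ⟨D, hD⟩ := ((isCompact_closedBall (t, r) 1).image cc).bddAbove
  have bF : ∀ t r, |V r * U.f t r - N t r| ≤ (4 * C) * m r := fun t r => by
    have h1 := S.bU t r; have h2 := S.bN t r; have h3 := V_sqrt r; have h4 := V_pos r
    calc |V r * U.f t r - N t r| ≤ |V r * U.f t r| + |N t r| := abs_sub _ _
      _ = V r * |U.f t r| + |N t r| := by rw [abs_mul, abs_of_pos h4]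
      _ ≤ V r * (C * √(q r)) + C * m r := by gcongr
      _ ≤ _ := by nlinarith
  refine ⟨max D 0 + 4 * C * Im, by have := Im_nonneg; have := le_max_right D 0; positivity, fun t1 r1 h1 h2 s hs => ?_⟩
  have hb : |U.t t1 r1 - l * U.r t1 r1| ≤ max D 0 := (hD ⟨(t1, r1), by
    rw [Metric.mem_closedBall, Prod.dist_eq, Real.dist_eq, Real.dist_eq]; exact max_le h1 h2, rfl⟩).trans (le_max_left _ _)
  have e := ray_ftc (F := fun t r => V r * U.f t r - N t r) (fun t r => by rw [S.eq]; ring) (S.cFW U) hl t1 r1 s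
  have hr := (ray_bd (F := fun t r => V r * U.f t r - N t r) (K := 4 * C) (by positivity) bF hl t1 r1 hs.le).trans
    (mul_le_mul_of_nonneg_left (m_half r1 hl) (by positivity))
  rw [one_mul]
  rw [show U.t (t1 + s) (r1 + l * s) - l * U.r (t1 + s) (r1 + l * s) = (U.t t1 r1 - l * U.r t1 r1) - _ from (sub_eq_of_eq_add e).symm]
  exact (abs_sub _ _).trans (add_le_add hb hr)

theorem Sc.bNl (S : Sc U N Nt Nr C E) {l : ℝ} (hl : l = 1 ∨ l = -1) (t r : ℝ) :
    |Nt t r - l * Nr t r| ≤ C * (|U.t t r - l * U.r t r| + 1) * m r := by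
  rcases hl with rfl | rfl
  · simpa using S.bNm t r
  · simpa [sub_neg_eq_add] using S.bNp t r

theorem V_m (r : ℝ) : V r ≤ 3 * m r := by
  have h := V_sqrt r; have h2 := V_pos r
  have : 1 ≤ √(q r) := Real.one_le_sqrt.2 (one_le_q r)
  nlinarith

/-- regularity of a function given by characteristic integrals -/
theorem Sc.reg (S : Sc U N Nt Nr C E) {L : ℝ → ℝ → ℝ} (cL : Continuous fun p : ℝ × ℝ => L p.1 p.2) {K0 K : ℝ}
    (hK0 : 0 ≤ K0) (hK : 0 ≤ K) (bL : ∀ t r, |L t r| ≤ K0 * √(q r)) (bF : ∀ t r, |V r * L t r - N t r| ≤ K * m r)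
    (hd : ∀ l : ℝ, l = 1 ∨ l = -1 → ∀ t r, HasDerivAt (fun x => L (t + 1 * x) (r + -l * x)) (Jd (fun t r => V r * L t r - N t r) 1 l t r) 0) :
    ∃ W : F2, W.f = L ∧ (∀ t r, W.t t r = (Jd (fun t r => V r * L t r - N t r) 1 (-1) t r + Jd (fun t r => V r * L t r - N t r) 1 1 t r) / 2) ∧
      (∀ t r, W.r t r = (Jd (fun t r => V r * L t r - N t r) 1 (-1) t r - Jd (fun t r => V r * L t r - N t r) 1 1 t r) / 2) ∧
      ∀ t r, W.tt t r = W.rr t r - V r * W.f t r + N t r := by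
  have hC := S.hC
  have hI := Im_nonneg
  set F : ℝ → ℝ → ℝ := fun t r => V r * L t r - N t r with hF
  have cF : Continuous fun p : ℝ × ℝ => F p.1 p.2 := by
    have := S.cN; simp only [hF]; fun_prop
  have ca : ∀ l : ℝ, l = 1 ∨ l = -1 → Continuous fun p : ℝ × ℝ => Jd F 1 l p.1 p.2 := fun l hl => Jd_cont cF bF hK 1 hl
  let G : ℝ → ℝ → ℝ → ℝ := fun l t r => V r * Jd F 1 l t r - l * V1 r * L t r - (Nt t r - l * Nr t r)
  have cG : ∀ l : ℝ, l = 1 ∨ l = -1 → Continuous fun p : ℝ × ℝ => G l p.1 p.2 := fun l hl => by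
    have := ca l hl; have := S.cNt; have := S.cNr; have := continuous_V1; simp only [G]; fun_prop
  have bG : ∀ l : ℝ, l = 1 ∨ l = -1 → ∀ t r, ∃ B, ∀ t1 r1, |t1 - t| ≤ 1 → |r1 - r| ≤ 1 → ∀ s > 0,
      |G l (t1 + 1 * s) (r1 + l * s)| ≤ B * m (r + l * s) := by
    intro l hl t r
    obtain ⟨D, hD0, hD⟩ := S.Uray hl t r
    refine ⟨(3 * (K * Im) + 8 * K0 + C * (D + 1)) * 4, fun t1 r1 h1 h2 s hs => ?_⟩
    have hu := hD t1 r1 h1 h2 s hs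
    have hm : m (r1 + l * s) ≤ 4 * m (r + l * s) := m_shift (by rw [show r1 + l * s - (r + l * s) = r1 - r by ring]; exact h2)
    set y := r1 + l * s
    set x := t1 + 1 * s
    have hmy := m_pos y
    have hal : |l| = 1 := by rcases hl with rfl | rfl <;> simp
    have b1 : |V y * Jd F 1 l x y| ≤ 3 * (K * Im) * m y := by
      rw [abs_mul, abs_of_pos (V_pos y)]
      calc _ ≤ (3 * m y) * (K * Im) := mul_le_mul (V_m y) (Jd_bound cF bF hK 1 hl x y) (abs_nonneg _) (by positivity)
        _ = _ := by ring
    have b2 : |l * V1 y * L x y| ≤ 8 * K0 * m y := by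
      rw [abs_mul, abs_mul, hal, one_mul]
      calc _ ≤ |V1 y| * (K0 * √(q y)) := by gcongr; exact bL x y
        _ = K0 * (|V1 y| * √(q y)) := by ring
        _ ≤ K0 * (8 * m y) := mul_le_mul_of_nonneg_left (V1_sqrt y) hK0
        _ = _ := by ring
    have b3 : |Nt x y - l * Nr x y| ≤ C * (D + 1) * m y := (S.bNl hl x y).trans (by gcongr)
    calc |G l x y| ≤ |V y * Jd F 1 l x y| + |l * V1 y * L x y| + |Nt x y - l * Nr x y| :=
          (abs_sub _ _).trans (by gcongr; exact abs_sub _ _)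
      _ ≤ (3 * (K * Im) + 8 * K0 + C * (D + 1)) * m y := by linarith
      _ ≤ (3 * (K * Im) + 8 * K0 + C * (D + 1)) * (4 * m (r + l * s)) := by gcongr
      _ = _ := by ring
  have cJ : ∀ l : ℝ, l = 1 ∨ l = -1 → Continuous fun p : ℝ × ℝ => Jd (G l) 1 l p.1 p.2 := fun l hl =>
    Jd_cont_loc (cG l hl) hl (bG l hl)
  have dF : ∀ l : ℝ, l = 1 ∨ l = -1 → ∀ t r, HasDerivAt (fun x => F (t + 1 * x) (r + -l * x)) (G l t r) 0 := by
    intro l hl t r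
    have d1 : HasDerivAt (fun x : ℝ => t + 1 * x) 1 0 := by
      simpa using ((hasDerivAt_id (0:ℝ)).const_mul 1).const_add t
    have d2 : HasDerivAt (fun x : ℝ => r + -l * x) (-l) 0 := by
      simpa using ((hasDerivAt_id (0:ℝ)).const_mul (-l)).const_add r
    have e1 := chainC S.hNt S.hNr S.cNt S.cNr d1 d2
    have e2 : HasDerivAt (fun x => V (r + -l * x)) (V1 r * -l) 0 := by
      refine HasDerivAt.comp (h := fun x : ℝ => r + -l * x) (h₂ := V) (0:ℝ) ?_ d2
      simpa using hasDerivAt_V r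
    refine ((e2.fun_mul (hd l hl t r)).fun_sub e1).congr_deriv ?_
    simp only [mul_zero, add_zero, G]; ring
  have dJ : ∀ l : ℝ, l = 1 ∨ l = -1 → ∀ t r, HasDerivAt (fun x => Jd F 1 l (t + 1 * x) (r + -l * x)) (Jd (G l) 1 l t r) 0 := by
    intro l hl t r
    obtain ⟨B, hB⟩ := bG l hl t r
    have hal : |l| = 1 := by rcases hl with rfl | rfl <;> simp
    refine Jd_deriv (B := B) cF (cG l hl) hl (Jd_int cF bF 1 hl t r).integrableOn (fun s x => ?_) (fun s hs x hx => ?_)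
    · have h := shift0 (dF l hl) (t + 1 * s) (r + l * s) x
      have e : ∀ x : ℝ, t + 1 * s + 1 * x = t + 1 * x + 1 * s := fun x => by ring
      have e' : ∀ x : ℝ, r + l * s + -l * x = r + -l * x + l * s := fun x => by ring
      simp only [e, e'] at h
      exact h
    · refine hB _ _ ?_ ?_ s hs
      · simpa using hx.le
      · simpa [abs_mul, hal] using hx.le
  have dR : ∀ l : ℝ, l = 1 ∨ l = -1 → ∀ t r, HasDerivAt (fun x => Jd F 1 l (t + 1 * x) (r + l * x)) (-F t r) 0 := by
    intro l hl t r
    simpa using Jd_hasDeriv_ray cF bF 1 hl t r 0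
  have l1 : (1:ℝ) = 1 ∨ (1:ℝ) = -1 := Or.inl rfl
  have l2 : (-1:ℝ) = 1 ∨ (-1:ℝ) = -1 := Or.inr rfl
  have c1 := ca 1 l1; have c2 := ca (-1) l2
  have cJ1 := cJ 1 l1; have cJ2 := cJ (-1) l2
  have cFn : Continuous fun p : ℝ × ℝ => -F p.1 p.2 := cF.neg
  have pL := partials_of_char (f := L) (by simpa only [neg_neg] using hd (-1) l2) (hd 1 l1) c2 c1
  have p1 := partials_of_char (f := Jd F 1 1) (dR 1 l1) (dJ 1 l1) cFn cJ1
  have p2 := partials_of_char (f := Jd F 1 (-1)) (by simpa only [neg_neg] using dJ (-1) l2) (dR (-1) l2) cJ2 cFn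
  refine ⟨{ f := L
            t := fun t r => (Jd F 1 (-1) t r + Jd F 1 1 t r) / 2
            r := fun t r => (Jd F 1 (-1) t r - Jd F 1 1 t r) / 2
            tt := fun t r => (Jd (G 1) 1 1 t r + Jd (G (-1)) 1 (-1) t r - 2 * F t r) / 4
            tr := fun t r => (Jd (G (-1)) 1 (-1) t r - Jd (G 1) 1 1 t r) / 4
            rr := fun t r => (Jd (G 1) 1 1 t r + Jd (G (-1)) 1 (-1) t r + 2 * F t r) / 4
            ht := fun t r => (pL t r).1
            hr := fun t r => (pL t r).2
            htt := fun t r => (((p2 t r).1.fun_add (p1 t r).1).div_const 2).congr_deriv (by ring)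
            htr := fun t r => (((p2 t r).2.fun_add (p1 t r).2).div_const 2).congr_deriv (by ring)
            hrt := fun t r => (((p2 t r).1.fun_sub (p1 t r).1).div_const 2).congr_deriv (by ring)
            hrr := fun t r => (((p2 t r).2.fun_sub (p1 t r).2).div_const 2).congr_deriv (by ring)
            ctt := by fun_prop
            ctr := by fun_prop
            crr := by fun_prop }, rfl, fun _ _ => rfl, fun _ _ => rfl, fun t r => ?_⟩
  simp only [hF]; ring
end WMS

namespace WMS
variable {U : F2} {N Nt Nr : ℝ → ℝ → ℝ} {C E : ℝ}

theorem Sc.cau (S : Sc U N Nt Nr C E) {δ : ℝ} (hδ : 0 < δ) : ∃ T0 : ℝ, ∀ T ≥ T0, ∀ T' ≥ T, ∀ W W', Ap N T W → Ap N T' W' →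
    ∀ t r, |W'.f t r - W.f t r| ≤ δ * √(q r) := by
  obtain ⟨T0, -, h0⟩ := S.unif (ε := δ ^ 2 / 2) (by positivity)
  refine ⟨T0, fun T hT T' hT' W W' A A' t r => ?_⟩
  have e : ef (W'.sub W) T = ef W' T := by
    ext r; simp only [ef, F2.sub]; rw [A.f0, A.t0, A.r0]; ring
  have h := flat_const (X := W'.sub W) (fun t r => by
    have h1 := A.eq t r; have h2 := A'.eq t r
    simp only [F2.sub]; rw [h1, h2]; ring) (t0 := T) (by rw [e]; exact (A'.En S T).1) t
  rw [e] at h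
  have h1 := h0 T hT T' hT' W' A'
  have h2 := ef_sob h.1 r
  have h3 : (W'.f t r - W.f t r) ^ 2 ≤ δ ^ 2 * q r := h2.trans (mul_le_mul_of_nonneg_right (by linarith [h.2]) (q_pos r).le)
  have := abs_le_of_sob h3 (by positivity)
  rwa [Real.sqrt_sq hδ.le] at this

/-- the data of the limit construction -/
structure Lm (N : ℝ → ℝ → ℝ) (w : ℝ → F2) (L : ℝ → ℝ → ℝ) : Prop where
  A : ∀ T, Ap N T (w T)
  u : ∀ δ > 0, ∃ T0 : ℝ, ∀ T ≥ T0, ∀ t r, |(w T).f t r - L t r| ≤ δ * √(q r)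

theorem Sc.lm_ex (S : Sc U N Nt Nr C E) : ∃ w L, Lm N w L := by
  choose w hw using S.ap_ex
  have key : ∀ t r, ∃ l, Tendsto (fun T => (w T).f t r) atTop (nhds l) := fun t r => by
    refine cauchySeq_tendsto_of_complete (Metric.cauchySeq_iff'.2 fun ε hε => ?_)
    have hq := Real.sqrt_pos.2 (q_pos r)
    obtain ⟨T0, h0⟩ := S.cau (δ := ε / 2 / √(q r)) (by positivity)
    refine ⟨T0, fun T hT => ?_⟩
    have := h0 T0 le_rfl T hT _ _ (hw _) (hw _) t r
    rw [div_mul_cancel₀ _ hq.ne'] at this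
    rw [Real.dist_eq]; linarith
  choose L hL using key
  refine ⟨w, L, hw, fun δ hδ => ?_⟩
  obtain ⟨T0, h0⟩ := S.cau hδ
  refine ⟨T0, fun T hT t r => ?_⟩
  have h1 := ((hL t r).sub_const ((w T).f t r)).abs
  rw [abs_sub_comm]
  exact le_of_tendsto h1 (eventually_ge_atTop T |>.mono fun T' hT' => h0 T hT T' hT' _ _ (hw _) (hw _) t r)

variable {w : ℝ → F2} {L : ℝ → ℝ → ℝ}

theorem Lm.tt (H : Lm N w L) (t r : ℝ) : Tendsto (fun T => (w T).f t r) atTop (nhds (L t r)) := by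
  rw [Metric.tendsto_atTop]
  intro ε hε
  have hq := Real.sqrt_pos.2 (q_pos r)
  obtain ⟨T0, h0⟩ := H.u (ε / 2 / √(q r)) (by positivity)
  refine ⟨T0, fun T hT => ?_⟩
  have := h0 T hT t r
  rw [div_mul_cancel₀ _ hq.ne'] at this
  rw [Real.dist_eq]; linarith

theorem Lm.cL (H : Lm N w L) : Continuous fun p : ℝ × ℝ => L p.1 p.2 := by
  have hq : ∀ r, 0 < √(q r) := fun r => Real.sqrt_pos.2 (q_pos r)
  have cq : Continuous fun p : ℝ × ℝ => √(q p.2) := Real.continuous_sqrt.comp (continuous_q.comp continuous_snd)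
  have hu : TendstoUniformly (fun (T : ℝ) (p : ℝ × ℝ) => (w T).f p.1 p.2 / √(q p.2)) (fun p => L p.1 p.2 / √(q p.2)) atTop := by
    rw [Metric.tendstoUniformly_iff]
    intro ε hε
    obtain ⟨T0, h0⟩ := H.u (ε / 2) (by positivity)
    filter_upwards [eventually_ge_atTop T0] with T hT p
    have := h0 T hT p.1 p.2
    rw [dist_comm, Real.dist_eq, ← sub_div, abs_div, abs_of_pos (hq _), div_lt_iff₀ (hq _)]
    nlinarith [hq p.2]
  have c := hu.continuous (Eventually.of_forall fun T => ((w T).cf.div cq fun p => (hq _).ne')).frequently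
  have e : (fun p : ℝ × ℝ => L p.1 p.2) = fun p => L p.1 p.2 / √(q p.2) * √(q p.2) := by
    ext p; rw [div_mul_cancel₀ _ (hq _).ne']
  rw [e]; exact c.mul cq

theorem Lm.bL (H : Lm N w L) (S : Sc U N Nt Nr C E) (t r : ℝ) : |L t r| ≤ √(8 * C) * √(q r) :=
  le_of_tendsto (H.tt t r).abs (Eventually.of_forall fun T => (H.A T).bW S t r)

theorem Lm.bF (H : Lm N w L) (S : Sc U N Nt Nr C E) (t r : ℝ) : |V r * L t r - N t r| ≤ KK C * m r :=
  le_of_tendsto (((H.tt t r).const_mul (V r)).sub_const (N t r)).abs (Eventually.of_forall fun T => (H.A T).bF S t r)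

theorem Lm.cF (H : Lm N w L) (S : Sc U N Nt Nr C E) : Continuous fun p : ℝ × ℝ => V p.2 * L p.1 p.2 - N p.1 p.2 := by
  have := S.cN; have := H.cL; fun_prop

theorem Lm.ta (H : Lm N w L) (S : Sc U N Nt Nr C E) {l : ℝ} (hl : l = 1 ∨ l = -1) (t r : ℝ) :
    Tendsto (fun T => (w T).t t r - l * (w T).r t r) atTop (nhds (Jd (fun t r => V r * L t r - N t r) 1 l t r)) := by
  have h1 : Tendsto (fun T => ∫ s in (0:ℝ)..(T - t), (V (r + l * s) * L (t + 1 * s) (r + l * s) - N (t + 1 * s) (r + l * s))) atTop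
      (nhds (Jd (fun t r => V r * L t r - N t r) 1 l t r)) :=
    intervalIntegral_tendsto_integral_Ioi 0 (Jd_int (F := fun t r => V r * L t r - N t r) (H.cF S) (H.bF S) 1 hl t r).integrableOn
      (tendsto_atTop_add_const_right _ (-t) tendsto_id)
  have h2 : Tendsto (fun T => ((w T).t t r - l * (w T).r t r) - ∫ s in (0:ℝ)..(T - t), (V (r + l * s) * L (t + 1 * s) (r + l * s) - N (t + 1 * s) (r + l * s))) atTop (nhds 0) := by
    rw [Metric.tendsto_atTop]
    intro ε hε
    have hI := Im_nonneg
    obtain ⟨T0, h0⟩ := H.u (ε / (3 * (Im + 1)) / 2) (by positivity)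
    refine ⟨max T0 t, fun T hT => ?_⟩
    have hT0 := (le_max_left _ _).trans hT
    have hTt := (le_max_right _ _).trans hT
    set δ := ε / (3 * (Im + 1)) / 2 with hδ
    have hδ0 : 0 < δ := by positivity
    rw [(H.A T).ray S hl, Real.dist_eq, sub_zero]
    have i1 := ((S.cFW (w T)).comp (f := fun s : ℝ => (t + 1 * s, r + l * s)) (by fun_prop)).intervalIntegrable (μ := volume) 0 (T - t)
    have i2 := ((H.cF S).comp (f := fun s : ℝ => (t + 1 * s, r + l * s)) (by fun_prop)).intervalIntegrable (μ := volume) 0 (T - t)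
    have e := intervalIntegral.integral_sub i1 i2
    simp only [Function.comp] at e
    rw [← e]
    have hb := (ray_bd (F := fun t r => V r * (w T).f t r - N t r - (V r * L t r - N t r)) (K := 3 * δ) (by positivity) (fun t r => by
      rw [show V r * (w T).f t r - N t r - (V r * L t r - N t r) = V r * ((w T).f t r - L t r) by ring, abs_mul, abs_of_pos (V_pos r)]
      calc _ ≤ V r * (δ * √(q r)) := mul_le_mul_of_nonneg_left (h0 T hT0 t r) (V_pos r).le
        _ = δ * (V r * √(q r)) := by ring
        _ ≤ δ * (3 * m r) := mul_le_mul_of_nonneg_left (V_sqrt r) hδ0.le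
        _ = _ := by ring) hl t r (sub_nonneg.2 hTt)).trans (mul_le_mul_of_nonneg_left (m_half r hl) (by positivity))
    refine hb.trans_lt ?_
    have : 3 * δ * (Im + 1) = ε / 2 := by rw [hδ]; field_simp
    nlinarith
  simpa using h2.add h1

theorem Lm.dL (H : Lm N w L) (S : Sc U N Nt Nr C E) {l : ℝ} (hl : l = 1 ∨ l = -1) (t r : ℝ) :
    HasDerivAt (fun x => L (t + 1 * x) (r + -l * x)) (Jd (fun t r => V r * L t r - N t r) 1 l t r) 0 := by
  set F : ℝ → ℝ → ℝ := fun t r => V r * L t r - N t r with hF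
  have cJ : Continuous fun s => Jd F 1 l (t + 1 * s) (r + -l * s) :=
    (Jd_cont (H.cF S) (H.bF S) S.K0 1 hl).comp (f := fun s : ℝ => (t + 1 * s, r + -l * s)) (by fun_prop)
  have key : ∀ x, L (t + 1 * x) (r + -l * x) = L t r + ∫ s in (0:ℝ)..x, Jd F 1 l (t + 1 * s) (r + -l * s) := by
    intro x
    have e : ∀ T, (w T).f (t + 1 * x) (r + -l * x) = (w T).f t r + ∫ s in (0:ℝ)..x, ((w T).t (t + 1 * s) (r + -l * s) - l * (w T).r (t + 1 * s) (r + -l * s)) := by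
      intro T
      have cc : Continuous fun s => (w T).t (t + 1 * s) (r + -l * s) - l * (w T).r (t + 1 * s) (r + -l * s) := by
        have h1 := (w T).ct.comp (f := fun s : ℝ => (t + 1 * s, r + -l * s)) (by fun_prop)
        have h2 := (w T).cr.comp (f := fun s : ℝ => (t + 1 * s, r + -l * s)) (by fun_prop)
        exact h1.sub (continuous_const.mul h2)
      have := intervalIntegral.integral_eq_sub_of_hasDerivAt (a := 0) (b := x) (f := fun x => (w T).f (t + 1 * x) (r + -l * x)) (fun y _ => by
        have d1 : HasDerivAt (fun x : ℝ => t + 1 * x) 1 y := by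
          simpa using ((hasDerivAt_id y).const_mul 1).const_add t
        have d2 : HasDerivAt (fun x : ℝ => r + -l * x) (-l) y := by
          simpa using ((hasDerivAt_id y).const_mul (-l)).const_add r
        exact (chainC (w T).ht (w T).hr (w T).ct (w T).cr d1 d2).congr_deriv (g' := (w T).t (t + 1 * y) (r + -l * y) - l * (w T).r (t + 1 * y) (r + -l * y)) (by ring)) (cc.intervalIntegrable _ _)
      simp only [mul_zero, add_zero] at this
      linarith
    have t1 : Tendsto (fun T => (w T).f (t + 1 * x) (r + -l * x)) atTop (nhds (L t r + ∫ s in (0:ℝ)..x, Jd F 1 l (t + 1 * s) (r + -l * s))) := by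
      simp only [e]
      refine (H.tt t r).add (intervalIntegral.tendsto_integral_filter_of_dominated_convergence (fun _ => KK C * Im) ?_ ?_ (by simp) ?_)
      · refine Eventually.of_forall fun T => ?_
        have h1 := (w T).ct.comp (f := fun s : ℝ => (t + 1 * s, r + -l * s)) (by fun_prop)
        have h2 := (w T).cr.comp (f := fun s : ℝ => (t + 1 * s, r + -l * s)) (by fun_prop)
        exact (h1.sub (continuous_const.mul h2)).aestronglyMeasurable
      · filter_upwards [eventually_ge_atTop (t + |x|)] with T hT
        refine Eventually.of_forall fun s hs => ?_
        rw [Real.norm_eq_abs]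
        refine (H.A T).ab1 S hl ?_ _
        have : s ≤ |x| := by
          have := hs.2
          exact this.trans (max_le (abs_nonneg _) (le_abs_self _))
        linarith
      · exact Eventually.of_forall fun s _ => H.ta S hl _ _
    exact tendsto_nhds_unique (H.tt _ _) t1
  rw [funext key]
  have := intervalIntegral.integral_hasDerivAt_right (a := 0) (b := 0) (cJ.intervalIntegrable _ _) (cJ.stronglyMeasurableAtFilter _ _) cJ.continuousAt
  simpa using this.const_add (L t r)

theorem Lm.en_lim (H : Lm N w L) (S : Sc U N Nt Nr C E) {W : F2} (h0 : W.f = L)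
    (h1 : ∀ t r, W.t t r = (Jd (fun t r => V r * L t r - N t r) 1 (-1) t r + Jd (fun t r => V r * L t r - N t r) 1 1 t r) / 2)
    (h2 : ∀ t r, W.r t r = (Jd (fun t r => V r * L t r - N t r) 1 (-1) t r - Jd (fun t r => V r * L t r - N t r) 1 1 t r) / 2)
    {t e : ℝ} (he : ∀ᶠ T in atTop, ∫ r, ef (w T) t r ≤ e) : Integrable (ef W t) ∧ ∫ r, ef W t r ≤ e := by
  refine integrable_of_bdd (ef_cont' W t) (ef_nonneg W t) fun R hR => ?_
  have hlim : ∀ r, Tendsto (fun T => ef (w T) t r) atTop (nhds (ef W t r)) := fun r => by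
    have a1 := H.ta S (l := 1) (Or.inl rfl) t r
    have a2 := H.ta S (l := -1) (Or.inr rfl) t r
    have b1 : Tendsto (fun T => (w T).t t r) atTop (nhds (W.t t r)) := by
      rw [h1]; exact ((a2.add a1).div_const 2).congr fun T => by ring
    have b2 : Tendsto (fun T => (w T).r t r) atTop (nhds (W.r t r)) := by
      rw [h2]; exact ((a2.sub a1).div_const 2).congr fun T => by ring
    have b3 : Tendsto (fun T => (w T).f t r) atTop (nhds (W.f t r)) := by
      rw [h0]; exact H.tt t r
    exact (((b1.pow 2).add (b2.pow 2)).add ((b3.pow 2).const_mul (V r))).div_const 2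
  have hC := S.hC
  have hI := Im_nonneg
  have hK := S.K0
  have t1 : Tendsto (fun T => ∫ r in (-R)..R, ef (w T) t r) atTop (nhds (∫ r in (-R)..R, ef W t r)) := by
    refine intervalIntegral.tendsto_integral_filter_of_dominated_convergence (fun r => ((KK C * Im) ^ 2 + 3 * (8 * C * q r)) / 2) ?_ ?_ ?_ ?_
    · exact Eventually.of_forall fun T => (ef_cont' _ _).aestronglyMeasurable
    · filter_upwards [eventually_ge_atTop t] with T hT
      refine Eventually.of_forall fun r _ => ?_
      rw [Real.norm_eq_abs, abs_of_nonneg (ef_nonneg _ _ _)]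
      have a1 := sq_le_sq' (abs_le.1 ((H.A T).ab1 S (l := 1) (Or.inl rfl) hT r)).1 (abs_le.1 ((H.A T).ab1 S (l := 1) (Or.inl rfl) hT r)).2
      have a2 := sq_le_sq' (abs_le.1 ((H.A T).ab1 S (l := -1) (Or.inr rfl) hT r)).1 (abs_le.1 ((H.A T).ab1 S (l := -1) (Or.inr rfl) hT r)).2
      have a3 : (w T).f t r ^ 2 ≤ 8 * C * q r := by
        have := (H.A T).bW S t r
        calc (w T).f t r ^ 2 = |(w T).f t r| ^ 2 := (sq_abs _).symm
          _ ≤ (√(8 * C) * √(q r)) ^ 2 := by gcongr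
          _ = 8 * C * q r := by rw [mul_pow, Real.sq_sqrt (by positivity), Real.sq_sqrt (q_pos r).le]
      have a4 : V r * (w T).f t r ^ 2 ≤ 3 * (8 * C * q r) := mul_le_mul (V_le r) a3 (sq_nonneg _) (by norm_num)
      unfold ef
      nlinarith
    · have := continuous_q
      exact Continuous.intervalIntegrable (by fun_prop) _ _
    · exact Eventually.of_forall fun r _ => hlim r
  refine le_of_tendsto t1 (he.mono fun T hT => le_trans ?_ hT)
  exact interval_le_integral ((H.A T).En S t).1 (ef_nonneg _ _) (by linarith)

theorem Sc.limit (S : Sc U N Nt Nr C E) : ∃ W : F2, (∀ t r, W.tt t r = W.rr t r - V r * W.f t r + N t r) ∧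
    (∀ t, Integrable (ef W t)) ∧ ∀ ε > 0, ∃ T0 : ℝ, ∀ T ≥ T0, ∫ r, ef W T r ≤ ε := by
  obtain ⟨w, L, H⟩ := S.lm_ex
  obtain ⟨W, h0, h1, h2, h3⟩ := S.reg H.cL (Real.sqrt_nonneg _) S.K0 (H.bL S) (H.bF S) (fun l hl t r => H.dL S hl t r)
  refine ⟨W, h3, fun t => (H.en_lim S h0 h1 h2 (Eventually.of_forall fun T => ((H.A T).En S t).2)).1, fun ε hε => ?_⟩
  obtain ⟨T0, -, hT⟩ := S.unif hε
  exact ⟨T0, fun t ht => (H.en_lim S h0 h1 h2 (eventually_ge_atTop t |>.mono fun T hTt => hT t ht T hTt _ (H.A T))).2⟩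
end WMS

namespace WMS
variable {n : ℕ} {u : F2} {Q Q1 : ℝ → ℝ}

noncomputable def err (u : F2) (Q1 : ℝ → ℝ) (P : F2) (t r : ℝ) : ℝ :=
  ((u.r t r - Q1 r - P.r t r) ^ 2 + (u.t t r - P.t t r) ^ 2) * (r ^ 2 + 1)

theorem err_le (H : HM n Q Q1) (W : F2) (t r : ℝ) : err u Q1 ((UU u H).sub W).unlift t r ≤ 4 * ef W t r := by
  have h := enl_unlift_le W t r
  have h3 := q_ne r
  have e1 : u.r t r - Q1 r - ((UU u H).sub W).unlift.r t r = W.unlift.r t r := by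
    rw [unlift_r, unlift_r]
    simp only [F2.sub, UU]
    rw [lift_f, lift_r, ph_r]
    field_simp; ring
  have e2 : u.t t r - ((UU u H).sub W).unlift.t t r = W.unlift.t t r := by
    rw [unlift_t, unlift_t]
    simp only [F2.sub, UU]
    rw [lift_t, ph_t]
    field_simp; ring
  unfold err
  rw [e1, e2]
  unfold enl en at h
  nlinarith [sq_nonneg (W.unlift.f t r)]

theorem WM.scat (h : WM n u) (H : HM n Q Q1) : ∃ P : F2, Wv P (fun t r => 2 * P.f t r) ∧ (∀ t, Integrable (enl P t)) ∧
    Tendsto (fun t => ∫ r, err u Q1 P t r) atTop (nhds 0) := by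
  obtain ⟨C, E, S⟩ := h.sc H
  obtain ⟨W, h1, h2, h3⟩ := S.limit
  refine ⟨((UU u H).sub W).unlift, unlift_wv fun t r => ?_, fun t => enl_unlift_int (ef_sub_int (S.int t) (h2 t)).1, ?_⟩
  · have e1 := S.eq t r; have e2 := h1 t r
    simp only [F2.sub]; rw [e1, e2]; ring
  · rw [Metric.tendsto_atTop]
    intro ε hε
    obtain ⟨T0, hT⟩ := h3 (ε / 8) (by positivity)
    refine ⟨T0, fun t ht => ?_⟩
    have n0 : ∀ r, 0 ≤ err u Q1 ((UU u H).sub W).unlift t r := fun r => by unfold err; positivity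
    have le : ∫ r, err u Q1 ((UU u H).sub W).unlift t r ≤ ∫ r, 4 * ef W t r :=
      integral_mono_of_nonneg (Eventually.of_forall n0) ((h2 t).const_mul 4) (Eventually.of_forall fun r => err_le H W t r)
    rw [integral_const_mul] at le
    rw [Real.dist_eq, sub_zero, abs_of_nonneg (integral_nonneg n0)]
    linarith [hT t ht]

theorem lin_sol {P : F2} (hP : Wv P (fun t r => 2 * P.f t r)) (hi : ∀ t, Integrable (enl P t)) : ContDiff ℝ 2 (fun p : ℝ × ℝ => P.f p.1 p.2) ∧
    (∀ t r : ℝ, deriv (deriv (fun s => P.f s r)) t - deriv (deriv (P.f t)) r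
        - (2 * r / (r ^ 2 + 1)) * deriv (P.f t) r + (2 / (r ^ 2 + 1)) * P.f t r = 0) ∧
    ∀ t : ℝ, Integrable (fun r : ℝ => ((deriv (fun s => P.f s r) t) ^ 2 + (deriv (P.f t) r) ^ 2) * (r ^ 2 + 1)) := by
  refine ⟨P.contDiff, fun t r => ?_, fun t => ?_⟩
  · rw [P.dtt, P.drr, P.dr]
    have := hP t r
    simp only at this; rw [← this]; ring
  · simp only [P.dt, P.dr]
    have := P.ct1 t; have := P.cr1 t
    refine integrable_of_le ((hi t).const_mul 2) (by fun_prop) fun r => ?_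
    rw [abs_of_nonneg (by positivity)]
    unfold enl en
    nlinarith [sq_nonneg (P.f t r)]

theorem mkHM (hc : ContDiff ℝ 2 Q) (hq : ∀ r : ℝ, deriv (deriv Q) r + (2 * r / (r ^ 2 + 1)) * deriv Q r
      - Real.sin (2 * Q r) / (r ^ 2 + 1) = 0) (hQb : Tendsto Q atBot (nhds 0)) (hQt : Tendsto Q atTop (nhds ((n : ℝ) * Real.pi))) : HM n Q (deriv Q) where
  d1 r := (hc.differentiable (by norm_num) r).hasDerivAt
  d2 r := by
    have hd : Differentiable ℝ (deriv Q) := (contDiff_succ_iff_deriv (n := 1).1 hc).2.2.differentiable (by norm_num)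
    refine (hd r).hasDerivAt.congr_deriv ?_
    have := hq r
    rw [sub_div, mul_div_right_comm]; linarith
  bot := hQb
  top := hQt
end WMS

theorem stmt19 (n : ℕ) (Q : ℝ → ℝ) (hQ : IsHarmonicMapSol Q)
    (hQb : Tendsto Q atBot (nhds 0))
    (hQt : Tendsto Q atTop (nhds ((n : ℝ) * Real.pi)))
    (ψ : ℝ → ℝ → ℝ) (hreg : ContDiff ℝ 2 (fun p : ℝ × ℝ => ψ p.1 p.2))
    (heq : ∀ t r : ℝ,
      deriv (deriv (fun s => ψ s r)) t - deriv (deriv (ψ t)) r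
        - (2 * r / (r ^ 2 + 1)) * deriv (ψ t) r + Real.sin (2 * ψ t r) / (r ^ 2 + 1) = 0)
    (hfin : ∀ t : ℝ, Integrable (fun r : ℝ =>
      ((deriv (fun s => ψ s r) t) ^ 2 + (deriv (ψ t) r) ^ 2
        + 2 * Real.sin (ψ t r) ^ 2 / (r ^ 2 + 1)) * (r ^ 2 + 1)))
    (hbv : ∀ t : ℝ, Tendsto (ψ t) atBot (nhds 0) ∧
      Tendsto (ψ t) atTop (nhds ((n : ℝ) * Real.pi))) :
    ∃ φp φm : ℝ → ℝ → ℝ, IsLinearizedSol φp ∧ IsLinearizedSol φm ∧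
      Tendsto (fun t : ℝ => ∫ r : ℝ,
          ((deriv (ψ t) r - deriv Q r - deriv (φp t) r) ^ 2 +
            (deriv (fun s => ψ s r) t - deriv (fun s => φp s r) t) ^ 2) * (r ^ 2 + 1))
        atTop (nhds 0) ∧
      Tendsto (fun t : ℝ => ∫ r : ℝ,
          ((deriv (ψ t) r - deriv Q r - deriv (φm t) r) ^ 2 +
            (deriv (fun s => ψ s r) t - deriv (fun s => φm s r) t) ^ 2) * (r ^ 2 + 1))
        atBot (nhds 0) := by
  have H : WMS.HM n Q (deriv Q) := WMS.mkHM hQ.1 hQ.2 hQb hQt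
  have hu : WMS.WM n (WMS.mkF2 ψ hreg) := by
    set u := WMS.mkF2 ψ hreg with hu
    have e : u.f = ψ := rfl
    rw [← e] at heq hfin hbv
    refine ⟨fun t r => ?_, fun t => ?_, fun t => (hbv t).1, fun t => (hbv t).2⟩
    · have := heq t r
      rwa [u.dtt, u.drr, u.dr] at this
    · have h := (hfin t).div_const 2
      simp only [u.dt, u.dr] at h
      refine h.congr (Eventually.of_forall fun r => ?_)
      simp only [WMS.en]
      field_simp
  obtain ⟨P, h1, h2, h3⟩ := hu.scat H
  obtain ⟨M, g1, g2, g3⟩ := (hu.rev 0).scat H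
  refine ⟨P.f, (M.rev 0).f, WMS.lin_sol h1 h2, WMS.lin_sol (g1.rev 0) (fun t => ?_), ?_, ?_⟩
  · have e : WMS.enl (M.rev 0) t = WMS.enl M (0 - t) := by
      funext r; exact WMS.en_rev _ _ _ _ _
    rw [e]; exact g2 _
  · refine h3.congr fun t => ?_
    have e1 : ∀ a b, deriv (fun s => ψ s b) a = (WMS.mkF2 ψ hreg).t a b := (WMS.mkF2 ψ hreg).dt
    have e2 : ∀ a b, deriv (ψ a) b = (WMS.mkF2 ψ hreg).r a b := (WMS.mkF2 ψ hreg).dr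
    congr 1; funext r
    rw [P.dt, P.dr, e1, e2]
    rfl
  · refine (g3.comp tendsto_neg_atBot_atTop).congr fun t => ?_
    have e1 : ∀ a b, deriv (fun s => ψ s b) a = (WMS.mkF2 ψ hreg).t a b := (WMS.mkF2 ψ hreg).dt
    have e2 : ∀ a b, deriv (ψ a) b = (WMS.mkF2 ψ hreg).r a b := (WMS.mkF2 ψ hreg).dr
    simp only [Function.comp]
    congr 1; funext r
    rw [(M.rev 0).dt, (M.rev 0).dr, e1, e2]
    simp only [WMS.err, WMS.F2.rev, zero_sub, neg_neg]
    ring
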